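/- Assume that in each partition λᵢ at most one odd number appears an odd number of times and at most one even number appears an odd number of times. Let s be the number of indices i such that some odd number appears an odd number of times in λᵢ, let ℓ = Σᵢ l([λᵢ/2]), and let Aut[λᵢ/2] = Π_a ⌊n_a/2⌋! where n_a is the multiplicity of a in λᵢ. Define εᵢ = −1 if either (λᵢ has an odd number appearing an odd number of times and no even number appearing an odd number of times) or (λᵢ has an odd number a and an even number b each appearing an odd number of times, with a > b), and εᵢ = +1 otherwise; set ε = Πᵢ εᵢ. Then there exists a polynomial Q ∈ ℚ[X,Y] such that: (i) for every m ≥ 0 the m-th derivative at 0 of q ↦ Q(q, tanh q)/cosh q equals s^odd_{λ₁,…,λ_k}(m); (ii) the degree of Q in X is at most ℓ; (iii) the coefficient of X^ℓ Y^j in Q vanishes for all j > ℓ+s; and (iv) the coefficient of X^ℓ Y^{ℓ+s} in Q equals (−1/2)^ℓ · ε · (ℓ+s)!/Πᵢ Aut[λᵢ/2]. In particular this leading coefficient is nonzero. -/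

import Mathlib

open Polynomial
open scoped Classical

/-- The ramification type of `w` for a real polynomial `P`: the multiset of
multiplicities of the complex roots of `P - w`. -/
noncomputable def ramType (P : Polynomial ℝ) (w : ℝ) : Multiset ℕ :=
  ((P.map (algebraMap ℝ ℂ) - Polynomial.C (w : ℂ)).roots.toFinset.val).map
    fun z => (P.map (algebraMap ℝ ℂ) - Polynomial.C (w : ℂ)).rootMultiplicity z

/-- A disorder of `P`: a pair `x₁ < x₂` with `P x₁ = P x₂` and the multiplicity of `x₁`
as a root of `P - P x₁` strictly greater than that of `x₂`. -/
def disorders (P : Polynomial ℝ) : Set (ℝ × ℝ) :=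
  {p | p.1 < p.2 ∧ P.eval p.1 = P.eval p.2 ∧
    (P - Polynomial.C (P.eval p.2)).rootMultiplicity p.2
      < (P - Polynomial.C (P.eval p.1)).rootMultiplicity p.1}

/-- The sign `ε(P) = (-1)^{number of disorders}`. -/
noncomputable def epsilonP (P : Polynomial ℝ) : ℤ := (-1) ^ Nat.card (disorders P)

/-- `P = X^n + a₂ X^(n-2) + ⋯ + a_n`: monic of degree `n` with vanishing coefficient
of `X^(n-1)`. -/
def IsNormalized (n : ℕ) (P : Polynomial ℝ) : Prop :=
  P.natDegree = n ∧ P.Monic ∧ P.coeff (n - 1) = 0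

/-- A multiset of positive integers summing to `n`. -/
def IsPartitionOf (n : ℕ) (Λ : Multiset ℕ) : Prop := Λ.sum = n ∧ 0 ∉ Λ

/-- The reduced ramification type: subtract 1 from every part of the ramification type
and delete the zeros. -/
noncomputable def redRamType (P : Polynomial ℝ) (w : ℝ) : Multiset ℕ :=
  ((ramType P w).map fun a => a - 1).filter fun a => a ≠ 0

/-- The s-number of normalized real polynomials of degree `n = m + Σ|λᵢ| + 1` with
reduced ramification type `λ i` at the point `-(i+1)` for `i = 0,…,k-1`, and a simple
branch point at `-(k+j+1)` for `j = 0,…,m-1`. -/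
noncomputable def sNum {k : ℕ} (lam : Fin k → Multiset ℕ) (m : ℕ) : ℤ :=
  ∑ᶠ P ∈ {P : Polynomial ℝ |
      IsNormalized (m + (∑ i, (lam i).sum) + 1) P ∧
      (∀ i : Fin k, redRamType P (-(((i : ℕ) + 1 : ℕ) : ℝ)) = lam i) ∧
      ∀ j : Fin m, redRamType P (-((k + (j : ℕ) + 1 : ℕ) : ℝ)) = ({1} : Multiset ℕ)},
    epsilonP P

/-- `s^even(m)`: the s-number if the degree `n = m + Σ|λᵢ| + 1` is even, `0` otherwise. -/
noncomputable def sEven {k : ℕ} (lam : Fin k → Multiset ℕ) (m : ℕ) : ℤ :=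
  if Even (m + (∑ i, (lam i).sum) + 1) then sNum lam m else 0

/-- `s^odd(m)`: the s-number if the degree `n = m + Σ|λᵢ| + 1` is odd, `0` otherwise. -/
noncomputable def sOdd {k : ℕ} (lam : Fin k → Multiset ℕ) (m : ℕ) : ℤ :=
  if Odd (m + (∑ i, (lam i).sum) + 1) then sNum lam m else 0

noncomputable section

open Filter Topology Finset Complex ComplexConjugate

/-- The antiderivative of a complex polynomial that vanishes at `0`. -/
def prim : ℂ[X] →ₗ[ℂ] ℂ[X] :=
  Polynomial.lsum fun i => ((i + 1 : ℂ)⁻¹) • monomial (i + 1)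

theorem prim_monomial (i : ℕ) (a : ℂ) :
    prim (monomial i a) = monomial (i + 1) ((i + 1 : ℂ)⁻¹ * a) := by
  simp [prim, Polynomial.lsum_apply, Polynomial.sum_monomial_index, smul_monomial]

theorem derivative_prim (p : ℂ[X]) : derivative (prim p) = p := by
  induction p using Polynomial.induction_on' with
  | add p q hp hq => simp [hp, hq]
  | monomial i a =>
    have : (i + 1 : ℂ) ≠ 0 := by exact_mod_cast i.succ_ne_zero
    rw [prim_monomial, derivative_monomial]
    congr 1
    push_cast
    field_simp

theorem prim_eval_zero (p : ℂ[X]) : (prim p).eval 0 = 0 := by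
  induction p using Polynomial.induction_on' with
  | add p q hp hq => simp [hp, hq]
  | monomial i a => simp [prim_monomial]

theorem eq_prim {p q : ℂ[X]} (h : derivative q = p) (h0 : q.eval 0 = 0) : q = prim p := by
  have h1 : derivative (q - prim p) = 0 := by simp [derivative_prim, h]
  have h2 := eq_C_of_derivative_eq_zero h1
  have h3 : (q - prim p).eval 0 = 0 := by simp [h0, prim_eval_zero]
  rw [h2, eval_C] at h3
  rw [h3, C_0, sub_eq_zero] at h2
  exact h2

theorem prim_C_mul (a : ℂ) (p : ℂ[X]) : prim (C a * p) = C a * prim p := by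
  rw [C_mul', C_mul', map_smul]

theorem prim_frame (p : ℂ[X]) (m s y : ℂ) :
    (prim p).eval (m + s * y) - (prim p).eval m
      = s * (prim (p.comp (C m + C s * X))).eval y := by
  have h : (prim p).comp (C m + C s * X) - C ((prim p).eval m)
      = prim (C s * p.comp (C m + C s * X)) := by
    apply eq_prim
    · simp [derivative_comp, derivative_prim]
    · simp
  have := congrArg (eval y) h
  rw [prim_C_mul] at this
  simpa using this

theorem natDegree_prim_le (p : ℂ[X]) : (prim p).natDegree ≤ p.natDegree + 1 := by
  have := congrArg natDegree (derivative_prim p)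
  rw [Polynomial.natDegree_derivative] at this
  omega

/-- The conjugate of a complex polynomial. -/
def pconj (p : ℂ[X]) : ℂ[X] := p.map conj

theorem pconj_prim (p : ℂ[X]) : pconj (prim p) = prim (pconj p) := by
  apply eq_prim
  · rw [pconj, derivative_map, derivative_prim, pconj]
  · have := eval_map_apply (f := conj) (p := prim p) (x := 0)
    rw [map_zero, prim_eval_zero, map_zero] at this
    exact this

theorem eval_pconj (p : ℂ[X]) (z : ℂ) :
    (pconj p).eval (conj z) = conj (p.eval z) :=
  eval_map_apply _ _

/-- Quadrature nodes for `prim` on polynomials of degree at most `N`. -/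
def quadPoly (N r : ℕ) : ℂ[X] :=
  prim (Lagrange.basis (range (N + 1)) (fun i : ℕ => (i : ℂ)) r)

theorem prim_quad (N : ℕ) (p : ℂ[X]) (hp : p.natDegree ≤ N) :
    prim p = ∑ r ∈ range (N + 1), C (p.eval (r : ℂ)) * quadPoly N r := by
  have hinj : Set.InjOn (fun i : ℕ => (i : ℂ)) (range (N + 1) : Set ℕ) :=
    fun a _ b _ h => Nat.cast_injective h
  have hdeg : p.degree < (range (N + 1)).card := by
    rw [card_range]
    exact lt_of_le_of_lt degree_le_natDegree (by exact_mod_cast Nat.lt_succ_of_le hp)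
  have h := Lagrange.eq_interpolate hinj hdeg
  conv_lhs => rw [h]
  rw [Lagrange.interpolate_apply, map_sum]
  exact sum_congr rfl fun r _ => prim_C_mul _ _

/-- A root of `Q` at which the derivative vanishes to order `m` has order at least `m + 1`. -/
theorem pow_dvd_of_derivative {Q : ℂ[X]} {a : ℂ} {m : ℕ} (h0 : Q.eval a = 0)
    (h : (X - C a) ^ m ∣ derivative Q) : (X - C a) ^ (m + 1) ∣ Q := by
  by_cases hQ : Q = 0
  · simp [hQ]
  have hd : derivative Q ≠ 0 := by
    intro hd
    have := eq_C_of_derivative_eq_zero hd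
    rw [this, eval_C] at h0
    rw [h0] at this
    exact hQ (by simpa using this)
  have h1 := (le_rootMultiplicity_iff hd).2 h
  rw [derivative_rootMultiplicity_of_root h0] at h1
  have h2 : 0 < Q.rootMultiplicity a := (rootMultiplicity_pos hQ).2 h0
  exact (le_rootMultiplicity_iff hQ).1 (by omega)

/-- Counting roots of `Q - v` through the critical points of `Q`. -/
theorem sum_rootMultiplicity_le {Q : ℂ[X]} (hQ : derivative Q ≠ 0) (v : ℂ) (D : Finset ℂ)
    (hD : ∀ p ∈ D, Q.eval p = v) :
    ∑ p ∈ D, ((derivative Q).rootMultiplicity p + 1) ≤ (derivative Q).natDegree + 1 := by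
  set R := Q - C v with hR
  have hRd : derivative R = derivative Q := by simp [hR]
  have hR0 : R ≠ 0 := fun h => hQ (by rw [← hRd, h, derivative_zero])
  have hroot : ∀ p ∈ D, R.IsRoot p := fun p hp => by simp [hR, hD p hp]
  have h1 : ∑ p ∈ D, ((derivative Q).rootMultiplicity p + 1) = ∑ p ∈ D, R.roots.count p := by
    refine sum_congr rfl fun p hp => ?_
    rw [← hRd, derivative_rootMultiplicity_of_root (hroot p hp), count_roots]
    have := (rootMultiplicity_pos hR0).2 (hroot p hp)
    omega
  have h2 : ∑ p ∈ D, R.roots.count p ≤ R.roots.card := by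
    calc ∑ p ∈ D, R.roots.count p ≤ ∑ p ∈ D ∪ R.roots.toFinset, R.roots.count p :=
          sum_le_sum_of_subset subset_union_left
      _ = R.roots.card := Multiset.sum_count_eq_card (fun a ha => by simp_all)
  have h3 : R.natDegree ≤ (derivative Q).natDegree + 1 := by
    have := Polynomial.natDegree_derivative R
    rw [hRd] at this
    omega
  rw [h1]
  exact h2.trans ((card_roots' R).trans h3)

/-- The monic polynomial with roots `x k`, `k ∈ V`, of multiplicities `lam k`. -/
def vprod {ι : Type*} (V : Finset ι) (lam : ι → ℕ) (x : ι → ℂ) : ℂ[X] :=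
  ∏ k ∈ V, (X - C (x k)) ^ lam k

section vprod
variable {ι : Type*} (V : Finset ι) (lam : ι → ℕ) (x : ι → ℂ)

theorem vprod_monic : (vprod V lam x).Monic :=
  monic_prod_of_monic _ _ fun _ _ => (monic_X_sub_C _).pow _

theorem natDegree_vprod : (vprod V lam x).natDegree = ∑ k ∈ V, lam k := by
  rw [vprod, natDegree_prod_of_monic _ _ fun k _ => (monic_X_sub_C _).pow _]
  simp

theorem rootMultiplicity_vprod (p : ℂ) :
    (vprod V lam x).rootMultiplicity p = ∑ k ∈ V with x k = p, lam k := by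
  induction V using Finset.induction_on with
  | empty => simp [vprod]
  | insert a s ha ih =>
    have h1 : vprod (insert a s) lam x = (X - C (x a)) ^ lam a * vprod s lam x := by
      simp [vprod, prod_insert ha]
    rw [h1, rootMultiplicity_mul (by rw [← h1]; exact (vprod_monic _ _ _).ne_zero), ih,
      filter_insert]
    split_ifs with h
    · rw [sum_insert (by simp [ha]), ← h, rootMultiplicity_X_sub_C_pow]
    · have : ((X - C (x a)) ^ lam a).rootMultiplicity p = 0 := by
        rw [rootMultiplicity_eq_zero_iff]
        intro h2
        exfalso
        simp only [IsRoot.def, eval_pow, eval_sub, eval_X, eval_C] at h2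
        exact h (sub_eq_zero.1 (eq_zero_of_pow_eq_zero h2)).symm
      rw [this, zero_add]

theorem eval_vprod (y : ℂ) : (vprod V lam x).eval y = ∏ k ∈ V, (y - x k) ^ lam k := by
  simp [vprod, eval_prod]

/-- The derivative of the polynomials attached to vertices. -/
def wpoly (u : ℂ) (b : ℕ) : ℂ[X] := C u * X ^ b * vprod V lam x

variable {V lam x} {u : ℂ} {b : ℕ}

theorem wpoly_ne_zero (hu : u ≠ 0) : wpoly V lam x u b ≠ 0 :=
  mul_ne_zero (mul_ne_zero (by simpa using hu) (pow_ne_zero _ X_ne_zero))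
    (vprod_monic _ _ _).ne_zero

theorem natDegree_wpoly (hu : u ≠ 0) :
    (wpoly V lam x u b).natDegree = b + ∑ k ∈ V, lam k := by
  rw [wpoly, natDegree_mul (mul_ne_zero (by simpa using hu) (pow_ne_zero _ X_ne_zero))
    (vprod_monic _ _ _).ne_zero, natDegree_C_mul_X_pow _ _ hu, natDegree_vprod]

theorem natDegree_wpoly_le : (wpoly V lam x u b).natDegree ≤ b + ∑ k ∈ V, lam k := by
  refine natDegree_mul_le.trans ?_
  rw [natDegree_vprod]
  exact Nat.add_le_add_right (natDegree_C_mul_X_pow_le _ _) _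

theorem eval_wpoly (y : ℂ) :
    (wpoly V lam x u b).eval y = u * y ^ b * ∏ k ∈ V, (y - x k) ^ lam k := by
  simp [wpoly, eval_vprod]

theorem rootMultiplicity_wpoly (hu : u ≠ 0) (p : ℂ) :
    (wpoly V lam x u b).rootMultiplicity p
      = (if p = 0 then b else 0) + ∑ k ∈ V with x k = p, lam k := by
  have h1 : wpoly V lam x u b = C u * (X ^ b * vprod V lam x) := by rw [wpoly, mul_assoc]
  have h2 : (C u : ℂ[X]) ≠ 0 := by simpa using hu
  have h3 : (X ^ b : ℂ[X]) ≠ 0 := pow_ne_zero _ X_ne_zero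
  rw [h1, rootMultiplicity_mul (by rw [← h1]; exact wpoly_ne_zero hu), rootMultiplicity_C,
    rootMultiplicity_mul (mul_ne_zero h3 (vprod_monic _ _ _).ne_zero), rootMultiplicity_vprod,
    zero_add]
  congr 1
  split_ifs with h
  · have := rootMultiplicity_X_sub_C_pow (0 : ℂ) b
    rw [C_0, sub_zero] at this
    rw [h, this]
  · simp_all

theorem sum_image_le (hu : u ≠ 0) (v : ℂ) (D : Finset ℂ)
    (hD : ∀ p ∈ D, (prim (wpoly V lam x u b)).eval p = v) :
    ∑ p ∈ D, ((if p = 0 then b else 0) + (∑ k ∈ V with x k = p, lam k) + 1)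
      ≤ b + ∑ k ∈ V, lam k + 1 := by
  have h := sum_rootMultiplicity_le (Q := prim (wpoly V lam x u b))
    (by rw [derivative_prim]; exact wpoly_ne_zero hu) v D hD
  simpa only [derivative_prim, rootMultiplicity_wpoly hu, natDegree_wpoly hu] using h

/-- If all critical values vanish, all the vertices sit at the origin. -/
theorem eq_zero_of_values_zero (hu : u ≠ 0)
    (h : ∀ j ∈ V, (prim (wpoly V lam x u b)).eval (x j) = 0) : ∀ j ∈ V, x j = 0 := by
  have h1 := sum_image_le (V := V) (lam := lam) (x := x) (b := b) hu 0 (insert 0 (V.image x)) (by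
    intro p hp
    rcases mem_insert.1 hp with rfl | hp
    · exact prim_eval_zero _
    · obtain ⟨j, hj, rfl⟩ := mem_image.1 hp
      exact h j hj)
  have h2 : ∑ p ∈ insert 0 (V.image x), (∑ k ∈ V with x k = p, lam k) = ∑ k ∈ V, lam k :=
    sum_fiberwise_of_maps_to
      (fun j hj => mem_insert_of_mem (mem_image_of_mem x hj)) _
  rw [sum_add_distrib, sum_add_distrib, h2, sum_ite_eq' ] at h1
  simp only [mem_insert_self, if_true, sum_const, smul_eq_mul, mul_one] at h1
  intro j hj
  have h3 : (insert 0 (V.image x)).card ≤ 1 := by omega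
  exact card_le_one.1 h3 _ (mem_insert_of_mem (mem_image_of_mem x hj)) _
    (mem_insert_self _ _)

/-- Nondegeneracy for distinct vertices. -/
theorem nondegenerate_of_injOn (hu : u ≠ 0) (hlam : ∀ k ∈ V, 1 ≤ lam k) (hx : Set.InjOn x V)
    (hx0 : ∀ k ∈ V, x k ≠ 0) (e : ι → ℂ)
    (h : ∀ j ∈ V, (prim (∑ k ∈ V, C (e k * lam k) * (X - C (x k)) ^ (lam k - 1) *
      wpoly (V.erase k) lam x u b)).eval (x j) = 0) : ∀ k ∈ V, e k = 0 := by
  set G : ℂ[X] := C u * ∑ k ∈ V, C (e k * lam k) * ∏ i ∈ V.erase k, (X - C (x i)) with hG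
  set M : ℂ[X] := ∏ k ∈ V, (X - C (x k)) ^ (lam k - 1) with hM
  set S : ℂ[X] := ∑ k ∈ V, C (e k * lam k) * (X - C (x k)) ^ (lam k - 1) *
      wpoly (V.erase k) lam x u b with hS
  have hSG : S = X ^ b * M * G := by
    rw [hS, hG, hM, mul_sum, mul_sum]
    refine sum_congr rfl fun k hk => ?_
    rw [← mul_prod_erase V _ hk, wpoly, vprod]
    have : ∏ i ∈ V.erase k, (X - C (x i)) ^ lam i
        = (∏ i ∈ V.erase k, (X - C (x i)) ^ (lam i - 1)) * ∏ i ∈ V.erase k, (X - C (x i)) := by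
      rw [← prod_mul_distrib]
      refine prod_congr rfl fun i hi => ?_
      rw [← pow_succ, Nat.sub_add_cancel (hlam i (mem_of_mem_erase hi))]
    rw [this]
    ring
  have hMm : M.Monic := monic_prod_of_monic _ _ fun k _ => (monic_X_sub_C _).pow _
  have hGdeg : G.degree < V.card := by
    rw [hG]
    refine lt_of_le_of_lt (degree_mul_le _ _) ?_
    have h2 : (∑ k ∈ V, C (e k * lam k) * ∏ i ∈ V.erase k, (X - C (x i))).degree < V.card := by
      refine lt_of_le_of_lt (degree_sum_le _ _) ?_
      rw [Finset.sup_lt_iff (by exact WithBot.bot_lt_coe _)]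
      intro k hk
      refine lt_of_le_of_lt (degree_mul_le _ _) ?_
      rw [degree_prod]
      simp only [degree_X_sub_C, sum_const, card_erase_of_mem hk]
      have h3 : 0 < V.card := card_pos.2 ⟨k, hk⟩
      calc (C (e k * (lam k : ℂ))).degree + (V.card - 1) • (1 : WithBot ℕ)
          ≤ 0 + (V.card - 1) • (1 : WithBot ℕ) := by gcongr; exact degree_C_le
        _ = ((V.card - 1 : ℕ) : WithBot ℕ) := by simp
        _ < V.card := by exact_mod_cast Nat.sub_lt h3 one_pos
    rw [degree_C hu, zero_add]
    exact h2
  have hG0 : G = 0 := by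
    by_contra hGne
    have hS0 : S ≠ 0 := by
      rw [hSG]
      exact mul_ne_zero (mul_ne_zero (pow_ne_zero _ X_ne_zero) hMm.ne_zero) hGne
    have hR0 : prim S ≠ 0 := fun h0 => hS0 (by rw [← derivative_prim S, h0, derivative_zero])
    have hdvd1 : ∀ k ∈ V, (X - C (x k)) ^ (lam k) ∣ prim S := by
      intro k hk
      have h1 : (X - C (x k)) ^ (lam k - 1) ∣ derivative (prim S) := by
        rw [derivative_prim, hSG]
        exact Dvd.dvd.mul_right (Dvd.dvd.mul_left (dvd_prod_of_mem _ hk) _) _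
      have h2 := pow_dvd_of_derivative (h k hk) h1
      rwa [Nat.sub_add_cancel (hlam k hk)] at h2
    have hdvd0 : X ^ (b + 1) ∣ prim S := by
      have h1 : (X - C (0 : ℂ)) ^ b ∣ derivative (prim S) := by
        rw [derivative_prim, hSG, C_0, sub_zero, mul_assoc]
        exact dvd_mul_right _ _
      have h2 := pow_dvd_of_derivative (prim_eval_zero S) h1
      rwa [C_0, sub_zero] at h2
    have hdvd2 : vprod V lam x ∣ prim S := by
      refine prod_dvd_of_coprime ?_ hdvd1
      intro i hi j hj hij
      exact ((isCoprime_X_sub_C_of_isUnit_sub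
        (sub_ne_zero.2 (fun h' => hij (hx hi hj h'))).isUnit).pow)
    have hcop : IsCoprime (X ^ (b + 1) : ℂ[X]) (vprod V lam x) := by
      refine IsCoprime.prod_right fun k hk => ?_
      have := isCoprime_X_sub_C_of_isUnit_sub (R := ℂ) (a := 0) (b := x k)
        (sub_ne_zero.2 (hx0 k hk).symm).isUnit
      rw [C_0, sub_zero] at this
      exact this.pow
    have h3 := natDegree_le_of_dvd (hcop.mul_dvd hdvd0 hdvd2) hR0
    rw [natDegree_mul (pow_ne_zero _ X_ne_zero) (vprod_monic _ _ _).ne_zero, natDegree_X_pow,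
      natDegree_vprod] at h3
    have h4 := natDegree_prim_le S
    rw [hSG, natDegree_mul (mul_ne_zero (pow_ne_zero _ X_ne_zero) hMm.ne_zero) hGne,
      natDegree_mul (pow_ne_zero _ X_ne_zero) hMm.ne_zero, natDegree_X_pow] at h4
    have h5 : M.natDegree = ∑ k ∈ V, (lam k - 1) := by
      rw [hM, natDegree_prod_of_monic _ _ fun k _ => (monic_X_sub_C _).pow _]
      simp
    have h6 : ∑ k ∈ V, lam k = (∑ k ∈ V, (lam k - 1)) + V.card := by
      rw [card_eq_sum_ones, ← sum_add_distrib]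
      exact sum_congr rfl fun k hk => (Nat.sub_add_cancel (hlam k hk)).symm
    have h7 : G.natDegree < V.card := (natDegree_lt_iff_degree_lt hGne).2 hGdeg
    rw [hSG] at h3
    omega
  intro k hk
  have h1 := congrArg (eval (x k)) hG0
  rw [hG, eval_mul, eval_C, eval_finsetSum, sum_eq_single k] at h1
  · simp only [eval_mul, eval_C, eval_prod, eval_sub, eval_X, eval_zero, mul_eq_zero, hu,
      false_or] at h1
    rcases h1 with (h1 | h1) | h1
    · exact h1
    · have := hlam k hk
      exact absurd (Nat.cast_eq_zero.1 h1) (by omega)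
    · obtain ⟨i, hi, h2⟩ := prod_eq_zero_iff.1 h1
      exact absurd (hx hk (mem_of_mem_erase hi) (sub_eq_zero.1 h2))
        (ne_of_mem_erase hi).symm
  · intro i hi hik
    rw [eval_mul, eval_prod, prod_eq_zero (mem_erase.2 ⟨hik.symm, hk⟩) (by simp),
      mul_zero]
  · exact fun h => absurd hk h

end vprod

theorem eval_prim_quad {N : ℕ} {p : ℂ[X]} (hp : p.natDegree ≤ N) (y : ℂ) :
    (prim p).eval y
      = ∑ r ∈ range (N + 1), p.eval (r : ℂ) * (quadPoly N r).eval y := by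
  rw [prim_quad N p hp, eval_finsetSum]
  simp

/-- Zeros of a parametrized family near a nondegenerate zero. -/
theorem exists_unique_zero_near {P E : Type*} [NormedAddCommGroup P] [NormedSpace ℂ P]
    [FiniteDimensional ℂ P] [NormedAddCommGroup E] [NormedSpace ℂ E] [FiniteDimensional ℂ E]
    (F : P × E → E) (hF : ContDiff ℂ 1 F) (p0 : P) (z0 : E) (h0 : F (p0, z0) = 0)
    (hinj : ∀ ζ : E, HasDerivAt (fun τ : ℂ => F (p0, z0 + τ • ζ)) 0 0 → ζ = 0) :
    (∃ ε > 0, ∀ᶠ p in 𝓝 p0, ∀ z z', dist z z0 < ε → dist z' z0 < ε →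
      F (p, z) = 0 → F (p, z') = 0 → z = z') ∧
    ∀ ε > 0, ∀ᶠ p in 𝓝 p0, ∃ z, dist z z0 < ε ∧ F (p, z) = 0 := by
  have : CompleteSpace P := FiniteDimensional.complete ℂ P
  have : CompleteSpace E := FiniteDimensional.complete ℂ E
  have hFd := (hF.contDiffAt (x := (p0, z0))).hasStrictFDerivAt (by norm_num)
  set F' := fderiv ℂ F (p0, z0)
  have hG := (hasStrictFDerivAt_fst (𝕜 := ℂ) (p := (p0, z0))).prodMk hFd
  set G' := (ContinuousLinearMap.fst ℂ P E).prod F' with hG'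
  have hker : Function.Injective (G' : P × E →ₗ[ℂ] P × E) := by
    rw [← LinearMap.ker_eq_bot, LinearMap.ker_eq_bot']
    rintro ⟨p, ζ⟩ h
    have h1 : p = 0 := congrArg Prod.fst h
    have h2 : F' (p, ζ) = 0 := congrArg Prod.snd h
    subst h1
    have h3 : HasDerivAt (fun τ : ℂ => (p0, z0 + τ • ζ)) ((0 : P), ζ) 0 := by
      refine (hasDerivAt_const _ _).prodMk ?_
      simpa using ((hasDerivAt_id (0 : ℂ)).smul_const ζ).const_add z0
    have h4 : HasFDerivAt F F' ((fun τ : ℂ => (p0, z0 + τ • ζ)) 0) := by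
      simpa using hFd.hasFDerivAt
    have h5 := h4.comp_hasDerivAt (0 : ℂ) h3
    rw [h2] at h5
    rw [hinj ζ h5]
    rfl
  let e' := (LinearEquiv.ofInjectiveEndo (G' : P × E →ₗ[ℂ] P × E) hker).toContinuousLinearEquiv
  have he' : (e' : P × E →L[ℂ] P × E) = G' := by
    ext x <;> rfl
  have hG2 : HasStrictFDerivAt (fun q : P × E => (q.1, F q)) (e' : P × E →L[ℂ] P × E) (p0, z0) := by
    rw [he']; exact hG
  let e := hG2.toOpenPartialHomeomorph
  have hsrc : (p0, z0) ∈ e.source := hG2.mem_toOpenPartialHomeomorph_source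
  have hval : ∀ q, e q = (q.1, F q) := fun q => rfl
  constructor
  · have hopen : e.source ∈ 𝓝 (p0, z0) := e.open_source.mem_nhds hsrc
    rw [nhds_prod_eq, Filter.mem_prod_iff] at hopen
    obtain ⟨s, hs, t, ht, hst⟩ := hopen
    obtain ⟨ε, hε, hball⟩ := Metric.mem_nhds_iff.1 ht
    refine ⟨ε, hε, ?_⟩
    filter_upwards [hs] with p hp z z' hz hz' h1 h2
    have := e.injOn (hst (Set.mk_mem_prod hp (hball (Metric.mem_ball.2 hz))))
      (hst (Set.mk_mem_prod hp (hball (Metric.mem_ball.2 hz')))) (by rw [hval, hval]; simp [h1, h2])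
    exact congrArg Prod.snd this
  · intro ε hε
    have htgt : (p0, (0 : E)) ∈ e.target := by
      have := e.map_source hsrc
      rwa [hval, h0] at this
    have hsymm : e.symm (p0, 0) = (p0, z0) := by
      have := e.left_inv hsrc
      rwa [hval, h0] at this
    have hc : Tendsto (fun p : P => (p, (0 : E))) (𝓝 p0) (𝓝 (p0, 0)) :=
      (continuous_id.prodMk continuous_const).tendsto p0
    have h1 := hc.eventually (e.open_target.mem_nhds htgt)
    have h2 : Tendsto (fun p : P => e.symm (p, 0)) (𝓝 p0) (𝓝 (p0, z0)) := by
      have := (e.continuousAt_symm htgt).tendsto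
      rw [hsymm] at this
      exact this.comp hc
    have h3 := ((continuous_snd.tendsto (p0, z0)).comp h2).eventually (Metric.ball_mem_nhds z0 hε)
    filter_upwards [h1, h3] with p hp1 hp3
    refine ⟨(e.symm (p, 0)).2, hp3, ?_⟩
    have h4 := e.right_inv hp1
    rw [hval] at h4
    have h5 : (e.symm (p, 0)).1 = p := congrArg Prod.fst h4
    have h6 : F (e.symm (p, 0)) = 0 := congrArg Prod.snd h4
    calc F (p, (e.symm (p, 0)).2) = F (e.symm (p, 0)) := by
          congr 1; exact Prod.ext h5.symm rfl
      _ = 0 := h6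

section
variable {ι : Type*} {V : Finset ι} {lam : ι → ℕ} {u : ℂ} {b : ℕ}

theorem hasDerivAt_prim_wpoly (a e : ι → ℂ) (y c : ℂ) :
    HasDerivAt (fun τ : ℂ => (prim (wpoly V lam (fun k => a k + τ * e k) u b)).eval (y + τ * c))
      (-(prim (∑ k ∈ V, C (e k * lam k) * (X - C (a k)) ^ (lam k - 1) *
        wpoly (V.erase k) lam a u b)).eval y + (wpoly V lam a u b).eval y * c) 0 := by
  set S := ∑ k ∈ V, C (e k * lam k) * (X - C (a k)) ^ (lam k - 1) *
        wpoly (V.erase k) lam a u b with hS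
  set N := b + ∑ k ∈ V, lam k with hN
  have hSdeg : S.natDegree ≤ N := by
    refine natDegree_sum_le_of_forall_le _ _ fun k hk => ?_
    refine natDegree_mul_le.trans ?_
    have h1 : (C (e k * (lam k : ℂ)) * (X - C (a k)) ^ (lam k - 1)).natDegree ≤ lam k - 1 := by
      refine (natDegree_C_mul_le _ _).trans ?_
      simp
    have h2 := natDegree_wpoly_le (V := V.erase k) (lam := lam) (x := a) (u := u) (b := b)
    have h3 := add_sum_erase V lam hk
    omega
  have hlin : ∀ x : ℂ, HasDerivAt (fun τ : ℂ => x + τ * c) c 0 := fun x => by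
    simpa using ((hasDerivAt_id (0 : ℂ)).mul_const c).const_add x
  have hp : ∀ r : ℂ, HasDerivAt
      (fun τ : ℂ => (wpoly V lam (fun k => a k + τ * e k) u b).eval r) (-S.eval r) 0 := by
    intro r
    simp only [eval_wpoly]
    have h1 : HasDerivAt (fun τ : ℂ => ∏ k ∈ V, (r - (a k + τ * e k)) ^ lam k)
        (∑ k ∈ V, (∏ i ∈ V.erase k, (r - (a i + 0 * e i)) ^ lam i) •
          ((lam k : ℂ) * (r - (a k + 0 * e k)) ^ (lam k - 1) * (-e k))) 0 := by
      refine HasDerivAt.fun_finsetProd fun k _ => ?_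
      refine HasDerivAt.fun_pow ?_ _
      simpa using (((hasDerivAt_id (0 : ℂ)).mul_const (e k)).const_add (a k)).const_sub r
    refine (h1.const_mul (u * r ^ b)).congr_deriv ?_
    symm
    rw [hS, eval_finsetSum, ← sum_neg_distrib, mul_sum]
    refine sum_congr rfl fun k _ => ?_
    simp [eval_wpoly]
    ring
  have hsum : HasDerivAt (fun τ : ℂ => ∑ r ∈ range (N + 1),
      (wpoly V lam (fun k => a k + τ * e k) u b).eval (r : ℂ) *
        (quadPoly N r).eval (y + τ * c))
      (∑ r ∈ range (N + 1), (-S.eval (r : ℂ) * (quadPoly N r).eval y +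
        (wpoly V lam a u b).eval (r : ℂ) * ((derivative (quadPoly N r)).eval y * c))) 0 := by
    refine HasDerivAt.fun_sum fun r _ => ?_
    have h1 : HasDerivAt (fun τ : ℂ => (quadPoly N r).eval (y + τ * c))
        ((derivative (quadPoly N r)).eval y * c) 0 := by
      have := (quadPoly N r).hasDerivAt (y + 0 * c)
      have := this.comp (0 : ℂ) (hlin y)
      simpa [Function.comp_def] using this
    have := (hp r).mul h1
    simpa [Pi.mul_def] using this
  have hfun : (fun τ : ℂ => (prim (wpoly V lam (fun k => a k + τ * e k) u b)).eval (y + τ * c))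
      = fun τ : ℂ => ∑ r ∈ range (N + 1),
      (wpoly V lam (fun k => a k + τ * e k) u b).eval (r : ℂ) *
        (quadPoly N r).eval (y + τ * c) := by
    funext τ
    exact eval_prim_quad natDegree_wpoly_le _
  rw [hfun]
  refine hsum.congr_deriv ?_
  symm
  rw [sum_add_distrib, eval_prim_quad hSdeg, ← sum_neg_distrib]
  congr 1
  · exact sum_congr rfl fun r _ => by ring
  · have h1 := congrArg derivative (prim_quad N (wpoly V lam a u b) natDegree_wpoly_le)
    rw [derivative_prim] at h1
    conv_lhs => rw [h1]
    simp [eval_finsetSum, sum_mul, mul_assoc]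

theorem exists_ref (a : ι → ℂ) (V : Finset ι) : ∃ ref : ι → ι, (∀ j ∈ V, ref j ∈ V) ∧
    (∀ j ∈ V, a (ref j) = a j) ∧ ∀ j k, a j = a k → ref j = ref k := by
  let r : ℂ → ι → ι := fun v j => if h : ∃ k ∈ V, a k = v then h.choose else j
  by_cases hV : V.Nonempty
  · obtain ⟨i0, hi0⟩ := hV
    refine ⟨fun j => if h : ∃ k ∈ V, a k = a j then h.choose else i0, ?_, ?_, ?_⟩
    · intro j hj
      have h : ∃ k ∈ V, a k = a j := ⟨j, hj, rfl⟩
      simp only [dif_pos h]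
      exact h.choose_spec.1
    · intro j hj
      have h : ∃ k ∈ V, a k = a j := ⟨j, hj, rfl⟩
      simp only [dif_pos h]
      exact h.choose_spec.2
    · intro j k hjk
      simp only [hjk]
  · rw [not_nonempty_iff_eq_empty] at hV
    subst hV
    by_cases hι : Nonempty ι
    · exact ⟨fun _ => hι.some, by simp, by simp, fun _ _ _ => rfl⟩
    · exact ⟨id, by simp, by simp, fun j => (hι ⟨j⟩).elim⟩

theorem vprod_regroup (ref : ι → ι) (x : ι → ℂ) (h : ∀ k ∈ V, x k = x (ref k)) :
    vprod V lam x = vprod (V.image ref) (fun r => ∑ k ∈ V with ref k = r, lam k) x := by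
  rw [vprod, vprod, ← prod_fiberwise_of_maps_to
    (fun k hk => mem_image_of_mem ref hk)]
  refine prod_congr rfl fun r _ => ?_
  rw [← prod_pow_eq_pow_sum]
  refine prod_congr rfl fun k hk => ?_
  obtain ⟨hk, hr⟩ := mem_filter.1 hk
  rw [h k hk, hr]

/-- Nondegeneracy of the critical value map, on configurations with prescribed collisions. -/
theorem nondegenerate (hu : u ≠ 0) (hlam : ∀ k ∈ V, 1 ≤ lam k) (a e : ι → ℂ)
    (hae : ∀ j ∈ V, ∀ k ∈ V, a j = a k → e j = e k) (ha0 : ∀ k ∈ V, a k ≠ 0)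
    (h : ∀ j ∈ V, HasDerivAt
      (fun τ : ℂ => (prim (wpoly V lam (fun k => a k + τ * e k) u b)).eval (a j + τ * e j)) 0 0) :
    ∀ k ∈ V, e k = 0 := by
  obtain ⟨ref, href, hval, hcompat⟩ := exists_ref a V
  have heref : ∀ k ∈ V, e k = e (ref k) := fun k hk =>
    (hae _ (href k hk) _ hk (hval k hk)).symm
  set M : ι → ℕ := fun r => ∑ k ∈ V with ref k = r, lam k with hM
  have hregroup : ∀ τ : ℂ, wpoly V lam (fun k => a k + τ * e k) u b
      = wpoly (V.image ref) M (fun k => a k + τ * e k) u b := by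
    intro τ
    rw [wpoly, wpoly, vprod_regroup ref]
    intro k hk
    rw [hval k hk, ← heref k hk]
  have hmem : ∀ j ∈ V.image ref, j ∈ V := by
    intro j hj
    obtain ⟨k, hk, rfl⟩ := mem_image.1 hj
    exact href k hk
  have hMpos : ∀ j ∈ V.image ref, 1 ≤ M j := by
    intro j hj
    obtain ⟨k, hk, rfl⟩ := mem_image.1 hj
    exact (hlam k hk).trans (single_le_sum (f := lam) (fun _ _ => Nat.zero_le _)
      (mem_filter.2 ⟨hk, rfl⟩))
  have hinj : Set.InjOn a (V.image ref : Finset ι) := by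
    intro i hi j hj hij
    obtain ⟨i', hi', rfl⟩ := mem_image.1 (mem_coe.1 hi)
    obtain ⟨j', hj', rfl⟩ := mem_image.1 (mem_coe.1 hj)
    rw [hval _ hi', hval _ hj'] at hij
    exact hcompat _ _ hij
  have key := nondegenerate_of_injOn (b := b) hu hMpos hinj (fun k hk => ha0 k (hmem k hk)) e (by
    intro j hj
    have h1 := h j (hmem j hj)
    simp only [hregroup] at h1
    have h2 := h1.unique (hasDerivAt_prim_wpoly a e (a j) (e j))
    have h3 : (wpoly (V.image ref) M a u b).eval (a j) = 0 := by
      rw [eval_wpoly, prod_eq_zero hj, mul_zero]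
      rw [sub_self, zero_pow]
      have := hMpos j hj
      omega
    rw [h3, zero_mul, add_zero, eq_comm, neg_eq_zero] at h2
    exact h2)
  intro k hk
  rw [heref k hk]
  exact key _ (mem_image_of_mem _ hk)

end

section
variable {ι : Type*}

theorem wpoly_congr {V : Finset ι} {lam : ι → ℕ} {x x' : ι → ℂ} {u : ℂ} {b : ℕ}
    (h : ∀ k ∈ V, x k = x' k) : wpoly V lam x u b = wpoly V lam x' u b := by
  rw [wpoly, wpoly, vprod, vprod]
  congr 1
  exact prod_congr rfl fun k hk => by rw [h k hk]

theorem wpoly_erase {V : Finset ι} {lam : ι → ℕ} {x : ι → ℂ} {u : ℂ} {r : ι} (hr : r ∈ V)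
    (h : x r = 0) : wpoly V lam x u 0 = wpoly (V.erase r) lam x u (lam r) := by
  rw [wpoly, wpoly, vprod, vprod, ← mul_prod_erase V _ hr, h, C_0, sub_zero, pow_zero,
    mul_one, mul_assoc]

/-- The weight seen by the vertices of `c` in the frame with origin `m` and scale `s`. -/
def frameW (V c : Finset ι) (lam : ι → ℕ) (x : ι → ℂ) (u : ℂ) (b : ℕ)
    (m s : ℂ) : ℂ[X] :=
  C u * (C m + C s * X) ^ b * ∏ k ∈ V \ c, (C m + C s * X - C (x k)) ^ lam k

theorem eval_frameW (V c : Finset ι) (lam : ι → ℕ) (x : ι → ℂ) (u : ℂ) (b : ℕ) (m s y : ℂ) :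
    (frameW V c lam x u b m s).eval y
      = u * (m + s * y) ^ b * ∏ k ∈ V \ c, (m + s * y - x k) ^ lam k := by
  simp [frameW, eval_prod]

theorem frameW_zero (V c : Finset ι) (lam : ι → ℕ) (x : ι → ℂ) (u : ℂ) (b : ℕ) (m : ℂ) :
    frameW V c lam x u b m 0 = C (u * m ^ b * ∏ k ∈ V \ c, (m - x k) ^ lam k) := by
  simp [frameW, map_prod]

theorem natDegree_frame_le {V c : Finset ι} (hc : c ⊆ V) (lam : ι → ℕ) (x y : ι → ℂ) (u : ℂ)
    (b : ℕ) (m s : ℂ) :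
    (frameW V c lam x u b m s * vprod c lam y).natDegree ≤ b + ∑ k ∈ V, lam k := by
  have h0 : (C m + C s * X).natDegree ≤ 1 := by
    have := natDegree_linear_le (a := s) (b := m)
    rwa [add_comm] at this
  have h1 : (C u * (C m + C s * X) ^ b).natDegree ≤ b := by
    refine (natDegree_C_mul_le _ _).trans (natDegree_pow_le.trans ?_)
    nlinarith
  have h2 : (∏ k ∈ V \ c, (C m + C s * X - C (x k)) ^ lam k).natDegree ≤ ∑ k ∈ V \ c, lam k := by
    refine (natDegree_prod_le _ _).trans (sum_le_sum fun k _ => ?_)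
    refine natDegree_pow_le.trans ?_
    have : (C m + C s * X - C (x k)).natDegree ≤ 1 := natDegree_sub_C.le.trans h0
    nlinarith
  have h3 := natDegree_vprod c lam y
  have h4 := sum_sdiff (f := lam) hc
  have h5 := natDegree_mul_le (p := frameW V c lam x u b m s) (q := vprod c lam y)
  have h6 : (frameW V c lam x u b m s).natDegree ≤ b + ∑ k ∈ V \ c, lam k :=
    natDegree_mul_le.trans (add_le_add h1 h2)
  omega

theorem wpoly_frame {V c : Finset ι} (hc : c ⊆ V) {lam : ι → ℕ} {x y : ι → ℂ} {u : ℂ}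
    {b : ℕ} {m s : ℂ} (h : ∀ k ∈ c, x k = m + s * y k) (z : ℂ) :
    (prim (wpoly V lam x u b)).eval (m + s * z) - (prim (wpoly V lam x u b)).eval m
      = s ^ (1 + ∑ k ∈ c, lam k) * (prim (frameW V c lam x u b m s * vprod c lam y)).eval z := by
  have h1 : (wpoly V lam x u b).comp (C m + C s * X)
      = C (s ^ (∑ k ∈ c, lam k)) * (frameW V c lam x u b m s * vprod c lam y) := by
    rw [wpoly, vprod, ← prod_sdiff hc, frameW, vprod]
    simp only [mul_comp, C_comp, pow_comp, X_comp, Polynomial.prod_comp, sub_comp]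
    have h2 : ∏ k ∈ c, (C m + C s * X - C (x k)) ^ lam k
        = C (s ^ (∑ k ∈ c, lam k)) * ∏ k ∈ c, (X - C (y k)) ^ lam k := by
      rw [← prod_pow_eq_pow_sum, map_prod, ← prod_mul_distrib]
      refine prod_congr rfl fun k hk => ?_
      rw [h k hk, C_pow, ← mul_pow]
      congr 1
      simp only [map_add, map_mul]
      ring
    rw [h2]
    ring
  rw [prim_frame, h1, prim_C_mul, eval_mul, eval_C]
  ring

theorem wpoly_shift {V : Finset ι} {lam : ι → ℕ} {x y : ι → ℂ} {u : ℂ} {m : ℂ}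
    (h : ∀ k ∈ V, x k = m + y k) (z : ℂ) :
    (prim (wpoly V lam x u 0)).eval (m + z) - (prim (wpoly V lam x u 0)).eval m
      = (prim (wpoly V lam y u 0)).eval z := by
  have := wpoly_frame (Finset.Subset.refl V) (lam := lam) (x := x) (y := y) (u := u) (b := 0)
    (m := m) (s := 1) (by simpa using h) z
  rw [one_mul, one_pow, one_mul] at this
  rw [this]
  simp [frameW, wpoly]

variable (V : Finset ι) (lam : ι → ℕ)

/-- The critical value equations. -/
def Eqs (u : ℂ) (b : ℕ) (d : ι → ℝ) (t : ℝ) (x : ι → ℂ) : Prop :=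
  (∀ j ∉ V, x j = 0) ∧
    ∀ j ∈ V, (prim (wpoly V lam x u b)).eval (x j) = ((1 + t * (d j - 1) : ℝ) : ℂ)

/-- The cluster of `j`. -/
def clus (α : ι → ℂ) (j : ι) : Finset ι := V.filter fun k => α k = α j

/-- The scale of the cluster of `j` at time `t`. -/
def sc (α : ι → ℂ) (t : ℝ) (j : ι) : ℝ :=
  t ^ (((1 + ∑ k ∈ clus V α j, lam k : ℕ) : ℝ)⁻¹)

/-- Closeness of a configuration to a limit configuration. -/
def Near (α y : ι → ℂ) (η t : ℝ) (x : ι → ℂ) : Prop :=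
  ∀ j ∈ V, ‖x j - α j‖ < η ∧
    ∀ k ∈ V, α k = α j → ‖(x j - x k) / (sc V lam α t j : ℂ) - (y j - y k)‖ < η

/-- The weight at a cluster. -/
def cw (u : ℂ) (b : ℕ) (α : ι → ℂ) (j : ι) : ℂ :=
  u * α j ^ b * ∏ k ∈ V \ clus V α j, (α j - α k) ^ lam k

/-- Limit configurations at time `t0`: either nondegenerate, or with clusters at time `0`. -/
structure Base (u : ℂ) (b : ℕ) (d : ι → ℝ) (t0 : ℝ) (α y : ι → ℂ) : Prop where
  eqs : Eqs V lam u b d t0 α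
  ne_zero : ∀ j ∈ V, α j ≠ 0
  alt : (0 < t0 ∧ Set.InjOn α V) ∨ (t0 = 0 ∧ ∀ j ∈ V, Set.InjOn y (clus V α j) ∧
    ∀ k ∈ clus V α j, (prim (wpoly (clus V α j) lam y (cw V lam u b α j) 0)).eval (y k) -
      (prim (wpoly (clus V α j) lam y (cw V lam u b α j) 0)).eval (y j)
        = ((d k - d j : ℝ) : ℂ))

end

section
variable {ι : Type*} (V : Finset ι) (lam : ι → ℕ)

/-- The configuration with cluster coordinates `z` and scales `s`. -/
def Xf (ref : ι → ι) (s z : ι → ℂ) (j : ι) : ℂ :=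
  if j ∈ V then z (ref j) + s (ref j) * (if ref j = j then 0 else z j) else 0

/-- Coordinates relative to the reference vertex of the cluster. -/
def Yf (ref : ι → ι) (z : ι → ℂ) (j : ι) : ℂ := if ref j = j then 0 else z j

/-- The critical value equations in cluster coordinates. -/
def clusterEq (ref : ι → ι) (α : ι → ℂ) (u : ℂ) (b : ℕ) (d : ι → ℝ)
    (q : (ℂ × (ι → ℂ)) × (ι → ℂ)) (j : ι) : ℂ :=
  if j ∈ V then
    if ref j = j then
      (prim (wpoly V lam (Xf V ref q.1.2 q.2) u b)).eval (q.2 j) - (1 + q.1.1 * (d j - 1))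
    else
      (prim (frameW V (clus V α (ref j)) lam (Xf V ref q.1.2 q.2) u b (q.2 (ref j))
        (q.1.2 (ref j)) * vprod (clus V α (ref j)) lam (Yf ref q.2))).eval (q.2 j)
        - (d j - d (ref j))
  else q.2 j

variable {V lam} {ref : ι → ι} {α : ι → ℂ} {u : ℂ} {b : ℕ} {d : ι → ℝ}

theorem clus_subset (α : ι → ℂ) (j : ι) : clus V α j ⊆ V := filter_subset _ _

theorem clusterEq_eq_zero_iff (hrefV : ∀ j ∈ V, ref j ∈ V) (hrefα : ∀ j ∈ V, α (ref j) = α j)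
    (hrefc : ∀ j k, α j = α k → ref j = ref k) {t : ℝ} {s : ι → ℂ} (ht : t ≠ 0)
    (hs : ∀ j ∈ V, s (ref j) ^ (1 + ∑ k ∈ clus V α j, lam k) = t) (z : ι → ℂ) :
    clusterEq V lam ref α u b d ((t, s), z) = 0 ↔
      Eqs V lam u b d t (Xf V ref s z) ∧ ∀ j ∉ V, z j = 0 := by
  have hrr : ∀ j ∈ V, ref (ref j) = ref j := fun j hj => hrefc _ _ (hrefα j hj)
  have hXref : ∀ j ∈ V, ref j = j → Xf V ref s z j = z j := by
    intro j hj h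
    simp [Xf, hj, h]
  have hframe : ∀ j ∈ V, (prim (wpoly V lam (Xf V ref s z) u b)).eval (z (ref j) + s (ref j) * z j)
      - (prim (wpoly V lam (Xf V ref s z) u b)).eval (z (ref j))
      = t * (prim (frameW V (clus V α (ref j)) lam (Xf V ref s z) u b (z (ref j))
        (s (ref j)) * vprod (clus V α (ref j)) lam (Yf ref z))).eval (z j) := by
    intro j hj
    have h1 := wpoly_frame (clus_subset (V := V) α (ref j)) (lam := lam) (x := Xf V ref s z)
      (y := Yf ref z) (u := u) (b := b) (m := z (ref j)) (s := s (ref j)) (by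
        intro k hk
        obtain ⟨hkV, hk⟩ := mem_filter.1 hk
        have : ref k = ref j := by rw [hrefc k (ref j) hk, hrr j hj]
        simp only [Xf, hkV, if_true, Yf, this]) (z j)
    have h2 := hs (ref j) (hrefV j hj)
    rw [hrr j hj] at h2
    rw [h1, h2]
  have htC : (t : ℂ) ≠ 0 := by exact_mod_cast ht
  have hval : ∀ j ∈ V, ref j = j → (clusterEq V lam ref α u b d ((t, s), z) j = 0 ↔
      (prim (wpoly V lam (Xf V ref s z) u b)).eval (Xf V ref s z j)
        = ((1 + t * (d j - 1) : ℝ) : ℂ)) := by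
    intro j hj h
    simp only [clusterEq, hj, if_true, h, hXref j hj h, sub_eq_zero]
    push_cast
    rfl
  constructor
  · intro h
    have hj : ∀ j, clusterEq V lam ref α u b d ((t, s), z) j = 0 := fun j => congrFun h j
    refine ⟨⟨fun j hjV => by simp [Xf, hjV], fun j hjV => ?_⟩, fun j hjV => ?_⟩
    · have h0 := (hval (ref j) (hrefV j hjV) (hrr j hjV)).1 (hj _)
      by_cases hr : ref j = j
      · exact (hval j hjV hr).1 (hj j)
      · have h1 := hj j
        simp only [clusterEq, hjV, if_true, hr, if_false, sub_eq_zero] at h1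
        have h2 := hframe j hjV
        rw [h1] at h2
        rw [hXref _ (hrefV j hjV) (hrr j hjV)] at h0
        rw [h0] at h2
        have h3 : Xf V ref s z j = z (ref j) + s (ref j) * z j := by simp [Xf, hjV, hr]
        rw [h3, sub_eq_iff_eq_add.1 h2]
        push_cast
        ring
    · have := hj j
      simpa [clusterEq, hjV] using this
  · rintro ⟨⟨_, h⟩, hz⟩
    funext j
    by_cases hjV : j ∈ V
    · by_cases hr : ref j = j
      · exact (hval j hjV hr).2 (h j hjV)
      · have h0 := h (ref j) (hrefV j hjV)
        have h1 := h j hjV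
        have h3 : Xf V ref s z j = z (ref j) + s (ref j) * z j := by simp [Xf, hjV, hr]
        rw [hXref _ (hrefV j hjV) (hrr j hjV)] at h0
        rw [h3] at h1
        have h2 := hframe j hjV
        rw [h0, h1] at h2
        simp only [clusterEq, hjV, if_true, hr, if_false, Pi.zero_apply, sub_eq_zero]
        apply mul_left_cancel₀ htC
        rw [← h2]
        push_cast
        ring
    · simpa [clusterEq, hjV] using hz j hjV

theorem contDiff_clusterEq [Fintype ι] : ContDiff ℂ 1 (clusterEq V lam ref α u b d) := by
  rw [contDiff_pi]
  intro j
  have hX : ∀ k, ContDiff ℂ 1 (fun q : (ℂ × (ι → ℂ)) × (ι → ℂ) => Xf V ref q.1.2 q.2 k) := by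
    intro k
    unfold Xf
    split_ifs <;> fun_prop
  have hY : ∀ k, ContDiff ℂ 1 (fun q : (ℂ × (ι → ℂ)) × (ι → ℂ) => Yf ref q.2 k) := by
    intro k
    unfold Yf
    split_ifs <;> fun_prop
  have hL : ∀ N r, ContDiff ℂ 1
      (fun q : (ℂ × (ι → ℂ)) × (ι → ℂ) => (quadPoly N r).eval (q.2 j)) := by
    intro N r
    have h : ContDiff ℂ 1 fun z : ℂ => (quadPoly N r).eval z := by
      simpa using (quadPoly N r).contDiff_aeval (𝕜 := ℂ) 1
    exact h.comp (by fun_prop)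
  unfold clusterEq
  split_ifs with h1 h2
  · refine ContDiff.sub ?_ (by fun_prop)
    simp only [eval_prim_quad (natDegree_wpoly_le (V := V) (lam := lam) (u := u) (b := b)),
      eval_wpoly]
    refine ContDiff.sum fun r _ => ContDiff.mul (ContDiff.mul (by fun_prop) ?_) (hL _ r)
    exact contDiff_prod fun k _ => (contDiff_const.sub (hX k)).pow _
  · refine ContDiff.sub ?_ (by fun_prop)
    simp only [eval_prim_quad (natDegree_frame_le (clus_subset (V := V) α (ref j)) lam _ _ u b _ _),
      eval_mul, eval_frameW, eval_vprod]
    refine ContDiff.sum fun r _ => ContDiff.mul (ContDiff.mul (ContDiff.mul (by fun_prop) ?_) ?_)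
      (hL _ r)
    · exact contDiff_prod fun k _ => ContDiff.pow (ContDiff.sub (by fun_prop) (hX k)) _
    · exact contDiff_prod fun k _ => (contDiff_const.sub (hY k)).pow _
  · fun_prop

end

section
variable {ι : Type*} {V : Finset ι} {lam : ι → ℕ} {ref : ι → ι} {α y : ι → ℂ} {u : ℂ} {b : ℕ} {d : ι → ℝ} {t0 : ℝ}

theorem cw_ne_zero (hu : u ≠ 0) {j : ι} (hj : α j ≠ 0) : cw V lam u b α j ≠ 0 := by
  refine mul_ne_zero (mul_ne_zero hu (pow_ne_zero _ hj)) ?_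
  refine prod_ne_zero_iff.2 fun k hk => pow_ne_zero _ (sub_ne_zero.2 ?_)
  obtain ⟨hkV, hk⟩ := mem_sdiff.1 hk
  intro h
  exact hk (mem_filter.2 ⟨hkV, h.symm⟩)

theorem Base.ref_eq (hB : Base V lam u b d t0 α y) (hrefV : ∀ j ∈ V, ref j ∈ V)
    (hrefα : ∀ j ∈ V, α (ref j) = α j) {j : ι} (hj : j ∈ V) (h : ref j ≠ j) :
    t0 = 0 ∧ sc V lam α t0 (ref j) = 0 := by
  rcases hB.alt with ⟨_, hinj⟩ | ⟨h0, _⟩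
  · exact absurd (hinj (hrefV j hj) hj (hrefα j hj)) h
  · refine ⟨h0, ?_⟩
    rw [h0, sc, Real.zero_rpow]
    positivity

/-- Base point in cluster coordinates. -/
def zbase (V : Finset ι) (ref : ι → ι) (α y : ι → ℂ) (j : ι) : ℂ :=
  if j ∈ V then if ref j = j then α j else y j - y (ref j) else 0

theorem Base.Xf_eq (hB : Base V lam u b d t0 α y) (hrefV : ∀ j ∈ V, ref j ∈ V)
    (hrefα : ∀ j ∈ V, α (ref j) = α j) (hrefc : ∀ j k, α j = α k → ref j = ref k)
    (ζ : ι → ℂ) (τ : ℂ) {j : ι} (hj : j ∈ V) :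
    Xf V ref (fun k => (sc V lam α t0 k : ℂ)) (zbase V ref α y + τ • ζ) j
      = α j + τ * ζ (ref j) := by
  have hrr : ref (ref j) = ref j := hrefc _ _ (hrefα j hj)
  simp only [Xf, hj, if_true, Pi.add_apply, Pi.smul_apply, smul_eq_mul, zbase, hrefV j hj, hrr,
    hrefα j hj]
  split_ifs with h
  · ring
  · rw [(hB.ref_eq hrefV hrefα hj h).2]
    simp

theorem Base.clusterEq_zbase (hB : Base V lam u b d t0 α y) (hrefV : ∀ j ∈ V, ref j ∈ V)
    (hrefα : ∀ j ∈ V, α (ref j) = α j) (hrefc : ∀ j k, α j = α k → ref j = ref k) :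
    clusterEq V lam ref α u b d ((t0, fun k => (sc V lam α t0 k : ℂ)), zbase V ref α y) = 0 := by
  have hX : ∀ j ∈ V, Xf V ref (fun k => (sc V lam α t0 k : ℂ)) (zbase V ref α y) j = α j := by
    intro j hj
    simpa using hB.Xf_eq hrefV hrefα hrefc 0 0 hj
  funext j
  by_cases hj : j ∈ V
  · have hrr : ref (ref j) = ref j := hrefc _ _ (hrefα j hj)
    by_cases hr : ref j = j
    · simp only [clusterEq, hj, if_true, hr, Pi.zero_apply, sub_eq_zero]
      rw [wpoly_congr hX, show zbase V ref α y j = α j by simp [zbase, hj, hr], hB.eqs.2 j hj]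
      push_cast
      rfl
    · obtain ⟨h0, hs⟩ := hB.ref_eq hrefV hrefα hj hr
      rcases hB.alt with ⟨h1, _⟩ | ⟨_, hy⟩
      · exact absurd h0 h1.ne'
      simp only [clusterEq, hj, if_true, hr, if_false, Pi.zero_apply, sub_eq_zero, hs,
        ofReal_zero, frameW_zero]
      have hzr : zbase V ref α y (ref j) = α (ref j) := by simp [zbase, hrefV j hj, hrr]
      have hjr : j ∈ clus V α (ref j) := mem_filter.2 ⟨hj, (hrefα j hj).symm⟩
      have h2 := (hy (ref j) (hrefV j hj)).2 j hjr
      have h3 : ∀ k ∈ clus V α (ref j), y k = y (ref j) + Yf ref (zbase V ref α y) k := by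
        intro k hk
        obtain ⟨hkV, hk⟩ := mem_filter.1 hk
        have h4 : ref k = ref j := by rw [hrefc k (ref j) hk, hrr]
        simp only [Yf, zbase, hkV, if_true, h4]
        split_ifs with h5
        · rw [h5, add_zero]
        · ring
      have h4 := wpoly_shift (lam := lam) (u := cw V lam u b α (ref j)) h3 (y j - y (ref j))
      rw [add_sub_cancel, h2] at h4
      have h5 : zbase V ref α y j = y j - y (ref j) := by simp [zbase, hj, hr]
      have h6 : u * α (ref j) ^ b * ∏ k ∈ V \ clus V α (ref j),
          (α (ref j) - Xf V ref (fun k => (sc V lam α t0 k : ℂ)) (zbase V ref α y) k) ^ lam k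
          = cw V lam u b α (ref j) := by
        rw [cw]
        congr 1
        exact prod_congr rfl fun k hk => by rw [hX k (mem_sdiff.1 hk).1]
      rw [hzr, h5, h6]
      rw [wpoly, pow_zero, mul_one] at h4
      rw [← h4]
      push_cast
      rfl
  · simp [clusterEq, hj, zbase]

theorem Base.injective [Fintype ι] (hB : Base V lam u b d t0 α y) (hu : u ≠ 0)
    (hlam : ∀ k ∈ V, 1 ≤ lam k) (hrefV : ∀ j ∈ V, ref j ∈ V)
    (hrefα : ∀ j ∈ V, α (ref j) = α j) (hrefc : ∀ j k, α j = α k → ref j = ref k) (ζ : ι → ℂ)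
    (h : HasDerivAt (fun τ : ℂ => clusterEq V lam ref α u b d
      ((t0, fun k => (sc V lam α t0 k : ℂ)), zbase V ref α y + τ • ζ)) 0 0) : ζ = 0 := by
  have hj := fun j => (hasDerivAt_pi.1 h) j
  have hX := fun (τ : ℂ) (j : ι) (hj : j ∈ V) => hB.Xf_eq hrefV hrefα hrefc ζ τ hj
  have hrr : ∀ j ∈ V, ref (ref j) = ref j := fun j hj => hrefc _ _ (hrefα j hj)
  have h1 : ∀ j ∈ V, ζ (ref j) = 0 := by
    refine nondegenerate (b := b) hu hlam α (fun j => ζ (ref j))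
      (fun j _ k _ hjk => by simp only [hrefc j k hjk]) hB.ne_zero fun j hjV => ?_
    have h2 := hj (ref j)
    simp only [clusterEq, hrefV j hjV, if_true, hrr j hjV] at h2
    have h3 := h2.add_const (1 + (t0 : ℂ) * (d (ref j) - 1))
    simp only [sub_add_cancel] at h3
    refine h3.congr_of_eventuallyEq (Eventually.of_forall fun τ => ?_)
    simp only [Pi.add_apply, Pi.smul_apply, smul_eq_mul]
    rw [wpoly_congr (hX τ)]
    have h5 : zbase V ref α y (ref j) = α j := by simp [zbase, hrefV j hjV, hrr j hjV, hrefα j hjV]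
    rw [h5]
  funext j
  by_cases hjV : j ∈ V
  · by_cases hr : ref j = j
    · rw [← hr]; exact h1 j hjV
    obtain ⟨h0, hs⟩ := hB.ref_eq hrefV hrefα hjV hr
    rcases hB.alt with ⟨h2, _⟩ | ⟨_, hy⟩
    · exact absurd h0 h2.ne'
    set r := ref j with hr'
    have hrV : r ∈ V := hrefV j hjV
    have hrr' : ref r = r := hrr j hjV
    have hrc : r ∈ clus V α r := mem_filter.2 ⟨hrV, rfl⟩
    have hmem : ∀ k ∈ clus V α r, k ∈ V ∧ ref k = r := by
      intro k hk
      obtain ⟨hkV, hk⟩ := mem_filter.1 hk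
      exact ⟨hkV, by rw [hrefc k r hk, hrr j hjV]⟩
    have hζr : ζ r = 0 := h1 j hjV
    have hjr : j ∈ (clus V α r).erase r :=
      mem_erase.2 ⟨fun h => hr h.symm, mem_filter.2 ⟨hjV, (hrefα j hjV).symm⟩⟩
    refine nondegenerate (V := (clus V α r).erase r) (lam := lam) (b := lam r)
      (u := cw V lam u b α r) (cw_ne_zero hu (hB.ne_zero r hrV))
      (fun k hk => hlam k (hmem k (mem_of_mem_erase hk)).1) (fun k => y k - y r) ζ
      ?_ ?_ ?_ j hjr
    · intro k hk l hl hkl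
      have := (hy r hrV).1 (mem_of_mem_erase hk) (mem_of_mem_erase hl)
        (sub_left_injective hkl)
      rw [this]
    · intro k hk
      refine sub_ne_zero.2 fun h => ne_of_mem_erase hk ?_
      exact (hy r hrV).1 (mem_of_mem_erase hk) hrc h
    · intro k hk
      obtain ⟨hkr, hkc⟩ := mem_erase.1 hk
      obtain ⟨hkV, hkref⟩ := hmem k hkc
      have h2 := hj k
      simp only [clusterEq, hkV, if_true, hkref, Ne.symm hkr, if_false] at h2
      have h3 := h2.add_const ((d k : ℂ) - d r)
      simp only [sub_add_cancel] at h3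
      refine h3.congr_of_eventuallyEq (Eventually.of_forall fun τ => ?_)
      simp only [hs, ofReal_zero, frameW_zero]
      have h5 : (zbase V ref α y + τ • ζ) k = y k - y r + τ * ζ k := by
        simp [zbase, hkV, hkref, Ne.symm hkr]
      have h6 : (zbase V ref α y + τ • ζ) r = α r := by
        simp [zbase, hrV, hrr', hζr]
      rw [h5, h6]
      have h7 : u * α r ^ b * ∏ k ∈ V \ clus V α r, (α r - Xf V ref
          (fun k => (sc V lam α t0 k : ℂ)) (zbase V ref α y + τ • ζ) k) ^ lam k
          = cw V lam u b α r := by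
        rw [cw]
        congr 1
        refine prod_congr rfl fun i hi => ?_
        have hiV := (mem_sdiff.1 hi).1
        rw [hX τ i hiV, h1 i hiV, mul_zero, add_zero]
      rw [h7, ← wpoly_erase hrc (by simp [hζr]), wpoly, pow_zero, mul_one]
      congr 3
      rw [vprod, vprod]
      refine prod_congr rfl fun i hi => ?_
      obtain ⟨hiV, hiref⟩ := hmem i hi
      simp only [Yf, Pi.add_apply, Pi.smul_apply, smul_eq_mul, zbase, hiV, if_true, hiref]
      split_ifs with h8
      · rw [← h8, hζr]; simp
      · rfl
  · have h2 := hj j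
    simp only [clusterEq, hjV, if_false, Pi.add_apply, Pi.smul_apply, smul_eq_mul] at h2
    have h3 : HasDerivAt (fun τ : ℂ => zbase V ref α y j + τ * ζ j) (ζ j) 0 := by
      simpa using ((hasDerivAt_id (0 : ℂ)).mul_const (ζ j)).const_add (zbase V ref α y j)
    exact h3.unique h2

theorem continuous_sc (j : ι) : Continuous fun t : ℝ => sc V lam α t j := by
  unfold sc
  exact Real.continuous_rpow_const (by positivity)

theorem sc_pow {t : ℝ} (ht : 0 ≤ t) (j : ι) :
    sc V lam α t j ^ (1 + ∑ k ∈ clus V α j, lam k) = t := by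
  rw [sc, Real.rpow_inv_natCast_pow ht (by omega)]

theorem sc_pos {t : ℝ} (ht : 0 < t) (j : ι) : 0 < sc V lam α t j := Real.rpow_pos_of_pos ht _

theorem Near.mono {η η' t : ℝ} {x : ι → ℂ} (h : Near V lam α y η t x) (hη : η ≤ η') :
    Near V lam α y η' t x := fun j hj =>
  ⟨(h j hj).1.trans_le hη, fun k hk hkj => ((h j hj).2 k hk hkj).trans_le hη⟩

/-- Near a limit configuration there is exactly one solution. -/
theorem Base.exists_unique_near [Fintype ι] (hB : Base V lam u b d t0 α y) (hu : u ≠ 0)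
    (hlam : ∀ k ∈ V, 1 ≤ lam k) :
    (∃ η > 0, ∀ᶠ t in 𝓝[Set.Ioi 0] t0, ∀ x x', Eqs V lam u b d t x → Eqs V lam u b d t x' →
      Near V lam α y η t x → Near V lam α y η t x' → x = x') ∧
    ∀ η > 0, ∀ᶠ t in 𝓝[Set.Ioi 0] t0, ∃ x, Eqs V lam u b d t x ∧ Near V lam α y η t x := by
  obtain ⟨ref, hrefV, hrefα, hrefc⟩ := exists_ref α V
  have hrr : ∀ j ∈ V, ref (ref j) = ref j := fun j hj => hrefc _ _ (hrefα j hj)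
  set S : ℝ → ι → ℂ := fun t k => (sc V lam α t k : ℂ) with hS
  obtain ⟨⟨ε, hε, huniq⟩, hex⟩ := exists_unique_zero_near (clusterEq V lam ref α u b d)
    contDiff_clusterEq (t0, S t0) (zbase V ref α y) (hB.clusterEq_zbase hrefV hrefα hrefc)
    (fun ζ h => hB.injective hu hlam hrefV hrefα hrefc ζ h)
  have hlim : Tendsto (fun t : ℝ => ((t : ℂ), S t)) (𝓝[Set.Ioi 0] t0) (𝓝 ((t0 : ℂ), S t0)) := by
    have h1 : Continuous fun t : ℝ => ((t : ℂ), S t) :=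
      continuous_ofReal.prodMk
        (continuous_pi fun k => continuous_ofReal.comp (continuous_sc k))
    exact (h1.tendsto t0).mono_left nhdsWithin_le_nhds
  have hscongr : ∀ t, ∀ j ∈ V, ∀ k, α k = α j → sc V lam α t k = sc V lam α t j := by
    intro t j hj k hk
    simp only [sc, clus, hk]
  have hSpow : ∀ t : ℝ, 0 < t → ∀ j ∈ V, S t (ref j) ^ (1 + ∑ k ∈ clus V α j, lam k) = t := by
    intro t ht j hj
    have h1 : clus V α j = clus V α (ref j) := by simp only [clus, hrefα j hj]
    rw [h1]
    simp only [hS]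
    exact_mod_cast sc_pow ht.le (ref j)
  constructor
  · -- cluster coordinates of a configuration
    let Z : ℝ → (ι → ℂ) → ι → ℂ := fun t x j =>
      if j ∈ V then if ref j = j then x j else (x j - x (ref j)) / S t (ref j) else 0
    have hXZ : ∀ t, 0 < t → ∀ x : ι → ℂ, (∀ j ∉ V, x j = 0) → Xf V ref (S t) (Z t x) = x := by
      intro t ht x hx
      have hS0 : ∀ j, S t j ≠ 0 := fun j => by
        simp only [hS]; exact_mod_cast (sc_pos ht j).ne'
      funext j
      by_cases hj : j ∈ V
      · simp only [Xf, hj, if_true, Z, hrefV j hj, hrr j hj]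
        split_ifs with h
        · rw [h]; ring
        · rw [mul_div_cancel₀ _ (hS0 _)]; ring
      · simp [Xf, hj, hx j hj]
    have hdist : ∀ η > 0, ∀ t x, Near V lam α y η t x → dist (Z t x) (zbase V ref α y) < η := by
      intro η hη t x hN
      rw [dist_pi_lt_iff hη]
      intro j
      rw [dist_eq_norm]
      by_cases hj : j ∈ V
      · simp only [Z, zbase, hj, if_true]
        split_ifs with h
        · exact (hN j hj).1
        · have := (hN j hj).2 (ref j) (hrefV j hj) (hrefα j hj)
          rwa [← hscongr t j hj (ref j) (hrefα j hj)] at this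
      · simp [Z, zbase, hj, hη]
    refine ⟨ε, hε, ?_⟩
    filter_upwards [hlim.eventually huniq, eventually_mem_nhdsWithin (s := Set.Ioi (0 : ℝ))] with t h ht x x' hx hx' hN hN'
    have h1 := h (Z t x) (Z t x') (hdist ε hε t x hN) (hdist ε hε t x' hN')
      ((clusterEq_eq_zero_iff hrefV hrefα hrefc ht.ne' (hSpow t ht) _).2
        ⟨by rw [hXZ t ht x hx.1]; exact hx, fun j hj => by simp [Z, hj]⟩)
      ((clusterEq_eq_zero_iff hrefV hrefα hrefc ht.ne' (hSpow t ht) _).2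
        ⟨by rw [hXZ t ht x' hx'.1]; exact hx', fun j hj => by simp [Z, hj]⟩)
    rw [← hXZ t ht x hx.1, h1, hXZ t ht x' hx'.1]
  · intro η hη
    have hsmall : ∀ᶠ t in 𝓝[Set.Ioi 0] t0, ∀ j ∈ V, ref j ≠ j →
        sc V lam α t (ref j) * (‖y j - y (ref j)‖ + η) < η / 2 := by
      rw [Filter.eventually_all_finset]
      intro j hj
      by_cases hr : ref j = j
      · exact Eventually.of_forall fun t h => absurd hr h
      have h1 : Tendsto (fun t => sc V lam α t (ref j) * (‖y j - y (ref j)‖ + η))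
          (𝓝[Set.Ioi 0] t0) (𝓝 (sc V lam α t0 (ref j) * (‖y j - y (ref j)‖ + η))) :=
        (((continuous_sc _).tendsto t0).mono_left nhdsWithin_le_nhds).mul_const _
      rw [(hB.ref_eq hrefV hrefα hj hr).2, zero_mul] at h1
      filter_upwards [h1.eventually (gt_mem_nhds (half_pos hη))] with t ht _
      exact ht
    filter_upwards [hlim.eventually (hex (η / 2) (half_pos hη)), eventually_mem_nhdsWithin (s := Set.Ioi (0 : ℝ)), hsmall]
      with t ⟨z, hz, hFz⟩ ht hsm
    obtain ⟨hE, hz0⟩ := (clusterEq_eq_zero_iff hrefV hrefα hrefc ht.ne' (hSpow t ht) _).1 hFz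
    refine ⟨_, hE, ?_⟩
    have hzj : ∀ j, ‖z j - zbase V ref α y j‖ < η / 2 := by
      intro j
      rw [← dist_eq_norm]
      exact (dist_le_pi_dist _ _ j).trans_lt hz
    have hS0 : ∀ j, S t j ≠ 0 := fun j => by
      simp only [hS]; exact_mod_cast (sc_pos ht j).ne'
    have hYf : ∀ j ∈ V, ‖Yf ref z j - (y j - y (ref j))‖ < η / 2 := by
      intro j hj
      have h1 := hzj j
      simp only [Yf, zbase, hj, if_true] at h1 ⊢
      split_ifs with hr
      · rw [hr]; simpa using hη
      · simpa [hr] using h1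
    intro j hj
    constructor
    · have h1 := hzj (ref j)
      simp only [zbase, hrefV j hj, if_true, hrr j hj, hrefα j hj] at h1
      have h2 : Xf V ref (S t) z j - α j = (z (ref j) - α j) + S t (ref j) * Yf ref z j := by
        simp only [Xf, hj, if_true, Yf]; ring
      rw [h2]
      refine (norm_add_le _ _).trans_lt ?_
      have h3 : ‖S t (ref j) * Yf ref z j‖ < η / 2 := by
        by_cases hr : ref j = j
        · simpa [Yf, hr] using hη
        · refine lt_of_le_of_lt ?_ (hsm j hj hr)
          rw [norm_mul]
          have h4 : ‖S t (ref j)‖ = sc V lam α t (ref j) := by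
            simp only [hS, norm_real, Real.norm_eq_abs, abs_of_pos (sc_pos ht _)]
          rw [h4]
          refine mul_le_mul_of_nonneg_left ?_ (sc_pos ht _).le
          have h5 := hYf j hj
          have h6 : ‖Yf ref z j‖ ≤ ‖Yf ref z j - (y j - y (ref j))‖ + ‖y j - y (ref j)‖ := by
            simpa using norm_add_le (Yf ref z j - (y j - y (ref j))) (y j - y (ref j))
          linarith
      linarith
    · intro k hk hkj
      have hrk : ref k = ref j := hrefc k j hkj
      have h1 : (Xf V ref (S t) z j - Xf V ref (S t) z k) / (sc V lam α t j : ℂ)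
          = Yf ref z j - Yf ref z k := by
        have h2 : (sc V lam α t j : ℂ) = S t (ref j) := by
          simp only [hS, hscongr t j hj (ref j) (hrefα j hj)]
        rw [h2, div_eq_iff (hS0 _)]
        simp only [Xf, hj, hk, if_true, Yf, hrk]
        ring
      rw [h1]
      have h3 := hYf j hj
      have h4 := hYf k hk
      rw [hrk] at h4
      calc ‖Yf ref z j - Yf ref z k - (y j - y k)‖
          = ‖(Yf ref z j - (y j - y (ref j))) - (Yf ref z k - (y k - y (ref j)))‖ := by
            congr 1; ring
        _ ≤ _ := norm_sub_le _ _
        _ < η := by linarith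

variable {T : Type*}

theorem Ultrafilter.exists_tendsto_of_bounded (l : Ultrafilter T) (f : T → ℂ) (R : ℝ)
    (h : ∀ᶠ t in l, ‖f t‖ ≤ R) : ∃ a, Tendsto f l (𝓝 a) := by
  obtain ⟨a, _, ha⟩ := (isCompact_closedBall (0 : ℂ) R).ultrafilter_le_nhds (l.map f) (by
    rw [Filter.le_principal_iff]
    change ∀ᶠ t in l, f t ∈ Metric.closedBall 0 R
    simpa using h)
  exact ⟨a, ha⟩

theorem Ultrafilter.bounded_or_atTop (l : Ultrafilter T) (f : T → ℝ) :
    (∃ R, ∀ᶠ t in l, f t ≤ R) ∨ Tendsto f l atTop := by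
  by_cases h : ∃ R, ∀ᶠ t in l, f t ≤ R
  · exact Or.inl h
  · refine Or.inr (tendsto_atTop.2 fun R => ?_)
    push Not at h
    filter_upwards [h R] with t ht using ht.le

theorem tendsto_prim_vprod {l : Filter T} {c : Finset ι} {N : ℕ} {W : T → ℂ[X]} {W0 : ℂ[X]}
    (hW : ∀ t, (W t).natDegree ≤ N) (hW0 : W0.natDegree ≤ N)
    (hlim : ∀ r : ℂ, Tendsto (fun t => (W t).eval r) l (𝓝 (W0.eval r)))
    {y : T → ι → ℂ} {a : ι → ℂ} (hy : ∀ k ∈ c, Tendsto (fun t => y t k) l (𝓝 (a k)))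
    {z : T → ℂ} {z0 : ℂ} (hz : Tendsto z l (𝓝 z0)) :
    Tendsto (fun t => (prim (W t * vprod c lam (y t))).eval (z t)) l
      (𝓝 ((prim (W0 * vprod c lam a)).eval z0)) := by
  have hdeg : ∀ (p : ℂ[X]) (x : ι → ℂ), p.natDegree ≤ N →
      (p * vprod c lam x).natDegree ≤ N + ∑ k ∈ c, lam k := by
    intro p x hp
    refine natDegree_mul_le.trans ?_
    rw [natDegree_vprod]
    omega
  simp only [fun t => eval_prim_quad (hdeg (W t) (y t) (hW t)) (z t),
    eval_prim_quad (hdeg W0 a hW0), eval_mul, eval_vprod]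
  refine tendsto_finsetSum _ fun r _ => ((hlim _).mul ?_).mul ?_
  · exact tendsto_finsetProd _ fun k hk => (tendsto_const_nhds.sub (hy k hk)).pow _
  · exact ((quadPoly _ r).continuous.tendsto z0).comp hz

/-- Rescaled vertices cannot have all their critical values tend to `0`. -/
theorem no_collapse (l : Ultrafilter T) {c : Finset ι} {N : ℕ} {W : T → ℂ[X]}
    (hW : ∀ t, (W t).natDegree ≤ N) {w : ℂ} (hw : w ≠ 0) {b : ℕ} (hb : b ≤ N)
    (hlim : ∀ r : ℂ, Tendsto (fun t => (W t).eval r) l (𝓝 (w * r ^ b)))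
    {y : T → ι → ℂ} (hbd : ∀ᶠ t in l, ∀ j ∈ c, ‖y t j‖ ≤ 1)
    (hone : ∀ᶠ t in l, ∃ j ∈ c, ‖y t j‖ = 1)
    (hval : ∀ j ∈ c, Tendsto (fun t => (prim (W t * vprod c lam (y t))).eval (y t j)) l (𝓝 0)) :
    False := by
  have h1 : ∀ j, ∃ a, j ∈ c → Tendsto (fun t => y t j) l (𝓝 a) := by
    intro j
    by_cases hj : j ∈ c
    · obtain ⟨a, ha⟩ := l.exists_tendsto_of_bounded (fun t => y t j) 1 (by
        filter_upwards [hbd] with t ht using ht j hj)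
      exact ⟨a, fun _ => ha⟩
    · exact ⟨0, fun h => absurd h hj⟩
  choose a ha using h1
  have h2 : ∀ j ∈ c, a j = 0 := by
    refine eq_zero_of_values_zero (lam := lam) (b := b) hw fun j hj => ?_
    have h3 := tendsto_prim_vprod (lam := lam) hW (W0 := C w * X ^ b)
      ((natDegree_C_mul_X_pow_le _ _).trans hb) (by simpa using hlim) (fun k hk => ha k hk)
      (ha j hj)
    exact tendsto_nhds_unique h3 (hval j hj)
  have h3 : ∀ᶠ t in l, ∀ j ∈ c, ‖y t j‖ < 1 := by
    rw [Filter.eventually_all_finset]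
    intro j hj
    have h4 := (ha j hj).norm
    rw [h2 j hj, norm_zero] at h4
    exact h4.eventually (gt_mem_nhds one_pos)
  obtain ⟨t, ht, j, hj, ht'⟩ := (h3.and hone).exists
  exact absurd ht' (ht j hj).ne

theorem no_collapse_frame (l : Ultrafilter T) {V c : Finset ι} (hc : c ⊆ V) {u : ℂ} {b : ℕ}
    {x : T → ι → ℂ} {m : T → ℂ} {ρ : T → ℝ} (hρ : ∀ᶠ t in l, 0 < ρ t)
    {κ : T → ℂ} {w : ℂ} (hw : w ≠ 0) {b' : ℕ}
    (hb' : b' ≤ b + ∑ k ∈ V, lam k)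
    (hlim : ∀ z : ℂ, Tendsto (fun t => κ t * (frameW V c lam (x t) u b (m t) (ρ t)).eval z) l
      (𝓝 (w * z ^ b')))
    (hbd : ∀ᶠ t in l, ∀ j ∈ c, ‖x t j - m t‖ ≤ ρ t)
    (hone : ∀ᶠ t in l, ∃ j ∈ c, ‖x t j - m t‖ = ρ t)
    (hval : ∀ j ∈ c, Tendsto (fun t => κ t * ((prim (wpoly V lam (x t) u b)).eval (x t j) -
      (prim (wpoly V lam (x t) u b)).eval (m t)) / ρ t ^ (1 + ∑ k ∈ c, lam k)) l (𝓝 0)) :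
    False := by
  have hnorm : ∀ t, 0 < ρ t → ∀ j, ‖(x t j - m t) / ρ t‖ = ‖x t j - m t‖ / ρ t := by
    intro t ht j
    rw [norm_div, norm_real, Real.norm_eq_abs, abs_of_pos ht]
  refine no_collapse (lam := lam) l (c := c) (N := b + ∑ k ∈ V, lam k)
    (W := fun t => C (κ t) * frameW V c lam (x t) u b (m t) (ρ t)) (fun t => ?_) hw hb'
    (by simpa using hlim) (y := fun t j => (x t j - m t) / ρ t) ?_ ?_ fun j hj => ?_
  · refine (natDegree_C_mul_le _ _).trans ?_
    have h := natDegree_frame_le hc lam (x t) 0 u b (m t) (ρ t)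
    by_cases h0 : frameW V c lam (x t) u b (m t) (ρ t) = 0
    · simp [h0]
    · rw [natDegree_mul h0 (vprod_monic _ _ _).ne_zero] at h
      omega
  · filter_upwards [hρ, hbd] with t ht h j hj
    rw [hnorm t ht, div_le_one ht]
    exact h j hj
  · filter_upwards [hρ, hone] with t ht ⟨j, hj, h⟩
    exact ⟨j, hj, by rw [hnorm t ht, h, div_self ht.ne']⟩
  · refine (hval j hj).congr' ?_
    filter_upwards [hρ] with t ht
    have hρ0 : (ρ t : ℂ) ≠ 0 := by exact_mod_cast ht.ne'
    have h := wpoly_frame hc (lam := lam) (x := x t) (y := fun j => (x t j - m t) / ρ t)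
      (u := u) (b := b) (m := m t) (s := ρ t) (fun k _ => by field_simp; ring)
      ((x t j - m t) / ρ t)
    rw [mul_div_cancel₀ _ hρ0, add_sub_cancel] at h
    rw [h, mul_assoc, prim_C_mul, eval_mul, eval_C]
    field_simp

/-- The largest norm of the values of `f` on `c`. -/
def maxn (c : Finset ι) (f : ι → ℂ) : ℝ := (c.sup fun j => ‖f j‖₊ : NNReal)

theorem le_maxn {c : Finset ι} (f : ι → ℂ) {j : ι} (hj : j ∈ c) : ‖f j‖ ≤ maxn c f :=
  NNReal.coe_le_coe.2 (le_sup (f := fun j => ‖f j‖₊) hj)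

theorem exists_eq_maxn {c : Finset ι} {f : ι → ℂ} (h : 0 < maxn c f) :
    ∃ j ∈ c, ‖f j‖ = maxn c f := by
  rcases c.eq_empty_or_nonempty with rfl | hc
  · simp [maxn] at h
  · obtain ⟨j, hj, h⟩ := exists_mem_eq_sup c hc fun j => ‖f j‖₊
    exact ⟨j, hj, by rw [maxn, h]; rfl⟩

theorem maxn_nonneg (c : Finset ι) (f : ι → ℂ) : 0 ≤ maxn c f := NNReal.coe_nonneg _

theorem tendsto_maxn {l : Filter T} {c : Finset ι} {f : T → ι → ℂ}
    (h : ∀ j ∈ c, Tendsto (fun t => f t j) l (𝓝 0)) :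
    Tendsto (fun t => maxn c (f t)) l (𝓝 0) := by
  have h1 : Tendsto (fun t => ∑ j ∈ c, ‖f t j‖) l (𝓝 0) := by
    simpa using tendsto_finsetSum c fun j hj => (h j hj).norm
  refine squeeze_zero (fun t => maxn_nonneg _ _) (fun t => ?_) h1
  by_cases h0 : 0 < maxn c (f t)
  · obtain ⟨j, hj, h2⟩ := exists_eq_maxn h0
    rw [← h2]
    exact single_le_sum (f := fun j => ‖f t j‖) (fun _ _ => norm_nonneg _) hj
  · exact (not_lt.1 h0).trans (sum_nonneg fun _ _ => norm_nonneg _)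

theorem exists_bound_of_eqs (hu : u ≠ 0) (l : Ultrafilter T) {τ : T → ℝ} (hτ : Tendsto τ l (𝓝 t0))
    {x : T → ι → ℂ} (hE : ∀ᶠ t in l, Eqs V lam u b d (τ t) (x t)) :
    ∃ R, ∀ᶠ t in l, maxn V (x t) ≤ R := by
  refine (l.bounded_or_atTop fun t => maxn V (x t)).resolve_right fun h => ?_
  have hpos : ∀ᶠ t in l, 0 < maxn V (x t) := h.eventually_gt_atTop 0
  refine no_collapse_frame (lam := lam) l (Finset.Subset.refl V) (x := x) (m := fun _ => 0) hpos
    (κ := fun t => ((maxn V (x t) : ℂ) ^ b)⁻¹) hu (b' := b) le_self_add ?_ ?_ ?_ ?_ (u := u) (b := b)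
  · intro z
    refine tendsto_const_nhds.congr' ?_
    filter_upwards [hpos] with t ht
    have : (maxn V (x t) : ℂ) ≠ 0 := by exact_mod_cast ht.ne'
    simp only [eval_frameW, sdiff_self, bot_eq_empty, prod_empty, zero_add,
      mul_pow]
    field_simp
  · exact Eventually.of_forall fun t j hj => by simpa using le_maxn (x t) hj
  · filter_upwards [hpos] with t ht
    simpa using exists_eq_maxn ht
  · intro j hj
    have h1 : Tendsto (fun t => ((1 + τ t * (d j - 1) : ℝ) : ℂ)) l
        (𝓝 ((1 + t0 * (d j - 1) : ℝ) : ℂ)) :=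
      (continuous_ofReal.tendsto _).comp (tendsto_const_nhds.add (hτ.mul_const _))
    have h2 : Tendsto (fun t => ((maxn V (x t) ^ (b + (1 + ∑ k ∈ V, lam k)))⁻¹ : ℝ)) l (𝓝 0) :=
      tendsto_inv_atTop_zero.comp ((tendsto_pow_atTop (by omega)).comp h)
    have h3 := h1.mul ((continuous_ofReal.tendsto _).comp h2)
    rw [ofReal_zero, mul_zero] at h3
    refine h3.congr' ?_
    filter_upwards [hE] with t ht
    rw [ht.2 j hj, prim_eval_zero, sub_zero]
    simp only [Function.comp]
    push_cast
    ring

theorem tendsto_eqs (l : Filter T) [l.NeBot] {τ : T → ℝ}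
    (hτ : Tendsto τ l (𝓝 t0)) {x : T → ι → ℂ} (hE : ∀ᶠ t in l, Eqs V lam u b d (τ t) (x t))
    {α : ι → ℂ} (hα : ∀ j ∈ V, Tendsto (fun t => x t j) l (𝓝 (α j))) {j : ι} (hj : j ∈ V) :
    (prim (wpoly V lam α u b)).eval (α j) = ((1 + t0 * (d j - 1) : ℝ) : ℂ) := by
  have h1 : Tendsto (fun t => ((1 + τ t * (d j - 1) : ℝ) : ℂ)) l
      (𝓝 ((1 + t0 * (d j - 1) : ℝ) : ℂ)) :=
    (continuous_ofReal.tendsto _).comp (tendsto_const_nhds.add (hτ.mul_const _))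
  have h2 := tendsto_prim_vprod (lam := lam) (W := fun _ : T => C u * X ^ b) (W0 := C u * X ^ b)
    (fun _ => natDegree_C_mul_X_pow_le _ _) (natDegree_C_mul_X_pow_le _ _)
    (fun _ => tendsto_const_nhds) hα (hα j hj)
  refine tendsto_nhds_unique (h2.congr' ?_) h1
  filter_upwards [hE] with t ht
  exact ht.2 j hj

theorem mem_clus {j k : ι} : k ∈ clus V α j ↔ k ∈ V ∧ α k = α j := mem_filter

/-- The weight in a shrinking frame at a cluster tends to the cluster weight. -/
theorem tendsto_frameW {l : Filter T} {x : T → ι → ℂ}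
    (hα : ∀ j ∈ V, Tendsto (fun t => x t j) l (𝓝 (α j))) {j : ι} {m : T → ℂ}
    (hm : Tendsto m l (𝓝 (α j))) {s : T → ℂ} (hs : Tendsto s l (𝓝 0)) (z : ℂ) :
    Tendsto (fun t => (frameW V (clus V α j) lam (x t) u b (m t) (s t)).eval z) l
      (𝓝 (cw V lam u b α j)) := by
  simp only [eval_frameW]
  have h0 : Tendsto (fun t => m t + s t * z) l (𝓝 (α j)) := by
    simpa using hm.add (hs.mul_const z)
  exact ((tendsto_const_nhds.mul (h0.pow b))).mul (tendsto_finsetProd _ fun k hk =>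
    (h0.sub (hα k (mem_sdiff.1 hk).1)).pow _)

theorem maxn_pos_of_ne {c : Finset ι} {f : ι → ℂ} {j : ι} (hj : j ∈ c) (h : f j ≠ 0) :
    0 < maxn c f := (norm_pos_iff.2 h).trans_le (le_maxn f hj)

/-- The points of a cluster away from zero cannot collapse to its centre. -/
theorem no_collapse_clus (hu : u ≠ 0) (l : Ultrafilter T) {x : T → ι → ℂ}
    (hα : ∀ j ∈ V, Tendsto (fun t => x t j) l (𝓝 (α j))) {j0 : ι} (hj0 : j0 ∈ V) (h0 : α j0 ≠ 0)
    (hρ : ∀ᶠ t in l, 0 < maxn (clus V α j0) fun k => x t k - x t j0)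
    (hval : ∀ j ∈ clus V α j0, Tendsto (fun t => ((prim (wpoly V lam (x t) u b)).eval (x t j) -
      (prim (wpoly V lam (x t) u b)).eval (x t j0)) /
        (maxn (clus V α j0) fun k => x t k - x t j0 : ℂ) ^ (1 + ∑ k ∈ clus V α j0, lam k)) l (𝓝 0)) :
    False := by
  have hρ0 : Tendsto (fun t => maxn (clus V α j0) fun k => x t k - x t j0) l (𝓝 0) :=
    tendsto_maxn fun j hj => by
      have := (hα j (mem_clus.1 hj).1).sub (hα j0 hj0)
      rwa [(mem_clus.1 hj).2, sub_self] at this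
  refine no_collapse_frame (lam := lam) l (clus_subset (V := V) α j0) (x := x)
    (m := fun t => x t j0) hρ (κ := fun _ => 1) (cw_ne_zero (V := V) (lam := lam) (b := b) hu h0)
    (b' := 0) zero_le (u := u) (b := b) (V := V) (fun z => ?_)
    (Eventually.of_forall fun t j hj => le_maxn (fun k => x t k - x t j0) hj)
    (hρ.mono fun t ht => exists_eq_maxn ht) fun j hj => by simpa only [one_mul] using hval j hj
  simpa using tendsto_frameW (lam := lam) (u := u) (b := b) hα (hα j0 hj0)
    ((continuous_ofReal.tendsto _).comp hρ0) z

theorem limit_injOn (hu : u ≠ 0) (l : Ultrafilter T) {τ : T → ℝ} (ht0 : 0 < t0)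
    {x : T → ι → ℂ} (hE : ∀ᶠ t in l, Eqs V lam u b d (τ t) (x t))
    (hI : ∀ᶠ t in l, Set.InjOn (x t) V)
    (hα : ∀ j ∈ V, Tendsto (fun t => x t j) l (𝓝 (α j)))
    (hval : ∀ j ∈ V, (prim (wpoly V lam α u b)).eval (α j) = ((1 + t0 * (d j - 1) : ℝ) : ℂ))
    (hne : ∀ j ∈ V, α j ≠ 0) : Set.InjOn α V := by
  intro j0 hj0 k0 hk0 hjk
  by_contra hne0
  have hd : ∀ j ∈ clus V α j0, d j = d j0 := by
    intro j hj
    have h1 := hval j (mem_clus.1 hj).1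
    rw [(mem_clus.1 hj).2, hval j0 hj0, ofReal_inj] at h1
    have h2 : t0 * (d j0 - d j) = 0 := by linarith
    rcases mul_eq_zero.1 h2 with h | h
    · exact absurd h ht0.ne'
    · linarith
  have hρ : ∀ᶠ t in l, 0 < maxn (clus V α j0) (fun k => x t k - x t j0) := by
    filter_upwards [hI] with t ht
    exact maxn_pos_of_ne (mem_clus.2 ⟨hk0, hjk.symm⟩) (sub_ne_zero.2 fun h =>
      hne0 (ht hj0 hk0 h.symm))
  refine no_collapse_clus (lam := lam) (b := b) hu l hα hj0 (hne j0 hj0) hρ fun j hj => ?_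
  refine tendsto_const_nhds.congr' ?_
  filter_upwards [hE] with t ht
  rw [ht.2 j (mem_clus.1 hj).1, ht.2 j0 hj0, hd j hj]
  simp

theorem cluster_bounded (hu : u ≠ 0) (l : Ultrafilter T) {τ : T → ℝ}
    (hτ0 : ∀ᶠ t in l, 0 < τ t)
    {x : T → ι → ℂ} (hE : ∀ᶠ t in l, Eqs V lam u b d (τ t) (x t))
    (hα : ∀ j ∈ V, Tendsto (fun t => x t j) l (𝓝 (α j)))
    (hne : ∀ j ∈ V, α j ≠ 0) {j0 k0 : ι} (hj0 : j0 ∈ V) (hk0 : k0 ∈ V) (hjk : α k0 = α j0) :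
    ∃ z, Tendsto (fun t => (x t j0 - x t k0) / (sc V lam α (τ t) j0 : ℂ)) l (𝓝 z) := by
  have hs : ∀ᶠ t in l, 0 < sc V lam α (τ t) j0 := by
    filter_upwards [hτ0] with t ht using sc_pos ht _
  have key : ∃ R, ∀ᶠ t in l, maxn (clus V α j0) (fun k => x t k - x t j0) /
      sc V lam α (τ t) j0 ≤ R := by
    refine (l.bounded_or_atTop _).resolve_right fun h => ?_
    have hρ : ∀ᶠ t in l, 0 < maxn (clus V α j0) (fun k => x t k - x t j0) := by
      filter_upwards [h.eventually_gt_atTop 0, hs] with t ht hs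
      exact (div_pos_iff_of_pos_right hs).1 ht
    refine no_collapse_clus (lam := lam) (b := b) hu l hα hj0 (hne j0 hj0) hρ fun j hj => ?_
    have h2 : Tendsto (fun t => (d j - d j0) * ((maxn (clus V α j0) (fun k => x t k - x t j0) /
        sc V lam α (τ t) j0) ^ (1 + ∑ k ∈ clus V α j0, lam k))⁻¹) l (𝓝 0) := by
      have := (tendsto_inv_atTop_zero.comp ((tendsto_pow_atTop (α := ℝ)
        (n := 1 + ∑ k ∈ clus V α j0, lam k) (by omega)).comp h)).const_mul (d j - d j0)
      simpa using this
    have h3 := (continuous_ofReal.tendsto _).comp h2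
    rw [ofReal_zero] at h3
    refine h3.congr' ?_
    filter_upwards [hE, hτ0] with t ht htp
    rw [ht.2 j (mem_clus.1 hj).1, ht.2 j0 hj0]
    have h4 := sc_pow (V := V) (lam := lam) (α := α) htp.le j0
    simp only [Function.comp]
    rw [div_pow, h4]
    push_cast
    rw [inv_div]
    ring
  obtain ⟨R, hR⟩ := key
  refine l.exists_tendsto_of_bounded _ R ?_
  filter_upwards [hR, hs] with t ht hs
  rw [norm_div, norm_real, Real.norm_of_nonneg hs.le, norm_sub_rev]
  exact (div_le_div_of_nonneg_right (le_maxn (fun k => x t k - x t j0)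
    (mem_clus.2 ⟨hk0, hjk⟩)) hs.le).trans ht

theorem tendsto_sc {l : Filter T} {τ : T → ℝ} (hτ : Tendsto τ l (𝓝 0)) (j : ι) :
    Tendsto (fun t => (sc V lam α (τ t) j : ℂ)) l (𝓝 0) := by
  have h0 : sc V lam α 0 j = 0 := by
    rw [sc, Real.zero_rpow]
    positivity
  have h1 := (continuous_sc (V := V) (lam := lam) (α := α) j).tendsto 0
  rw [h0] at h1
  have h2 := (continuous_ofReal.tendsto _).comp (h1.comp hτ)
  rwa [ofReal_zero] at h2

theorem limit_cluster_injOn (hu : u ≠ 0) (l : Ultrafilter T) {τ : T → ℝ}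
    (hτ0 : ∀ᶠ t in l, 0 < τ t)
    {x : T → ι → ℂ} (hE : ∀ᶠ t in l, Eqs V lam u b d (τ t) (x t))
    (hI : ∀ᶠ t in l, Set.InjOn (x t) V)
    (hα : ∀ j ∈ V, Tendsto (fun t => x t j) l (𝓝 (α j)))
    (hne : ∀ j ∈ V, α j ≠ 0) {j : ι} (hj : j ∈ V) (hy : ∀ j1 ∈ clus V α j, ∀ k ∈ clus V α j,
      Tendsto (fun t => (x t j1 - x t k) / (sc V lam α (τ t) j : ℂ)) l (𝓝 (y j1 - y k)))
    (hval : ∀ k ∈ clus V α j, (prim (wpoly (clus V α j) lam y (cw V lam u b α j) 0)).eval (y k) -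
      (prim (wpoly (clus V α j) lam y (cw V lam u b α j) 0)).eval (y j) = ((d k - d j : ℝ) : ℂ)) :
    Set.InjOn y (clus V α j) := by
  intro j1 hj1 k1 hk1 hyy
  by_contra hne1
  have hj1V := (mem_clus.1 hj1).1
  have hj1α := (mem_clus.1 hj1).2
  have hs : ∀ᶠ t in l, 0 < sc V lam α (τ t) j := by
    filter_upwards [hτ0] with t ht using sc_pos ht _
  set c := (clus V α j).filter fun k => y k = y j1 with hcdef
  have hc : ∀ k, k ∈ c ↔ k ∈ clus V α j ∧ y k = y j1 := fun k => mem_filter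
  have hcV : c ⊆ V := (filter_subset _ _).trans (clus_subset (V := V) α j)
  have hd : ∀ k ∈ c, d k = d j1 := by
    intro k hk
    have h1 := hval k ((hc k).1 hk).1
    rw [((hc k).1 hk).2, hval j1 hj1, ofReal_inj] at h1
    linarith
  have hρ : ∀ᶠ t in l, 0 < maxn c (fun k => x t k - x t j1) := by
    filter_upwards [hI] with t ht
    exact maxn_pos_of_ne ((hc k1).2 ⟨hk1, hyy.symm⟩) (sub_ne_zero.2 fun h =>
      hne1 (ht hj1V (mem_clus.1 hk1).1 h.symm))
  have hρ1 : Tendsto (fun t => maxn c fun k => (x t k - x t j1) / (sc V lam α (τ t) j : ℂ)) l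
      (𝓝 0) := tendsto_maxn fun k hk => by
    have h := hy k ((hc k).1 hk).1 j1 hj1
    rwa [((hc k).1 hk).2, sub_self] at h
  have hρ0 : Tendsto (fun t => maxn c fun k => x t k - x t j1) l (𝓝 0) :=
    tendsto_maxn fun k hk => by
      have := (hα k (hcV hk)).sub (hα j1 hj1V)
      rwa [(mem_clus.1 ((hc k).1 hk).1).2, hj1α, sub_self] at this
  have hρ2 : Tendsto (fun t => ((maxn c fun k => x t k - x t j1 : ℝ) : ℂ) /
      (sc V lam α (τ t) j : ℂ)) l (𝓝 0) := by
    rw [tendsto_zero_iff_norm_tendsto_zero]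
    refine hρ1.congr' ?_
    filter_upwards [hs, hρ] with t ht hρt
    obtain ⟨k, hk, h⟩ := exists_eq_maxn hρt
    have h2 : 0 < maxn c fun k => (x t k - x t j1) / (sc V lam α (τ t) j : ℂ) := by
      refine maxn_pos_of_ne hk (div_ne_zero ?_ (by exact_mod_cast ht.ne'))
      rw [← norm_pos_iff, h]
      exact hρt
    obtain ⟨k', hk', h'⟩ := exists_eq_maxn h2
    have e1 := le_maxn (c := c) (fun k => x t k - x t j1) hk'
    have e2 := le_maxn (c := c) (fun k => (x t k - x t j1) / (sc V lam α (τ t) j : ℂ)) hk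
    rw [norm_div, norm_real, norm_real, Real.norm_of_nonneg ht.le,
      Real.norm_of_nonneg hρt.le]
    simp only [norm_div, norm_real, Real.norm_of_nonneg ht.le] at h' e2
    rw [h] at e2
    refine le_antisymm ?_ e2
    rw [← h']
    exact div_le_div_of_nonneg_right e1 ht.le
  have hsub : c ⊆ clus V α j := filter_subset _ _
  have hw : cw V lam u b α j * ∏ k ∈ clus V α j \ c, (y j1 - y k) ^ lam k ≠ 0 := by
    refine mul_ne_zero (cw_ne_zero hu (hne j hj)) (prod_ne_zero_iff.2 fun k hk =>
      pow_ne_zero _ (sub_ne_zero.2 fun h => ?_))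
    obtain ⟨hk1, hk2⟩ := mem_sdiff.1 hk
    exact hk2 ((hc k).2 ⟨hk1, h.symm⟩)
  refine no_collapse_frame (lam := lam) l hcV (x := x)
    (m := fun t => x t j1) hρ (κ := fun t => (∏ k ∈ clus V α j \ c,
      (sc V lam α (τ t) j : ℂ) ^ lam k)⁻¹) hw (b' := 0)
    (zero_le) (u := u) (b := b) (V := V) (fun z => ?_)
    (Eventually.of_forall fun t j hj => le_maxn (fun k => x t k - x t j1) hj)
    (hρ.mono fun t ht => exists_eq_maxn ht) fun k hk => ?_
  · have h1 := tendsto_frameW (lam := lam) (u := u) (b := b) (j := j) hα (hj1α ▸ hα j1 hj1V)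
      ((continuous_ofReal.tendsto _).comp hρ0) z
    have h2 : Tendsto (fun t => ∏ k ∈ clus V α j \ c, ((x t j1 - x t k) /
        (sc V lam α (τ t) j : ℂ) + ((maxn c fun k => x t k - x t j1 : ℝ) : ℂ) /
          (sc V lam α (τ t) j : ℂ) * z) ^ lam k) l
        (𝓝 (∏ k ∈ clus V α j \ c, (y j1 - y k) ^ lam k)) := by
      refine tendsto_finsetProd _ fun k hk => Tendsto.pow ?_ _
      have := (hy j1 hj1 k (mem_sdiff.1 hk).1).add (hρ2.mul_const z)
      simpa using this
    rw [pow_zero, mul_one]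
    refine (h1.mul h2).congr' ?_
    filter_upwards [hs] with t ht
    have hs0 : (sc V lam α (τ t) j : ℂ) ≠ 0 := by exact_mod_cast ht.ne'
    have h3 : V \ c = (V \ clus V α j) ∪ (clus V α j \ c) := by
      ext k
      have h4 : k ∈ clus V α j → k ∈ V := fun h => clus_subset (V := V) α j h
      have h5 : k ∈ c → k ∈ clus V α j := fun h => hsub h
      simp only [Finset.mem_union, Finset.mem_sdiff]
      tauto
    have h6 : Disjoint (V \ clus V α j) (clus V α j \ c) := by
      rw [Finset.disjoint_left]
      intro k h7 h8
      exact (mem_sdiff.1 h7).2 (mem_sdiff.1 h8).1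
    simp only [eval_frameW, Function.comp]
    rw [h3, prod_union h6, ← prod_inv_distrib]
    have h9 : ∏ k ∈ clus V α j \ c, ((x t j1 - x t k) /
        (sc V lam α (τ t) j : ℂ) + ((maxn c fun k => x t k - x t j1 : ℝ) : ℂ) /
          (sc V lam α (τ t) j : ℂ) * z) ^ lam k = (∏ k ∈ clus V α j \ c,
          ((sc V lam α (τ t) j : ℂ) ^ lam k)⁻¹) * ∏ k ∈ clus V α j \ c,
          (x t j1 + ((maxn c fun k => x t k - x t j1 : ℝ) : ℂ) * z - x t k) ^ lam k := by
      rw [← prod_mul_distrib]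
      refine prod_congr rfl fun k _ => ?_
      rw [← inv_pow, ← mul_pow]
      congr 1
      field_simp
      ring
    rw [h9]
    ring
  · refine tendsto_const_nhds.congr' ?_
    filter_upwards [hE] with t ht
    rw [ht.2 k (hcV hk), ht.2 j1 hj1V, hd k hk]
    simp

/-- Compactness: limits of solutions are limit configurations. -/
theorem exists_limit (hu : u ≠ 0) (hlam : ∀ k ∈ V, 1 ≤ lam k) (l : Ultrafilter T) {τ : T → ℝ}
    (hτ : Tendsto τ l (𝓝 t0)) (hτ0 : ∀ᶠ t in l, 0 < τ t)
    {x : T → ι → ℂ} (hE : ∀ᶠ t in l, Eqs V lam u b d (τ t) (x t))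
    (hI : ∀ᶠ t in l, Set.InjOn (x t) V)
    (hv : ∀ j ∈ V, 1 + t0 * (d j - 1) ≠ 0) :
    ∃ α y, Base V lam u b d t0 α y ∧ (∀ j ∈ V, Tendsto (fun t => x t j) l (𝓝 (α j))) ∧
      (∀ j ∈ V, ∀ k ∈ V, α k = α j → Tendsto (fun t => (x t j - x t k) /
        (sc V lam α (τ t) j : ℂ)) l (𝓝 (y j - y k))) ∧
      (∀ j ∈ V, ∑ k ∈ clus V α j, (lam k : ℂ) * y k = 0) ∧ ∀ j ∉ V, y j = 0 := by
  obtain ⟨R, hR⟩ := exists_bound_of_eqs hu l hτ hE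
  have h1 : ∀ j, ∃ a, (j ∈ V → Tendsto (fun t => x t j) l (𝓝 a)) ∧ (j ∉ V → a = 0) := by
    intro j
    by_cases hj : j ∈ V
    · obtain ⟨a, ha⟩ := l.exists_tendsto_of_bounded (fun t => x t j) R
        (hR.mono fun t ht => (le_maxn (x t) hj).trans ht)
      exact ⟨a, fun _ => ha, fun h => absurd hj h⟩
    · exact ⟨0, fun h => absurd h hj, fun _ => rfl⟩
  choose α hα hα0 using h1
  have hval : ∀ j ∈ V, (prim (wpoly V lam α u b)).eval (α j) = ((1 + t0 * (d j - 1) : ℝ) : ℂ) :=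
    fun j hj => tendsto_eqs (l : Filter T) hτ hE hα hj
  have hne : ∀ j ∈ V, α j ≠ 0 := by
    intro j hj h
    have h2 := hval j hj
    rw [h, prim_eval_zero, eq_comm, ofReal_eq_zero] at h2
    exact hv j hj h2
  have ht0 : 0 ≤ t0 := ge_of_tendsto hτ (hτ0.mono fun t ht => ht.le)
  rcases ht0.lt_or_eq with ht0 | ht0
  · have hinj := limit_injOn hu l ht0 hE hI hα hval hne
    refine ⟨α, 0, ⟨⟨hα0, hval⟩, hne, Or.inl ⟨ht0, hinj⟩⟩, hα, ?_, by simp, by simp⟩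
    intro j hj k hk hkj
    rw [hinj hk hj hkj]
    simp
  · subst ht0
    have h2 : ∀ j k, ∃ z, j ∈ V → k ∈ clus V α j →
        Tendsto (fun t => (x t j - x t k) / (sc V lam α (τ t) j : ℂ)) l (𝓝 z) := by
      intro j k
      by_cases h : j ∈ V ∧ k ∈ clus V α j
      · obtain ⟨z, hz⟩ := cluster_bounded hu l hτ0 hE hα hne h.1 (mem_clus.1 h.2).1
          (mem_clus.1 h.2).2
        exact ⟨z, fun _ _ => hz⟩
      · exact ⟨0, fun h1 h2 => absurd ⟨h1, h2⟩ h⟩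
    choose z hz using h2
    set Λ : ι → ℂ := fun j => ∑ k ∈ clus V α j, (lam k : ℂ) with hΛ
    have hclus : ∀ j k, α k = α j → clus V α k = clus V α j := fun j k h => by
      simp only [clus, h]
    have hsc : ∀ j k t, α k = α j → sc V lam α t k = sc V lam α t j := fun j k t h => by
      simp only [sc, hclus j k h]
    have hΛ0 : ∀ j ∈ V, Λ j ≠ 0 := by
      intro j hj h
      have h3 : ((∑ k ∈ clus V α j, lam k : ℕ) : ℂ) = 0 := by
        rw [← h]
        push_cast
        rfl
      rw [Nat.cast_eq_zero, sum_eq_zero_iff] at h3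
      have := hlam j hj
      have := h3 j (mem_clus.2 ⟨hj, rfl⟩)
      omega
    set f : T → ι → ℂ := fun t j => ∑ k ∈ clus V α j, (lam k : ℂ) / Λ j *
      ((x t j - x t k) / (sc V lam α (τ t) j : ℂ)) with hf
    set y : ι → ℂ := fun j => if j ∈ V then ∑ k ∈ clus V α j, (lam k : ℂ) / Λ j * z j k else 0
      with hy
    have hfy : ∀ j ∈ V, Tendsto (fun t => f t j) l (𝓝 (y j)) := by
      intro j hj
      simp only [hy, hj, if_true]
      exact tendsto_finsetSum _ fun k hk => (hz j k hj hk).const_mul _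
    have hΛs : ∀ j ∈ V, ∑ k ∈ clus V α j, (lam k : ℂ) / Λ j = 1 := by
      intro j hj
      rw [← sum_div]
      exact div_self (hΛ0 j hj)
    have hff : ∀ t, ∀ j ∈ V, f t j = x t j / (sc V lam α (τ t) j : ℂ) -
        (∑ k ∈ clus V α j, (lam k : ℂ) / Λ j * x t k) / (sc V lam α (τ t) j : ℂ) := by
      intro t j hj
      simp only [hf, sub_div, mul_sub, sum_sub_distrib]
      rw [← sum_mul, hΛs j hj, one_mul, sum_div]
      simp only [mul_div_assoc]
    have hfd : ∀ t, ∀ j ∈ V, ∀ k ∈ V, α k = α j →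
        (x t j - x t k) / (sc V lam α (τ t) j : ℂ) = f t j - f t k := by
      intro t j hj k hk h
      rw [hff t j hj, hff t k hk, hsc j k _ h, hclus j k h]
      have : Λ k = Λ j := by simp only [hΛ, hclus j k h]
      rw [this]
      ring
    have hdiff : ∀ j ∈ V, ∀ k ∈ V, α k = α j → Tendsto (fun t => (x t j - x t k) /
        (sc V lam α (τ t) j : ℂ)) l (𝓝 (y j - y k)) := by
      intro j hj k hk h
      simp only [fun t => hfd t j hj k hk h]
      exact (hfy j hj).sub (hfy k hk)
    have hs : ∀ j, ∀ᶠ t in l, 0 < sc V lam α (τ t) j := fun j =>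
      hτ0.mono fun t ht => sc_pos ht _
    have heq : ∀ j ∈ V, ∀ k ∈ clus V α j,
        (prim (wpoly (clus V α j) lam y (cw V lam u b α j) 0)).eval (y k) -
          (prim (wpoly (clus V α j) lam y (cw V lam u b α j) 0)).eval (y j)
            = ((d k - d j : ℝ) : ℂ) := by
      intro j hj k hk
      have hm : Tendsto (fun t => x t j - (sc V lam α (τ t) j : ℂ) * f t j) l (𝓝 (α j)) := by
        simpa using (hα j hj).sub ((tendsto_sc (lam := lam) hτ j).mul (hfy j hj))
      have h3 := fun (z : T → ℂ) (z0 : ℂ) (hz : Tendsto z l (𝓝 z0)) =>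
        tendsto_prim_vprod (lam := lam) (c := clus V α j)
        (N := b + ∑ k ∈ V, lam k) (W := fun t => frameW V (clus V α j) lam (x t) u b
          (x t j - (sc V lam α (τ t) j : ℂ) * f t j) (sc V lam α (τ t) j))
        (W0 := C (cw V lam u b α j)) (fun t => by
          have h := natDegree_frame_le (clus_subset (V := V) α j) lam (x t) 0 u b
            (x t j - (sc V lam α (τ t) j : ℂ) * f t j) (sc V lam α (τ t) j)
          by_cases h0 : frameW V (clus V α j) lam (x t) u b
            (x t j - (sc V lam α (τ t) j : ℂ) * f t j) (sc V lam α (τ t) j) = 0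
          · simp [h0]
          · rw [natDegree_mul h0 (vprod_monic _ _ _).ne_zero] at h
            omega) (by simp)
        (fun r => by
          simpa using tendsto_frameW (lam := lam) hα hm (tendsto_sc (lam := lam) hτ j) r)
        (fun k hk => hfy k (mem_clus.1 hk).1) hz
      have h4 := (h3 _ _ (hfy k (mem_clus.1 hk).1)).sub (h3 _ _ (hfy j hj))
      have hwp : wpoly (clus V α j) lam y (cw V lam u b α j) 0
          = C (cw V lam u b α j) * vprod (clus V α j) lam y := by rw [wpoly, pow_zero, mul_one]
      rw [hwp]
      refine tendsto_nhds_unique h4 (tendsto_const_nhds.congr' ?_)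
      filter_upwards [hE, hs j, hτ0] with t ht hst hτt
      have hs0 : (sc V lam α (τ t) j : ℂ) ≠ 0 := by exact_mod_cast hst.ne'
      have hx : ∀ k ∈ clus V α j, x t k = x t j - (sc V lam α (τ t) j : ℂ) * f t j +
          (sc V lam α (τ t) j : ℂ) * f t k := by
        intro k hk
        have h := hfd t j hj k (mem_clus.1 hk).1 (mem_clus.1 hk).2
        rw [div_eq_iff hs0] at h
        linear_combination -h
      have hw := fun z => wpoly_frame (clus_subset (V := V) α j) (lam := lam) (u := u) (b := b)
        hx z
      have hk' := hw (f t k)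
      have hj' := hw (f t j)
      rw [← hx k hk, ht.2 k (mem_clus.1 hk).1] at hk'
      rw [← hx j (mem_clus.2 ⟨hj, rfl⟩), ht.2 j hj] at hj'
      have hsp := sc_pow (V := V) (lam := lam) (α := α) hτt.le j
      have hsp' : (sc V lam α (τ t) j : ℂ) ^ (1 + ∑ k ∈ clus V α j, lam k) = τ t := by
        exact_mod_cast hsp
      rw [hsp'] at hk' hj'
      have hτ' : (τ t : ℂ) ≠ 0 := by exact_mod_cast hτt.ne'
      refine mul_left_cancel₀ hτ' ?_
      push_cast at hk' hj' ⊢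
      linear_combination hk' - hj'
    refine ⟨α, y, ⟨⟨hα0, hval⟩, hne, Or.inr ⟨rfl, fun j hj => ⟨?_, heq j hj⟩⟩⟩, hα, hdiff, ?_, ?_⟩
    · refine limit_cluster_injOn hu l hτ0 hE hI hα hne hj (fun j1 hj1 k hk => ?_) (heq j hj)
      obtain ⟨hj1V, hj1α⟩ := mem_clus.1 hj1
      obtain ⟨hkV, hkα⟩ := mem_clus.1 hk
      simpa only [hsc j j1 _ hj1α] using hdiff j1 hj1V k hkV (hkα.trans hj1α.symm)
    · intro j hj
      have h3 : Tendsto (fun t => ∑ k ∈ clus V α j, (lam k : ℂ) * f t k) l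
          (𝓝 (∑ k ∈ clus V α j, (lam k : ℂ) * y k)) :=
        tendsto_finsetSum _ fun k hk => (hfy k (mem_clus.1 hk).1).const_mul _
      refine tendsto_nhds_unique (h3.congr fun t => ?_) tendsto_const_nhds
      have h4 : ∀ k ∈ clus V α j, (lam k : ℂ) * f t k =
          ((lam k : ℂ) * x t k - (lam k : ℂ) * ∑ i ∈ clus V α j, (lam i : ℂ) / Λ j * x t i) /
            (sc V lam α (τ t) j : ℂ) := by
        intro k hk
        obtain ⟨hkV, hkα⟩ := mem_clus.1 hk
        have : Λ k = Λ j := by simp only [hΛ, hclus j k hkα]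
        rw [hff t k hkV, hsc j k _ hkα, hclus j k hkα, this]
        ring
      rw [sum_congr rfl h4, ← sum_div, sum_sub_distrib, ← sum_mul]
      have h5 : ∑ i ∈ clus V α j, (lam i : ℂ) / Λ j * x t i
          = (∑ i ∈ clus V α j, (lam i : ℂ) * x t i) / Λ j := by
        rw [sum_div]
        exact sum_congr rfl fun _ _ => by ring
      rw [h5, show (∑ i ∈ clus V α j, (lam i : ℂ)) = Λ j from rfl,
        mul_div_cancel₀ _ (hΛ0 j hj), sub_self, zero_div]
    · intro j hj
      simp only [hy, hj, if_false]

/-- Limit configurations, centered in each cluster. -/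
structure NF (V : Finset ι) (lam : ι → ℕ) (u : ℂ) (b : ℕ) (d : ι → ℝ) (t0 : ℝ)
    (p : (ι → ℂ) × (ι → ℂ)) : Prop where
  base : Base V lam u b d t0 p.1 p.2
  centered : ∀ j ∈ V, ∑ k ∈ clus V p.1 j, (lam k : ℂ) * p.2 k = 0
  supp : ∀ j ∉ V, p.2 j = 0

theorem sum_lam_ne_zero {c : Finset ι} (hlam : ∀ k ∈ c, 1 ≤ lam k) {j : ι} (hj : j ∈ c) :
    (∑ k ∈ c, (lam k : ℂ)) ≠ 0 := by
  intro h
  have h3 : ((∑ k ∈ c, lam k : ℕ) : ℂ) = 0 := by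
    rw [← h]
    push_cast
    rfl
  rw [Nat.cast_eq_zero, sum_eq_zero_iff] at h3
  have := hlam j hj
  have := h3 j hj
  omega

theorem centered_eq {c : Finset ι} (hlam : ∀ k ∈ c, 1 ≤ lam k) {y y' : ι → ℂ}
    (h : ∑ k ∈ c, (lam k : ℂ) * y k = 0) (h' : ∑ k ∈ c, (lam k : ℂ) * y' k = 0)
    (hd : ∀ j ∈ c, ∀ k ∈ c, y j - y k = y' j - y' k) {j : ι} (hj : j ∈ c) : y j = y' j := by
  have h1 : ∑ k ∈ c, (lam k : ℂ) * (y j - y k) = ∑ k ∈ c, (lam k : ℂ) * (y' j - y' k) :=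
    sum_congr rfl fun k hk => by rw [hd j hj k hk]
  simp only [mul_sub, sum_sub_distrib, h, h', sub_zero, ← sum_mul] at h1
  exact mul_left_cancel₀ (sum_lam_ne_zero hlam hj) h1

theorem NF.eq_of (hlam : ∀ k ∈ V, 1 ≤ lam k) {p q : (ι → ℂ) × (ι → ℂ)}
    (hp : NF V lam u b d t0 p) (hq : NF V lam u b d t0 q) (hα : ∀ j ∈ V, p.1 j = q.1 j)
    (hy : ∀ j ∈ V, ∀ k ∈ V, p.1 k = p.1 j → p.2 j - p.2 k = q.2 j - q.2 k) : p = q := by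
  have h1 : p.1 = q.1 := by
    funext j
    by_cases hj : j ∈ V
    · exact hα j hj
    · rw [hp.base.eqs.1 j hj, hq.base.eqs.1 j hj]
  refine Prod.ext h1 (funext fun j => ?_)
  by_cases hj : j ∈ V
  · refine centered_eq (c := clus V p.1 j) (fun k hk => hlam k (mem_clus.1 hk).1)
      (hp.centered j hj) (h1 ▸ hq.centered j hj) (fun i hi k hk => ?_) (mem_clus.2 ⟨hj, rfl⟩)
    obtain ⟨hiV, hi⟩ := mem_clus.1 hi
    obtain ⟨hkV, hk⟩ := mem_clus.1 hk
    exact hy i hiV k hkV (hk.trans hi.symm)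
  · rw [hp.supp j hj, hq.supp j hj]

theorem NF.separated (hlam : ∀ k ∈ V, 1 ≤ lam k) {p q : (ι → ℂ) × (ι → ℂ)}
    (hp : NF V lam u b d t0 p) (hq : NF V lam u b d t0 q) (hpq : p ≠ q) :
    ∃ η > 0, ∀ t x, Near V lam p.1 p.2 η t x → Near V lam q.1 q.2 η t x → False := by
  by_cases hα : ∀ j ∈ V, p.1 j = q.1 j
  · have h1 : ∃ j ∈ V, ∃ k ∈ V, p.1 k = p.1 j ∧ p.2 j - p.2 k ≠ q.2 j - q.2 k := by
      by_contra! h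
      exact hpq (hp.eq_of hlam hq hα h)
    obtain ⟨j, hj, k, hk, hjk, hne⟩ := h1
    have hc : ∀ i ∈ V, clus V p.1 i = clus V q.1 i := by
      intro i hi
      ext k
      simp only [mem_clus]
      refine and_congr_right fun hk => ?_
      rw [hα k hk, hα i hi]
    refine ⟨‖(p.2 j - p.2 k) - (q.2 j - q.2 k)‖ / 2, half_pos (norm_pos_iff.2 (sub_ne_zero.2 hne)),
      fun t x h h' => ?_⟩
    have e1 := (h j hj).2 k hk hjk
    have e2 := (h' j hj).2 k hk (by rw [← hα k hk, ← hα j hj, hjk])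
    have e3 : sc V lam q.1 t j = sc V lam p.1 t j := by rw [sc, sc, hc j hj]
    rw [e3] at e2
    have e4 := norm_sub_le ((x j - x k) / (sc V lam p.1 t j : ℂ) - (q.2 j - q.2 k))
      ((x j - x k) / (sc V lam p.1 t j : ℂ) - (p.2 j - p.2 k))
    rw [sub_sub_sub_cancel_left] at e4
    linarith
  · push Not at hα
    obtain ⟨j, hj, hne⟩ := hα
    refine ⟨‖p.1 j - q.1 j‖ / 2, half_pos (norm_pos_iff.2 (sub_ne_zero.2 hne)),
      fun t x h h' => ?_⟩
    have e1 := (h j hj).1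
    have e2 := (h' j hj).1
    have e4 := norm_sub_le (x j - q.1 j) (x j - p.1 j)
    rw [sub_sub_sub_cancel_left] at e4
    linarith

theorem exists_pos_forall_finite {β : Type*} {Y : Set β} (hY : Y.Finite) {P : β → ℝ → Prop}
    (hP : ∀ p ∈ Y, ∃ η > 0, P p η) (hmono : ∀ p η η', 0 < η' → η' ≤ η → P p η → P p η') :
    ∃ η > 0, ∀ p ∈ Y, P p η := by
  induction Y, hY using Set.Finite.induction_on with
  | empty => exact ⟨1, one_pos, by simp⟩
  | @insert a s _ _ ih =>
    obtain ⟨η, hη, h⟩ := ih fun p hp => hP p (Set.mem_insert_of_mem _ hp)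
    obtain ⟨η', hη', h'⟩ := hP a (Set.mem_insert _ _)
    refine ⟨min η η', lt_min hη hη', fun p hp => ?_⟩
    rcases Set.mem_insert_iff.1 hp with rfl | hp
    · exact hmono _ _ _ (lt_min hη hη') (min_le_right _ _) h'
    · exact hmono _ _ _ (lt_min hη hη') (min_le_left _ _) (h p hp)

theorem limit_near (hu : u ≠ 0) (hlam : ∀ k ∈ V, 1 ≤ lam k) (l : Ultrafilter T) {τ : T → ℝ}
    (hτ : Tendsto τ l (𝓝 t0)) (hτ0 : ∀ᶠ t in l, 0 < τ t)
    {x : T → ι → ℂ} (hE : ∀ᶠ t in l, Eqs V lam u b d (τ t) (x t))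
    (hI : ∀ᶠ t in l, Set.InjOn (x t) V)
    (hv : ∀ j ∈ V, 1 + t0 * (d j - 1) ≠ 0) :
    ∃ p, NF V lam u b d t0 p ∧ ∀ η > 0, ∀ᶠ t in l,
      Near V lam p.1 p.2 η (τ t) (x t) := by
  obtain ⟨α, y, hB, h1, h2, h3, h4⟩ := exists_limit hu hlam l hτ hτ0 hE hI hv
  refine ⟨(α, y), ⟨hB, h3, h4⟩, fun η hη => ?_⟩
  unfold Near
  rw [Filter.eventually_all_finset]
  intro j hj
  refine Eventually.and ?_ ?_
  · have := (Metric.tendsto_nhds.1 (h1 j hj)) η hη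
    simpa only [dist_eq_norm] using this
  · rw [Filter.eventually_all_finset]
    intro k hk
    by_cases h : α k = α j
    · have := (Metric.tendsto_nhds.1 (h2 j hj k hk h)) η hη
      filter_upwards [this] with t ht _
      rwa [dist_eq_norm] at ht
    · exact Eventually.of_forall fun t h' => absurd h' h

/-- Near `t0`, sums over solutions are sums over limit configurations. -/
theorem sum_eq_sum_limits [Fintype ι] (hu : u ≠ 0) (hlam : ∀ k ∈ V, 1 ≤ lam k)
    (hv : ∀ j ∈ V, 1 + t0 * (d j - 1) ≠ 0)
    {Y : Set ((ι → ℂ) × (ι → ℂ))} (hY : Y.Finite) (hNF : ∀ p ∈ Y, NF V lam u b d t0 p)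
    {Z : ℝ → Set (ι → ℂ)} (hZ : ∀ t, ∀ x ∈ Z t, Eqs V lam u b d t x ∧ Set.InjOn x V)
    (hex : ∀ p ∈ Y, ∀ η > 0, ∀ᶠ t in 𝓝[Set.Ioi 0] t0, ∃ x ∈ Z t, Near V lam p.1 p.2 η t x)
    (hlim : ∀ l : Ultrafilter ℝ, (l : Filter ℝ) ≤ 𝓝[Set.Ioi 0] t0 → ∀ x : ℝ → ι → ℂ,
      (∀ᶠ t in (l : Filter ℝ), x t ∈ Z t) → ∀ p, NF V lam u b d t0 p →
      (∀ η > 0, ∀ᶠ t in (l : Filter ℝ), Near V lam p.1 p.2 η t (x t)) → p ∈ Y)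
    {M : Type*} [AddCommMonoid M] {f : (ι → ℂ) → M} {g : (ι → ℂ) × (ι → ℂ) → M}
    (hfg : ∀ p ∈ Y, ∃ η > 0, ∀ᶠ t in 𝓝[Set.Ioi 0] t0, ∀ x ∈ Z t,
      Near V lam p.1 p.2 η t x → f x = g p) :
    ∀ᶠ t in 𝓝[Set.Ioi 0] t0, ∑ᶠ x ∈ Z t, f x = ∑ᶠ p ∈ Y, g p := by
  have hnear : ∀ (p : (ι → ℂ) × (ι → ℂ)) (η η' : ℝ), η' ≤ η → ∀ t x,
      Near V lam p.1 p.2 η' t x → Near V lam p.1 p.2 η t x := fun p η η' h t x hx => hx.mono h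
  obtain ⟨η1, hη1, h1⟩ := exists_pos_forall_finite hY
    (P := fun p η => ∀ᶠ t in 𝓝[Set.Ioi 0] t0, ∀ x x', Eqs V lam u b d t x →
      Eqs V lam u b d t x' → Near V lam p.1 p.2 η t x → Near V lam p.1 p.2 η t x' → x = x')
    (fun p hp => ((hNF p hp).base.exists_unique_near hu hlam).1)
    (fun p η η' _ hle h => h.mono fun t ht x x' hx hx' hn hn' =>
      ht x x' hx hx' (hn.mono hle) (hn'.mono hle))
  obtain ⟨η2, hη2, h2⟩ := exists_pos_forall_finite hY hfg
    (fun p η η' _ hle h => h.mono fun t ht x hx hn => ht x hx (hn.mono hle))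
  obtain ⟨η3, hη3, h3⟩ := exists_pos_forall_finite (hY.prod hY)
    (P := fun p η => p.1 ≠ p.2 → ∀ t x, Near V lam p.1.1 p.1.2 η t x →
      Near V lam p.2.1 p.2.2 η t x → False)
    (fun p hp => by
      by_cases h : p.1 = p.2
      · exact ⟨1, one_pos, fun h' => absurd h h'⟩
      · obtain ⟨η, hη, h'⟩ := (hNF p.1 hp.1).separated hlam (hNF p.2 hp.2) h
        exact ⟨η, hη, fun _ => h'⟩)
    (fun p η η' _ hle h hne t x hn hn' => h hne t x (hn.mono hle) (hn'.mono hle))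
  set η := min η1 (min η2 η3) with hηdef
  have hη : 0 < η := lt_min hη1 (lt_min hη2 hη3)
  have hle1 : η ≤ η1 := min_le_left _ _
  have hle2 : η ≤ η2 := (min_le_right _ _).trans (min_le_left _ _)
  have hle3 : η ≤ η3 := (min_le_right _ _).trans (min_le_right _ _)
  have hsurj : ∀ᶠ t in 𝓝[Set.Ioi 0] t0, ∀ x ∈ Z t, ∃ p ∈ Y, Near V lam p.1 p.2 η t x := by
    by_contra hcon
    have hfr := Filter.not_eventually.1 hcon
    have hne := (Filter.frequently_iff_neBot.1 hfr)
    obtain ⟨l, hl⟩ := Filter.exists_ultrafilter_le (f := 𝓝[Set.Ioi 0] t0 ⊓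
      𝓟 {t | ¬∀ x ∈ Z t, ∃ p ∈ Y, Near V lam p.1 p.2 η t x})
    have hl1 : (l : Filter ℝ) ≤ 𝓝[Set.Ioi 0] t0 := hl.trans inf_le_left
    have hl2 : ∀ᶠ t in (l : Filter ℝ), ∃ x, x ∈ Z t ∧ ∀ p ∈ Y, ¬Near V lam p.1 p.2 η t x := by
      have := Filter.le_principal_iff.1 (hl.trans inf_le_right)
      filter_upwards [this] with t ht
      simpa using ht
    choose! x hx using fun t (h : ∃ x, x ∈ Z t ∧ ∀ p ∈ Y, ¬Near V lam p.1 p.2 η t x) => h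
    have hxZ : ∀ᶠ t in (l : Filter ℝ), x t ∈ Z t := hl2.mono fun t ht => (hx t ht).1
    obtain ⟨p, hp, hpn⟩ := limit_near (T := ℝ) hu hlam l (τ := id)
      (tendsto_id'.2 (hl1.trans nhdsWithin_le_nhds))
      (hl1 self_mem_nhdsWithin) (hxZ.mono fun t ht => (hZ t _ ht).1)
      (hxZ.mono fun t ht => (hZ t _ ht).2) hv
    have hpY := hlim l hl1 x hxZ p hp hpn
    obtain ⟨t, ht1, ht2⟩ := (hl2.and (hpn η hη)).exists
    exact (hx t ht1).2 p hpY ht2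
  have e1 := (Filter.eventually_all_finite hY).2 h1
  have e2 := (Filter.eventually_all_finite hY).2 h2
  have e3 := (Filter.eventually_all_finite hY).2 fun p hp => hex p hp η hη
  filter_upwards [hsurj, e1, e2, e3] with t ht t1 t2 t3
  choose! e he hne using t3
  refine (finsum_mem_eq_of_bijOn e ⟨he, fun p hp q hq hpq => ?_, fun x hx => ?_⟩ fun p hp => ?_).symm
  · by_contra h
    refine h3 (p, q) ⟨hp, hq⟩ h t (e p) ((hne p hp).mono hle3) ?_
    change Near V lam q.1 q.2 η3 t (e p)
    rw [hpq]
    exact (hne q hq).mono hle3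
  · obtain ⟨p, hp, hn⟩ := ht x hx
    exact ⟨p, hp, t1 p hp _ _ (hZ t _ (he p hp)).1 (hZ t x hx).1 ((hne p hp).mono hle1)
      (hn.mono hle1)⟩
  · exact (t2 p hp (e p) (he p hp) ((hne p hp).mono hle2)).symm

/-- Configurations invariant under complex conjugation, labels being preserved. -/
def IsRealC (V : Finset ι) (lam : ι → ℕ) (d : ι → ℝ) (x : ι → ℂ) : Prop :=
  ∀ j ∈ V, ∃ k ∈ V, x k = conj (x j) ∧ lam k = lam j ∧ d k = d j

/-- The analogue of `IsRealC` for limit configurations. -/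
def FReal (V : Finset ι) (lam : ι → ℕ) (d : ι → ℝ) (p : (ι → ℂ) × (ι → ℂ)) : Prop :=
  ∀ j ∈ V, ∃ k ∈ V, p.1 k = conj (p.1 j) ∧ p.2 k = conj (p.2 j) ∧
    lam k = lam j ∧ d k = d j

/-- Label preserving involutions. -/
structure LInv (V : Finset ι) (lam : ι → ℕ) (d : ι → ℝ) (κ : ι → ι) : Prop where
  mem : ∀ j ∈ V, κ j ∈ V
  inv : ∀ j ∈ V, κ (κ j) = j
  lam_eq : ∀ j ∈ V, lam (κ j) = lam j
  d_eq : ∀ j ∈ V, d (κ j) = d j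

theorem IsRealC.exists_inv {x : ι → ℂ} (h : IsRealC V lam d x) (hx : Set.InjOn x V) :
    ∃ κ, LInv V lam d κ ∧ ∀ j ∈ V, x (κ j) = conj (x j) := by
  choose! κ h1 h2 h3 h4 using h
  refine ⟨κ, ⟨h1, fun j hj => hx (h1 _ (h1 _ hj)) hj ?_, h3, h4⟩, h2⟩
  rw [h2 _ (h1 j hj), h2 j hj, conj_conj]

theorem NF.pair_inj {p : (ι → ℂ) × (ι → ℂ)} (hp : NF V lam u b d t0 p) {j k : ι} (hj : j ∈ V)
    (hk : k ∈ V) (h1 : p.1 k = p.1 j) (h2 : p.2 k = p.2 j) : k = j := by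
  rcases hp.base.alt with ⟨_, h⟩ | ⟨_, h⟩
  · exact h hk hj h1
  · exact (h j hj).1 (mem_clus.2 ⟨hk, h1⟩) (mem_clus.2 ⟨hj, rfl⟩) h2

theorem FReal.exists_inv {p : (ι → ℂ) × (ι → ℂ)} (hr : FReal V lam d p)
    (hp : NF V lam u b d t0 p) : ∃ κ, LInv V lam d κ ∧
      ∀ j ∈ V, p.1 (κ j) = conj (p.1 j) ∧ p.2 (κ j) = conj (p.2 j) := by
  choose! κ h1 h2 h3 h4 h5 using hr
  refine ⟨κ, ⟨h1, fun j hj => hp.pair_inj hj (h1 _ (h1 _ hj)) ?_ ?_, h4, h5⟩,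
    fun j hj => ⟨h2 j hj, h3 j hj⟩⟩
  · rw [h2 _ (h1 j hj), h2 j hj, conj_conj]
  · rw [h3 _ (h1 j hj), h3 j hj, conj_conj]

theorem LInv.sum_clus {κ : ι → ι} (hκ : LInv V lam d κ) {α : ι → ℂ}
    (hα : ∀ j ∈ V, α (κ j) = conj (α j)) {M : Type*} [AddCommMonoid M] {j : ι}
    (hj : j ∈ V) (f : ι → M) :
    ∑ k ∈ clus V α (κ j), f k = ∑ k ∈ clus V α j, f (κ k) := by
  symm
  refine sum_nbij' κ κ (fun k hk => ?_) (fun k hk => ?_)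
    (fun k hk => hκ.inv k (mem_clus.1 hk).1) (fun k hk => hκ.inv k (mem_clus.1 hk).1)
    (fun _ _ => rfl)
  · obtain ⟨hkV, hk⟩ := mem_clus.1 hk
    exact mem_clus.2 ⟨hκ.mem k hkV, by rw [hα k hkV, hα j hj, hk]⟩
  · obtain ⟨hkV, hk⟩ := mem_clus.1 hk
    exact mem_clus.2 ⟨hκ.mem k hkV, by rw [hα k hkV, hk, hα j hj, conj_conj]⟩

theorem LInv.sc_eq {κ : ι → ι} (hκ : LInv V lam d κ) {α : ι → ℂ}
    (hα : ∀ j ∈ V, α (κ j) = conj (α j)) {j : ι} (hj : j ∈ V) (t : ℝ) :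
    sc V lam α t (κ j) = sc V lam α t j := by
  rw [sc, sc, hκ.sum_clus hα hj,
    sum_congr rfl fun k hk => hκ.lam_eq k (mem_clus.1 hk).1]

theorem Ultrafilter.exists_eventually_of_finite {β : Type*} [Finite β] (l : Ultrafilter T)
    {P : β → T → Prop} (h : ∀ᶠ t in l, ∃ b, P b t) :
    ∃ b, ∀ᶠ t in l, P b t := by
  by_contra! hc
  have h1 : ∀ b, ∀ᶠ t in l, ¬P b t := hc
  obtain ⟨t, ⟨b, hb⟩, ht⟩ := (h.and (Filter.eventually_all.2 h1)).exists
  exact ht b hb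

theorem limit_real [Finite ι] (hlam : ∀ k ∈ V, 1 ≤ lam k) (l : Ultrafilter T) {τ : T → ℝ}
    {x : T → ι → ℂ} (hI : ∀ᶠ t in l, Set.InjOn (x t) V)
    (hR : ∀ᶠ t in l, IsRealC V lam d (x t)) {p : (ι → ℂ) × (ι → ℂ)}
    (hp : NF V lam u b d t0 p)
    (hn : ∀ η > 0, ∀ᶠ t in l, Near V lam p.1 p.2 η (τ t) (x t)) :
    ∃ κ, LInv V lam d κ ∧ (∀ᶠ t in l, ∀ j ∈ V, x t (κ j) = conj (x t j)) ∧
      ∀ j ∈ V, p.1 (κ j) = conj (p.1 j) ∧ p.2 (κ j) = conj (p.2 j) := by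
  obtain ⟨κ, hκ⟩ := l.exists_eventually_of_finite (P := fun κ t => LInv V lam d κ ∧
    ∀ j ∈ V, x t (κ j) = conj (x t j)) (by
      filter_upwards [hI, hR] with t h1 h2 using h2.exists_inv h1)
  have hL : LInv V lam d κ := hκ.exists.choose_spec.1
  have hx : ∀ᶠ t in l, ∀ j ∈ V, x t (κ j) = conj (x t j) :=
    hκ.mono fun t ht => ht.2
  have hα : ∀ j ∈ V, Tendsto (fun t => x t j) l (𝓝 (p.1 j)) := by
    intro j hj
    rw [Metric.tendsto_nhds]
    intro η hη
    filter_upwards [hn η hη] with t ht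
    rw [dist_eq_norm]
    exact (ht j hj).1
  have hy : ∀ j ∈ V, ∀ k ∈ V, p.1 k = p.1 j → Tendsto (fun t => (x t j - x t k) /
      (sc V lam p.1 (τ t) j : ℂ)) l (𝓝 (p.2 j - p.2 k)) := by
    intro j hj k hk hkj
    rw [Metric.tendsto_nhds]
    intro η hη
    filter_upwards [hn η hη] with t ht
    rw [dist_eq_norm]
    exact (ht j hj).2 k hk hkj
  have h1 : ∀ j ∈ V, p.1 (κ j) = conj (p.1 j) := by
    intro j hj
    refine tendsto_nhds_unique (hα _ (hL.mem j hj))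
      (((continuous_conj.tendsto _).comp (hα j hj)).congr' ?_)
    filter_upwards [hx] with t ht using (ht j hj).symm
  refine ⟨κ, hL, hx, fun j hj => ⟨h1 j hj, ?_⟩⟩
  have h2 : ∀ i ∈ clus V p.1 j, ∀ k ∈ clus V p.1 j,
      p.2 (κ i) - p.2 (κ k) = conj (p.2 i) - conj (p.2 k) := by
    intro i hi k hk
    obtain ⟨hiV, hi⟩ := mem_clus.1 hi
    obtain ⟨hkV, hk⟩ := mem_clus.1 hk
    refine tendsto_nhds_unique (hy _ (hL.mem i hiV) _ (hL.mem k hkV) (by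
      rw [h1 k hkV, h1 i hiV, hk, hi])) ?_
    have h3 := (continuous_conj.tendsto _).comp (hy i hiV k hkV (hk.trans hi.symm))
    rw [map_sub] at h3
    refine h3.congr' ?_
    filter_upwards [hx] with t ht
    rw [ht i hiV, ht k hkV, hL.sc_eq h1 hiV, Function.comp, map_div₀, map_sub, conj_ofReal]
  refine centered_eq (c := clus V p.1 j) (y := fun k => p.2 (κ k))
    (y' := fun k => conj (p.2 k)) (fun k hk => hlam k (mem_clus.1 hk).1) ?_ ?_ h2
    (mem_clus.2 ⟨hj, rfl⟩)
  · rw [← hp.centered (κ j) (hL.mem j hj), hL.sum_clus h1 hj]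
    exact sum_congr rfl fun k hk => by rw [hL.lam_eq k (mem_clus.1 hk).1]
  · have h3 := congrArg conj (hp.centered j hj)
    simpa [map_sum] using h3

theorem pconj_wpoly_inv {κ : ι → ι} (hκ : LInv V lam d κ) (hu : conj u = u)
    (x : ι → ℂ) : wpoly V lam (fun j => conj (x (κ j))) u b
      = pconj (wpoly V lam x u b) := by
  have h1 : pconj (wpoly V lam x u b)
      = C u * X ^ b * ∏ k ∈ V, (X - C (conj (x k))) ^ lam k := by
    simp [wpoly, vprod, pconj, Polynomial.map_prod, hu]
  rw [h1, wpoly, vprod]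
  congr 1
  refine prod_nbij' κ κ (fun k hk => hκ.mem k hk) (fun k hk => hκ.mem k hk)
    (fun k hk => hκ.inv k hk) (fun k hk => hκ.inv k hk) fun k hk => by rw [hκ.lam_eq k hk]

theorem Eqs.conj {κ : ι → ι} (hκ : LInv V lam d κ) (hu : conj u = u) {t : ℝ}
    {x : ι → ℂ} (hx : Eqs V lam u b d t x) :
    Eqs V lam u b d t fun j => if j ∈ V then conj (x (κ j)) else 0 := by
  refine ⟨fun j hj => if_neg hj, fun j hj => ?_⟩
  rw [wpoly_congr (x' := fun j => conj (x (κ j))) (fun k hk => if_pos hk),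
    pconj_wpoly_inv hκ hu]
  beta_reduce
  rw [if_pos hj, ← pconj_prim, eval_pconj, hx.2 _ (hκ.mem j hj),
    hκ.d_eq j hj, conj_ofReal]

theorem Near.conj {κ : ι → ι} (hκ : LInv V lam d κ) {p : (ι → ℂ) × (ι → ℂ)}
    (hp : ∀ j ∈ V, p.1 (κ j) = conj (p.1 j) ∧ p.2 (κ j) = conj (p.2 j))
    {η t : ℝ} {x : ι → ℂ} (hx : Near V lam p.1 p.2 η t x) :
    Near V lam p.1 p.2 η t fun j => if j ∈ V then conj (x (κ j)) else 0 := by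
  intro j hj
  obtain ⟨h1, h2⟩ := hx (κ j) (hκ.mem j hj)
  refine ⟨?_, fun k hk hkj => ?_⟩
  · beta_reduce
    rw [if_pos hj, ← conj_conj (p.1 j), ← (hp j hj).1, ← map_sub, RCLike.norm_conj]
    exact h1
  · have h3 := h2 (κ k) (hκ.mem k hk) (by rw [(hp k hk).1, (hp j hj).1, hkj])
    rw [hκ.sc_eq (fun j hj => (hp j hj).1) hj] at h3
    beta_reduce
    rw [if_pos hj, if_pos hk, ← conj_conj (p.2 j), ← conj_conj (p.2 k),
      ← (hp j hj).2, ← (hp k hk).2, ← map_sub, ← map_sub,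
      ← conj_ofReal (sc V lam p.1 t j), ← map_div₀, ← map_sub, RCLike.norm_conj]
    exact h3

/-- A vertex of a limit configuration that stays real. -/
def ReF (p : (ι → ℂ) × (ι → ℂ)) (j : ι) : Prop := (p.1 j).im = 0 ∧ (p.2 j).im = 0

/-- The order of the real vertices near a limit configuration. -/
def LtF (p : (ι → ℂ) × (ι → ℂ)) (j k : ι) : Prop :=
  (p.1 j).re < (p.1 k).re ∨ (p.1 j = p.1 k ∧ (p.2 j).re < (p.2 k).re)

theorem re_lt_of_norm_sub_lt {z w z' w' : ℂ} {η : ℝ} (hz : ‖z' - z‖ < η) (hw : ‖w' - w‖ < η)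
    (h : z.re + 2 * η ≤ w.re) : z'.re < w'.re := by
  have h1 := (abs_re_le_norm (z' - z)).trans_lt hz
  have h2 := (abs_re_le_norm (w' - w)).trans_lt hw
  rw [sub_re, abs_lt] at h1 h2
  linarith [h1.2, h2.1]

theorem NF.near_pair {p : (ι → ℂ) × (ι → ℂ)} (hp : NF V lam u b d t0 p) {j k : ι} (hj : j ∈ V)
    (hk : k ∈ V) (hjk : j ≠ k) : ∃ η > 0, ∀ t > 0, ∀ x, Near V lam p.1 p.2 η t x →
      x j ≠ x k ∧ (LtF p j k → (x j).re < (x k).re) := by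
  by_cases hα : p.1 j = p.1 k
  · have hy : p.2 j ≠ p.2 k := fun h => hjk (hp.pair_inj hk hj hα h)
    by_cases hlt : (p.2 j).re < (p.2 k).re
    · refine ⟨(p.2 k).re - (p.2 j).re, by linarith, fun t ht x hx => ?_⟩
      have h1 := ((hx j hj).2 k hk hα.symm)
      have h2 := (abs_re_le_norm _).trans_lt h1
      rw [sub_re, abs_lt, Complex.div_ofReal_re, sub_re, sub_re] at h2
      have h3 : ((x j).re - (x k).re) / sc V lam p.1 t j < 0 := by linarith [h2.2]
      have h4 : (x j).re < (x k).re := by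
        rcases div_neg_iff.1 h3 with ⟨_, h⟩ | ⟨h, _⟩
        · exact absurd h (sc_pos ht j).not_gt
        · linarith
      exact ⟨fun h => by rw [h] at h4; exact lt_irrefl _ h4, fun _ => h4⟩
    · refine ⟨‖p.2 j - p.2 k‖, norm_pos_iff.2 (sub_ne_zero.2 hy), fun t ht x hx => ⟨?_, ?_⟩⟩
      · intro h
        have h1 := ((hx j hj).2 k hk hα.symm)
        rw [h, sub_self, zero_div, zero_sub, norm_neg] at h1
        exact lt_irrefl _ h1
      · rintro (h | ⟨_, h⟩)
        · rw [hα] at h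
          exact absurd h (lt_irrefl _)
        · exact absurd h hlt
  · have hα' : 0 < ‖p.1 j - p.1 k‖ := norm_pos_iff.2 (sub_ne_zero.2 hα)
    have hne : ∀ t x, Near V lam p.1 p.2 (‖p.1 j - p.1 k‖ / 2) t x → x j ≠ x k := by
      intro t x hx h
      have h1 := (hx j hj).1
      have h2 := (hx k hk).1
      rw [h] at h1
      have h3 : ‖p.1 j - p.1 k‖ ≤ ‖x k - p.1 k‖ + ‖x k - p.1 j‖ := by
        rw [show p.1 j - p.1 k = (x k - p.1 k) - (x k - p.1 j) by ring]
        exact norm_sub_le _ _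
      linarith
    by_cases hlt : (p.1 j).re < (p.1 k).re
    · refine ⟨min (‖p.1 j - p.1 k‖ / 2) (((p.1 k).re - (p.1 j).re) / 2),
        lt_min (by linarith) (by linarith), fun t ht x hx =>
          ⟨hne t x (hx.mono (min_le_left _ _)), fun _ => ?_⟩⟩
      have h1 := hx.mono (min_le_right _ _)
      exact re_lt_of_norm_sub_lt (h1 j hj).1 (h1 k hk).1 (by linarith)
    · refine ⟨‖p.1 j - p.1 k‖ / 2, by linarith, fun t ht x hx => ⟨hne t x hx, ?_⟩⟩
      rintro (h | ⟨h, _⟩)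
      · exact absurd h hlt
      · exact absurd h hα

theorem NF.ltF_or {p : (ι → ℂ) × (ι → ℂ)} (hp : NF V lam u b d t0 p) {j k : ι} (hj : j ∈ V)
    (hk : k ∈ V) (hjk : j ≠ k) (h1 : ReF p j) (h2 : ReF p k) : LtF p j k ∨ LtF p k j := by
  by_cases hα : p.1 j = p.1 k
  · have hy : p.2 j ≠ p.2 k := fun h => hjk (hp.pair_inj hk hj hα h)
    have hy' : (p.2 j).re ≠ (p.2 k).re := fun h => hy (Complex.ext h (by rw [h1.2, h2.2]))
    rcases lt_or_gt_of_ne hy' with h | h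
    · exact Or.inl (Or.inr ⟨hα, h⟩)
    · exact Or.inr (Or.inr ⟨hα.symm, h⟩)
  · have hα' : (p.1 j).re ≠ (p.1 k).re := fun h => hα (Complex.ext h (by rw [h1.1, h2.1]))
    rcases lt_or_gt_of_ne hα' with h | h
    · exact Or.inl (Or.inl h)
    · exact Or.inr (Or.inl h)

/-- Solutions near a real limit configuration are real, with the order pattern given by the
limit. -/
theorem NF.near_pattern [Fintype ι] {p : (ι → ℂ) × (ι → ℂ)} (hp : NF V lam u b d t0 p)
    (hr : FReal V lam d p) (hu0 : u ≠ 0) (hu : conj u = u) (hlam : ∀ k ∈ V, 1 ≤ lam k) :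
    ∃ η > 0, ∀ᶠ t in 𝓝[Set.Ioi 0] t0, ∀ x, Eqs V lam u b d t x → Near V lam p.1 p.2 η t x →
      Set.InjOn x V ∧ IsRealC V lam d x ∧ (∀ j ∈ V, (x j).im = 0 ↔ ReF p j) ∧
      (∀ j ∈ V, ∀ k ∈ V, ReF p j → ReF p k → ((x j).re < (x k).re ↔ LtF p j k)) ∧
      ∀ j ∈ V, ReF p j → ((x j).re < 0 ↔ (p.1 j).re < 0) := by
  obtain ⟨κ, hκ, hpκ⟩ := hr.exists_inv hp
  obtain ⟨⟨η1, hη1, h1⟩, -⟩ := hp.base.exists_unique_near hu0 hlam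
  obtain ⟨η2, hη2, h2⟩ := exists_pos_forall_finite
    (Y := {q : ι × ι | q.1 ∈ V ∧ q.2 ∈ V ∧ q.1 ≠ q.2}) (Set.toFinite _)
    (P := fun q η => ∀ t > 0, ∀ x, Near V lam p.1 p.2 η t x →
      x q.1 ≠ x q.2 ∧ (LtF p q.1 q.2 → (x q.1).re < (x q.2).re))
    (fun q hq => hp.near_pair hq.1 hq.2.1 hq.2.2)
    (fun q η η' _ hle h t ht x hx => h t ht x (hx.mono hle))
  obtain ⟨η3, hη3, h3⟩ := exists_pos_forall_finite (Y := {j : ι | j ∈ V ∧ ReF p j})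
    (Set.toFinite _) (P := fun j η => ∀ x : ℂ, ‖x - p.1 j‖ < η → (x.re < 0 ↔ (p.1 j).re < 0))
    (fun j hj => by
      have h4 : (p.1 j).re ≠ 0 := fun h => hp.base.ne_zero j hj.1 (Complex.ext h hj.2.1)
      refine ⟨|(p.1 j).re|, abs_pos.2 h4, fun x hx => ?_⟩
      have h5 := (abs_re_le_norm _).trans_lt hx
      rw [sub_re, abs_lt] at h5
      rcases lt_or_gt_of_ne h4 with h | h
      · rw [abs_of_neg h] at h5
        exact iff_of_true (by linarith [h5.2]) h
      · rw [abs_of_pos h] at h5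
        exact iff_of_false (by linarith [h5.1]) h.not_gt)
    (fun j η η' _ hle h x hx => h x (hx.trans_le hle))
  refine ⟨min η3 (min η1 η2), lt_min hη3 (lt_min hη1 hη2), ?_⟩
  filter_upwards [h1, self_mem_nhdsWithin] with t ht htpos x hE hN
  have hN1 := hN.mono ((min_le_right _ _).trans (min_le_left _ _))
  have hN2 := hN.mono ((min_le_right _ _).trans (min_le_right _ _))
  have hinj : Set.InjOn x V := by
    intro j hj k hk hjk
    by_contra hne
    exact (h2 (j, k) ⟨hj, hk, hne⟩ t htpos x hN2).1 hjk
  have hconj : ∀ j ∈ V, x j = conj (x (κ j)) := by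
    intro j hj
    have := congrFun (ht x _ hE (hE.conj hκ hu) hN1 (hN1.conj hκ hpκ)) j
    rwa [if_pos hj] at this
  have hconj' : ∀ j ∈ V, x (κ j) = conj (x j) := fun j hj => by
    rw [hconj j hj, conj_conj]
  refine ⟨hinj, fun j hj => ⟨κ j, hκ.mem j hj, hconj' j hj, hκ.lam_eq j hj, hκ.d_eq j hj⟩,
    fun j hj => ?_, fun j hj k hk hj' hk' => ?_,
    fun j hj hj' => h3 j ⟨hj, hj'⟩ _ ((hN j hj).1.trans_le (min_le_left _ _))⟩
  · have h5 : (x j).im = 0 ↔ κ j = j := by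
      rw [← conj_eq_iff_im, ← hconj' j hj]
      exact ⟨fun h => hinj (hκ.mem j hj) hj h, fun h => by rw [h]⟩
    have h4 : ReF p j ↔ κ j = j := by
      rw [ReF, ← conj_eq_iff_im, ← conj_eq_iff_im, ← (hpκ j hj).1,
        ← (hpκ j hj).2]
      exact ⟨fun h => hp.pair_inj hj (hκ.mem j hj) h.1 h.2, fun h => by rw [h]; exact ⟨rfl, rfl⟩⟩
    rw [h5, h4]
  · by_cases hjk : j = k
    · subst hjk
      exact iff_of_false (lt_irrefl _) (by rintro (h | ⟨_, h⟩) <;> exact lt_irrefl _ h)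
    · refine ⟨fun h => ?_, (h2 (j, k) ⟨hj, hk, hjk⟩ t htpos x hN2).2⟩
      rcases hp.ltF_or hj hk hjk hj' hk' with h5 | h5
      · exact h5
      · exact absurd ((h2 (k, j) ⟨hk, hj, Ne.symm hjk⟩ t htpos x hN2).2 h5) h.not_gt

/-- The order pattern of the real vertices of a configuration, together with the set of its
negative vertices. -/
def pat (V : Finset ι) (x : ι → ℂ) : (ι → ι → Prop) × (ι → Prop) :=
  (fun j k => j ∈ V ∧ k ∈ V ∧ (x j).im = 0 ∧ (x k).im = 0 ∧ (x j).re < (x k).re ∨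
    (j = k ∧ j ∈ V ∧ (x j).im = 0), fun j => j ∈ V ∧ (x j).im = 0 ∧ (x j).re < 0)

/-- The order pattern of the real vertices near a limit configuration. -/
def patF (V : Finset ι) (p : (ι → ℂ) × (ι → ℂ)) : (ι → ι → Prop) × (ι → Prop) :=
  (fun j k => j ∈ V ∧ k ∈ V ∧ ReF p j ∧ ReF p k ∧ LtF p j k ∨ (j = k ∧ j ∈ V ∧ ReF p j),
    fun j => j ∈ V ∧ ReF p j ∧ (p.1 j).re < 0)

/-- Real solutions with a pattern satisfying `Q`. -/
def RSol (V : Finset ι) (lam : ι → ℕ) (u : ℂ) (b : ℕ) (d : ι → ℝ) (Q : (ι → ι → Prop) × (ι → Prop) → Prop)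
    (t : ℝ) : Set (ι → ℂ) :=
  {x | Eqs V lam u b d t x ∧ Set.InjOn x V ∧ IsRealC V lam d x ∧ Q (pat V x)}

/-- Real limit configurations with a pattern satisfying `Q`. -/
def RLim (V : Finset ι) (lam : ι → ℕ) (u : ℂ) (b : ℕ) (d : ι → ℝ) (Q : (ι → ι → Prop) × (ι → Prop) → Prop)
    (t : ℝ) : Set ((ι → ℂ) × (ι → ℂ)) :=
  {p | NF V lam u b d t p ∧ FReal V lam d p ∧ Q (patF V p)}

theorem NF.near_pat [Fintype ι] {p : (ι → ℂ) × (ι → ℂ)} (hp : NF V lam u b d t0 p)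
    (hr : FReal V lam d p) (hu0 : u ≠ 0) (hu : conj u = u) (hlam : ∀ k ∈ V, 1 ≤ lam k) :
    ∃ η > 0, ∀ᶠ t in 𝓝[Set.Ioi 0] t0, ∀ x, Eqs V lam u b d t x → Near V lam p.1 p.2 η t x →
      Set.InjOn x V ∧ IsRealC V lam d x ∧ pat V x = patF V p := by
  obtain ⟨η, hη, h⟩ := hp.near_pattern hr hu0 hu hlam
  refine ⟨η, hη, h.mono fun t ht x hE hN => ?_⟩
  obtain ⟨h1, h2, h3, h4, h0⟩ := ht x hE hN
  refine ⟨h1, h2, Prod.ext ?_ ?_⟩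
  · funext j k
    refine propext (or_congr ?_ ?_)
    · constructor
      · rintro ⟨hj, hk, h5, h6, h7⟩
        have h5' := (h3 j hj).1 h5
        have h6' := (h3 k hk).1 h6
        exact ⟨hj, hk, h5', h6', (h4 j hj k hk h5' h6').1 h7⟩
      · rintro ⟨hj, hk, h5, h6, h7⟩
        exact ⟨hj, hk, (h3 j hj).2 h5, (h3 k hk).2 h6, (h4 j hj k hk h5 h6).2 h7⟩
    · exact and_congr_right fun _ => and_congr_right fun hj => h3 j hj
  · funext j
    refine propext (and_congr_right fun hj => ?_)
    rw [h3 j hj]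
    exact and_congr_right fun h => h0 j hj h

theorem sum_RSol_eq_RLim [Fintype ι] (hu0 : u ≠ 0) (hu : conj u = u)
    (hlam : ∀ k ∈ V, 1 ≤ lam k) (hv : ∀ j ∈ V, 1 + t0 * (d j - 1) ≠ 0)
    {Q : (ι → ι → Prop) × (ι → Prop) → Prop} (hfin : (RLim V lam u b d Q t0).Finite)
    {M : Type*} [AddCommMonoid M] (F : (ι → ι → Prop) × (ι → Prop) → M) :
    ∀ᶠ t in 𝓝[Set.Ioi 0] t0, ∑ᶠ x ∈ RSol V lam u b d Q t, F (pat V x)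
      = ∑ᶠ p ∈ RLim V lam u b d Q t0, F (patF V p) := by
  refine sum_eq_sum_limits hu0 hlam hv hfin (fun p hp => hp.1) (fun t x hx => ⟨hx.1, hx.2.1⟩)
    (fun p hp η hη => ?_) (fun l hl x hx p hp hn => ?_) (fun p hp => ?_)
  · obtain ⟨η', hη', h⟩ := hp.1.near_pat hp.2.1 hu0 hu hlam
    filter_upwards [h, (hp.1.base.exists_unique_near hu0 hlam).2 _ (lt_min hη hη')]
      with t h1 ⟨x, hx, hn⟩
    obtain ⟨h2, h3, h4⟩ := h1 x hx (hn.mono (min_le_right _ _))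
    exact ⟨x, ⟨hx, h2, h3, h4 ▸ hp.2.2⟩, hn.mono (min_le_left _ _)⟩
  · obtain ⟨κ, hκ, -, h1⟩ := limit_real hlam l (hx.mono fun t ht => ht.2.1)
      (hx.mono fun t ht => ht.2.2.1) hp hn
    have hr : FReal V lam d p := fun j hj =>
      ⟨κ j, hκ.mem j hj, (h1 j hj).1, (h1 j hj).2, hκ.lam_eq j hj, hκ.d_eq j hj⟩
    obtain ⟨η', hη', h⟩ := hp.near_pat hr hu0 hu hlam
    obtain ⟨t, h2, h3, h4⟩ := ((h.filter_mono hl).and (hx.and (hn η' hη'))).exists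
    exact ⟨hp, hr, (h2 _ h3.1 h4).2.2 ▸ h3.2.2.2⟩
  · obtain ⟨η', hη', h⟩ := hp.1.near_pat hp.2.1 hu0 hu hlam
    exact ⟨η', hη', h.mono fun t ht x hx hn => by rw [(ht x hx.1 hn).2.2]⟩

theorem finite_solutions [Fintype ι] (hu0 : u ≠ 0) (hlam : ∀ k ∈ V, 1 ≤ lam k) (ht0 : 0 < t0)
    (hv : ∀ j ∈ V, 1 + t0 * (d j - 1) ≠ 0) :
    {x | Eqs V lam u b d t0 x ∧ Set.InjOn x V}.Finite := by
  by_contra hinf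
  obtain ⟨f, hf⟩ : ∃ f : ℕ → ι → ℂ, Function.Injective f ∧
      ∀ n, f n ∈ {x | Eqs V lam u b d t0 x ∧ Set.InjOn x V} := by
    have := Set.Infinite.to_subtype hinf
    exact ⟨fun n => (Infinite.natEmbedding _ n : {x | Eqs V lam u b d t0 x ∧ Set.InjOn x V}),
      fun m n h => (Infinite.natEmbedding _).injective (Subtype.ext h), fun n => Subtype.coe_prop _⟩
  obtain ⟨p, hp, hn⟩ := limit_near (T := ℕ) hu0 hlam (hyperfilter ℕ) (τ := fun _ => t0)
    tendsto_const_nhds (Eventually.of_forall fun _ => ht0)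
    (Eventually.of_forall fun n => (hf.2 n).1) (Eventually.of_forall fun n => (hf.2 n).2) hv
  obtain ⟨⟨η, hη, h⟩, -⟩ := hp.base.exists_unique_near hu0 hlam
  have h1 := h.self_of_nhdsWithin ht0
  obtain ⟨n, hn1⟩ := (hn η hη).exists
  have h2 : ∀ᶠ m in (hyperfilter ℕ : Filter ℕ), m = n := by
    filter_upwards [hn η hη] with m hm
    exact hf.1 (h1 _ _ (hf.2 m).1 (hf.2 n).1 hm hn1)
  exact notMem_hyperfilter_of_finite (Set.finite_singleton n) h2

theorem clus_of_injOn {α : ι → ℂ} (h : Set.InjOn α V) {j : ι} (hj : j ∈ V) : clus V α j = {j} := by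
  ext k
  rw [mem_clus, mem_singleton]
  exact ⟨fun hk => h hk.1 hj hk.2, by rintro rfl; exact ⟨hj, rfl⟩⟩

theorem nf_iff_of_pos (hlam : ∀ k ∈ V, 1 ≤ lam k) (ht0 : 0 < t0)
    (hv : ∀ j ∈ V, 1 + t0 * (d j - 1) ≠ 0) {p : (ι → ℂ) × (ι → ℂ)} :
    NF V lam u b d t0 p ↔ Eqs V lam u b d t0 p.1 ∧ Set.InjOn p.1 V ∧ p.2 = 0 := by
  constructor
  · intro hp
    rcases hp.base.alt with ⟨_, h⟩ | ⟨h, _⟩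
    · refine ⟨hp.base.eqs, h, funext fun j => ?_⟩
      by_cases hj : j ∈ V
      · have h1 := hp.centered j hj
        rw [clus_of_injOn h hj, sum_singleton] at h1
        have h2 : (lam j : ℂ) ≠ 0 := Nat.cast_ne_zero.2 (by have := hlam j hj; omega)
        exact (mul_eq_zero.1 h1).resolve_left h2
      · exact hp.supp j hj
    · exact absurd h ht0.ne'
  · rintro ⟨h1, h2, h3⟩
    refine ⟨⟨h1, fun j hj h0 => hv j hj ?_, Or.inl ⟨ht0, h2⟩⟩, fun j hj => ?_, fun j hj => ?_⟩
    · have := h1.2 j hj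
      rw [h0, prim_eval_zero] at this
      exact_mod_cast this.symm
    · simp [h3]
    · simp [h3]

theorem patF_zero (x : ι → ℂ) : patF V (x, (0 : ι → ℂ)) = pat V x := by
  simp [patF, pat, ReF, LtF]

theorem RLim_eq_image (hlam : ∀ k ∈ V, 1 ≤ lam k) (ht0 : 0 < t0)
    (hv : ∀ j ∈ V, 1 + t0 * (d j - 1) ≠ 0) {Q : (ι → ι → Prop) × (ι → Prop) → Prop} :
    RLim V lam u b d Q t0 = (fun x => (x, (0 : ι → ℂ))) '' RSol V lam u b d Q t0 := by
  ext ⟨x, y⟩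
  constructor
  · rintro ⟨h1, h2, h3⟩
    obtain ⟨h4, h5, h6⟩ := (nf_iff_of_pos hlam ht0 hv).1 h1
    dsimp only at h4 h5 h6
    subst h6
    refine ⟨x, ⟨h4, h5, fun j hj => ?_, (patF_zero x) ▸ h3⟩, rfl⟩
    obtain ⟨k, hk, h7, -, h8, h9⟩ := h2 j hj
    exact ⟨k, hk, h7, h8, h9⟩
  · rintro ⟨x', ⟨h4, h5, h6, h7⟩, h⟩
    obtain ⟨rfl, rfl⟩ := Prod.mk.inj h
    refine ⟨(nf_iff_of_pos hlam ht0 hv).2 ⟨h4, h5, rfl⟩, fun j hj => ?_, (patF_zero x').symm ▸ h7⟩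
    obtain ⟨k, hk, h7, h8, h9⟩ := h6 j hj
    exact ⟨k, hk, h7, by simp, h8, h9⟩

/-- The signed number of real solutions does not change along a path of critical values. -/
theorem sum_RSol_eq [Fintype ι] (hu0 : u ≠ 0) (hu : conj u = u)
    (hlam : ∀ k ∈ V, 1 ≤ lam k) (hd : ∀ j ∈ V, 0 < d j) (Q : (ι → ι → Prop) × (ι → Prop) → Prop)
    {M : Type*} [AddCommMonoid M] (F : (ι → ι → Prop) × (ι → Prop) → M) {t : ℝ} (ht : 0 < t) (ht1 : t ≤ 1) :
    ∑ᶠ x ∈ RSol V lam u b d Q t, F (pat V x) = ∑ᶠ x ∈ RSol V lam u b d Q 1, F (pat V x) := by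
  have hv : ∀ t ∈ Set.Ioc (0 : ℝ) 1, ∀ j ∈ V, 1 + t * (d j - 1) ≠ 0 := by
    intro t ht j hj
    have := mul_pos ht.1 (hd j hj)
    nlinarith [ht.2]
  have hloc : ∀ t ∈ Set.Ioc (0 : ℝ) 1, ∀ᶠ t' in 𝓝[Set.Ioc 0 1] t,
      ∑ᶠ x ∈ RSol V lam u b d Q t', F (pat V x) = ∑ᶠ x ∈ RSol V lam u b d Q t, F (pat V x) := by
    intro t ht
    have hfin : (RLim V lam u b d Q t).Finite := by
      rw [RLim_eq_image hlam ht.1 (hv t ht)]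
      exact ((finite_solutions hu0 hlam ht.1 (hv t ht)).subset fun x hx => ⟨hx.1, hx.2.1⟩).image _
    have h1 := sum_RSol_eq_RLim hu0 hu hlam (hv t ht) hfin F
    have h2 : ∑ᶠ p ∈ RLim V lam u b d Q t, F (patF V p)
        = ∑ᶠ x ∈ RSol V lam u b d Q t, F (pat V x) := by
      rw [RLim_eq_image hlam ht.1 (hv t ht), finsum_mem_image fun x _ x' _ h => (Prod.mk.inj h).1]
      exact finsum_mem_congr rfl fun x hx => by rw [patF_zero x]
    rw [h2] at h1
    exact h1.filter_mono (nhdsWithin_mono _ fun x hx => hx.1)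
  exact isPreconnected_Ioc.induction₂ (fun t t' => ∑ᶠ x ∈ RSol V lam u b d Q t, F (pat V x)
    = ∑ᶠ x ∈ RSol V lam u b d Q t', F (pat V x)) (fun t ht => (hloc t ht).mono fun _ h => h.symm)
    (fun _ _ _ _ _ _ h h' => h.trans h') (fun _ _ _ _ h => h.symm) ⟨ht, ht1⟩ ⟨one_pos, le_rfl⟩

theorem sum_RSol_one [Fintype ι] (hu0 : u ≠ 0) (hu : conj u = u)
    (hlam : ∀ k ∈ V, 1 ≤ lam k) (hd : ∀ j ∈ V, 0 < d j) {Q : (ι → ι → Prop) × (ι → Prop) → Prop}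
    (hfin : (RLim V lam u b d Q 0).Finite) {M : Type*} [AddCommMonoid M]
    (F : (ι → ι → Prop) × (ι → Prop) → M) :
    ∑ᶠ x ∈ RSol V lam u b d Q 1, F (pat V x) = ∑ᶠ p ∈ RLim V lam u b d Q 0, F (patF V p) := by
  have h1 := sum_RSol_eq_RLim hu0 hu hlam (fun j _ => by simp) hfin F
  have h2 : ∀ᶠ t in 𝓝[Set.Ioi (0 : ℝ)] 0, t ∈ Set.Ioc (0 : ℝ) 1 := Ioc_mem_nhdsGT one_pos
  obtain ⟨t, h3, h4⟩ := (h1.and h2).exists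
  rw [← h3, sum_RSol_eq hu0 hu hlam hd Q F h4.1 h4.2]

variable {A : Finset ι} {w : ι → ℝ} {a β : ℂ}

/-- Centered real configurations with prescribed differences of critical values. -/
def Sol (V : Finset ι) (lam : ι → ℕ) (u : ℂ) (w : ι → ℝ) : Set (ι → ℂ) :=
  {x | (∀ j ∉ V, x j = 0) ∧ Set.InjOn x V ∧ IsRealC V lam w x ∧ ∑ j ∈ V, (lam j : ℂ) * x j = 0 ∧
    ∀ j ∈ V, ∀ k ∈ V, (prim (wpoly V lam x u 0)).eval (x k)
      - (prim (wpoly V lam x u 0)).eval (x j) = ((w k - w j : ℝ) : ℂ)}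

/-- The function `f` on `A`, extended by zero. -/
def ext0 (A : Finset ι) (f : ι → ℂ) (j : ι) : ℂ := if j ∈ A then f j else 0

theorem ext0_of_mem {f : ι → ℂ} {j : ι} (hj : j ∈ A) : ext0 A f j = f j := if_pos hj

/-- The configuration with value `a` on `A` and `β` on the rest of `V`. -/
def cfg (V A : Finset ι) (a β : ℂ) (j : ι) : ℂ :=
  if j ∈ A then a else if j ∈ V then β else 0

theorem cfg_of_mem {j : ι} (hj : j ∈ A) : cfg V A a β j = a := if_pos hj

theorem cfg_of_mem_sdiff {j : ι} (hj : j ∈ V \ A) : cfg V A a β j = β := by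
  obtain ⟨h1, h2⟩ := mem_sdiff.1 hj
  rw [cfg, if_neg h2, if_pos h1]

theorem clus_cfg (hA : A ⊆ V) (h : a ≠ β) {j : ι} (hj : j ∈ A) : clus V (cfg V A a β) j = A := by
  ext k
  rw [mem_clus, cfg_of_mem hj]
  constructor
  · rintro ⟨hk, h1⟩
    by_contra h2
    rw [cfg_of_mem_sdiff (mem_sdiff.2 ⟨hk, h2⟩)] at h1
    exact h h1.symm
  · exact fun hk => ⟨hA hk, cfg_of_mem hk⟩

theorem clus_cfg_sdiff (h : a ≠ β) {j : ι} (hj : j ∈ V \ A) :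
    clus V (cfg V A a β) j = V \ A := by
  ext k
  rw [mem_clus, cfg_of_mem_sdiff hj]
  constructor
  · rintro ⟨hk, h1⟩
    refine mem_sdiff.2 ⟨hk, fun h2 => ?_⟩
    rw [cfg_of_mem h2] at h1
    exact h h1
  · exact fun hk => ⟨(mem_sdiff.1 hk).1, cfg_of_mem_sdiff hk⟩

theorem cw_cfg (hA : A ⊆ V) (h : a ≠ β) {j : ι} (hj : j ∈ A) :
    cw V lam u b (cfg V A a β) j = u * a ^ b * (a - β) ^ ∑ k ∈ V \ A, lam k := by
  rw [cw, clus_cfg hA h hj, cfg_of_mem hj, ← prod_pow_eq_pow_sum]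
  exact congrArg _ (prod_congr rfl fun k hk => by rw [cfg_of_mem_sdiff hk])

theorem cw_cfg_sdiff (hA : A ⊆ V) (h : a ≠ β) {j : ι} (hj : j ∈ V \ A) :
    cw V lam u b (cfg V A a β) j = u * β ^ b * (β - a) ^ ∑ k ∈ A, lam k := by
  rw [cw, clus_cfg_sdiff h hj, cfg_of_mem_sdiff hj, ← Finset.prod_pow_eq_pow_sum,
    Finset.sdiff_sdiff_eq_self hA]
  exact congrArg _ (Finset.prod_congr rfl fun k hk => by rw [cfg_of_mem hk])

theorem nf_cluster {α y : ι → ℂ} {C : Finset ι} (hC : C ⊆ V) {v : ℂ}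
    (hclus : ∀ j ∈ C, clus V α j = C) (hcw : ∀ j ∈ C, cw V lam u b α j = v)
    (hp : NF V lam u b d 0 (α, y)) (hr : FReal V lam d (α, y)) (hα : ∀ j ∈ C, (α j).im = 0) :
    ext0 C y ∈ Sol C lam v d := by
  have h0 : ∀ j ∈ V, Set.InjOn y (clus V α j) ∧
    ∀ k ∈ clus V α j, (prim (wpoly (clus V α j) lam y (cw V lam u b α j) 0)).eval (y k) -
      (prim (wpoly (clus V α j) lam y (cw V lam u b α j) 0)).eval (y j)
        = ((d k - d j : ℝ) : ℂ) := by
    rcases hp.base.alt with ⟨h, _⟩ | ⟨_, h⟩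
    · exact absurd h (lt_irrefl _)
    · exact h
  refine ⟨fun j hj => if_neg hj, fun j hj k hk h => ?_, fun j hj => ?_, ?_, fun j hj k hk => ?_⟩
  · rw [ext0_of_mem hj, ext0_of_mem hk] at h
    have h1 := (h0 j (hC hj)).1
    rw [hclus j hj] at h1
    exact h1 hj hk h
  · obtain ⟨k, hk, h1, h2, h3, h4⟩ := hr j (hC hj)
    have hkC : k ∈ C := by
      rw [← hclus j hj, mem_clus]
      refine ⟨hk, ?_⟩
      dsimp only at h1
      rw [h1, conj_eq_iff_im.2 (hα j hj)]
    exact ⟨k, hkC, by rw [ext0_of_mem hkC, ext0_of_mem hj]; exact h2, h3, h4⟩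
  · by_cases hne : C.Nonempty
    · obtain ⟨j, hj⟩ := hne
      have h1 := hp.centered j (hC hj)
      rw [hclus j hj] at h1
      rw [← h1]
      exact sum_congr rfl fun k hk => by rw [ext0_of_mem hk]
    · rw [not_nonempty_iff_eq_empty.1 hne, sum_empty]
  · have h1 := (h0 j (hC hj)).2
    rw [hclus j hj, hcw j hj] at h1
    rw [wpoly_congr (x' := y) (fun k hk => ext0_of_mem hk), ext0_of_mem hj, ext0_of_mem hk]
    exact h1 k hk

theorem mem_RLim_cfg (hA : A ⊆ V) (ha : a.im = 0) (hβ : β.im = 0) (haβ : a ≠ β) (ha0 : a ≠ 0)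
    (hβ0 : β ≠ 0) (hE : Eqs V lam u b d 0 (cfg V A a β)) (y : ι → ℂ) :
    NF V lam u b d 0 (cfg V A a β, y) ∧ FReal V lam d (cfg V A a β, y) ↔
      (∀ j ∉ V, y j = 0) ∧
      ext0 A y ∈ Sol A lam (u * a ^ b * (a - β) ^ ∑ k ∈ V \ A, lam k) d ∧
      ext0 (V \ A) y ∈ Sol (V \ A) lam (u * β ^ b * (β - a) ^ ∑ k ∈ A, lam k) d := by
  have hcA : ∀ j ∈ A, clus V (cfg V A a β) j = A := fun j hj => clus_cfg hA haβ hj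
  have hcB : ∀ j ∈ V \ A, clus V (cfg V A a β) j = V \ A := fun j hj => clus_cfg_sdiff haβ hj
  have hwA := fun j hj => cw_cfg (u := u) (b := b) (lam := lam) hA haβ (j := j) hj
  have hwB := fun j hj => cw_cfg_sdiff (u := u) (b := b) (lam := lam) hA haβ (j := j) hj
  constructor
  · rintro ⟨h1, h2⟩
    exact ⟨h1.supp, nf_cluster hA hcA hwA h1 h2 fun j hj => by rw [cfg_of_mem hj, ha],
      nf_cluster sdiff_subset hcB hwB h1 h2 fun j hj => by rw [cfg_of_mem_sdiff hj, hβ]⟩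
  · rintro ⟨h1, h2, h3⟩
    have key : ∀ C v, (∀ j ∈ C, clus V (cfg V A a β) j = C) →
        (∀ j ∈ C, cw V lam u b (cfg V A a β) j = v) → ext0 C y ∈ Sol C lam v d → ∀ j ∈ C,
        (Set.InjOn y (clus V (cfg V A a β) j) ∧ ∀ k ∈ clus V (cfg V A a β) j,
          (prim (wpoly (clus V (cfg V A a β) j) lam y (cw V lam u b (cfg V A a β) j) 0)).eval (y k)
          - (prim (wpoly (clus V (cfg V A a β) j) lam y (cw V lam u b (cfg V A a β) j) 0)).eval
            (y j) = ((d k - d j : ℝ) : ℂ)) ∧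
        ∑ k ∈ clus V (cfg V A a β) j, (lam k : ℂ) * y k = 0 ∧
        ∃ k ∈ C, y k = conj (y j) ∧ lam k = lam j ∧ d k = d j := by
      rintro C v hC hv ⟨-, h5, h6, h7, h8⟩ j hj
      rw [hC j hj, hv j hj]
      refine ⟨⟨fun i hi k hk h => h5 hi hk (by rw [ext0_of_mem hi, ext0_of_mem hk, h]),
        fun k hk => ?_⟩, ?_, ?_⟩
      · have := h8 j hj k hk
        rwa [wpoly_congr (x' := y) (fun k hk => ext0_of_mem hk), ext0_of_mem hj,
          ext0_of_mem hk] at this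
      · rw [← h7]
        exact sum_congr rfl fun k hk => by rw [ext0_of_mem hk]
      · obtain ⟨k, hk, h9, h10⟩ := h6 j hj
        rw [ext0_of_mem hk, ext0_of_mem hj] at h9
        exact ⟨k, hk, h9, h10⟩
    have key2 : ∀ j ∈ V, j ∈ A ∨ j ∈ V \ A := fun j hj => by
      by_cases h : j ∈ A
      · exact Or.inl h
      · exact Or.inr (mem_sdiff.2 ⟨hj, h⟩)
    refine ⟨⟨⟨hE, fun j hj => ?_, Or.inr ⟨rfl, fun j hj => ?_⟩⟩, fun j hj => ?_, h1⟩,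
      fun j hj => ?_⟩
    · change cfg V A a β j ≠ 0
      rcases key2 j hj with h | h
      · rwa [cfg_of_mem h]
      · rwa [cfg_of_mem_sdiff h]
    · rcases key2 j hj with h | h
      · exact (key _ _ hcA hwA h2 j h).1
      · exact (key _ _ hcB hwB h3 j h).1
    · rcases key2 j hj with h | h
      · exact (key _ _ hcA hwA h2 j h).2.1
      · exact (key _ _ hcB hwB h3 j h).2.1
    · rcases key2 j hj with h | h
      · obtain ⟨k, hk, h4⟩ := (key _ _ hcA hwA h2 j h).2.2
        refine ⟨k, hA hk, ?_, h4⟩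
        dsimp only
        rw [cfg_of_mem hk, cfg_of_mem h, conj_eq_iff_im.2 ha]
      · obtain ⟨k, hk, h4⟩ := (key _ _ hcB hwB h3 j h).2.2
        refine ⟨k, (mem_sdiff.1 hk).1, ?_, h4⟩
        dsimp only
        rw [cfg_of_mem_sdiff hk, cfg_of_mem_sdiff h, conj_eq_iff_im.2 hβ]

theorem ext0_add_left {y z : ι → ℂ} (hy : ∀ j ∉ A, y j = 0) (hz : ∀ j ∉ V \ A, z j = 0) :
    ext0 A (y + z) = y := by
  funext j
  by_cases hj : j ∈ A
  · rw [ext0_of_mem hj, Pi.add_apply, hz j (by simp [hj]), add_zero]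
  · rw [ext0, if_neg hj, hy j hj]

theorem ext0_add_right {y z : ι → ℂ} (hy : ∀ j ∉ A, y j = 0) (hz : ∀ j ∉ V \ A, z j = 0) :
    ext0 (V \ A) (y + z) = z := by
  funext j
  by_cases hj : j ∈ V \ A
  · rw [ext0_of_mem hj, Pi.add_apply, hy j (mem_sdiff.1 hj).2, zero_add]
  · rw [ext0, if_neg hj, hz j hj]

theorem ext0_add_ext0 {y : ι → ℂ} (hy : ∀ j ∉ V, y j = 0) :
    ext0 A y + ext0 (V \ A) y = y := by
  funext j
  by_cases hj : j ∈ A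
  · simp [ext0, hj]
  · by_cases hj' : j ∈ V
    · simp [ext0, hj, hj']
    · simp [ext0, hj, hj', hy j hj']

/-- Decomposition of the limit configurations into pairs of cluster configurations. -/
theorem RLim_eq_biUnion {𝒜 : Finset (Finset ι)} (h𝒜 : ∀ A ∈ 𝒜, A ⊆ V) {a β : Finset ι → ℂ}
    (ha : ∀ A, (a A).im = 0 ∧ (a A).re < 0) (hβ : ∀ A, (β A).im = 0 ∧ 0 < (β A).re)
    (hE : ∀ A ∈ 𝒜, Eqs V lam u b d 0 (cfg V A (a A) (β A)))
    {Q : (ι → ι → Prop) × (ι → Prop) → Prop}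
    (hex : ∀ p, NF V lam u b d 0 p → FReal V lam d p → Q (patF V p) →
      ∃ A ∈ 𝒜, p.1 = cfg V A (a A) (β A))
    (hQ : ∀ A ∈ 𝒜, ∀ y, NF V lam u b d 0 (cfg V A (a A) (β A), y) →
      FReal V lam d (cfg V A (a A) (β A), y) → Q (patF V (cfg V A (a A) (β A), y))) :
    RLim V lam u b d Q 0 = ⋃ A ∈ (𝒜 : Set (Finset ι)), (fun q : (ι → ℂ) × (ι → ℂ) =>
      (cfg V A (a A) (β A), q.1 + q.2)) ''
      (Sol A lam (u * a A ^ b * (a A - β A) ^ ∑ k ∈ V \ A, lam k) d ×ˢ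
        Sol (V \ A) lam (u * β A ^ b * (β A - a A) ^ ∑ k ∈ A, lam k) d) := by
  have hne : ∀ A, a A ≠ β A := fun A h => by
    have h1 := (ha A).2
    rw [h] at h1
    exact lt_asymm h1 (hβ A).2
  have ha0 : ∀ A, a A ≠ 0 := fun A h => by
    have h1 := (ha A).2
    rw [h] at h1
    exact lt_irrefl _ h1
  have hβ0 : ∀ A, β A ≠ 0 := fun A h => by
    have h1 := (hβ A).2
    rw [h] at h1
    exact lt_irrefl _ h1
  ext ⟨α, y⟩
  simp only [Set.mem_iUnion, Set.mem_image, Set.mem_prod, Prod.exists]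
  constructor
  · rintro ⟨h1, h2, h3⟩
    obtain ⟨A, hA, h4⟩ := hex _ h1 h2 h3
    dsimp only at h4
    subst h4
    obtain ⟨h5, h6, h7⟩ := (mem_RLim_cfg (h𝒜 A hA) (ha A).1 (hβ A).1 (hne A) (ha0 A) (hβ0 A)
      (hE A hA) y).1 ⟨h1, h2⟩
    exact ⟨A, hA, _, _, ⟨h6, h7⟩, by rw [ext0_add_ext0 h5]⟩
  · rintro ⟨A, hA, y1, y2, ⟨h1, h2⟩, h⟩
    obtain ⟨rfl, rfl⟩ := Prod.mk.inj h
    have h3 := (mem_RLim_cfg (h𝒜 A hA) (ha A).1 (hβ A).1 (hne A) (ha0 A) (hβ0 A)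
      (hE A hA) (y1 + y2)).2 ⟨fun j hj => ?_, ?_, ?_⟩
    · exact ⟨h3.1, h3.2, hQ A hA _ h3.1 h3.2⟩
    · rw [Pi.add_apply, h1.1 j fun h => hj (h𝒜 A hA h), h2.1 j (by simp [hj]), add_zero]
    · rwa [ext0_add_left h1.1 h2.1]
    · rwa [ext0_add_right h1.1 h2.1]

variable {x : ι → ℂ}

/-- The part of the sign of a pair of vertices `x_j < x_k` coming from equal critical values. -/
def tw (lam : ι → ℕ) (w : ι → ℝ) (j k : ι) : ℤ :=
  if w j = w k then (-1) ^ (lam k + 1 + if lam k < lam j then 1 else 0) else 1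

/-- The sign contributed by a pair of real vertices `x_j < x_k`. -/
def es (lam : ι → ℕ) (w : ι → ℝ) (j k : ι) : ℤ := (-1) ^ lam k * tw lam w j k

/-- The sign of a configuration. -/
def sgn (V : Finset ι) (lam : ι → ℕ) (w : ι → ℝ) (x : ι → ℂ) : ℤ :=
  ∏ j ∈ V, ∏ k ∈ V, if (x j).im = 0 ∧ (x k).im = 0 ∧ (x j).re < (x k).re then es lam w j k else 1

/-- The sign of a configuration with an additional vertex of multiplicity `b` at the origin,
expressed by its pattern. -/
def sgnPat (V : Finset ι) (lam : ι → ℕ) (w : ι → ℝ) (b : ℕ)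
    (π : (ι → ι → Prop) × (ι → Prop)) : ℤ :=
  (∏ j ∈ V, ∏ k ∈ V, if j ≠ k ∧ π.1 j k then es lam w j k else 1) *
    ∏ j ∈ V, if π.1 j j then (if π.2 j then (-1) ^ b else (-1) ^ lam j) else 1

theorem tw_mul_self (j k : ι) : tw lam w j k * tw lam w j k = 1 := by
  unfold tw
  split_ifs <;> simp [← mul_pow]

theorem es_mul_self (j k : ι) : es lam w j k * es lam w j k = 1 := by
  rw [es, mul_mul_mul_comm, tw_mul_self, ← mul_pow]
  simp

theorem es_congr {j j' k k' : ι} (hj : lam j = lam j') (hj' : w j = w j') (hk : lam k = lam k')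
    (hk' : w k = w k') : es lam w j k = es lam w j' k' := by
  simp only [es, tw, hj, hj', hk, hk']

theorem prod_real (hinj : Set.InjOn x V) (hr : IsRealC V lam w x) {f : ι → ℤ}
    (hf : ∀ j, f j * f j = 1) (hc : ∀ j k, lam j = lam k → w j = w k → f j = f k) :
    (∏ j ∈ V, if (x j).im = 0 then f j else 1) = ∏ j ∈ V, f j := by
  obtain ⟨κ, hκ, hx⟩ := hr.exists_inv hinj
  have h1 : ∏ j ∈ V, (if (x j).im = 0 then 1 else f j) = 1 := by
    refine prod_involution (fun j _ => κ j) (fun j hj => ?_) (fun j hj h hκj => h ?_)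
      (fun j hj => hκ.mem j hj) (fun j hj => hκ.inv j hj)
    · simp only [hx j hj, conj_im, neg_eq_zero, hc _ _ (hκ.lam_eq j hj) (hκ.d_eq j hj)]
      split_ifs
      · rfl
      · exact hf j
    · have := hx j hj
      rw [hκj] at this
      rw [if_pos (conj_eq_iff_im.1 this.symm)]
  calc _ = (∏ j ∈ V, if (x j).im = 0 then f j else 1) *
        ∏ j ∈ V, (if (x j).im = 0 then 1 else f j) := by rw [h1, mul_one]
    _ = _ := by
      rw [← prod_mul_distrib]
      exact prod_congr rfl fun j _ => by split_ifs <;> simp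

theorem prod_prod_split (hA : A ⊆ V) (f : ι → ι → ℤ) :
    ∏ j ∈ V, ∏ k ∈ V, f j k = ((∏ j ∈ A, ∏ k ∈ A, f j k) * ∏ j ∈ V \ A, ∏ k ∈ V \ A, f j k) *
      ((∏ j ∈ A, ∏ k ∈ V \ A, f j k) * ∏ j ∈ V \ A, ∏ k ∈ A, f j k) := by
  have h1 : ∀ g : ι → ℤ, ∏ k ∈ V, g k = (∏ k ∈ A, g k) * ∏ k ∈ V \ A, g k := fun g => by
    rw [mul_comm, prod_sdiff hA]
  rw [h1]
  simp only [h1, prod_mul_distrib]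
  ring

theorem sgnPat_cfg (hA : A ⊆ V) (ha : a.im = 0 ∧ a.re < 0) (hβ : β.im = 0 ∧ 0 < β.re) {u v : ℂ}
    {y z : ι → ℂ} (hy : y ∈ Sol A lam u w) (hz : z ∈ Sol (V \ A) lam v w) :
    sgnPat V lam w b (patF V (cfg V A a β, y + z)) = sgn A lam w y * sgn (V \ A) lam w z *
      ((∏ j ∈ A, ∏ k ∈ V \ A, es lam w j k) * ((-1) ^ (b * A.card) *
        (-1) ^ ∑ k ∈ V \ A, lam k)) := by
  have hyz : ∀ j ∈ A, (y + z) j = y j := fun j hj => by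
    rw [Pi.add_apply, hz.1 j (by simp [hj]), add_zero]
  have hyz' : ∀ j ∈ V \ A, (y + z) j = z j := fun j hj => by
    rw [Pi.add_apply, hy.1 j (mem_sdiff.1 hj).2, zero_add]
  have hRA : ∀ j ∈ A, ReF (cfg V A a β, y + z) j ↔ (y j).im = 0 := fun j hj => by
    simp only [ReF, hyz j hj, cfg_of_mem hj, ha.1, true_and]
  have hRB : ∀ j ∈ V \ A, ReF (cfg V A a β, y + z) j ↔ (z j).im = 0 := fun j hj => by
    simp only [ReF, hyz' j hj, cfg_of_mem_sdiff hj, hβ.1, true_and]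
  have hBV : ∀ j ∈ V \ A, j ∈ V := fun j hj => (mem_sdiff.1 hj).1
  have hlt : a.re < β.re := ha.2.trans hβ.2
  have haβ : a ≠ β := fun h => by rw [h] at hlt; exact lt_irrefl _ hlt
  rw [sgnPat, prod_prod_split hA, ← prod_sdiff hA]
  have e1 : (∏ j ∈ A, ∏ k ∈ A, if j ≠ k ∧ (patF V (cfg V A a β, y + z)).1 j k
      then es lam w j k else 1) = sgn A lam w y := by
    refine prod_congr rfl fun j hj => prod_congr rfl fun k hk => ?_
    refine if_congr ?_ rfl rfl
    simp only [patF, hRA j hj, hRA k hk, LtF, cfg_of_mem hj, cfg_of_mem hk, hyz j hj, hyz k hk,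
      hA hj, hA hk, lt_irrefl, true_and, false_or]
    constructor
    · rintro ⟨h, h1 | h1⟩
      · exact h1
      · exact absurd h1.1 h
    · exact fun h => ⟨fun h1 => by rw [h1] at h; exact lt_irrefl _ h.2.2, Or.inl h⟩
  have e2 : (∏ j ∈ V \ A, ∏ k ∈ V \ A, if j ≠ k ∧ (patF V (cfg V A a β, y + z)).1 j k
      then es lam w j k else 1) = sgn (V \ A) lam w z := by
    refine prod_congr rfl fun j hj => prod_congr rfl fun k hk => ?_
    refine if_congr ?_ rfl rfl
    simp only [patF, hRB j hj, hRB k hk, LtF, cfg_of_mem_sdiff hj, cfg_of_mem_sdiff hk, hyz' j hj,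
      hyz' k hk, hBV j hj, hBV k hk, lt_irrefl, true_and, false_or]
    constructor
    · rintro ⟨h, h1 | h1⟩
      · exact h1
      · exact absurd h1.1 h
    · exact fun h => ⟨fun h1 => by rw [h1] at h; exact lt_irrefl _ h.2.2, Or.inl h⟩
  have e3 : (∏ j ∈ A, ∏ k ∈ V \ A, if j ≠ k ∧ (patF V (cfg V A a β, y + z)).1 j k
      then es lam w j k else 1) = ∏ j ∈ A, ∏ k ∈ V \ A, es lam w j k := by
    have h1 : ∀ j ∈ A, (∏ k ∈ V \ A, if j ≠ k ∧ (patF V (cfg V A a β, y + z)).1 j k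
        then es lam w j k else 1) = if (y j).im = 0 then ∏ k ∈ V \ A, es lam w j k else 1 := by
      intro j hj
      have h2 : ∀ k ∈ V \ A, (j ≠ k ∧ (patF V (cfg V A a β, y + z)).1 j k) ↔
          (y j).im = 0 ∧ (z k).im = 0 := by
        intro k hk
        have hjk : j ≠ k := fun h => (mem_sdiff.1 hk).2 (h ▸ hj)
        simp only [patF, hRA j hj, hRB k hk, LtF, cfg_of_mem hj, cfg_of_mem_sdiff hk,
          hA hj, hBV k hk, true_and, hlt, hjk, false_and, or_false, true_or, and_true, ne_eq,
          not_false_eq_true]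
      rw [prod_congr rfl fun k hk => if_congr (h2 k hk) rfl rfl]
      split_ifs with h3
      · simp only [h3, true_and]
        exact prod_real hz.2.1 hz.2.2.1 (fun k => es_mul_self j k)
          (fun k k' h h' => es_congr rfl rfl h h')
      · simp [h3]
    rw [prod_congr rfl h1]
    refine prod_real (f := fun j => ∏ k ∈ V \ A, es lam w j k) hy.2.1 hy.2.2.1 (fun j => ?_)
      (fun j j' h h' => ?_)
    · rw [← prod_mul_distrib]
      exact prod_eq_one fun k _ => es_mul_self j k
    · exact prod_congr rfl fun k _ => es_congr h h' rfl rfl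
  have e4 : (∏ j ∈ V \ A, ∏ k ∈ A, if j ≠ k ∧ (patF V (cfg V A a β, y + z)).1 j k
      then es lam w j k else 1) = 1 := by
    refine prod_eq_one fun j hj => prod_eq_one fun k hk => if_neg ?_
    simp only [patF, LtF, cfg_of_mem hk, cfg_of_mem_sdiff hj, hlt.not_gt, haβ.symm, false_and,
      and_false, or_false, false_or]
    rintro ⟨h, h1, -⟩
    exact h h1
  have e5 : (∏ j ∈ A, if (patF V (cfg V A a β, y + z)).1 j j then
      (if (patF V (cfg V A a β, y + z)).2 j then (-1 : ℤ) ^ b else (-1) ^ lam j) else 1)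
      = (-1) ^ (b * A.card) := by
    have h1 : ∀ j ∈ A, (if (patF V (cfg V A a β, y + z)).1 j j then
        (if (patF V (cfg V A a β, y + z)).2 j then (-1 : ℤ) ^ b else (-1) ^ lam j) else 1)
        = if (y j).im = 0 then (-1) ^ b else 1 := by
      intro j hj
      simp only [patF, hRA j hj, LtF, cfg_of_mem hj, hA hj, true_and, lt_irrefl, false_or,
        and_false, ha.2, and_true]
      split_ifs <;> rfl
    rw [prod_congr rfl h1, prod_real (f := fun _ => (-1 : ℤ) ^ b) hy.2.1 hy.2.2.1
      (fun j => by simp [← mul_pow]) (fun _ _ _ _ => rfl), prod_const, pow_mul]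
  have e6 : (∏ j ∈ V \ A, if (patF V (cfg V A a β, y + z)).1 j j then
      (if (patF V (cfg V A a β, y + z)).2 j then (-1 : ℤ) ^ b else (-1) ^ lam j) else 1)
      = (-1) ^ ∑ k ∈ V \ A, lam k := by
    have h1 : ∀ j ∈ V \ A, (if (patF V (cfg V A a β, y + z)).1 j j then
        (if (patF V (cfg V A a β, y + z)).2 j then (-1 : ℤ) ^ b else (-1) ^ lam j) else 1)
        = if (z j).im = 0 then (-1) ^ lam j else 1 := by
      intro j hj
      simp only [patF, hRB j hj, LtF, cfg_of_mem_sdiff hj, hBV j hj, true_and, lt_irrefl, false_or,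
        and_false, hβ.2.not_gt, if_false]
    rw [prod_congr rfl h1, prod_real (f := fun j => (-1 : ℤ) ^ lam j) hz.2.1 hz.2.2.1
      (fun j => by simp [← mul_pow]) (fun _ _ h _ => by rw [h]), prod_pow_eq_pow_sum]
  rw [e1, e2, e3, e4, e5, e6]
  ring

/-- The weighted mean of a configuration. -/
def wmean (V : Finset ι) (lam : ι → ℕ) (x : ι → ℂ) : ℂ :=
  (∑ j ∈ V, (lam j : ℂ) * x j) / ∑ j ∈ V, (lam j : ℂ)

/-- The configuration translated by `-c`. -/
def shiftC (V : Finset ι) (c : ℂ) (x : ι → ℂ) (j : ι) : ℂ :=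
  if j ∈ V then x j - c else 0

theorem shiftC_of_mem {c : ℂ} {x : ι → ℂ} {j : ι} (hj : j ∈ V) : shiftC V c x j = x j - c :=
  if_pos hj

theorem shiftC_of_notMem {c : ℂ} {x : ι → ℂ} {j : ι} (hj : j ∉ V) : shiftC V c x j = 0 :=
  if_neg hj

theorem wmean_shiftC (h : (∑ j ∈ V, (lam j : ℂ)) ≠ 0) {x y : ι → ℂ} {c : ℂ}
    (hy : ∀ j ∈ V, y j = x j - c) : wmean V lam y = wmean V lam x - c := by
  rw [wmean, wmean, sum_congr rfl fun j hj => by rw [hy j hj, mul_sub], sum_sub_distrib,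
    ← sum_mul]
  field_simp

/-- A centered configuration is recovered from its translates. -/
theorem shiftC_wmean (h : (∑ j ∈ V, (lam j : ℂ)) ≠ 0) {x y : ι → ℂ} {c : ℂ}
    (hx : ∑ j ∈ V, (lam j : ℂ) * x j = 0) (hx0 : ∀ j ∉ V, x j = 0)
    (hy : ∀ j ∈ V, y j = x j - c) : shiftC V (wmean V lam y) y = x := by
  have h1 : wmean V lam y = - c := by
    rw [wmean_shiftC h hy, wmean, hx, zero_div, zero_sub]
  funext j
  by_cases hj : j ∈ V
  · rw [shiftC_of_mem hj, hy j hj, h1]; ring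
  · rw [shiftC_of_notMem hj, hx0 j hj]

theorem sum_shiftC_wmean (h : (∑ j ∈ V, (lam j : ℂ)) ≠ 0) (y : ι → ℂ) :
    ∑ j ∈ V, (lam j : ℂ) * shiftC V (wmean V lam y) y j = 0 := by
  have h1 : wmean V lam (shiftC V (wmean V lam y) y) = 0 := by
    rw [wmean_shiftC h fun j hj => shiftC_of_mem hj, sub_self]
  rw [wmean, div_eq_zero_iff] at h1
  exact h1.resolve_right h

theorem conj_wmean {d : ι → ℝ} {y : ι → ℂ} (hy : Set.InjOn y V) (hr : IsRealC V lam d y) :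
    conj (wmean V lam y) = wmean V lam y := by
  obtain ⟨κ, hκ, hx⟩ := hr.exists_inv hy
  rw [wmean, map_div₀, map_sum, map_sum]
  simp only [map_mul, Complex.conj_natCast]
  congr 1
  refine sum_bij' (fun j _ => κ j) (fun j _ => κ j) hκ.mem hκ.mem hκ.inv hκ.inv
    fun j hj => ?_
  rw [hκ.lam_eq j hj, hx j hj]

theorem prim_shiftC {x y : ι → ℂ} {c : ℂ} (hy : ∀ j ∈ V, y j = x j - c) (z : ℂ) :
    (prim (wpoly V lam x u 0)).eval (c + z) - (prim (wpoly V lam x u 0)).eval c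
      = (prim (wpoly V lam y u 0)).eval z :=
  wpoly_shift (fun k hk => by rw [hy k hk]; ring) z

theorem Sol_congr {w' : ι → ℝ} (h : ∀ j ∈ V, ∀ k ∈ V, w' k - w' j = w k - w j) :
    Sol V lam u w' = Sol V lam u w := by
  have h1 : ∀ x, IsRealC V lam w' x ↔ IsRealC V lam w x := fun x =>
    forall₂_congr fun j hj => exists_congr fun k => and_congr_right fun hk =>
      and_congr_right fun _ => and_congr_right fun _ => by
        rw [← sub_eq_zero, h j hj k hk, sub_eq_zero]
  ext x
  simp only [Sol, Set.mem_ofPred_eq, h1]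
  refine and_congr_right fun _ => and_congr_right fun _ => and_congr_right fun _ =>
    and_congr_right fun _ => forall₂_congr fun j hj => forall₂_congr fun k hk => ?_
  rw [h j hj k hk]

theorem Sol_finite [Fintype ι] (hu0 : u ≠ 0) (hlam : ∀ k ∈ V, 1 ≤ lam k) :
    (Sol V lam u w).Finite := by
  rcases V.eq_empty_or_nonempty with rfl | ⟨j0, hj0⟩
  · refine (Set.finite_singleton (0 : ι → ℂ)).subset fun x hx => ?_
    exact funext fun j => hx.1 j (notMem_empty j)
  obtain ⟨m, hm⟩ : ∃ m : ℝ, ∀ j ∈ V, m < w j := by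
    obtain ⟨j1, -, h1⟩ := V.exists_min_image w ⟨j0, hj0⟩
    exact ⟨w j1 - 1, fun j hj => by linarith [h1 j hj]⟩
  have hs := sum_lam_ne_zero hlam hj0
  refine ((finite_solutions (u := u) (b := 0) (d := fun j => w j - m) hu0 hlam one_pos
    fun j hj => by linarith [hm j hj]).image fun y => shiftC V (wmean V lam y) y).subset
      fun x hx => ?_
  obtain ⟨h1, h2, -, h3, h4⟩ := hx
  set R := prim (wpoly V lam x u 0)
      - C ((prim (wpoly V lam x u 0)).eval (x j0) - ((w j0 - m : ℝ) : ℂ)) with hR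
  have hdeg : R.degree ≠ 0 := fun h => by
    have h5 : derivative R = 0 := by rw [eq_C_of_degree_eq_zero h, derivative_C]
    rw [hR, derivative_sub, derivative_prim, derivative_C, sub_zero] at h5
    exact wpoly_ne_zero hu0 h5
  obtain ⟨c, hc⟩ := IsAlgClosed.exists_root R hdeg
  rw [IsRoot.def, hR, eval_sub, eval_C] at hc
  refine ⟨shiftC V c x, ⟨⟨fun j hj => shiftC_of_notMem hj, fun j hj => ?_⟩, fun j hj k hk h => ?_⟩,
    shiftC_wmean hs h3 h1 fun j hj => shiftC_of_mem hj⟩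
  · rw [← prim_shiftC fun j hj => shiftC_of_mem hj, shiftC_of_mem hj]
    have h5 := h4 j0 hj0 j hj
    rw [add_sub_cancel]
    push_cast at h5 hc ⊢
    linear_combination h5 - hc
  · rw [shiftC_of_mem hj, shiftC_of_mem hk] at h
    exact h2 hj hk (sub_left_inj.1 h)

variable {ξ : ι}

theorem shift_mem_RSol (hξ : ξ ∉ V) (hw : ∀ j ∈ V, w ξ < w j) {x : ι → ℂ}
    (hx : x ∈ Sol (insert ξ V) lam u w) :
    shiftC V (x ξ) x ∈ RSol V lam u (lam ξ) (fun j => w j - w ξ) (fun _ => True) 1 ∧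
      (x ξ).im = 0 := by
  obtain ⟨h1, h2, h3, -, h4⟩ := hx
  have hξV : ξ ∈ insert ξ V := mem_insert_self _ _
  have hre : conj (x ξ) = x ξ := by
    obtain ⟨k, hk, hk1, -, hk2⟩ := h3 ξ hξV
    rcases mem_insert.1 hk with rfl | hk
    · exact hk1.symm
    · exact absurd hk2 (hw k hk).ne'
  refine ⟨⟨⟨fun j hj => shiftC_of_notMem hj, fun j hj => ?_⟩, fun j hj k hk h => ?_, fun j hj => ?_,
    trivial⟩, conj_eq_iff_im.1 hre⟩
  · have h5 : wpoly V lam (shiftC V (x ξ) x) u (lam ξ)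
        = wpoly (insert ξ V) lam (shiftC V (x ξ) x) u 0 := by
      rw [wpoly_erase hξV (shiftC_of_notMem hξ), erase_insert hξ]
    rw [h5, ← prim_shiftC (x := x) (c := x ξ), shiftC_of_mem hj, add_sub_cancel]
    · rw [h4 ξ hξV j (mem_insert_of_mem hj)]
      congr 1
      ring
    · intro k hk
      rcases mem_insert.1 hk with rfl | hk
      · rw [shiftC_of_notMem hξ, sub_self]
      · rw [shiftC_of_mem hk]
  · rw [shiftC_of_mem hj, shiftC_of_mem hk] at h
    exact h2 (mem_insert_of_mem hj) (mem_insert_of_mem hk) (sub_left_inj.1 h)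
  · obtain ⟨k, hk, hk1, hk2, hk3⟩ := h3 j (mem_insert_of_mem hj)
    have hkV : k ∈ V := by
      rcases mem_insert.1 hk with rfl | hk
      · exact absurd hk3 (hw j hj).ne
      · exact hk
    refine ⟨k, hkV, ?_, hk2, by simp only [hk3]⟩
    rw [shiftC_of_mem hkV, shiftC_of_mem hj, map_sub, hre, hk1]

theorem RSol.ne_zero (hw : ∀ j ∈ V, w ξ < w j) {b : ℕ} {Q} {y : ι → ℂ}
    (hy : y ∈ RSol V lam u b (fun j => w j - w ξ) Q 1) {j : ι} (hj : j ∈ V) : y j ≠ 0 := by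
  intro h
  have h1 := hy.1.2 j hj
  rw [h, prim_eval_zero] at h1
  have h2 := ofReal_eq_zero.1 h1.symm
  linarith [hw j hj]

theorem recenter_mem_Sol (hlam : ∀ k ∈ insert ξ V, 1 ≤ lam k) (hξ : ξ ∉ V)
    (hw : ∀ j ∈ V, w ξ < w j) {y : ι → ℂ}
    (hy : y ∈ RSol V lam u (lam ξ) (fun j => w j - w ξ) (fun _ => True) 1) :
    shiftC (insert ξ V) (wmean (insert ξ V) lam y) y ∈ Sol (insert ξ V) lam u w := by
  have hne := fun j (hj : j ∈ V) => RSol.ne_zero hw hy hj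
  obtain ⟨⟨h1, h2⟩, h3, h4, -⟩ := hy
  have hξV : ξ ∈ insert ξ V := mem_insert_self _ _
  have hinj : Set.InjOn y (insert ξ V : Finset ι) := by
    rw [coe_insert, Set.injOn_insert (by simpa using hξ)]
    refine ⟨h3, ?_⟩
    rintro ⟨j, hj, h⟩
    exact hne j hj (h.trans (h1 ξ hξ))
  have hr : IsRealC (insert ξ V) lam w y := by
    intro j hj
    rcases mem_insert.1 hj with rfl | hj
    · exact ⟨j, hξV, by rw [h1 j hξ, map_zero], rfl, rfl⟩
    · obtain ⟨k, hk, hk1, hk2, hk3⟩ := h4 j hj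
      exact ⟨k, mem_insert_of_mem hk, hk1, hk2, sub_left_inj.1 hk3⟩
  have hc := conj_wmean hinj hr
  set c := wmean (insert ξ V) lam y with hcd
  refine ⟨fun j hj => shiftC_of_notMem hj, fun j hj k hk h => ?_, fun j hj => ?_,
    sum_shiftC_wmean (sum_lam_ne_zero hlam hξV) y, ?_⟩
  · rw [shiftC_of_mem hj, shiftC_of_mem hk] at h
    exact hinj hj hk (sub_left_inj.1 h)
  · obtain ⟨k, hk, hk1, hk2, hk3⟩ := hr j hj
    refine ⟨k, hk, ?_, hk2, hk3⟩
    rw [shiftC_of_mem hj, shiftC_of_mem hk, map_sub, hc, hk1]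
  · have h5 : ∀ j ∈ insert ξ V, (prim (wpoly (insert ξ V) lam y u 0)).eval (y j)
        = ((w j - w ξ : ℝ) : ℂ) := by
      intro j hj
      rw [wpoly_erase hξV (h1 ξ hξ), erase_insert hξ]
      rcases mem_insert.1 hj with rfl | hj
      · rw [h1 j hξ, prim_eval_zero, sub_self, ofReal_zero]
      · rw [h2 j hj]
        congr 1
        ring
    have h6 : ∀ j ∈ insert ξ V, y j = shiftC (insert ξ V) c y j - (-c) := fun j hj => by
      rw [shiftC_of_mem hj]; ring
    have h7 : ∀ j ∈ insert ξ V, shiftC (insert ξ V) c y j = -c + y j := fun j hj => by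
      rw [shiftC_of_mem hj]; ring
    intro j hj k hk
    have h8 := prim_shiftC (lam := lam) (u := u) h6 (y j)
    have h9 := prim_shiftC (lam := lam) (u := u) h6 (y k)
    rw [← h7 j hj, h5 j hj] at h8
    rw [← h7 k hk, h5 k hk] at h9
    push_cast at h8 h9 ⊢
    linear_combination h9 - h8

theorem sgn_insert (hξ : ξ ∉ V) (hw : ∀ j ∈ V, w ξ < w j) {x : ι → ℂ}
    (hx : x ∈ Sol (insert ξ V) lam u w) :
    sgn (insert ξ V) lam w x = sgnPat V lam w (lam ξ) (pat V (shiftC V (x ξ) x)) := by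
  obtain ⟨hy, hre⟩ := shift_mem_RSol hξ hw hx
  have hne := fun j (hj : j ∈ V) => RSol.ne_zero hw hy hj
  set y := shiftC V (x ξ) x with hyd
  have him : ∀ j ∈ V, (y j).im = (x j).im := fun j hj => by
    rw [hyd, shiftC_of_mem hj, sub_im, hre, sub_zero]
  have hyre : ∀ j ∈ V, (y j).re = (x j).re - (x ξ).re := fun j hj => by
    rw [hyd, shiftC_of_mem hj, sub_re]
  rw [sgn, prod_insert hξ]
  simp only [prod_insert hξ, lt_irrefl, and_false, if_false, one_mul]
  rw [prod_mul_distrib, ← mul_assoc, ← prod_mul_distrib, mul_comm, sgnPat]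
  congr 1
  · refine prod_congr rfl fun j hj => prod_congr rfl fun k hk => ?_
    refine if_congr ?_ rfl rfl
    simp only [pat, hj, hk, him j hj, him k hk, hyre j hj, hyre k hk, true_and, sub_lt_sub_iff_right]
    constructor
    · rintro ⟨h1, h2, h3⟩
      exact ⟨fun h => by subst h; exact lt_irrefl _ h3, Or.inl ⟨h1, h2, h3⟩⟩
    · rintro ⟨h1, h2 | h2⟩
      · exact h2
      · exact absurd h2.1 h1
  · refine prod_congr rfl fun j hj => ?_
    have h1 : tw lam w ξ j = 1 := by rw [tw, if_neg (hw j hj).ne]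
    have h2 : tw lam w j ξ = 1 := by rw [tw, if_neg (hw j hj).ne']
    have h3 : (pat V y).1 j j ↔ (x j).im = 0 := by
      simp [pat, hj, him j hj]
    have h4 : (pat V y).2 j ↔ (x j).im = 0 ∧ (x j).re < (x ξ).re := by
      simp [pat, hj, him j hj, hyre j hj, sub_neg]
    rw [es, es, h1, h2, mul_one, mul_one]
    simp only [h3, h4, hre, true_and]
    by_cases h5 : (x j).im = 0
    · have h6 : (x j).re ≠ (x ξ).re := fun h => hne j hj (Complex.ext
        (by rw [hyre j hj, h, sub_self, zero_re]) (by rw [him j hj, h5, zero_im]))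
      rcases h6.lt_or_gt with h7 | h7
      · simp [h5, h7, h7.not_gt]
      · simp [h5, h7, h7.not_gt]
    · simp [h5]

theorem sum_Sol_insert (hlam : ∀ k ∈ insert ξ V, 1 ≤ lam k) (hξ : ξ ∉ V)
    (hw : ∀ j ∈ V, w ξ < w j) :
    ∑ᶠ x ∈ Sol (insert ξ V) lam u w, sgn (insert ξ V) lam w x
      = ∑ᶠ y ∈ RSol V lam u (lam ξ) (fun j => w j - w ξ) (fun _ => True) 1,
        sgnPat V lam w (lam ξ) (pat V y) := by
  have hξV : ξ ∈ insert ξ V := mem_insert_self _ _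
  have hs := sum_lam_ne_zero hlam hξV
  have hsh : ∀ x : ι → ℂ, ∀ j ∈ insert ξ V, shiftC V (x ξ) x j = x j - x ξ := fun x j hj => by
    rcases mem_insert.1 hj with rfl | hj
    · rw [shiftC_of_notMem hξ, sub_self]
    · rw [shiftC_of_mem hj]
  refine finsum_mem_eq_of_bijOn (fun x => shiftC V (x ξ) x) ⟨fun x hx => (shift_mem_RSol hξ hw hx).1,
    fun x hx x' hx' h => ?_, fun y hy => ?_⟩ fun x hx => sgn_insert hξ hw hx
  · dsimp only at h
    rw [← shiftC_wmean hs hx.2.2.2.1 hx.1 (hsh x), ← shiftC_wmean hs hx'.2.2.2.1 hx'.1 (hsh x'), h]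
  · refine ⟨_, recenter_mem_Sol hlam hξ hw hy, funext fun j => ?_⟩
    dsimp only
    by_cases hj : j ∈ V
    · rw [shiftC_of_mem hj, shiftC_of_mem hξV, shiftC_of_mem (mem_insert_of_mem hj),
        hy.1.1 ξ hξ]
      ring
    · rw [shiftC_of_notMem hj, hy.1.1 j hj]

theorem RSol_finite [Fintype ι] (hu0 : u ≠ 0) (hlam : ∀ k ∈ V, 1 ≤ lam k) {b : ℕ}
    (hw : ∀ j ∈ V, w ξ < w j) {Q} : (RSol V lam u b (fun j => w j - w ξ) Q 1).Finite :=
  (finite_solutions hu0 hlam one_pos fun j hj => by linarith [hw j hj]).subset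
    fun _ hx => ⟨hx.1, hx.2.1⟩

theorem sum_RSol_split [Fintype ι] (hu0 : u ≠ 0) (hlam : ∀ k ∈ V, 1 ≤ lam k) {b : ℕ}
    (hw : ∀ j ∈ V, w ξ < w j) (Q : (ι → ι → Prop) × (ι → Prop) → Prop) (f : (ι → ℂ) → ℤ) :
    ∑ᶠ y ∈ RSol V lam u b (fun j => w j - w ξ) (fun _ => True) 1, f y
      = ∑ᶠ y ∈ RSol V lam u b (fun j => w j - w ξ) Q 1, f y
        + ∑ᶠ y ∈ RSol V lam u b (fun j => w j - w ξ) (fun π => ¬ Q π) 1, f y := by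
  rw [← finsum_mem_union _ (RSol_finite hu0 hlam hw) (RSol_finite hu0 hlam hw)]
  · congr! 3 with y
    simp only [RSol, Set.mem_union, Set.mem_ofPred_eq]
    tauto
  · exact Set.disjoint_left.2 fun y h1 h2 => h2.2.2.2 h1.2.2.2

/-- The signed count of centered configurations. -/
def sCount (V : Finset ι) (lam : ι → ℕ) (w : ι → ℝ) (u : ℂ) : ℤ :=
  ∑ᶠ x ∈ Sol V lam u w, sgn V lam w x

theorem finsum_mem_mul_prod {α β : Type*} {s : Set α} {t : Set β} (hs : s.Finite) (ht : t.Finite)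
    (f : α → ℤ) (g : β → ℤ) (c : ℤ) :
    ∑ᶠ q ∈ s ×ˢ t, f q.1 * g q.2 * c = (∑ᶠ x ∈ s, f x) * (∑ᶠ y ∈ t, g y) * c := by
  rw [finsum_mem_eq_finite_toFinset_sum _ hs, finsum_mem_eq_finite_toFinset_sum _ ht,
    finsum_mem_eq_finite_toFinset_sum _ (hs.prod ht), sum_mul_sum, sum_mul]
  rw [← Set.Finite.toFinset_prod hs ht, sum_product]
  simp only [sum_mul]

theorem sum_RSol_eq_sum_split [Fintype ι] (hu0 : u ≠ 0) (hu : conj u = u)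
    (hlam : ∀ k ∈ V, 1 ≤ lam k) {ξ : ι} (hw : ∀ j ∈ V, w ξ < w j) {b : ℕ}
    {𝒜 : Finset (Finset ι)} (h𝒜 : ∀ A ∈ 𝒜, A ⊆ V) {a β : Finset ι → ℂ}
    (ha : ∀ A, (a A).im = 0 ∧ (a A).re < 0) (hβ : ∀ A, (β A).im = 0 ∧ 0 < (β A).re)
    (hE : ∀ A ∈ 𝒜, Eqs V lam u b (fun j => w j - w ξ) 0 (cfg V A (a A) (β A)))
    {Q : (ι → ι → Prop) × (ι → Prop) → Prop}
    (hex : ∀ p, NF V lam u b (fun j => w j - w ξ) 0 p → FReal V lam (fun j => w j - w ξ) p →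
      Q (patF V p) → ∃ A ∈ 𝒜, p.1 = cfg V A (a A) (β A))
    (hQ : ∀ A ∈ 𝒜, ∀ y, NF V lam u b (fun j => w j - w ξ) 0 (cfg V A (a A) (β A), y) →
      FReal V lam (fun j => w j - w ξ) (cfg V A (a A) (β A), y) →
      Q (patF V (cfg V A (a A) (β A), y))) :
    ∑ᶠ y ∈ RSol V lam u b (fun j => w j - w ξ) Q 1, sgnPat V lam w b (pat V y)
      = ∑ A ∈ 𝒜, sCount A lam w (u * a A ^ b * (a A - β A) ^ ∑ k ∈ V \ A, lam k)
        * sCount (V \ A) lam w (u * β A ^ b * (β A - a A) ^ ∑ k ∈ A, lam k)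
        * ((∏ j ∈ A, ∏ k ∈ V \ A, es lam w j k) * ((-1) ^ (b * A.card) *
          (-1) ^ ∑ k ∈ V \ A, lam k)) := by
  have hne : ∀ A, a A - β A ≠ 0 := fun A h => by
    have h1 := (ha A).2
    rw [sub_eq_zero.1 h] at h1
    exact lt_asymm h1 (hβ A).2
  have ha0 : ∀ A, a A ≠ 0 := fun A h => by
    have h1 := (ha A).2
    rw [h] at h1
    exact lt_irrefl _ h1
  have hβ0 : ∀ A, β A ≠ 0 := fun A h => by
    have h1 := (hβ A).2
    rw [h] at h1
    exact lt_irrefl _ h1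
  have hcong : ∀ (B : Finset ι) (v : ℂ), Sol B lam v (fun j => w j - w ξ) = Sol B lam v w :=
    fun B v => Sol_congr fun j _ k _ => by ring
  have hR := RLim_eq_biUnion h𝒜 ha hβ hE hex hQ
  simp only [hcong] at hR
  have hf1 : ∀ A ∈ 𝒜, (Sol A lam (u * a A ^ b * (a A - β A) ^ ∑ k ∈ V \ A, lam k) w).Finite :=
    fun A hA => Sol_finite (mul_ne_zero (mul_ne_zero hu0 (pow_ne_zero _ (ha0 A)))
      (pow_ne_zero _ (hne A))) fun k hk => hlam k (h𝒜 A hA hk)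
  have hf2 : ∀ A ∈ 𝒜, (Sol (V \ A) lam (u * β A ^ b * (β A - a A) ^ ∑ k ∈ A, lam k) w).Finite :=
    fun A _ => Sol_finite (mul_ne_zero (mul_ne_zero hu0 (pow_ne_zero _ (hβ0 A)))
      (pow_ne_zero _ (by rw [← neg_sub]; exact neg_ne_zero.2 (hne A))))
      fun k hk => hlam k (sdiff_subset hk)
  have hfin : (RLim V lam u b (fun j => w j - w ξ) Q 0).Finite := by
    rw [hR]
    exact 𝒜.finite_toSet.biUnion fun A hA => ((hf1 A hA).prod (hf2 A hA)).image _
  rw [sum_RSol_one hu0 hu hlam (fun j hj => sub_pos.2 (hw j hj)) hfin, hR,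
    finsum_mem_biUnion _ 𝒜.finite_toSet, finsum_mem_coe_finset]
  · refine sum_congr rfl fun A hA => ?_
    rw [finsum_mem_image]
    · rw [sCount, sCount, ← finsum_mem_mul_prod (hf1 A hA) (hf2 A hA)]
      exact finsum_mem_congr rfl fun q hq => sgnPat_cfg (h𝒜 A hA) (ha A) (hβ A) hq.1 hq.2
    · rintro ⟨y, z⟩ ⟨h1, h2⟩ ⟨y', z'⟩ ⟨h1', h2'⟩ h
      have h3 := (Prod.mk.inj h).2
      dsimp only at h1 h2 h1' h2' h3
      refine Prod.ext ?_ ?_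
      · rw [← ext0_add_left h1.1 h2.1, ← ext0_add_left h1'.1 h2'.1, h3]
      · rw [← ext0_add_right h1.1 h2.1, ← ext0_add_right h1'.1 h2'.1, h3]
  · exact fun A hA => ((hf1 A hA).prod (hf2 A hA)).image _
  · intro A hA A' hA' hAA'
    refine Set.disjoint_left.2 ?_
    rintro _ ⟨q, -, rfl⟩ ⟨q', -, h⟩
    refine hAA' ?_
    have h1 : cfg V A' (a A') (β A') = cfg V A (a A) (β A) := (Prod.mk.inj h).1
    have key : ∀ {B : Finset ι} (_ : B ∈ 𝒜) (j : ι), j ∈ B ↔ j ∈ V ∧ (cfg V B (a B) (β B) j).re < 0 := by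
      intro B hB j
      constructor
      · exact fun hj => ⟨h𝒜 B hB hj, by rw [cfg_of_mem hj]; exact (ha B).2⟩
      · rintro ⟨h2, h3⟩
        by_contra h4
        rw [cfg_of_mem_sdiff (mem_sdiff.2 ⟨h2, h4⟩)] at h3
        exact lt_asymm h3 (hβ B).2
    ext j
    rw [key hA, key hA', h1]

theorem prim_scale (x : ι → ℂ) (r z : ℂ) :
    (prim (wpoly V lam (fun j => r * x j) u b)).eval (r * z)
      = r ^ (1 + b + ∑ k ∈ V, lam k) * (prim (wpoly V lam x u b)).eval z := by
  have h := prim_frame (wpoly V lam (fun j => r * x j) u b) 0 r z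
  have h1 : (wpoly V lam (fun j => r * x j) u b).comp (C 0 + C r * X)
      = C (r ^ (b + ∑ k ∈ V, lam k)) * wpoly V lam x u b := by
    rw [wpoly, vprod, wpoly, vprod]
    simp only [mul_comp, C_comp, pow_comp, X_comp, Polynomial.prod_comp, sub_comp, C_0, zero_add]
    have h2 : ∏ k ∈ V, (C r * X - C (r * x k)) ^ lam k
        = C (r ^ ∑ k ∈ V, lam k) * ∏ k ∈ V, (X - C (x k)) ^ lam k := by
      rw [← prod_pow_eq_pow_sum, map_prod, ← prod_mul_distrib]
      refine prod_congr rfl fun k _ => ?_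
      rw [C_mul, ← mul_sub, mul_pow, C_pow]
    rw [h2, pow_add, C_mul, C_pow, mul_pow, C_pow]
    ring
  rw [zero_add, prim_eval_zero, sub_zero, h1, prim_C_mul, eval_mul, eval_C] at h
  rw [h]
  ring

theorem prim_C_scale (x : ι → ℂ) (c z : ℂ) :
    (prim (wpoly V lam x (c * u) b)).eval z = c * (prim (wpoly V lam x u b)).eval z := by
  rw [wpoly, C_mul, mul_assoc, mul_assoc, prim_C_mul, eval_mul, eval_C, ← mul_assoc, ← wpoly]

theorem IsRealC.smul {d : ι → ℝ} {x : ι → ℂ} (h : IsRealC V lam d x) (r : ℝ) :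
    IsRealC V lam d fun j => r * x j := fun j hj => by
  obtain ⟨k, hk, h1, h2⟩ := h j hj
  exact ⟨k, hk, by simp only [h1, map_mul, conj_ofReal], h2⟩

theorem sgn_smul (x : ι → ℂ) {r : ℝ} (hr : 0 < r) :
    sgn V lam w (fun j => r * x j) = sgn V lam w x := by
  unfold sgn
  simp only [re_ofReal_mul, im_ofReal_mul, mul_eq_zero, hr.ne', false_or,
    mul_lt_mul_iff_right₀ hr]

theorem pat_smul (x : ι → ℂ) {r : ℝ} (hr : 0 < r) :
    pat V (fun j => r * x j) = pat V x := by
  unfold pat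
  simp only [re_ofReal_mul, im_ofReal_mul, mul_eq_zero, hr.ne', false_or,
    mul_lt_mul_iff_right₀ hr, mul_neg_iff, hr, hr.not_gt, false_and, true_and, or_false]

theorem Sol_smul {r c : ℝ} (hr : 0 < r) (hrc : r ^ (1 + ∑ k ∈ V, lam k) * c = 1) {x : ι → ℂ}
    (hx : x ∈ Sol V lam u w) : (fun j => (r : ℂ) * x j) ∈ Sol V lam (c * u) w := by
  have hr0 : (r : ℂ) ≠ 0 := ofReal_ne_zero.2 hr.ne'
  obtain ⟨h1, h2, h3, h4, h5⟩ := hx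
  refine ⟨fun j hj => by simp only [h1 j hj, mul_zero], fun j hj k hk h => h2 hj hk (mul_left_cancel₀ hr0 h),
    h3.smul r, ?_, fun j hj k hk => ?_⟩
  · rw [← mul_zero (r : ℂ), ← h4, mul_sum]
    exact sum_congr rfl fun j _ => by ring
  · rw [← h5 j hj k hk]
    simp only [prim_C_scale, prim_scale]
    have h6 : (r : ℂ) ^ (1 + 0 + ∑ k ∈ V, lam k) * c = 1 := by
      rw [add_zero]; exact_mod_cast hrc
    linear_combination ((prim (wpoly V lam x u 0)).eval (x k)
      - (prim (wpoly V lam x u 0)).eval (x j)) * h6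

theorem sCount_scale {c : ℝ} (hc : 0 < c) : sCount V lam w (c * u) = sCount V lam w u := by
  have hN : 1 + ∑ k ∈ V, lam k ≠ 0 := by omega
  set r : ℝ := c⁻¹ ^ (((1 + ∑ k ∈ V, lam k : ℕ) : ℝ)⁻¹) with hr
  have hr0 : 0 < r := Real.rpow_pos_of_pos (inv_pos.2 hc) _
  have hrc : r ^ (1 + ∑ k ∈ V, lam k) * c = 1 := by
    rw [hr, Real.rpow_inv_natCast_pow (inv_pos.2 hc).le hN, inv_mul_cancel₀ hc.ne']
  have hrc' : r⁻¹ ^ (1 + ∑ k ∈ V, lam k) * c⁻¹ = 1 := by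
    rw [inv_pow, ← mul_inv, hrc, inv_one]
  refine (finsum_mem_eq_of_bijOn (fun (x : ι → ℂ) j => (r : ℂ) * x j) ⟨fun x hx => Sol_smul hr0 hrc hx,
    fun x _ y _ h => ?_, fun x hx => ?_⟩ fun x _ => (sgn_smul x hr0).symm).symm
  · exact funext fun j => mul_left_cancel₀ (ofReal_ne_zero.2 hr0.ne') (congrFun h j)
  · have h := Sol_smul (inv_pos.2 hr0) hrc' hx
    rw [← mul_assoc, ← ofReal_mul, inv_mul_cancel₀ hc.ne', ofReal_one, one_mul] at h
    refine ⟨_, h, funext fun j => ?_⟩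
    dsimp only
    rw [← mul_assoc, ← ofReal_mul, mul_inv_cancel₀ hr0.ne', ofReal_one, one_mul]

theorem sCount_of_pos {v : ℝ} (hv : 0 < v) : sCount V lam w v = sCount V lam w 1 := by
  rw [← sCount_scale (u := 1) hv, mul_one]

theorem sCount_of_neg {v : ℝ} (hv : v < 0) : sCount V lam w v = sCount V lam w (-1) := by
  rw [← sCount_scale (u := -1) (neg_pos.2 hv)]
  push_cast
  congr 1
  ring

theorem RSol_smul {d d' : ι → ℝ} {Q} {t t' r : ℝ} (hr : 0 < r)
    (h : ∀ j ∈ V, 1 + t' * (d' j - 1) = r ^ (1 + b + ∑ k ∈ V, lam k) * (1 + t * (d j - 1)))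
    (hd : ∀ j ∈ V, ∀ k ∈ V, d j = d k → d' j = d' k) {x : ι → ℂ}
    (hx : x ∈ RSol V lam u b d Q t) : (fun j => (r : ℂ) * x j) ∈ RSol V lam u b d' Q t' := by
  have hr0 : (r : ℂ) ≠ 0 := ofReal_ne_zero.2 hr.ne'
  obtain ⟨⟨h1, h5⟩, h2, h3, h4⟩ := hx
  refine ⟨⟨fun j hj => by simp only [h1 j hj, mul_zero], fun j hj => ?_⟩,
    fun j hj k hk h => h2 hj hk (mul_left_cancel₀ hr0 h), ?_, ?_⟩
  · rw [prim_scale, h5 j hj, h j hj]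
    push_cast
    rfl
  · intro j hj
    obtain ⟨k, hk, h6, h7, h8⟩ := h3.smul r j hj
    exact ⟨k, hk, h6, h7, hd k hk j hj h8⟩
  · rwa [pat_smul x hr]

/-- The number of solutions with a given pattern does not depend on the position of the
lowest level. -/
theorem sum_RSol_add [Fintype ι] (hu0 : u ≠ 0) (hu : conj u = u)
    (hlam : ∀ k ∈ V, 1 ≤ lam k) {d : ι → ℝ} (hd : ∀ j ∈ V, 0 < d j) {Q}
    {M : Type*} [AddCommMonoid M] (F : (ι → ι → Prop) × (ι → Prop) → M) {h : ℝ} (hh : 0 ≤ h) :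
    ∑ᶠ x ∈ RSol V lam u b (fun j => d j + h) Q 1, F (pat V x)
      = ∑ᶠ x ∈ RSol V lam u b d Q 1, F (pat V x) := by
  have h1 : 0 < 1 + h := by linarith
  rw [← sum_RSol_eq hu0 hu hlam hd Q F (inv_pos.2 h1) (inv_le_one_of_one_le₀ (by linarith))]
  have hN : 1 + b + ∑ k ∈ V, lam k ≠ 0 := by omega
  set r : ℝ := (1 + h) ^ (((1 + b + ∑ k ∈ V, lam k : ℕ) : ℝ)⁻¹) with hr
  have hr0 : 0 < r := Real.rpow_pos_of_pos h1 _
  have hrc : r ^ (1 + b + ∑ k ∈ V, lam k) = 1 + h := by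
    rw [hr, Real.rpow_inv_natCast_pow h1.le hN]
  have hrc' : r⁻¹ ^ (1 + b + ∑ k ∈ V, lam k) = (1 + h)⁻¹ := by rw [inv_pow, hrc]
  refine (finsum_mem_eq_of_bijOn (fun (x : ι → ℂ) j => (r : ℂ) * x j)
    ⟨fun x hx => RSol_smul hr0 (fun j _ => ?_) (fun j _ k _ h => ?_) hx,
    fun x _ y _ h => ?_, fun x hx => ?_⟩ fun x _ => by rw [pat_smul x hr0]).symm
  · rw [hrc]
    field_simp
    ring
  · rw [h]
  · exact funext fun j => mul_left_cancel₀ (ofReal_ne_zero.2 hr0.ne') (congrFun h j)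
  · refine ⟨fun j => ((r⁻¹ : ℝ) : ℂ) * x j, RSol_smul (inv_pos.2 hr0) (fun j _ => ?_)
      (fun j _ k _ h => add_right_cancel h) hx, funext fun j => ?_⟩
    · rw [hrc']
      field_simp
      ring
    · dsimp only
      rw [← mul_assoc, ← ofReal_mul, mul_inv_cancel₀ hr0.ne', ofReal_one, one_mul]

theorem vprod_const {x : ι → ℂ} {c : ℂ} (h : ∀ j ∈ V, x j = c) :
    vprod V lam x = (X - C c) ^ ∑ k ∈ V, lam k := by
  rw [vprod, ← prod_pow_eq_pow_sum]
  exact prod_congr rfl fun k hk => by rw [h k hk]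

theorem vprod_split (hA : A ⊆ V) {x : ι → ℂ} {a β : ℂ} (ha : ∀ j ∈ A, x j = a)
    (hβ : ∀ j ∈ V \ A, x j = β) :
    vprod V lam x = (X - C a) ^ (∑ k ∈ A, lam k) * (X - C β) ^ ∑ k ∈ V \ A, lam k := by
  rw [← vprod_const ha, ← vprod_const hβ, vprod, vprod, vprod, mul_comm, prod_sdiff hA]

theorem derivative_two (c a β : ℂ) (m n : ℕ) :
    derivative (C c * (X - C a) ^ (m + 1) * (X - C β) ^ (n + 1))
      = C c * ((X - C a) ^ m * (X - C β) ^ n *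
        (((m + 1 : ℕ) : ℂ[X]) * (X - C β) + ((n + 1 : ℕ) : ℂ[X]) * (X - C a))) := by
  simp only [derivative_mul, derivative_C, zero_mul, zero_add, derivative_X_sub_C_pow,
    Nat.add_sub_cancel]
  simp only [map_natCast]
  ring

theorem sum_eq_add_sdiff (hA : A ⊆ V) :
    ∑ k ∈ V, lam k = ∑ k ∈ A, lam k + ∑ k ∈ V \ A, lam k := by
  rw [add_comm, sum_sdiff hA]

theorem prim_of_two (hA : A ⊆ V) {x : ι → ℂ} {a β : ℂ} (ha : ∀ j ∈ A, x j = a)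
    (hβ : ∀ j ∈ V \ A, x j = β)
    (h0 : ((∑ k ∈ A, lam k + 1 : ℕ) : ℂ) * β + ((∑ k ∈ V \ A, lam k + 1 : ℕ) : ℂ) * a = 0)
    (h1 : u / ((∑ k ∈ V, lam k + 2 : ℕ) : ℂ) * (-a) ^ (∑ k ∈ A, lam k + 1) *
      (-β) ^ (∑ k ∈ V \ A, lam k + 1) = -1) :
    prim (wpoly V lam x u 1) = C (u / ((∑ k ∈ V, lam k + 2 : ℕ) : ℂ)) *
      (X - C a) ^ (∑ k ∈ A, lam k + 1) * (X - C β) ^ (∑ k ∈ V \ A, lam k + 1) + 1 := by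
  symm
  have hn := sum_eq_add_sdiff (lam := lam) hA
  have hn0 : ((∑ k ∈ V, lam k + 2 : ℕ) : ℂ) ≠ 0 := Nat.cast_ne_zero.2 (by omega)
  apply eq_prim
  · rw [derivative_add, derivative_one, add_zero, derivative_two, wpoly, vprod_split hA ha hβ]
    have h2 : ((∑ k ∈ A, lam k + 1 : ℕ) : ℂ[X]) * (X - C β)
        + ((∑ k ∈ V \ A, lam k + 1 : ℕ) : ℂ[X]) * (X - C a)
        = C ((∑ k ∈ V, lam k + 2 : ℕ) : ℂ) * X := by
      have h3 := congrArg C h0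
      simp only [C_add, C_mul, C_0, map_natCast] at h3
      rw [hn, map_natCast]
      push_cast at h3 ⊢
      linear_combination -h3
    rw [h2]
    have h4 : C u = C (u / ((∑ k ∈ V, lam k + 2 : ℕ) : ℂ)) * C ((∑ k ∈ V, lam k + 2 : ℕ) : ℂ) := by
      rw [← C_mul, div_mul_cancel₀ _ hn0]
    rw [h4]
    ring
  · simp only [eval_add, eval_mul, eval_C, eval_pow, eval_sub, eval_X, eval_one, zero_sub, h1]
    ring

/-- Conversely, a configuration with all critical values equal to one is of this form. -/
theorem exists_two_of_values_one (hu0 : u ≠ 0) {x : ι → ℂ}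
    (hx : ∀ j ∈ V, (prim (wpoly V lam x u 1)).eval (x j) = 1) (hx0 : ∀ j ∈ V, x j ≠ 0)
    {j0 : ι} (hj0 : j0 ∈ V) : ∃ A ⊆ V, j0 ∈ A ∧ ∃ β : ℂ, (∀ j ∈ A, x j = x j0) ∧
      (∀ j ∈ V \ A, x j = β) ∧
      ((∑ k ∈ A, lam k + 1 : ℕ) : ℂ) * β + ((∑ k ∈ V \ A, lam k + 1 : ℕ) : ℂ) * x j0 = 0 ∧
      u / ((∑ k ∈ V, lam k + 2 : ℕ) : ℂ) * (-x j0) ^ (∑ k ∈ A, lam k + 1) *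
        (-β) ^ (∑ k ∈ V \ A, lam k + 1) = -1 := by
  set R := prim (wpoly V lam x u 1) - 1 with hR
  set A := V.filter fun j => x j = x j0 with hAd
  have hA : A ⊆ V := filter_subset _ _
  have hn := sum_eq_add_sdiff (lam := lam) hA
  have hn0 : ((∑ k ∈ V, lam k + 2 : ℕ) : ℂ) ≠ 0 := Nat.cast_ne_zero.2 (by omega)
  have hRd : derivative R = wpoly V lam x u 1 := by
    rw [hR, derivative_sub, derivative_one, sub_zero, derivative_prim]
  have hRne : R ≠ 0 := fun h => wpoly_ne_zero hu0 (by rw [← hRd, h, derivative_zero])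
  have hdeg : R.natDegree ≤ ∑ k ∈ V, lam k + 2 := by
    refine (natDegree_sub_le _ _).trans (max_le ((natDegree_prim_le _).trans ?_) (by simp))
    have := natDegree_wpoly_le (V := V) (lam := lam) (x := x) (u := u) (b := 1)
    omega
  have hAx : ∀ j ∈ A, x j = x j0 := fun j hj => (mem_filter.1 hj).2
  have hdvd : ∀ j ∈ V, (X - C (x j)) ^ (∑ k ∈ V.filter (fun k => x k = x j), lam k + 1) ∣ R := by
    intro j hj
    refine pow_dvd_of_derivative (by simp [hR, hx j hj]) ?_
    rw [hRd, wpoly, vprod, ← prod_filter_mul_prod_filter_not V (fun k => x k = x j),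
      ← prod_pow_eq_pow_sum]
    refine Dvd.dvd.mul_left (Dvd.intro _ (congrArg₂ _ (prod_congr rfl fun k hk => ?_) rfl)) _
    rw [(mem_filter.1 hk).2]
  obtain ⟨β, hβ, c, hc⟩ : ∃ β : ℂ, (∀ j ∈ V \ A, x j = β) ∧ ∃ c : ℂ, R = C c *
      (X - C (x j0)) ^ (∑ k ∈ A, lam k + 1) * (X - C β) ^ (∑ k ∈ V \ A, lam k + 1) := by
    have hdeg2 : ∑ k ∈ V, lam k + 2 ≤ R.natDegree := by
      have h1 := natDegree_derivative_le R
      rw [hRd, natDegree_wpoly hu0] at h1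
      omega
    rcases (V \ A).eq_empty_or_nonempty with hB | ⟨j1, hj1⟩
    · obtain ⟨q, hq⟩ := hdvd j0 hj0
      rw [hB, sum_empty, add_zero] at hn
      have hq0 : q ≠ 0 := by rintro rfl; exact hRne (by rw [hq, mul_zero])
      have h1 : R.natDegree = ∑ k ∈ A, lam k + 1 + q.natDegree := by
        rw [hq, natDegree_mul (pow_ne_zero _ (X_sub_C_ne_zero _)) hq0, natDegree_pow,
          natDegree_X_sub_C, mul_one]
      have h2 : q.natDegree = 1 := by omega
      obtain ⟨c1, c0, rfl⟩ := exists_eq_X_add_C_of_natDegree_le_one h2.le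
      have hc1 : c1 ≠ 0 := by
        rintro rfl
        simp at h2
      refine ⟨-c0 / c1, fun j hj => by simp [hB] at hj, c1, ?_⟩
      have h3 : C c1 * C (-c0 / c1) = -C c0 := by rw [← C_mul, mul_div_cancel₀ _ hc1, C_neg]
      rw [hq, hB, sum_empty, zero_add, pow_one]
      linear_combination (X - C (x j0)) ^ (∑ k ∈ A, lam k + 1) * h3
    · obtain ⟨hj1V, hj1A⟩ := mem_sdiff.1 hj1
      have h01 : x j1 ≠ x j0 := fun h => hj1A (mem_filter.2 ⟨hj1V, h⟩)
      have hcard : (V.image x).card ≤ 2 := by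
        have h1 := sum_image_le (V := V) (lam := lam) (x := x) (b := 1) hu0 1 (V.image x) (by
          intro p hp
          obtain ⟨j, hj, rfl⟩ := mem_image.1 hp
          exact hx j hj)
        simp only [sum_add_distrib, sum_const, smul_eq_mul, mul_one] at h1
        rw [sum_fiberwise_of_maps_to fun j hj => mem_image_of_mem x hj] at h1
        omega
      have hB : ∀ j ∈ V \ A, x j = x j1 := by
        intro j hj
        obtain ⟨hjV, hjA⟩ := mem_sdiff.1 hj
        by_contra h
        refine absurd hcard (not_le.2 (two_lt_card.2 ⟨x j, mem_image_of_mem x hjV, x j1,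
          mem_image_of_mem x hj1V, x j0, mem_image_of_mem x hj0, h, fun h' => hjA
            (mem_filter.2 ⟨hjV, h'⟩), h01⟩))
      have hBA : V.filter (fun k => x k = x j1) = V \ A := by
        ext k
        constructor
        · intro hk
          obtain ⟨hk1, hk2⟩ := mem_filter.1 hk
          refine mem_sdiff.2 ⟨hk1, fun h => h01 ?_⟩
          rw [← hk2, hAx k h]
        · exact fun hk => mem_filter.2 ⟨(mem_sdiff.1 hk).1, hB k hk⟩
      have h2 := hdvd j1 hj1V
      rw [hBA] at h2
      obtain ⟨q, hq⟩ := (IsCoprime.pow (isCoprime_X_sub_C_of_isUnit_sub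
        (sub_ne_zero.2 h01.symm).isUnit)).mul_dvd (hdvd j0 hj0) h2
      have hq0 : q ≠ 0 := by rintro rfl; exact hRne (by rw [hq, mul_zero])
      have h1 : R.natDegree = ∑ k ∈ A, lam k + 1 + (∑ k ∈ V \ A, lam k + 1) + q.natDegree := by
        rw [hq, natDegree_mul (mul_ne_zero (pow_ne_zero _ (X_sub_C_ne_zero _))
          (pow_ne_zero _ (X_sub_C_ne_zero _))) hq0, natDegree_mul (pow_ne_zero _ (X_sub_C_ne_zero _))
          (pow_ne_zero _ (X_sub_C_ne_zero _)), natDegree_pow, natDegree_pow,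
          natDegree_X_sub_C, natDegree_X_sub_C, mul_one, mul_one]
      obtain ⟨c, hc⟩ := natDegree_eq_zero.1 (show q.natDegree = 0 by omega)
      exact ⟨x j1, hB, c, by rw [hq, ← hc]; ring⟩
  refine ⟨A, hA, mem_filter.2 ⟨hj0, rfl⟩, β, hAx, hβ, ?_⟩
  have hd := hRd
  rw [hc, derivative_two, wpoly, vprod_split hA hAx hβ] at hd
  have hcu : c = u / ((∑ k ∈ V, lam k + 2 : ℕ) : ℂ) := by
    have h1 : (X - C (x j0)) ^ (∑ k ∈ A, lam k) * (X - C β) ^ (∑ k ∈ V \ A, lam k) ≠ 0 :=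
      mul_ne_zero (pow_ne_zero _ (X_sub_C_ne_zero _)) (pow_ne_zero _ (X_sub_C_ne_zero _))
    have h2 : C c * (((∑ k ∈ A, lam k + 1 : ℕ) : ℂ[X]) * (X - C β)
        + ((∑ k ∈ V \ A, lam k + 1 : ℕ) : ℂ[X]) * (X - C (x j0))) = C u * X := by
      apply mul_left_cancel₀ h1
      linear_combination hd
    have h3 := congrArg (fun p => p.eval 1 - p.eval 0) h2
    simp only [eval_mul, eval_add, eval_sub, eval_C, eval_X, eval_natCast] at h3
    rw [eq_div_iff hn0, hn]
    push_cast at h3 ⊢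
    linear_combination h3
  have hR0 : R.eval 0 = -1 := by simp [hR, prim_eval_zero]
  have h5 : c * (-x j0) ^ (∑ k ∈ A, lam k + 1) * (-β) ^ (∑ k ∈ V \ A, lam k + 1) = -1 := by
    rw [← hR0, hc]
    simp
  refine ⟨?_, by rw [← hcu, h5]⟩
  have h6 : c ≠ 0 := by rintro rfl; simp at h5
  have h7 : β ≠ 0 := by rintro rfl; simp at h5
  have h8 := congrArg (eval 0) hd
  simp only [eval_mul, eval_add, eval_sub, eval_C, eval_X, eval_natCast, eval_pow, zero_sub,
    pow_one, mul_zero, zero_mul, mul_eq_zero, h6, false_or] at h8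
  rcases h8 with (h8 | h8) | h8
  · exact absurd (eq_zero_of_pow_eq_zero h8) (neg_ne_zero.2 (hx0 j0 hj0))
  · exact absurd (eq_zero_of_pow_eq_zero h8) (neg_ne_zero.2 h7)
  · linear_combination -h8

end

section

/-- The scale of the two roots in the limit. -/
def rad (v : ℝ) (m n : ℕ) : ℝ :=
  ((m + n + 2) / (|v| * ((m + 1) ^ (m + 1) * (n + 1) ^ (n + 1)))) ^ (((m + n + 2 : ℕ) : ℝ)⁻¹)

theorem rad_pos {v : ℝ} (hv : v ≠ 0) (m n : ℕ) : 0 < rad v m n := by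
  have := abs_pos.2 hv
  exact Real.rpow_pos_of_pos (by positivity) _

theorem rad_pow {v : ℝ} (hv : v ≠ 0) (m n : ℕ) :
    |v| * ((m + 1) ^ (m + 1) * (n + 1) ^ (n + 1)) * rad v m n ^ (m + n + 2) = m + n + 2 := by
  have := abs_pos.2 hv
  rw [rad, Real.rpow_inv_natCast_pow (by positivity) (by omega), mul_div_cancel₀]
  positivity

theorem neg_one_pow_cases (n : ℕ) : ((-1 : ℝ) ^ n = 1 ∧ Even n) ∨ ((-1 : ℝ) ^ n = -1 ∧ Odd n) := by
  rcases Nat.even_or_odd n with h | h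
  · exact Or.inl ⟨h.neg_one_pow, h⟩
  · exact Or.inr ⟨h.neg_one_pow, h⟩

theorem mul_neg_one_pow_of_odd {v : ℝ} {m n : ℕ} (hv : v * (-1) ^ (m + n) < 0) (hm : Odd m) :
    v * (-1) ^ (n + 1) = - |v| := by
  rw [pow_add, hm.neg_one_pow] at hv
  rw [pow_succ]
  rcases neg_one_pow_cases n with ⟨h, -⟩ | ⟨h, -⟩ <;> rw [h] at hv ⊢
  · rw [abs_of_pos (by linarith)]; ring
  · rw [abs_of_neg (by linarith)]; ring

theorem two_real_of {v a β : ℝ} {m n : ℕ} (hv0 : v ≠ 0) (ha : a < 0)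
    (h0 : ((m : ℝ) + 1) * β + (n + 1) * a = 0)
    (h1 : v / (m + n + 2) * (-a) ^ (m + 1) * (-β) ^ (n + 1) = -1) (hv : v * (-1) ^ (m + n) < 0) :
    Odd m ∧ a = -((m + 1) * rad v m n) ∧ β = (n + 1) * rad v m n := by
  have hm : (0 : ℝ) < m + 1 := by positivity
  have hn : (0 : ℝ) < n + 1 := by positivity
  obtain ⟨r, hr, hr0⟩ : ∃ r : ℝ, a = -((m + 1) * r) ∧ 0 < r :=
    ⟨-a / (m + 1), by field_simp, div_pos (by linarith) hm⟩
  have hβ : β = (n + 1) * r := by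
    apply mul_left_cancel₀ hm.ne'
    rw [hr] at h0
    linarith
  have h2 : v * (-1) ^ (n + 1) * ((m + 1) ^ (m + 1) * (n + 1) ^ (n + 1) * r ^ (m + n + 2))
      = -(m + n + 2) := by
    rw [hr, hβ, neg_neg, neg_eq_neg_one_mul ((n + 1) * r), mul_pow, mul_pow, mul_pow] at h1
    have h3 : (m : ℝ) + n + 2 ≠ 0 := by positivity
    field_simp at h1
    rw [show m + n + 2 = (m + 1) + (n + 1) by ring, pow_add r]
    linear_combination h1
  have h3 : 0 < (m + 1 : ℝ) ^ (m + 1) * (n + 1) ^ (n + 1) * r ^ (m + n + 2) := by positivity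
  have h4 : v * (-1) ^ (n + 1) < 0 := by
    have h5 : v * (-1) ^ (n + 1) * ((m + 1) ^ (m + 1) * (n + 1) ^ (n + 1) * r ^ (m + n + 2)) < 0 := by
      rw [h2]
      have : (0 : ℝ) < m + n + 2 := by positivity
      linarith
    exact neg_of_mul_neg_left h5 h3.le
  have hodd : Odd m := by
    rcases Nat.even_or_odd m with h | h
    · rw [pow_add, h.neg_one_pow, one_mul] at hv
      rw [pow_succ] at h4
      linarith
    · exact h
  have h5 : r = rad v m n := by
    have h6 := rad_pow hv0 m n
    rw [mul_neg_one_pow_of_odd hv hodd] at h2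
    have h7 : |v| * ((m + 1) ^ (m + 1) * (n + 1) ^ (n + 1)) ≠ 0 := by
      have := abs_pos.2 hv0
      positivity
    have h8 : r ^ (m + n + 2) = rad v m n ^ (m + n + 2) := by
      apply mul_left_cancel₀ h7
      rw [h6]
      linarith
    exact (pow_left_inj₀ hr0.le (rad_pos hv0 m n).le (by omega)).1 h8
  exact ⟨hodd, by rw [hr, h5], by rw [hβ, h5]⟩

theorem two_real {v : ℝ} {m n : ℕ} (hv0 : v ≠ 0) (hv : v * (-1) ^ (m + n) < 0) (hm : Odd m) :
    ((m : ℝ) + 1) * ((n + 1) * rad v m n) + (n + 1) * -((m + 1) * rad v m n) = 0 ∧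
      v / (m + n + 2) * (- -((m + 1) * rad v m n)) ^ (m + 1) * (-((n + 1) * rad v m n)) ^ (n + 1)
        = -1 := by
  refine ⟨by ring, ?_⟩
  have h6 := rad_pow hv0 m n
  have h7 := mul_neg_one_pow_of_odd hv hm
  rw [neg_neg, neg_eq_neg_one_mul ((n + 1) * rad v m n), mul_pow, mul_pow, mul_pow]
  rw [show m + n + 2 = (m + 1) + (n + 1) by ring, pow_add (rad v m n)] at h6
  have h3 : (m : ℝ) + n + 2 ≠ 0 := by positivity
  rw [div_mul_eq_mul_div, div_mul_eq_mul_div, div_eq_iff h3]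
  rw [← neg_eq_iff_eq_neg.2 h7] at h6
  linear_combination -h6

variable {ι : Type*} {V A : Finset ι} {lam : ι → ℕ} {v : ℝ} {w : ι → ℝ}

/-- Existence of real vertices. -/
def someReal (V : Finset ι) (π : (ι → ι → Prop) × (ι → Prop)) : Prop := ∃ j ∈ V, π.1 j j

theorem someReal_patF {p : (ι → ℂ) × (ι → ℂ)} : someReal V (patF V p) ↔ ∃ j ∈ V, ReF p j := by
  refine exists_congr fun j => and_congr_right fun hj => ?_
  simp only [patF, hj, true_and]
  tauto

theorem someReal_pat {x : ι → ℂ} : someReal V (pat V x) ↔ ∃ j ∈ V, (x j).im = 0 := by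
  refine exists_congr fun j => and_congr_right fun hj => ?_
  simp [pat, hj]

/-- A label preserving involution has a fixed point if the multiplicities have odd sum. -/
theorem LInv.exists_fixed {κ : ι → ι} (hκ : LInv V lam w κ) (hA : A ⊆ V)
    (hm : ∀ j ∈ A, κ j ∈ A) (hodd : Odd (∑ k ∈ A, lam k)) : ∃ j ∈ A, κ j = j := by
  by_contra! h
  have h1 : ((∑ k ∈ A, lam k : ℕ) : ZMod 2) = 0 := by
    rw [Nat.cast_sum]
    refine sum_involution (fun j _ => κ j) (fun j hj => ?_) (fun j hj _ => h j hj) hm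
      fun j hj => hκ.inv j (hA hj)
    rw [hκ.lam_eq j (hA hj)]
    exact CharTwo.add_self_eq_zero _
  rw [ZMod.natCast_eq_zero_iff_even] at h1
  exact (Nat.not_even_iff_odd.2 hodd) h1

theorem sum_RSol_simple [Fintype ι] (hv0 : v ≠ 0) (hv : v * (-1) ^ (∑ k ∈ V, lam k) < 0)
    (hlam : ∀ k ∈ V, 1 ≤ lam k) {ξ : ι} (hw : ∀ j ∈ V, w ξ < w j) :
    ∑ᶠ y ∈ RSol V lam v 1 (fun j => w j - w ξ) (someReal V) 1, sgnPat V lam w 1 (pat V y)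
      = ∑ A ∈ V.powerset with Odd (∑ k ∈ A, lam k), sCount A lam w (-1) * sCount (V \ A) lam w v
        * ((∏ j ∈ A, ∏ k ∈ V \ A, es lam w j k) * ((-1) ^ A.card * (-1) ^ ∑ k ∈ V \ A, lam k)) := by
  have hu0 : (v : ℂ) ≠ 0 := ofReal_ne_zero.2 hv0
  set m : Finset ι → ℕ := fun A => ∑ k ∈ A, lam k with hm
  set n : Finset ι → ℕ := fun A => ∑ k ∈ V \ A, lam k with hn
  have hmn : ∀ A ⊆ V, ∑ k ∈ V, lam k = m A + n A := fun A hA => sum_eq_add_sdiff hA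
  set a : Finset ι → ℝ := fun A => -((m A + 1) * rad v (m A) (n A)) with had
  set β : Finset ι → ℝ := fun A => (n A + 1) * rad v (m A) (n A) with hβd
  have ha : ∀ A, a A < 0 := fun A => neg_neg_of_pos (mul_pos (by positivity) (rad_pos hv0 _ _))
  have hβ : ∀ A, 0 < β A := fun A => mul_pos (by positivity) (rad_pos hv0 _ _)
  rw [sum_RSol_eq_sum_split hu0 (conj_ofReal v) hlam hw
    (𝒜 := V.powerset.filter fun A => Odd (∑ k ∈ A, lam k))
    (fun A hA => mem_powerset.1 (mem_filter.1 hA).1)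
    (a := fun A => (a A : ℂ)) (β := fun A => (β A : ℂ))
    (fun A => ⟨ofReal_im _, ha A⟩) (fun A => ⟨ofReal_im _, hβ A⟩)]
  · refine sum_congr rfl fun A hA => ?_
    obtain ⟨hA, hodd⟩ := mem_filter.1 hA
    have hAV := mem_powerset.1 hA
    have hv' := hv
    rw [hmn A hAV] at hv'
    have h1 := mul_neg_one_pow_of_odd hv' hodd
    have h2 : v * a A * (a A - β A) ^ n A < 0 := by
      have h3 : v * a A * (a A - β A) ^ n A
          = v * (-1) ^ (n A + 1) * (-a A * (β A - a A) ^ n A) := by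
        rw [← neg_sub (β A), neg_eq_neg_one_mul (β A - a A), mul_pow, pow_succ]
        ring
      rw [h3, h1, neg_mul, neg_lt_zero]
      have h4 := ha A
      have h5 := hβ A
      exact mul_pos (abs_pos.2 hv0) (mul_pos (by linarith) (pow_pos (by linarith) _))
    have h3 : sCount A lam w ((v : ℂ) * (a A : ℂ) ^ 1 * ((a A : ℂ) - (β A : ℂ)) ^ n A)
        = sCount A lam w (-1) := by
      rw [← sCount_of_neg h2]
      push_cast
      rw [pow_one]
    have h4 : sCount (V \ A) lam w ((v : ℂ) * (β A : ℂ) ^ 1 * ((β A : ℂ) - (a A : ℂ)) ^ m A)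
        = sCount (V \ A) lam w v := by
      have h5 : 0 < β A * (β A - a A) ^ m A := by
        have h4 := ha A
        have h5 := hβ A
        exact mul_pos h5 (pow_pos (by linarith) _)
      rw [← sCount_scale (u := (v : ℂ)) h5]
      push_cast
      congr 1
      ring
    rw [h3, h4, one_mul]
  · intro A hA
    obtain ⟨hA, hodd⟩ := mem_filter.1 hA
    have hAV := mem_powerset.1 hA
    have hv' := hv
    rw [hmn A hAV] at hv'
    obtain ⟨h1, h2⟩ := two_real hv0 hv' hodd
    refine ⟨fun j hj => ?_, fun j hj => ?_⟩
    · rw [cfg, if_neg fun h => hj (hAV h), if_neg hj]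
    · rw [prim_of_two hAV (fun j hj => cfg_of_mem hj) (fun j hj => cfg_of_mem_sdiff hj)]
      · simp only [eval_add, eval_mul, eval_C, eval_pow, eval_sub, eval_X, eval_one]
        by_cases hjA : j ∈ A
        · simp [cfg_of_mem hjA]
        · simp [cfg_of_mem_sdiff (mem_sdiff.2 ⟨hj, hjA⟩)]
      · have h3 : ((m A : ℝ) + 1) * β A + (n A + 1) * a A = 0 := h1
        exact_mod_cast h3
      · have h3 : v / (m A + n A + 2) * (-a A) ^ (m A + 1) * (-β A) ^ (n A + 1) = -1 := h2
        rw [hmn A hAV]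
        change (v : ℂ) / ((m A + n A + 2 : ℕ) : ℂ) * (-(a A : ℂ)) ^ (m A + 1)
          * (-(β A : ℂ)) ^ (n A + 1) = -1
        exact_mod_cast h3
  · intro p hp hr hQ
    obtain ⟨j0, hj0, hj0r⟩ := someReal_patF.1 hQ
    obtain ⟨A, hAV, hjA, c, hA1, hA2, h0, h1⟩ := exists_two_of_values_one hu0
      (fun j hj => by simpa using hp.base.eqs.2 j hj) hp.base.ne_zero hj0
    obtain ⟨r, hr⟩ : ∃ r : ℝ, p.1 j0 = r := ⟨_, (conj_eq_iff_real.1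
      (conj_eq_iff_im.2 hj0r.1)).choose_spec⟩
    obtain ⟨c, rfl⟩ : ∃ c' : ℝ, c = c' := by
      refine ⟨-((n A + 1) * r / (m A + 1)), ?_⟩
      have h2 : (m A + 1 : ℂ) ≠ 0 := by exact_mod_cast Nat.succ_ne_zero (m A)
      rw [hr] at h0
      have h3 : ((m A : ℂ) + 1) * c + (n A + 1) * r = 0 := by exact_mod_cast h0
      rw [ofReal_neg, ofReal_div, ← neg_eq_iff_eq_neg, eq_div_iff]
      · rw [ofReal_mul, ofReal_add, ofReal_add, ofReal_natCast,
          ofReal_natCast, ofReal_one]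
        linear_combination -h3
      · exact_mod_cast Nat.succ_ne_zero (m A)
    rw [hr] at h0 h1 hA1
    have hv' := hv
    rw [hmn A hAV] at hv'
    have h0' : ((m A : ℝ) + 1) * c + (n A + 1) * r = 0 := by
      exact_mod_cast h0
    have h1' : v / (m A + n A + 2) * (-r) ^ (m A + 1) * (-c) ^ (n A + 1) = -1 := by
      rw [hmn A hAV] at h1
      exact_mod_cast h1
    have hr0 : r ≠ 0 := by
      rintro rfl
      exact hp.base.ne_zero j0 hj0 (by rw [hr, ofReal_zero])
    rcases hr0.lt_or_gt with hneg | hpos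
    · obtain ⟨h2, h3, h4⟩ := two_real_of hv0 hneg h0' h1' hv'
      refine ⟨A, mem_filter.2 ⟨mem_powerset.2 hAV, h2⟩, funext fun j => ?_⟩
      by_cases hj : j ∈ A
      · rw [cfg_of_mem hj, hA1 j hj, h3]
      · by_cases hjV : j ∈ V
        · rw [cfg_of_mem_sdiff (mem_sdiff.2 ⟨hjV, hj⟩),
            hA2 j (mem_sdiff.2 ⟨hjV, hj⟩), h4]
        · rw [hp.base.eqs.1 j hjV, cfg, if_neg hj, if_neg hjV]
    · have hc : c < 0 := by
        have h5 : ((m A : ℝ) + 1) * c = -((n A + 1) * r) := by linarith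
        have h6 : ((m A : ℝ) + 1) * c < 0 := by
          rw [h5]
          exact neg_neg_of_pos (mul_pos (by positivity) hpos)
        exact neg_of_mul_neg_right h6 (by positivity)
      have hm' : m (V \ A) = n A := rfl
      have hn' : n (V \ A) = m A := by rw [hn, hm]; simp only [Finset.sdiff_sdiff_eq_self hAV]
      obtain ⟨h2, h3, h4⟩ := two_real_of (m := n A) (n := m A) (β := r) hv0 hc
        (by linarith) (by rw [← h1', add_comm (m A : ℝ)]; ring) (by rwa [add_comm])
      refine ⟨V \ A, mem_filter.2 ⟨mem_powerset.2 sdiff_subset, h2⟩,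
        funext fun j => ?_⟩
      have h5 : a (V \ A) = c := by
        simp only [had]
        rw [hm', hn', h3]
      have h6 : β (V \ A) = r := by
        simp only [hβd]
        rw [hm', hn', h4]
      rw [h5, h6]
      by_cases hj : j ∈ V \ A
      · rw [cfg_of_mem hj, hA2 j hj]
      · by_cases hjV : j ∈ V
        · rw [cfg_of_mem_sdiff (mem_sdiff.2 ⟨hjV, hj⟩), hA1 j]
          by_contra h7
          exact hj (mem_sdiff.2 ⟨hjV, h7⟩)
        · rw [hp.base.eqs.1 j hjV, cfg, if_neg hj, if_neg hjV]
  · intro A hA y hy hr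
    obtain ⟨hA, hodd⟩ := mem_filter.1 hA
    have hAV := mem_powerset.1 hA
    obtain ⟨κ, hκ, hx⟩ := hr.exists_inv hy
    dsimp only at hx
    have hab : (β A : ℂ) ≠ (a A : ℂ) := fun h => by
      have := ofReal_injective h
      linarith [ha A, hβ A]
    obtain ⟨j, hj, hκj⟩ := hκ.exists_fixed hAV (fun j hj => by
      by_contra h
      have h1 := (hx j (hAV hj)).1
      rw [cfg_of_mem hj, cfg_of_mem_sdiff (mem_sdiff.2 ⟨hκ.mem j (hAV hj), h⟩),
        conj_ofReal] at h1
      exact hab h1) hodd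
    have h1 := hx j (hAV hj)
    rw [hκj] at h1
    exact someReal_patF.2 ⟨j, hAV hj, conj_eq_iff_im.1 h1.1.symm,
      conj_eq_iff_im.1 h1.2.symm⟩

variable {B : Finset ι} {u : ℂ} {b : ℕ} {d : ι → ℝ} {ξ : ι}

/-- The total twist between two sets of labels. -/
def twist (lam : ι → ℕ) (w : ι → ℝ) (A B : Finset ι) : ℤ :=
  ∏ j ∈ A, ∏ k ∈ B, tw lam w j k

theorem prod_es : ∏ j ∈ A, ∏ k ∈ B, es lam w j k
    = ((-1) ^ ∑ k ∈ B, lam k) ^ A.card * twist lam w A B := by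
  simp only [es, twist, prod_mul_distrib, prod_pow_eq_pow_sum, sum_const,
    smul_eq_mul]
  rw [mul_comm A.card, pow_mul]

/-- Every pair consisting of a level and a multiplicity is taken by an even number of labels. -/
def Doubled (V : Finset ι) (lam : ι → ℕ) (w : ι → ℝ) : Prop :=
  ∀ a : ℕ, ∀ r : ℝ, Even (V.filter fun j => lam j = a ∧ w j = r).card

theorem prod_eq_one_of_doubled (h : Doubled V lam w) {f : ι → ℤ} (hf : ∀ j, f j * f j = 1)
    (hc : ∀ j k, lam j = lam k → w j = w k → f j = f k) : ∏ j ∈ V, f j = 1 := by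
  rw [← prod_fiberwise_of_maps_to (g := fun j => (lam j, w j))
    (t := V.image fun j => (lam j, w j)) fun j hj => mem_image_of_mem _ hj]
  refine prod_eq_one fun p hp => ?_
  obtain ⟨k, hk, rfl⟩ := mem_image.1 hp
  have h1 : ∀ j ∈ V.filter (fun j => (lam j, w j) = (lam k, w k)), f j = f k := fun j hj => by
    have := (mem_filter.1 hj).2
    simp only [Prod.mk.injEq] at this
    exact hc j k this.1 this.2
  rw [prod_congr rfl h1, prod_const]
  obtain ⟨n, hn⟩ := h (lam k) (w k)
  simp only [Prod.mk.injEq]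
  rw [hn, pow_add, ← mul_pow, hf, one_pow]

theorem twist_of_doubled_left (h : Doubled A lam w) : twist lam w A B = 1 :=
  prod_eq_one_of_doubled h (fun j => by
    rw [← prod_mul_distrib]
    exact prod_eq_one fun k _ => tw_mul_self j k) fun j k h1 h2 => by simp [tw, h1, h2]

theorem twist_of_doubled_right (h : Doubled B lam w) : twist lam w A B = 1 := by
  rw [twist, Finset.prod_comm]
  exact prod_eq_one_of_doubled h (fun j => by
    rw [← prod_mul_distrib]
    exact prod_eq_one fun k _ => tw_mul_self k j) fun j k h1 h2 => by simp [tw, h1, h2]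

theorem Doubled.even_card (h : Doubled V lam w) : Even V.card := by
  have := prod_eq_one_of_doubled h (f := fun _ => -1) (by simp) (by simp)
  rw [prod_const] at this
  exact (neg_one_pow_eq_one_iff_even (by norm_num)).1 this

theorem LInv.doubled {κ : ι → ι} (hκ : LInv V lam w κ) (h : ∀ j ∈ V, κ j ≠ j) :
    Doubled V lam w := by
  intro a r
  rw [← ZMod.natCast_eq_zero_iff_even, card_eq_sum_ones, Nat.cast_sum]
  refine sum_involution (fun j _ => κ j) (fun j hj => by decide)
    (fun j hj _ => h j (mem_filter.1 hj).1) (fun j hj => ?_)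
    fun j hj => hκ.inv j (mem_filter.1 hj).1
  obtain ⟨h1, h2, h3⟩ := mem_filter.1 hj
  exact mem_filter.2 ⟨hκ.mem j h1, by rw [hκ.lam_eq j h1, h2], by rw [hκ.d_eq j h1, h3]⟩

/-- The number of configurations without real vertices. -/
def kCount (V : Finset ι) (lam : ι → ℕ) (d : ι → ℝ) : ℤ :=
  ∑ᶠ _y ∈ RSol V lam (-1) 1 d (fun π => ¬ someReal V π) 1, 1

theorem RSol.exists_inv {Q} {x : ι → ℂ} (hx : x ∈ RSol V lam u b d Q 1)
    (hQ : ¬ someReal V (pat V x)) :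
    ∃ κ, LInv V lam d κ ∧ (∀ j ∈ V, κ j ≠ j) ∧ ∀ j ∈ V, x (κ j) = conj (x j) := by
  obtain ⟨κ, hκ, h⟩ := hx.2.2.1.exists_inv hx.2.1
  refine ⟨κ, hκ, fun j hj hf => hQ (someReal_pat.2 ⟨j, hj, ?_⟩), h⟩
  have := h j hj
  rw [hf] at this
  exact conj_eq_iff_im.1 this.symm

theorem doubled_of_kCount_ne_zero (h : kCount V lam d ≠ 0) : Doubled V lam d := by
  by_contra hd
  refine h (finsum_mem_eq_zero_of_forall_eq_zero fun x hx => ?_)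
  obtain ⟨κ, hκ, hf, -⟩ := RSol.exists_inv hx hx.2.2.2
  exact absurd (hκ.doubled hf) hd

theorem Doubled.congr_sub {c : ℝ} (h : Doubled V lam (fun j => w j - c)) : Doubled V lam w := by
  intro a r
  have := h a (r - c)
  simpa only [sub_left_inj] using this

theorem kCount_shift [Fintype ι] (hlam : ∀ k ∈ V, 1 ≤ lam k) {c c' : ℝ} (hc : ∀ j ∈ V, c < w j)
    (h : c' ≤ c) : kCount V lam (fun j => w j - c') = kCount V lam (fun j => w j - c) := by
  have := sum_RSol_add (u := (-1 : ℂ)) (b := 1) (by simp) (by simp) hlam (d := fun j => w j - c)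
    (fun j hj => sub_pos.2 (hc j hj)) (Q := fun π => ¬ someReal V π) (fun _ => (1 : ℤ))
    (h := c - c') (by linarith)
  rw [kCount, kCount, ← this]
  simp only [sub_add_sub_cancel]

theorem sgnPat_of_not_someReal {x : ι → ℂ} (h : ¬ someReal V (pat V x)) :
    sgnPat V lam w b (pat V x) = 1 := by
  rw [someReal_pat] at h
  push Not at h
  rw [sgnPat, prod_eq_one, prod_eq_one, one_mul]
  · exact fun j hj => if_neg fun h1 => h j hj (by simpa [pat, hj] using h1)
  · refine fun j hj => prod_eq_one fun k hk => if_neg fun h1 => h j hj ?_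
    have := h1.2
    simp only [pat] at this
    tauto

/-- The signed count with reversed leading coefficient, up to sign. -/
def tNum (lam : ι → ℕ) (w : ι → ℝ) (V : Finset ι) : ℤ :=
  if Odd (∑ k ∈ V, lam k) then (-1) ^ V.card * sCount V lam w (-1) else 0

/-- The signed count of odd degree. -/
def uNum (lam : ι → ℕ) (w : ι → ℝ) (V : Finset ι) : ℤ :=
  if Even (∑ k ∈ V, lam k) then sCount V lam w 1 else 0

theorem not_mem_RSol_of_odd (ho : Odd (∑ k ∈ V, lam k)) {x : ι → ℂ} {u : ℂ} :
    x ∉ RSol V lam u 1 d (fun π => ¬ someReal V π) 1 := fun hx => by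
  obtain ⟨κ, hκ, hf, -⟩ := RSol.exists_inv hx hx.2.2.2
  obtain ⟨j, hj, h⟩ := hκ.exists_fixed subset_rfl hκ.mem ho
  exact hf j hj h

theorem uNum_insert [Fintype ι] (hlam : ∀ k ∈ V, 1 ≤ lam k) (hξ : ξ ∉ V) (h1 : lam ξ = 1)
    (hw : ∀ j ∈ V, w ξ < w j) : uNum lam w (insert ξ V)
      = ∑ A ∈ V.powerset, twist lam w A (V \ A) * (tNum lam w A * uNum lam w (V \ A)) := by
  have hlam' : ∀ k ∈ insert ξ V, 1 ≤ lam k := by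
    simpa [h1] using hlam
  rw [uNum, sum_insert hξ, h1]
  split_ifs with he
  · have ho : Odd (∑ k ∈ V, lam k) := by
      rw [add_comm] at he
      exact Nat.not_even_iff_odd.1 fun h => Nat.even_add_one.1 he h
    have key := sum_RSol_simple (v := 1) one_ne_zero (by rw [ho.neg_one_pow]; norm_num) hlam hw
    rw [ofReal_one] at key
    rw [sCount, sum_Sol_insert hlam' hξ hw, h1, sum_RSol_split one_ne_zero hlam hw (someReal V),
      key, finsum_mem_eq_zero_of_forall_eq_zero (s := RSol V lam 1 1 _ (fun π => ¬ someReal V π) 1),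
      add_zero, sum_filter]
    · refine sum_congr rfl fun A hA => ?_
      split_ifs with hA'
      · have hB : Even (∑ k ∈ V \ A, lam k) := by
          rw [sum_eq_add_sdiff (mem_powerset.1 hA)] at ho
          exact (Nat.odd_add.1 ho).1 hA'
        rw [tNum, if_pos hA', uNum, if_pos hB, prod_es, hB.neg_one_pow, one_pow]
        ring
      · rw [tNum, if_neg hA', zero_mul, mul_zero]
    · exact fun x hx => (not_mem_RSol_of_odd ho hx).elim
  · refine (sum_eq_zero fun A hA => ?_).symm
    rw [tNum, uNum]
    split_ifs with hA' hB
    · refine absurd ?_ he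
      rw [sum_eq_add_sdiff (mem_powerset.1 hA), add_comm, Nat.even_add_one, Nat.not_even_iff_odd]
      exact hA'.add_even hB
    all_goals simp

theorem tNum_insert [Fintype ι] (hlam : ∀ k ∈ V, 1 ≤ lam k) (hξ : ξ ∉ V) (h1 : lam ξ = 1)
    (hw : ∀ j ∈ V, w ξ < w j) : tNum lam w (insert ξ V)
      = ∑ A ∈ V.powerset, twist lam w A (V \ A) * (tNum lam w A * tNum lam w (V \ A))
        - kCount V lam (fun j => w j - w ξ) := by
  have hlam' : ∀ k ∈ insert ξ V, 1 ≤ lam k := by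
    simpa [h1] using hlam
  have hne : (-1 : ℂ) ≠ 0 := by simp
  rw [tNum, sum_insert hξ, h1]
  split_ifs with he
  · have ho : Even (∑ k ∈ V, lam k) := by
      rw [add_comm] at he
      exact Nat.not_odd_iff_even.1 fun h => Nat.not_even_iff_odd.2 he h.add_one
    have key := sum_RSol_simple (v := -1) (by norm_num) (by rw [ho.neg_one_pow]; norm_num) hlam hw
    rw [ofReal_neg, ofReal_one] at key
    have hK : ∑ᶠ y ∈ RSol V lam (-1) 1 (fun j => w j - w ξ) (fun π => ¬ someReal V π) 1,
        sgnPat V lam w 1 (pat V y) = kCount V lam (fun j => w j - w ξ) :=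
      finsum_mem_congr rfl fun x hx => sgnPat_of_not_someReal hx.2.2.2
    have hK' : (-1) ^ V.card * kCount V lam (fun j => w j - w ξ)
        = kCount V lam (fun j => w j - w ξ) := by
      by_cases h : kCount V lam (fun j => w j - w ξ) = 0
      · rw [h, mul_zero]
      · rw [(doubled_of_kCount_ne_zero h).even_card.neg_one_pow, one_mul]
    rw [sCount, sum_Sol_insert hlam' hξ hw, h1, sum_RSol_split hne hlam hw (someReal V),
      key, hK, card_insert_of_notMem hξ, pow_succ, sum_filter]
    have hS : (-1) ^ V.card * ∑ A ∈ V.powerset, (if Odd (∑ k ∈ A, lam k) then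
        sCount A lam w (-1) * sCount (V \ A) lam w (-1) * ((∏ j ∈ A, ∏ k ∈ V \ A, es lam w j k)
          * ((-1) ^ A.card * (-1) ^ ∑ k ∈ V \ A, lam k)) else 0)
        = - ∑ A ∈ V.powerset, twist lam w A (V \ A) * (tNum lam w A * tNum lam w (V \ A)) := by
      rw [mul_sum, ← sum_neg_distrib]
      refine sum_congr rfl fun A hA => ?_
      split_ifs with hA'
      · have hB : Odd (∑ k ∈ V \ A, lam k) := by
          rw [sum_eq_add_sdiff (mem_powerset.1 hA)] at ho
          exact Nat.not_even_iff_odd.1 fun h => Nat.not_even_iff_odd.2 hA' ((Nat.even_add.1 ho).2 h)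
        have hc : V.card = A.card + (V \ A).card := by
          rw [add_comm, card_sdiff_add_card_eq_card (mem_powerset.1 hA)]
        have h2 : ((-1 : ℤ) ^ A.card) * (-1) ^ A.card = 1 := by rw [← mul_pow]; simp
        rw [tNum, if_pos hA', tNum, if_pos hB, prod_es, hB.neg_one_pow, hc, pow_add]
        linear_combination (-(-1) ^ A.card * (-1) ^ (V \ A).card * sCount A lam w (-1)
          * sCount (V \ A) lam w (-1) * twist lam w A (V \ A)) * h2
      · rw [tNum, if_neg hA', zero_mul, mul_zero, mul_zero, neg_zero]
    rw [mul_add, mul_comm ((-1) ^ V.card), mul_assoc, hS, mul_assoc, hK']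
    ring
  · have ho : Odd (∑ k ∈ V, lam k) := by
      rw [add_comm] at he
      exact Nat.not_even_iff_odd.1 fun h => he h.add_one
    rw [sum_eq_zero fun A hA => ?_, zero_sub, eq_comm, neg_eq_zero]
    · exact finsum_mem_eq_zero_of_forall_eq_zero fun x hx => (not_mem_RSol_of_odd ho hx).elim
    · rw [tNum, tNum]
      split_ifs with hA' hB
      · rw [sum_eq_add_sdiff (mem_powerset.1 hA)] at ho
        exact absurd (hA'.add_odd hB) (Nat.not_even_iff_odd.2 ho)
      all_goals simp

variable {r : ι → ℝ} {α β : ℝ}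

theorem eval_wpoly_real (t : ℝ) :
    (wpoly V lam (fun j => (r j : ℂ)) v b).eval (t : ℂ)
      = ((v * t ^ b * ∏ k ∈ V, (t - r k) ^ lam k : ℝ) : ℂ) := by
  rw [eval_wpoly]
  push_cast
  rfl

theorem prim_wpoly_real (t : ℝ) :
    ((prim (wpoly V lam (fun j => (r j : ℂ)) v b)).eval (t : ℂ)).im = 0 := by
  have h : pconj (wpoly V lam (fun j => (r j : ℂ)) v b) = wpoly V lam (fun j => (r j : ℂ)) v b := by
    simp [pconj, wpoly, vprod, Polynomial.map_prod]
  rw [← conj_eq_iff_im, ← eval_pconj, pconj_prim, h, conj_ofReal]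

theorem prim_lt (hv : v ≠ 0) (hab : α < β)
    (h : ∀ t ∈ Set.Ioo α β, 0 ≤ v * t ^ b * ∏ k ∈ V, (t - r k) ^ lam k) :
    ((prim (wpoly V lam (fun j => (r j : ℂ)) v b)).eval (α : ℂ)).re
      < ((prim (wpoly V lam (fun j => (r j : ℂ)) v b)).eval (β : ℂ)).re := by
  set p := wpoly V lam (fun j => (r j : ℂ)) v b with hp
  set g : ℝ → ℝ := fun t => ((prim p).eval (t : ℂ)).re with hg
  have hd : ∀ t : ℝ, HasDerivAt g (v * t ^ b * ∏ k ∈ V, (t - r k) ^ lam k) t := fun t => by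
    have h1 := ((prim p).hasDerivAt (t : ℂ)).real_of_complex
    rwa [derivative_prim, hp, eval_wpoly_real, ofReal_re] at h1
  have hmono : MonotoneOn g (Set.Icc α β) := by
    refine monotoneOn_of_deriv_nonneg (convex_Icc α β)
      (fun t _ => (hd t).continuousAt.continuousWithinAt)
      (fun t _ => (hd t).differentiableAt.differentiableWithinAt) fun t ht => ?_
    rw [interior_Icc] at ht
    rw [(hd t).deriv]
    exact h t ht
  refine (hmono ⟨le_rfl, hab.le⟩ ⟨hab.le, le_rfl⟩ hab.le).lt_of_ne fun heq => ?_
  have hp0 : p = 0 := by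
    refine eq_zero_of_infinite_isRoot _ (Set.Infinite.mono (s := (fun t : ℝ => (t : ℂ)) '' Set.Ioo α β)
      ?_ ((Set.Ioo_infinite hab).image ofReal_injective.injOn))
    rintro _ ⟨t, ht, rfl⟩
    have h2 : g =ᶠ[𝓝 t] fun _ => g α := by
      filter_upwards [Icc_mem_nhds ht.1 ht.2] with s hs
      exact le_antisymm (heq ▸ hmono hs ⟨hab.le, le_rfl⟩ hs.2) (hmono ⟨le_rfl, hab.le⟩ hs hs.1)
    have h3 := (hd t).unique ((hasDerivAt_const t (g α)).congr_of_eventuallyEq h2)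
    change p.eval (t : ℂ) = 0
    rw [hp, eval_wpoly_real, h3, ofReal_zero]
  exact wpoly_ne_zero (ofReal_ne_zero.2 hv) hp0

theorem prim_lt_of_even (hb : Even b) (h : ∀ k ∈ V, Even (lam k)) (hab : α < β) :
    ((prim (wpoly V lam (fun j => (r j : ℂ)) (1 : ℝ) b)).eval (α : ℂ)).re
      < ((prim (wpoly V lam (fun j => (r j : ℂ)) (1 : ℝ) b)).eval (β : ℂ)).re :=
  prim_lt one_ne_zero hab fun t _ => by
    rw [one_mul]
    exact mul_nonneg (hb.pow_nonneg t) (prod_nonneg fun k hk => (h k hk).pow_nonneg _)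

theorem prim_lt_of_le {k : ι} (hb : Even b) (hk : k ∈ V) (h : ∀ j ∈ V, j ≠ k → Even (lam j))
    (hab : α < β) (hβ : β ≤ r k) (ho : Odd (lam k)) :
    ((prim (wpoly V lam (fun j => (r j : ℂ)) (-1 : ℝ) b)).eval (α : ℂ)).re
      < ((prim (wpoly V lam (fun j => (r j : ℂ)) (-1 : ℝ) b)).eval (β : ℂ)).re :=
  prim_lt (by norm_num) hab fun t ht => by
    rw [← mul_prod_erase V _ hk]
    have h1 := prod_nonneg (s := V.erase k) (f := fun j => (t - r j) ^ lam j) fun j hj =>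
      (h j (mem_of_mem_erase hj) (ne_of_mem_erase hj)).pow_nonneg _
    have h2 : (t - r k) ^ lam k ≤ 0 := ho.pow_nonpos (by linarith [ht.2])
    have h3 := mul_nonneg (mul_nonneg (hb.pow_nonneg t) (neg_nonneg.2 h2)) h1
    linarith

theorem lt_prim_of_le {k : ι} (hb : Even b) (hk : k ∈ V) (h : ∀ j ∈ V, j ≠ k → Even (lam j))
    (hab : α < β) (hα : r k ≤ α) :
    ((prim (wpoly V lam (fun j => (r j : ℂ)) (-1 : ℝ) b)).eval (β : ℂ)).re
      < ((prim (wpoly V lam (fun j => (r j : ℂ)) (-1 : ℝ) b)).eval (α : ℂ)).re := by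
  have key := prim_lt (V := V) (lam := lam) (r := r) (b := b) one_ne_zero hab fun t ht => by
    rw [← mul_prod_erase V _ hk]
    have h1 := prod_nonneg (s := V.erase k) (f := fun j => (t - r j) ^ lam j) fun j hj =>
      (h j (mem_of_mem_erase hj) (ne_of_mem_erase hj)).pow_nonneg _
    have h2 : 0 ≤ (t - r k) ^ lam k := pow_nonneg (by linarith [ht.1]) _
    have h3 := mul_nonneg (mul_nonneg (hb.pow_nonneg t) h2) h1
    linarith
  have hneg : wpoly V lam (fun j => (r j : ℂ)) (-1 : ℝ) b
      = - wpoly V lam (fun j => (r j : ℂ)) (1 : ℝ) b := by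
    simp [wpoly]
  rw [hneg, map_neg, eval_neg, eval_neg, neg_re, neg_re]
  linarith

/-- The unimodal case: the vertex of odd multiplicity is the unique maximum. -/
theorem prim_lt_max {k : ι} (hb : Even b) (hk : k ∈ V) (h : ∀ j ∈ V, j ≠ k → Even (lam j))
    (ho : Odd (lam k)) {t : ℝ} (ht : t ≠ r k) :
    ((prim (wpoly V lam (fun j => (r j : ℂ)) (-1 : ℝ) b)).eval (t : ℂ)).re
      < ((prim (wpoly V lam (fun j => (r j : ℂ)) (-1 : ℝ) b)).eval (r k : ℂ)).re := by
  rcases ht.lt_or_gt with h1 | h1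
  · exact prim_lt_of_le hb hk h h1 le_rfl ho
  · exact lt_prim_of_le hb hk h h1 le_rfl

/-- Real configurations without coinciding labels are given by real vertices. -/
theorem LInv.eq_self {κ : ι → ι} (hκ : LInv V lam w κ)
    (hinj : ∀ j ∈ V, ∀ k ∈ V, lam j = lam k → w j = w k → j = k) : ∀ j ∈ V, κ j = j :=
  fun j hj => hinj _ (hκ.mem j hj) j hj (hκ.lam_eq j hj) (hκ.d_eq j hj)

theorem exists_real {x : ι → ℂ} (h : ∀ j, (x j).im = 0) : ∃ r : ι → ℝ, x = fun j => (r j : ℂ) :=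
  ⟨fun j => (x j).re, funext fun j => Complex.ext rfl (by simp [h j])⟩

/-- The critical value of a single cluster at one. -/
def clusVal (V : Finset ι) (lam : ι → ℕ) (v : ℝ) (b : ℕ) : ℝ :=
  ((prim (wpoly V lam (fun _ => ((1 : ℝ) : ℂ)) v b)).eval ((1 : ℝ) : ℂ)).re

theorem eval_prim_const {x : ι → ℂ} {c : ℝ} (hx : ∀ j ∈ V, x j = c) :
    (prim (wpoly V lam x v b)).eval (c : ℂ)
      = ((c ^ (1 + b + ∑ k ∈ V, lam k) * clusVal V lam v b : ℝ) : ℂ) := by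
  have h := prim_scale (V := V) (lam := lam) (u := (v : ℂ)) (b := b) (fun _ => ((1 : ℝ) : ℂ)) (c : ℂ)
    ((1 : ℝ) : ℂ)
  rw [ofReal_one, mul_one] at h
  rw [wpoly_congr (x' := fun _ => (c : ℂ)) hx, h, clusVal, ofReal_mul, ofReal_pow]
  congr 1
  exact Complex.ext (by simp) (by
    rw [ofReal_im]
    have := prim_wpoly_real (V := V) (lam := lam) (r := fun _ => 1) (v := v) (b := b) 1
    rwa [ofReal_one] at this)

theorem clusVal_pos (hv : v ≠ 0) (hb : Even b)
    (h : 0 ≤ v * (-1) ^ (∑ k ∈ V, lam k)) : 0 < clusVal V lam v b := by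
  have key := prim_lt (V := V) (lam := lam) (r := fun _ => 1) (b := b) hv (zero_lt_one' ℝ)
    fun t ht => by
      rw [prod_pow_eq_pow_sum, ← neg_sub, neg_eq_neg_one_mul, mul_pow]
      have h1 : 0 ≤ (1 - t) ^ (∑ k ∈ V, lam k) := pow_nonneg (by linarith [ht.2]) _
      have h2 := mul_nonneg (mul_nonneg (hb.pow_nonneg t) h) h1
      linarith
  rw [ofReal_zero, prim_eval_zero, zero_re] at key
  exact key

theorem sCount_empty {u : ℂ} : sCount ∅ lam w u = 1 := by
  have h : Sol (∅ : Finset ι) lam u w = {0} := by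
    ext x
    simp [Sol, IsRealC, funext_iff]
  rw [sCount, h, finsum_mem_singleton]
  simp [sgn]

theorem sCount_singleton {a : ι} (ha : 1 ≤ lam a) {u : ℂ} : sCount {a} lam w u = 1 := by
  have ha' : lam a ≠ 0 := by omega
  have h : Sol ({a} : Finset ι) lam u w = {0} := by
    ext x
    simp only [Sol, IsRealC, Set.mem_ofPred_eq, mem_singleton, Set.mem_singleton_iff,
      sum_singleton, mul_eq_zero, Nat.cast_eq_zero, ha', false_or, forall_eq]
    constructor
    · rintro ⟨h1, -, -, h2, -⟩
      funext j
      by_cases hj : j = a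
      · rw [hj, h2, Pi.zero_apply]
      · exact h1 j hj
    · rintro rfl
      simp
  rw [sCount, h, finsum_mem_singleton]
  simp [sgn]

theorem tNum_singleton {a : ι} (ha : Odd (lam a)) : tNum lam w {a} = -1 := by
  rw [tNum, sum_singleton, if_pos ha, sCount_singleton ha.pos]
  simp

theorem tNum_empty : tNum lam w ∅ = 0 := by
  simp [tNum]

/-- The position of a single cluster. -/
def clusPos (V : Finset ι) (lam : ι → ℕ) (v : ℝ) (b : ℕ) : ℝ :=
  (clusVal V lam v b)⁻¹ ^ (((1 + b + ∑ k ∈ V, lam k : ℕ) : ℝ)⁻¹)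

theorem clusPos_pos (h : 0 < clusVal V lam v b) : 0 < clusPos V lam v b :=
  Real.rpow_pos_of_pos (inv_pos.2 h) _

theorem clusPos_pow (h : 0 < clusVal V lam v b) :
    clusPos V lam v b ^ (1 + b + ∑ k ∈ V, lam k) * clusVal V lam v b = 1 := by
  rw [clusPos, Real.rpow_inv_natCast_pow (inv_pos.2 h).le (by omega), inv_mul_cancel₀ h.ne']

theorem eq_clusPos_of_pow (h : 0 < clusVal V lam v b) {c : ℝ} (hc : 0 < c)
    (h1 : c ^ (1 + b + ∑ k ∈ V, lam k) * clusVal V lam v b = 1) : c = clusPos V lam v b :=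
  (pow_left_inj₀ hc.le (clusPos_pos h).le (by omega)).1
    (mul_right_cancel₀ h.ne' (h1.trans (clusPos_pow h).symm))

theorem NF.exists_real {p : (ι → ℂ) × (ι → ℂ)} (hp : NF V lam v b d 0 p) (hr : FReal V lam d p)
    (hinj : ∀ j ∈ V, ∀ k ∈ V, lam j = lam k → d j = d k → j = k) :
    ∃ r : ι → ℝ, p.1 = (fun j => (r j : ℂ)) ∧ (∀ j ∉ V, r j = 0) ∧ (∀ j ∈ V, r j ≠ 0) ∧
      ∀ j ∈ V, (prim (wpoly V lam (fun j => (r j : ℂ)) v b)).eval (r j : ℂ) = 1 := by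
  obtain ⟨κ, hκ, hx⟩ := hr.exists_inv hp
  obtain ⟨r, hr⟩ := _root_.exists_real (x := p.1) fun j => by
    by_cases hj : j ∈ V
    · have := (hx j hj).1
      rw [hκ.eq_self hinj j hj] at this
      exact conj_eq_iff_im.1 this.symm
    · rw [hp.base.eqs.1 j hj, zero_im]
  refine ⟨r, hr, fun j hj => ?_, fun j hj h0 => ?_, fun j hj => ?_⟩
  · have := hp.base.eqs.1 j hj
    rw [hr] at this
    exact ofReal_eq_zero.1 this
  · refine hp.base.ne_zero j hj ?_
    rw [hr]
    exact ofReal_eq_zero.2 h0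
  · have := hp.base.eqs.2 j hj
    rw [hr] at this
    rw [this]
    simp

theorem eqs_const {c : ℝ} (h : c ^ (1 + b + ∑ k ∈ V, lam k) * clusVal V lam v b = 1) {x : ι → ℂ}
    (hx0 : ∀ j ∉ V, x j = 0) (hx : ∀ j ∈ V, x j = c) : Eqs V lam v b d 0 x := by
  refine ⟨hx0, fun j hj => ?_⟩
  rw [hx j hj, eval_prim_const hx, h]
  simp

theorem sCount_even [Fintype ι] (hlam : ∀ k, 1 ≤ lam k) (V : Finset ι)
    (hev : ∀ k ∈ V, Even (lam k)) (hinj : Set.InjOn w V) : sCount V lam w 1 = 1 := by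
  induction V using induction_on_min_value w with
  | empty => exact sCount_empty
  | insert ξ V hξ hmin ih =>
    have hb : Even (lam ξ) := hev ξ (mem_insert_self _ _)
    have hevV : ∀ k ∈ V, Even (lam k) := fun k hk => hev k (mem_insert_of_mem hk)
    have hw : ∀ j ∈ V, w ξ < w j := fun j hj => (hmin j hj).lt_of_ne fun h => hξ <| by
      rwa [hinj (mem_coe.2 (mem_insert_self _ _))
        (mem_coe.2 (mem_insert_of_mem hj)) h]
    have hsum : Even (∑ k ∈ V, lam k) := even_sum _ hevV
    have hc : 0 < clusVal V lam 1 (lam ξ) :=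
      clusVal_pos one_ne_zero hb (by rw [hsum.neg_one_pow]; norm_num)
    set c := clusPos V lam 1 (lam ξ) with hcd
    have hc0 : 0 < c := clusPos_pos hc
    rw [sCount, sum_Sol_insert (fun k _ => hlam k) hξ hw]
    have h1 : (1 : ℂ) = ((1 : ℝ) : ℂ) := by simp
    rw [sum_RSol_eq_sum_split one_ne_zero (by simp) (fun k _ => hlam k) hw (𝒜 := {∅}) (by simp)
      (a := fun _ => ((-1 : ℝ) : ℂ)) (β := fun _ => (c : ℂ))
      (fun _ => ⟨ofReal_im _, by rw [ofReal_re]; norm_num⟩)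
      (fun _ => ⟨ofReal_im _, by rwa [ofReal_re]⟩) _ _ (fun _ _ _ _ _ => trivial)]
    · rw [sum_singleton, sdiff_empty, sum_empty, pow_zero, mul_one,
        sCount_empty, one_mul, one_mul, prod_empty, card_empty, mul_zero, pow_zero,
        hsum.neg_one_pow, ← ofReal_pow, sCount_of_pos (pow_pos hc0 _),
        ih hevV (hinj.mono (by simp))]
      simp
    · simp only [mem_singleton, forall_eq]
      rw [h1]
      exact eqs_const (clusPos_pow hc) (fun j hj => by simp [cfg, hj]) fun j hj => by simp [cfg, hj, hcd]
    · intro p hp hr _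
      rw [h1] at hp
      obtain ⟨r, hpr, hr0, hrne, hr1⟩ := hp.exists_real hr fun j hj k hk _ h =>
        hinj (mem_coe.2 (mem_insert_of_mem hj))
          (mem_coe.2 (mem_insert_of_mem hk)) (sub_left_injective h)
      refine ⟨∅, mem_singleton_self _, ?_⟩
      have hmono : ∀ α β : ℝ, α < β → _ := fun α β h =>
        prim_lt_of_even (V := V) (lam := lam) (r := r) hb hevV h
      have heq : ∀ j ∈ V, ∀ k ∈ V, r j = r k := fun j hj k hk => by
        by_contra hne
        rcases Ne.lt_or_gt hne with h | h
        · have := hmono _ _ h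
          rw [hr1 j hj, hr1 k hk] at this
          exact lt_irrefl _ this
        · have := hmono _ _ h
          rw [hr1 j hj, hr1 k hk] at this
          exact lt_irrefl _ this
      rw [hpr]
      funext j
      by_cases hj : j ∈ V
      · have hpos : 0 < r j := by
          by_contra hn
          have h2 : r j < 0 := lt_of_le_of_ne (not_lt.1 hn) (hrne j hj)
          have := hmono _ _ h2
          rw [hr1 j hj, ofReal_zero, prim_eval_zero] at this
          norm_num at this
        have h3 := eval_prim_const (V := V) (lam := lam) (v := 1) (b := lam ξ)
          (x := fun j => (r j : ℂ)) (c := r j) fun k hk => by rw [heq k hk j hj]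
        rw [hr1 j hj] at h3
        have h4 : r j = c := eq_clusPos_of_pow hc hpos (by exact_mod_cast h3.symm)
        simp [cfg, hj, h4]
      · simp [cfg, hj, hr0 j hj]

theorem uNum_even [Fintype ι] (hlam : ∀ k, 1 ≤ lam k) (hev : ∀ k ∈ V, Even (lam k))
    (hinj : Set.InjOn w V) : uNum lam w V = 1 := by
  rw [uNum, if_pos (even_sum _ hev), sCount_even hlam V hev hinj]

variable {E : Finset ι} {j₀ : ι}

/-- A lowest vertex of even multiplicity cancels in the unimodal case. -/
theorem sCount_unimodal_insert [Fintype ι] (hlam : ∀ k, 1 ≤ lam k) (hξ : ξ ∉ V)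
    (hw : ∀ j ∈ V, w ξ < w j) (hb : Even (lam ξ)) (h0 : j₀ ∈ V) (ho : Odd (lam j₀))
    (hev : ∀ j ∈ V, j ≠ j₀ → Even (lam j))
    (hinj : ∀ j ∈ V, ∀ k ∈ V, lam j = lam k → w j = w k → j = k) :
    sCount (insert ξ V) lam w (-1) = 0 := by
  have hsum : Odd (∑ k ∈ V, lam k) := by
    rw [← add_sum_erase V _ h0]
    exact ho.add_even (even_sum _ fun k hk =>
      hev k (mem_of_mem_erase hk) (ne_of_mem_erase hk))
  have hc : 0 < clusVal V lam (-1) (lam ξ) :=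
    clusVal_pos (by norm_num) hb (by rw [hsum.neg_one_pow]; norm_num)
  set c := clusPos V lam (-1) (lam ξ) with hcd
  have hc0 : 0 < c := clusPos_pos hc
  have hN : Even (1 + lam ξ + ∑ k ∈ V, lam k) := by
    rw [add_right_comm]
    exact (hsum.one_add).add hb
  have hcpow : c ^ (1 + lam ξ + ∑ k ∈ V, lam k) * clusVal V lam (-1) (lam ξ) = 1 := clusPos_pow hc
  have hcneg : (-c) ^ (1 + lam ξ + ∑ k ∈ V, lam k) * clusVal V lam (-1) (lam ξ) = 1 := by
    rw [hN.neg_pow, hcpow]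
  have h1 : (-1 : ℂ) = ((-1 : ℝ) : ℂ) := by simp
  have hV : (∅ : Finset ι) ≠ V := fun h => by simp [← h] at h0
  rw [sCount, sum_Sol_insert (fun k _ => hlam k) hξ hw]
  rw [sum_RSol_eq_sum_split (by simp) (by simp) (fun k _ => hlam k) hw (𝒜 := {∅, V})
    (by simp) (a := fun _ => ((-c : ℝ) : ℂ)) (β := fun _ => (c : ℂ))
    (fun _ => ⟨ofReal_im _, by rw [ofReal_re]; linarith⟩)
    (fun _ => ⟨ofReal_im _, by rwa [ofReal_re]⟩) _ _ (fun _ _ _ _ _ => trivial)]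
  · have h2 : -c ^ lam ξ < 0 := neg_neg_of_pos (pow_pos hc0 _)
    have h3 : (-1 : ℂ) * ((-c : ℝ) : ℂ) ^ lam ξ = ((-c ^ lam ξ : ℝ) : ℂ) := by
      push_cast
      rw [hb.neg_pow]
      ring
    have h4 : (-1 : ℂ) * (c : ℂ) ^ lam ξ = ((-c ^ lam ξ : ℝ) : ℂ) := by
      push_cast
      ring
    rw [Finset.sum_pair hV, Finset.sdiff_empty, Finset.sdiff_self, Finset.sum_empty, pow_zero,
      mul_one, pow_zero, mul_one, sCount_empty, sCount_empty, h3, h4, sCount_of_neg h2,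
      hsum.neg_one_pow, (hb.mul_right V.card).neg_one_pow]
    simp
  · intro A hA
    rw [h1]
    rcases mem_insert.1 hA with rfl | hA
    · exact eqs_const hcpow (fun j hj => by simp [cfg, hj]) fun j hj => by simp [cfg, hj]
    · rw [mem_singleton] at hA
      subst hA
      exact eqs_const hcneg (fun j hj => by simp [cfg, hj]) fun j hj => by simp [cfg, hj]
  · intro p hp hr _
    rw [h1] at hp
    obtain ⟨r, hpr, hr0, hrne, hr1⟩ := hp.exists_real hr fun j hj k hk h h' =>
      hinj j hj k hk h (sub_left_injective h')
    have heq : ∀ j ∈ V, r j = r j₀ := fun j hj => by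
      by_contra hne
      have := prim_lt_max (r := r) hb h0 hev ho hne
      rw [hr1 j hj, hr1 j₀ h0] at this
      exact lt_irrefl _ this
    have h3 := eval_prim_const (V := V) (lam := lam) (v := -1) (b := lam ξ)
      (x := fun j => (r j : ℂ)) (c := r j₀) fun k hk => by rw [heq k hk]
    rw [hr1 j₀ h0] at h3
    have h4 : r j₀ ^ (1 + lam ξ + ∑ k ∈ V, lam k) * clusVal V lam (-1) (lam ξ) = 1 := by
      exact_mod_cast h3.symm
    rcases (hrne j₀ h0).lt_or_gt with hneg | hpos
    · have h5 : -r j₀ = c := eq_clusPos_of_pow hc (by linarith) (by rw [hN.neg_pow, h4])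
      refine ⟨V, by simp, ?_⟩
      rw [hpr]
      funext j
      by_cases hj : j ∈ V
      · simp [cfg, hj, heq j hj, ← h5]
      · simp [cfg, hj, hr0 j hj]
    · have h5 : r j₀ = c := eq_clusPos_of_pow hc hpos h4
      refine ⟨∅, by simp, ?_⟩
      rw [hpr]
      funext j
      by_cases hj : j ∈ V
      · simp [cfg, hj, heq j hj, h5]
      · simp [cfg, hj, hr0 j hj]

theorem Sol_unimodal_lt {x : ι → ℂ} (hx : x ∈ Sol V lam (-1) w) (h0 : j₀ ∈ V) (ho : Odd (lam j₀))
    (hev : ∀ j ∈ V, j ≠ j₀ → Even (lam j))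
    (hinj : ∀ j ∈ V, ∀ k ∈ V, lam j = lam k → w j = w k → j = k) {k : ι} (hk : k ∈ V)
    (hk0 : k ≠ j₀) : w k < w j₀ := by
  obtain ⟨h1, h2, h3, -, h5⟩ := hx
  obtain ⟨κ, hκ, hx⟩ := h3.exists_inv h2
  obtain ⟨r, rfl⟩ := exists_real (x := x) fun j => by
    by_cases hj : j ∈ V
    · have := hx j hj
      rw [hκ.eq_self hinj j hj] at this
      exact conj_eq_iff_im.1 this.symm
    · rw [h1 j hj, zero_im]
  have h6 : r k ≠ r j₀ := fun h => hk0 (h2 hk h0 (by simp [h]))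
  have h7 := prim_lt_max (r := r) (b := 0) Even.zero h0 hev ho h6
  have h8 := congrArg Complex.re (h5 k hk j₀ h0)
  rw [sub_re, ofReal_re] at h8
  rw [ofReal_neg, ofReal_one] at h7
  linarith

theorem tNum_insert_even [Fintype ι] (hlam : ∀ k, 1 ≤ lam k) (hE : E.Nonempty)
    (hev : ∀ j ∈ E, Even (lam j)) (hinj : Set.InjOn w E) (ho : Odd (lam j₀)) :
    tNum lam w (insert j₀ E) = 0 := by
  have h0 : j₀ ∉ E := fun h => Nat.not_even_iff_odd.2 ho (hev _ h)
  suffices h : sCount (insert j₀ E) lam w (-1) = 0 by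
    rw [tNum, h, mul_zero, ite_self]
  have hev' : ∀ j ∈ insert j₀ E, j ≠ j₀ → Even (lam j) := fun j hj hne =>
    hev j (mem_of_mem_insert_of_ne hj hne)
  have hinj' : ∀ j ∈ insert j₀ E, ∀ k ∈ insert j₀ E, lam j = lam k → w j = w k → j = k := by
    intro j hj k hk h1 h2
    rcases mem_insert.1 hj with rfl | hj' <;> rcases mem_insert.1 hk with rfl | hk'
    · rfl
    · exact absurd (h1 ▸ hev _ hk') (Nat.not_even_iff_odd.2 ho)
    · exact absurd (h1 ▸ hev _ hj') (Nat.not_even_iff_odd.2 ho)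
    · exact hinj hj' hk' h2
  by_cases hcase : ∀ e ∈ E, w e < w j₀
  · obtain ⟨ξ, hξ, hmin⟩ := E.exists_min_image w hE
    have hξ0 : j₀ ≠ ξ := fun h => h0 (h ▸ hξ)
    have h1 : insert j₀ E = insert ξ (insert j₀ (E.erase ξ)) := by
      rw [insert_comm, insert_erase hξ]
    have hsub : insert j₀ (E.erase ξ) ⊆ insert j₀ E := insert_subset_insert _ (erase_subset _ _)
    rw [h1]
    refine sCount_unimodal_insert hlam (by simp [hξ0.symm]) (fun j hj => ?_) (hev ξ hξ)
      (mem_insert_self _ _) ho (fun j hj => hev' j (hsub hj))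
      fun j hj k hk => hinj' j (hsub hj) k (hsub hk)
    rcases mem_insert.1 hj with rfl | hj
    · exact hcase ξ hξ
    · obtain ⟨h2, h3⟩ := mem_erase.1 hj
      exact (hmin j h3).lt_of_ne fun h => h2 (hinj h3 hξ h.symm)
  · push Not at hcase
    obtain ⟨e, he, hle⟩ := hcase
    refine finsum_mem_eq_zero_of_forall_eq_zero fun x hx => ?_
    have := Sol_unimodal_lt hx (mem_insert_self _ _) ho hev' hinj'
      (mem_insert_of_mem he) fun h => h0 (h ▸ he)
    exact absurd this hle.not_gt

variable {p q : ι}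

theorem kCount_empty : kCount (∅ : Finset ι) lam d = 1 := by
  have h : RSol (∅ : Finset ι) lam (-1) 1 d (fun π => ¬ someReal ∅ π) 1 = {0} := by
    ext x
    simp [RSol, Eqs, IsRealC, funext_iff, someReal]
  rw [kCount, h, finsum_mem_singleton]

/-- A pair of opposite purely imaginary vertices. -/
def imPair (p q : ι) (y : ℝ) : ι → ℂ :=
  cfg {p, q} {p} (y * Complex.I) (-(y * Complex.I))

theorem imPair_left (y : ℝ) : imPair p q y p = y * Complex.I := by simp [imPair, cfg]

theorem imPair_right (h : p ≠ q) (y : ℝ) : imPair p q y q = -(y * Complex.I) := by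
  simp [imPair, cfg, h.symm]

theorem pair_sdiff (h : p ≠ q) : ({p, q} : Finset ι) \ {p} = {q} := by
  ext j
  simp only [Finset.mem_sdiff, Finset.mem_insert, Finset.mem_singleton]
  constructor
  · tauto
  · rintro rfl
    exact ⟨Or.inr rfl, h.symm⟩

theorem neg_I_mul_pow (y : ℝ) (n : ℕ) :
    (-(y * Complex.I)) ^ n * (-(-(y * Complex.I))) ^ n = (((y ^ 2) ^ n : ℝ) : ℂ) := by
  rw [← mul_pow]
  push_cast
  congr 1
  linear_combination (-(y : ℂ) ^ 2) * Complex.I_mul_I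

theorem imPair_mem (h : p ≠ q) (hl : lam q = lam p) {y : ℝ}
    (hy : (y ^ 2) ^ (lam p + 1) = 2 * lam p + 2) :
    imPair p q y ∈ RSol {p, q} lam (-1) 1 (fun _ => 1) (fun π => ¬ someReal {p, q} π) 1 := by
  have hy0 : y ≠ 0 := by
    rintro rfl
    rw [zero_pow two_ne_zero, zero_pow (Nat.succ_ne_zero _)] at hy
    have : (0 : ℝ) < 2 * lam p + 2 := by positivity
    linarith
  have hA : ({p} : Finset ι) ⊆ {p, q} := by simp
  have hp := prim_of_two (lam := lam) (u := -1) hA (x := imPair p q y) (a := y * Complex.I)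
    (β := -(y * Complex.I)) (by simp [imPair_left]) (by simp [pair_sdiff h, imPair_right h])
    (by rw [pair_sdiff h]; simp [hl]) (by
      rw [pair_sdiff h, sum_pair h, sum_singleton, sum_singleton, hl,
        mul_assoc, neg_I_mul_pow, hy]
      have : (2 * (lam p : ℂ) + 2) ≠ 0 := by exact_mod_cast (by positivity : (2 * (lam p : ℝ) + 2) ≠ 0)
      push_cast
      rw [← two_mul]
      field_simp)
  refine ⟨⟨fun j hj => ?_, ?_⟩, ?_, ?_, ?_⟩
  · simp only [imPair, cfg]
    rw [if_neg fun h => hj (hA h), if_neg hj]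
  · rw [hp]
    simp [imPair_left, imPair_right h]
  · have hne : (y : ℂ) * Complex.I ≠ -(y * Complex.I) := fun h => by
      have := congrArg Complex.im h
      simp at this
      exact hy0 (by linarith)
    intro j hj k hk hjk
    simp only [coe_insert, coe_singleton, Set.mem_insert_iff,
      Set.mem_singleton_iff] at hj hk
    rcases hj with rfl | rfl <;> rcases hk with rfl | rfl
    · rfl
    · rw [imPair_left, imPair_right h] at hjk
      exact absurd hjk hne
    · rw [imPair_left, imPair_right h] at hjk
      exact absurd hjk.symm hne
    · rfl
  · intro j hj
    rcases mem_insert.1 hj with rfl | hj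
    · exact ⟨q, by simp, by simp [imPair_left, imPair_right h], hl, rfl⟩
    · rw [mem_singleton] at hj
      subst hj
      exact ⟨p, by simp, by simp [imPair_left, imPair_right h], hl.symm, rfl⟩
  · change ¬ someReal _ _
    rw [someReal_pat]
    simp [imPair_left, imPair_right h, hy0]

theorem kCount_pair_one (h : p ≠ q) (hl : lam q = lam p) :
    kCount {p, q} lam (fun _ => 1) = 2 := by
  obtain ⟨y, hy, hy0⟩ : ∃ y : ℝ, (y ^ 2) ^ (lam p + 1) = 2 * lam p + 2 ∧ 0 < y := by
    refine ⟨(2 * lam p + 2 : ℝ) ^ (((2 * (lam p + 1) : ℕ) : ℝ)⁻¹), ?_,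
      Real.rpow_pos_of_pos (by positivity) _⟩
    rw [← pow_mul, Real.rpow_inv_natCast_pow (by positivity) (by omega)]
  have hset : RSol {p, q} lam (-1) 1 (fun _ => 1) (fun π => ¬ someReal {p, q} π) 1
      = {imPair p q y, imPair p q (-y)} := by
    ext x
    constructor
    · intro hx
      obtain ⟨κ, hκ, hf, hxκ⟩ := RSol.exists_inv hx hx.2.2.2
      have hκp : κ p = q := by
        have h1 := hκ.mem p (by simp)
        have h2 := hf p (by simp)
        simpa [h2] using h1
      have hxq := hxκ p (by simp)
      rw [hκp] at hxq
      have hne : x p ≠ 0 := fun h0 => hx.2.2.2 (someReal_pat.2 ⟨p, by simp, by simp [h0]⟩)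
      have hxpq : x p ≠ x q := fun h1 => h (hx.2.1 (by simp) (by simp) h1)
      obtain ⟨A, hAV, hjA, c, hA1, hA2, h0, h1⟩ := exists_two_of_values_one (V := {p, q})
        (lam := lam) (u := -1) (by simp) (x := x) (fun j hj => by simpa using hx.1.2 j hj)
        (fun j hj h0 => hx.2.2.2 (someReal_pat.2 ⟨j, hj, by simp [h0]⟩)) (j0 := p) (by simp)
      have hAp : A = {p} := by
        refine Finset.Subset.antisymm (fun j hj => ?_) (by simpa using hjA)
        rcases mem_insert.1 (hAV hj) with rfl | h2
        · simp
        · rw [mem_singleton] at h2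
          subst h2
          exact absurd (hA1 j hj).symm hxpq
      subst hAp
      rw [pair_sdiff h] at hA2 h0 h1
      rw [← hA2 q (by simp)] at h0 h1
      simp only [sum_singleton, hl, sum_pair h] at h0 h1
      have h2 : x q = - x p := by
        have h3 : ((lam p + 1 : ℕ) : ℂ) ≠ 0 := Nat.cast_ne_zero.2 (by omega)
        rw [← mul_add] at h0
        exact eq_neg_of_add_eq_zero_left ((mul_eq_zero.1 h0).resolve_left h3)
      have h3 : (x p).re = 0 := by
        have := congrArg Complex.re (hxq.symm.trans h2)
        simp at this
        linarith
      obtain ⟨z, hz⟩ : ∃ z : ℝ, x p = z * Complex.I :=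
        ⟨(x p).im, Complex.ext (by simp [h3]) (by simp)⟩
      have h4 : (z ^ 2) ^ (lam p + 1) = 2 * lam p + 2 := by
        rw [h2, hz, mul_assoc, neg_I_mul_pow] at h1
        have h5 : ((lam p + lam p + 2 : ℕ) : ℂ) ≠ 0 := Nat.cast_ne_zero.2 (by omega)
        rw [div_mul_eq_mul_div, div_eq_iff h5, neg_one_mul, neg_one_mul, neg_inj] at h1
        have h6 : (z ^ 2) ^ (lam p + 1) = ((lam p + lam p + 2 : ℕ) : ℝ) := by exact_mod_cast h1
        rw [h6]
        push_cast
        ring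
      have h5 : z ^ 2 = y ^ 2 :=
        (pow_left_inj₀ (sq_nonneg z) (sq_nonneg y) (Nat.succ_ne_zero _)).1 (h4.trans hy.symm)
      have h6 : x = imPair p q z := by
        funext j
        by_cases hj : j ∈ ({p, q} : Finset ι)
        · rcases mem_insert.1 hj with rfl | hj
          · rw [hz, imPair_left]
          · rw [mem_singleton] at hj
            subst hj
            rw [h2, hz, imPair_right h]
        · rw [hx.1.1 j hj]
          simp only [imPair, cfg]
          rw [if_neg fun h => hj (by simp at h; simp [h]), if_neg hj]
      rcases sq_eq_sq_iff_eq_or_eq_neg.1 h5 with rfl | rfl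
      · exact Or.inl h6
      · exact Or.inr h6
    · rintro (rfl | rfl)
      · exact imPair_mem h hl hy
      · exact imPair_mem h hl (by rwa [neg_sq])
  rw [kCount, hset, finsum_mem_pair]
  · norm_num
  · intro h1
    have h2 := congrArg Complex.im (congrFun h1 p)
    simp [imPair_left] at h2
    linarith

theorem kCount_congr (h : ∀ j ∈ V, d j = w j) : kCount V lam d = kCount V lam w := by
  have h1 : RSol V lam (-1) 1 d (fun π => ¬ someReal V π) 1
      = RSol V lam (-1) 1 w (fun π => ¬ someReal V π) 1 := by
    ext x
    refine and_congr (and_congr_right fun _ => forall₂_congr fun j hj => by rw [h j hj])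
      (and_congr_right fun _ => and_congr_left fun _ => forall₂_congr fun j hj =>
        exists_congr fun k => and_congr_right fun hk => by rw [h j hj, h k hk])
  rw [kCount, kCount, h1]

theorem kCount_pair [Fintype ι] (h : p ≠ q) (hl : lam q = lam p) (hw : w q = w p)
    (hlam : 1 ≤ lam p) {c : ℝ} (hc : c < w p) : kCount {p, q} lam (fun j => w j - c) = 2 := by
  have hlam' : ∀ k ∈ ({p, q} : Finset ι), 1 ≤ lam k := by simp [hl, hlam]
  have h1 : kCount {p, q} lam (fun j => w j - (w p - 1)) = 2 := by
    rw [← kCount_pair_one h hl]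
    exact kCount_congr (by simp [hw])
  rcases le_total c (w p - 1) with h2 | h2
  · rw [kCount_shift hlam' (by simp [hw]) h2, h1]
  · rw [← kCount_shift hlam' (by simp [hw, hc]) h2, h1]

end

section
variable {ι σ : Type*} {V : Finset σ} {lam : ι → ℕ} {u : ℂ} {b : ℕ} {w d : ι → ℝ} {x : ι → ℂ} (e : σ ↪ ι)

theorem wpoly_map : wpoly (V.map e) lam x u b = wpoly V (lam ∘ e) (x ∘ e) u b := by
  rw [wpoly, wpoly, vprod, vprod, prod_map]
  rfl

theorem isRealC_map : IsRealC (V.map e) lam d x ↔ IsRealC V (lam ∘ e) (d ∘ e) (x ∘ e) := by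
  simp [IsRealC]

theorem injOn_map : Set.InjOn x (V.map e) ↔ Set.InjOn (x ∘ e) V := by
  rw [coe_map, ← Set.InjOn.comp_iff e.injective.injOn]

theorem bijOn_comp_embedding {S : Set (ι → ℂ)} {S' : Set (σ → ℂ)}
    (hS : ∀ x ∈ S, ∀ j ∉ V.map e, x j = 0) (hS' : ∀ y ∈ S', ∀ j ∉ V, y j = 0)
    (h : ∀ x : ι → ℂ, (∀ j ∉ V.map e, x j = 0) → (x ∈ S ↔ x ∘ e ∈ S')) :
    Set.BijOn (fun x : ι → ℂ => x ∘ e) S S' := by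
  refine ⟨fun x hx => (h x (hS x hx)).1 hx, fun x hx x' hx' hxx => ?_, fun y hy => ?_⟩
  · funext j
    by_cases hj : j ∈ V.map e
    · obtain ⟨i, -, rfl⟩ := mem_map.1 hj
      exact congrFun hxx i
    · rw [hS x hx j hj, hS x' hx' j hj]
  · have hy' : Function.extend e y 0 ∘ e = y := Function.extend_comp e.injective _ _
    refine ⟨Function.extend e y 0, (h _ fun j hj => ?_).2 (by rwa [hy']), hy'⟩
    by_cases hex : ∃ i, e i = j
    · obtain ⟨i, rfl⟩ := hex
      rw [e.injective.extend_apply]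
      exact hS' y hy i fun hi => hj (mem_map_of_mem e hi)
    · exact Function.extend_apply' _ _ _ hex

theorem sCount_map : sCount (V.map e) lam w u = sCount V (lam ∘ e) (w ∘ e) u := by
  refine finsum_mem_eq_of_bijOn _ (bijOn_comp_embedding (V := V) e (fun x hx => hx.1)
    (fun y hy => hy.1) fun x hx => ?_) fun x _ => ?_
  · have hx' : ∀ j ∉ V, (x ∘ e) j = 0 := fun j hj => hx _ (by simpa using hj)
    refine ⟨fun h => ⟨hx', (injOn_map e).1 h.2.1, (isRealC_map e).1 h.2.2.1, ?_, ?_⟩,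
      fun h => ⟨hx, (injOn_map e).2 h.2.1, (isRealC_map e).2 h.2.2.1, ?_, ?_⟩⟩
    · rw [← h.2.2.2.1, sum_map]
      rfl
    · intro j hj k hk
      have := h.2.2.2.2 (e j) (mem_map_of_mem e hj) (e k) (mem_map_of_mem e hk)
      rwa [wpoly_map] at this
    · rw [← h.2.2.2.1, sum_map]
      rfl
    · intro j hj k hk
      obtain ⟨j, hj', rfl⟩ := mem_map.1 hj
      obtain ⟨k, hk', rfl⟩ := mem_map.1 hk
      rw [wpoly_map]
      exact h.2.2.2.2 j hj' k hk'
  · simp only [sgn, prod_map]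
    rfl

theorem kCount_map : kCount (V.map e) lam d = kCount V (lam ∘ e) (d ∘ e) := by
  refine finsum_mem_eq_of_bijOn _ (bijOn_comp_embedding (V := V) e (fun x hx => hx.1.1)
    (fun y hy => hy.1.1) fun x hx => ?_) fun x _ => rfl
  have hx' : ∀ j ∉ V, (x ∘ e) j = 0 := fun j hj => hx _ (by simpa using hj)
  have h : Eqs (V.map e) lam (-1) 1 d 1 x ↔ Eqs V (lam ∘ e) (-1) 1 (d ∘ e) 1 (x ∘ e) :=
    ⟨fun h => ⟨hx', fun j hj => by
      have := h.2 (e j) (Finset.mem_map_of_mem e hj)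
      rwa [wpoly_map] at this⟩, fun h => ⟨hx, fun j hj => by
      obtain ⟨j, hj', rfl⟩ := Finset.mem_map.1 hj
      rw [wpoly_map]
      exact h.2 j hj'⟩⟩
  simp only [RSol, Set.mem_ofPred_eq, injOn_map, isRealC_map, someReal_pat, h, Finset.mem_map,
    exists_exists_and_eq_and]
  rfl

theorem tNum_map : tNum lam w (V.map e) = tNum (lam ∘ e) (w ∘ e) V := by
  rw [tNum, tNum, sCount_map, sum_map, card_map]
  rfl

theorem uNum_map : uNum lam w (V.map e) = uNum (lam ∘ e) (w ∘ e) V := by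
  rw [uNum, uNum, sCount_map, sum_map]
  rfl

end

/-- The binomial Leibniz rule for `E (p * q) = D p * q + p * E q`. -/
theorem iterate_mul_leibniz {R : Type*} [CommRing R] (D E : R →+ R)
    (h : ∀ p q, E (p * q) = D p * q + p * E q) (n : ℕ) (p q : R) :
    E^[n] (p * q) = ∑ j ∈ range (n + 1), (n.choose j : R) * (D^[j] p * E^[n - j] q) := by
  rw [← Finset.Nat.sum_antidiagonal_eq_sum_range_succ_mk (fun ij =>
    (n.choose ij.1 : R) * (D^[ij.1] p * E^[ij.2] q)) n]
  induction n with
  | zero => simp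
  | succ n ih =>
    rw [sum_antidiagonal_choose_succ_mul (fun i j => D^[i] p * E^[j] q),
      Function.iterate_succ_apply', ih, map_sum, ← sum_add_distrib]
    refine sum_congr rfl fun ij hij => ?_
    rw [← nsmul_eq_mul, map_nsmul, h, ← Function.iterate_succ_apply' D,
      ← Function.iterate_succ_apply' E, nsmul_eq_mul,
      Nat.choose_symm_of_eq_add (Finset.HasAntidiagonal.mem_antidiagonal.1 hij).symm]
    ring

/-- The derivation `(Y² - X) ∂/∂Y`. -/
def riccati : ℤ[X][X] →+ ℤ[X][X] :=
  (AddMonoidHom.mulLeft (X ^ 2 - C X)).comp derivative.toAddMonoidHom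

/-- The operator `(Y² - X) ∂/∂Y + Y`. -/
def riccatiY : ℤ[X][X] →+ ℤ[X][X] := riccati + AddMonoidHom.mulLeft X

theorem riccati_apply (p : ℤ[X][X]) : riccati p = (X ^ 2 - C X) * derivative p := rfl

theorem riccatiY_apply (p : ℤ[X][X]) : riccatiY p = (X ^ 2 - C X) * derivative p + X * p := rfl

theorem riccati_mul (p q : ℤ[X][X]) : riccati (p * q) = riccati p * q + p * riccati q := by
  simp only [riccati_apply, derivative_mul]
  ring

theorem riccatiY_mul (p q : ℤ[X][X]) : riccatiY (p * q) = riccati p * q + p * riccatiY q := by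
  simp only [riccati_apply, riccatiY_apply, derivative_mul]
  ring

theorem riccati_iterate_succ (n : ℕ) : riccati^[n + 1] X
    = ∑ j ∈ range (n + 1), (n.choose j : ℤ[X][X]) * (riccati^[j] X * riccati^[n - j] X)
      - if n = 0 then C X else 0 := by
  have h1 : riccati X = X * X - C X := by
    rw [riccati_apply, derivative_X]
    ring
  rw [← iterate_mul_leibniz _ _ riccati_mul, Function.iterate_succ_apply, h1]
  have h2 : ∀ p q, riccati^[n] (p - q) = riccati^[n] p - riccati^[n] q := fun p q => by
    induction n generalizing p q with
    | zero => rfl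
    | succ n ih => rw [Function.iterate_succ_apply, map_sub, ih]; rfl
  rw [h2]
  congr 1
  cases n with
  | zero => rfl
  | succ n =>
    rw [Function.iterate_succ_apply, riccati_apply, derivative_C, mul_zero, if_neg n.succ_ne_zero]
    exact iterate_map_zero riccati n

theorem riccatiY_iterate_succ (n : ℕ) : riccatiY^[n + 1] 1
    = ∑ j ∈ range (n + 1), (n.choose j : ℤ[X][X]) * (riccati^[j] X * riccatiY^[n - j] 1) := by
  rw [← iterate_mul_leibniz _ _ riccatiY_mul, Function.iterate_succ_apply]
  congr 1
  simp [riccatiY_apply]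

/-- The `m`-th derivative of `tanh ^ b / cosh` at `0`. -/
def tco : ℕ → ℕ → ℤ
  | 0, b => if b = 0 then 1 else 0
  | m + 1, b => b * tco m (b - 1) - (b + 1) * tco m (b + 1)

theorem tco_eq_zero {m b : ℕ} (h : ¬ (b ≤ m ∧ Even (m - b))) : tco m b = 0 := by
  induction m generalizing b with
  | zero =>
    rw [tco, if_neg]
    rintro rfl
    exact h ⟨le_rfl, by simp⟩
  | succ m ih =>
    have h1 : (b : ℤ) * tco m (b - 1) = 0 := by grind
    rw [tco, h1, ih, mul_zero, sub_zero]
    rintro ⟨h2, h3⟩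
    exact h ⟨by omega, by rw [show m + 1 - b = m - (b + 1) + 2 by omega]; exact h3.add even_two⟩

theorem coeff_riccatiY (p : ℤ[X][X]) (b : ℕ) : (riccatiY p).coeff b
    = (b : ℤ[X]) * p.coeff (b - 1) - ((b : ℤ[X]) + 1) * (X * p.coeff (b + 1)) := by
  rw [riccatiY_apply, sub_mul, coeff_add, coeff_sub, coeff_C_mul, coeff_derivative]
  rcases b with _ | b
  · have : (X ^ 2 * derivative p : ℤ[X][X]).coeff 0 = 0 := by
      simp [mul_coeff_zero]
    rw [this, mul_coeff_zero]
    simp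
  · rw [coeff_X_mul]
    have : (X ^ 2 * derivative p : ℤ[X][X]).coeff (b + 1) = b * p.coeff b := by
      rcases b with _ | b
      · rw [pow_two, mul_assoc, coeff_X_mul, mul_coeff_zero]
        simp
      · rw [coeff_X_pow_mul, coeff_derivative]
        push_cast
        ring
    rw [this]
    push_cast
    ring

theorem coeff_riccatiY_iterate (m b : ℕ) :
    (riccatiY^[m] 1).coeff b = C (tco m b) * X ^ ((m - b) / 2) := by
  induction m generalizing b with
  | zero =>
    rw [Function.iterate_zero, id, coeff_one, tco]
    split_ifs <;> simp
  | succ m ih =>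
    rw [Function.iterate_succ_apply', coeff_riccatiY, ih, ih, tco]
    have h1 : (b : ℤ[X]) * (C (tco m (b - 1)) * X ^ ((m - (b - 1)) / 2))
        = C (b * tco m (b - 1)) * X ^ ((m + 1 - b) / 2) := by
      rcases Nat.eq_zero_or_pos b with rfl | hb
      · simp
      · rw [show m + 1 - b = m - (b - 1) by omega]
        simp [mul_assoc]
    have h2 : (b + 1 : ℤ[X]) * (X * (C (tco m (b + 1)) * X ^ ((m - (b + 1)) / 2)))
        = C ((b + 1) * tco m (b + 1)) * X ^ ((m + 1 - b) / 2) := by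
      by_cases h : b + 1 ≤ m
      · rw [show (m + 1 - b) / 2 = (m - (b + 1)) / 2 + 1 by omega]
        simp
        ring
      · rw [tco_eq_zero fun h' => h h'.1]
        simp
    rw [h1, h2, C_sub, sub_mul]

section
variable {σ : Type*}

/-- The functions on finite sets with the convolution product twisted by `τ`. -/
def SetAlg (_τ : σ → σ → ℤ) : Type _ := Finset σ → ℤ

namespace SetAlg
variable {τ : σ → σ → ℤ}

instance : AddCommGroup (SetAlg τ) := inferInstanceAs (AddCommGroup (Finset σ → ℤ))

noncomputable instance : One (SetAlg τ) := ⟨fun V => if V = ∅ then 1 else 0⟩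

noncomputable instance : Mul (SetAlg τ) :=
  ⟨fun f g V => ∑ A ∈ V.powerset, (∏ j ∈ A, ∏ k ∈ V \ A, τ j k) * (f A * g (V \ A))⟩

theorem add_apply (f g : SetAlg τ) (V : Finset σ) : (f + g) V = f V + g V := rfl

theorem sub_apply (f g : SetAlg τ) (V : Finset σ) : (f - g) V = f V - g V := rfl

theorem zero_apply (V : Finset σ) : (0 : SetAlg τ) V = 0 := rfl

theorem one_apply (V : Finset σ) : (1 : SetAlg τ) V = if V = ∅ then 1 else 0 := rfl

theorem mul_apply (f g : SetAlg τ) (V : Finset σ) : (f * g) V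
    = ∑ A ∈ V.powerset, (∏ j ∈ A, ∏ k ∈ V \ A, τ j k) * (f A * g (V \ A)) := rfl

@[ext] theorem ext {f g : SetAlg τ} (h : ∀ V, f V = g V) : f = g := funext h

theorem mul_assoc' (f g h : SetAlg τ) : f * g * h = f * (g * h) := by
  ext V
  simp only [mul_apply, sum_mul, mul_sum]
  rw [sum_sigma', sum_sigma']
  refine sum_bij' (fun p _ => ⟨p.2, p.1 \ p.2⟩) (fun p _ => ⟨p.1 ∪ p.2, p.1⟩) ?_ ?_ ?_ ?_ ?_
  · rintro ⟨S, A⟩ h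
    simp only [mem_sigma, mem_powerset] at h ⊢
    exact ⟨h.2.trans h.1, sdiff_subset_sdiff h.1 subset_rfl⟩
  · grind
  · rintro ⟨S, A⟩ h
    simp only [mem_sigma, mem_powerset] at h ⊢
    rw [union_sdiff_of_subset h.2]
  · rintro ⟨A, B⟩ h
    simp only [mem_sigma, mem_powerset] at h ⊢
    rw [union_sdiff_cancel_left (disjoint_of_subset_right h.2 disjoint_sdiff)]
  · rintro ⟨S, A⟩ h
    simp only [mem_sigma, mem_powerset] at h ⊢
    have h1 : (V \ A) \ (S \ A) = V \ S := by
      ext j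
      have := @h.2 j
      simp only [Finset.mem_sdiff]
      tauto
    have h2 : V \ A = S \ A ∪ V \ S := by
      ext j
      have := @h.2 j
      have := @h.1 j
      simp only [Finset.mem_sdiff, Finset.mem_union]
      tauto
    have h3 : Disjoint (S \ A) (V \ S) := Finset.disjoint_of_subset_left Finset.sdiff_subset
      Finset.disjoint_sdiff
    rw [h1]
    have h4 : ∏ j ∈ S, ∏ k ∈ V \ S, τ j k
        = (∏ j ∈ A, ∏ k ∈ V \ S, τ j k) * ∏ j ∈ S \ A, ∏ k ∈ V \ S, τ j k := by
      rw [mul_comm, prod_sdiff h.2]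
    have h5 : ∏ j ∈ A, ∏ k ∈ V \ A, τ j k
        = (∏ j ∈ A, ∏ k ∈ S \ A, τ j k) * ∏ j ∈ A, ∏ k ∈ V \ S, τ j k := by
      rw [← prod_mul_distrib]
      exact prod_congr rfl fun j _ => by rw [h2, prod_union h3]
    rw [h4, h5]
    ring

theorem one_mul' (f : SetAlg τ) : 1 * f = f := by
  ext V
  rw [mul_apply, sum_eq_single ∅]
  · simp [one_apply]
  · intro A _ hA
    simp [one_apply, hA]
  · simp

theorem mul_one' (f : SetAlg τ) : f * 1 = f := by
  ext V
  rw [mul_apply, sum_eq_single V]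
  · simp [one_apply]
  · intro A hA hne
    rw [one_apply, if_neg, mul_zero, mul_zero]
    intro h
    exact hne (subset_antisymm (mem_powerset.1 hA) (sdiff_eq_empty_iff_subset.1 h))
  · simp

noncomputable instance : Ring (SetAlg τ) where
  __ := (inferInstance : AddCommGroup (SetAlg τ))
  mul_assoc := mul_assoc'
  one_mul := one_mul'
  mul_one := mul_one'
  zero_mul f := by
    ext V
    simp [mul_apply, zero_apply]
  mul_zero f := by
    ext V
    simp [mul_apply, zero_apply]
  left_distrib f g h := by
    ext V
    simp [mul_apply, add_apply, mul_add, sum_add_distrib]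
  right_distrib f g h := by
    ext V
    simp [mul_apply, add_apply, mul_add, add_mul, sum_add_distrib]
  zsmul := fun n f => n • f
  zsmul_zero' := fun f => zero_zsmul f
  zsmul_succ' := fun n f => SubNegMonoid.zsmul_succ' n f
  zsmul_neg' := fun n f => SubNegMonoid.zsmul_neg' n f

theorem sum_apply {α : Type*} (s : Finset α) (f : α → SetAlg τ) (V : Finset σ) :
    (∑ a ∈ s, f a) V = ∑ a ∈ s, f a V :=
  Finset.sum_apply V s f

theorem zsmul_apply (n : ℤ) (f : SetAlg τ) (V : Finset σ) : (n • f) V = n * f V := by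
  rfl

theorem intCast_mul_apply (n : ℤ) (f : SetAlg τ) (V : Finset σ) :
    ((n : SetAlg τ) * f) V = n * f V := by
  rw [← zsmul_eq_mul, zsmul_apply]

theorem natCast_mul_apply (n : ℕ) (f : SetAlg τ) (V : Finset σ) :
    ((n : SetAlg τ) * f) V = n * f V := by
  rw [← Int.cast_natCast, intCast_mul_apply]

/-- A function supported where all the twists are trivial is central. -/
theorem commute_of_twist {f : SetAlg τ} (h : ∀ A B : Finset σ, f A ≠ 0 →
    ∏ j ∈ A, ∏ k ∈ B, τ j k = ∏ j ∈ B, ∏ k ∈ A, τ j k) (g : SetAlg τ) : Commute f g := by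
  ext V
  rw [mul_apply, mul_apply]
  refine sum_bij' (fun A _ => V \ A) (fun A _ => V \ A) (by simp) (by simp) ?_ ?_ ?_
  · intro A hA
    exact Finset.sdiff_sdiff_eq_self (Finset.mem_powerset.1 hA)
  · intro A hA
    exact Finset.sdiff_sdiff_eq_self (Finset.mem_powerset.1 hA)
  · intro A hA
    rw [Finset.sdiff_sdiff_eq_self (Finset.mem_powerset.1 hA)]
    by_cases hf : f A = 0
    · simp [hf]
    · rw [h _ _ hf, mul_comm (f A)]

theorem mul_vanish {f g : SetAlg τ} {a b : ℕ} (hf : ∀ S, S.card < a → f S = 0)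
    (hg : ∀ S, S.card < b → g S = 0) (S : Finset σ) (hS : S.card < a + b) : (f * g) S = 0 := by
  refine sum_eq_zero fun A hA => ?_
  have := card_sdiff_add_card_eq_card (mem_powerset.1 hA)
  by_cases h : A.card < a
  · simp [hf A h]
  · simp [hg (S \ A) (by omega)]

theorem pow_vanish {f : SetAlg τ} (hf : f ∅ = 0) (n : ℕ) (S : Finset σ) (hS : S.card < n) :
    (f ^ n) S = 0 := by
  induction n generalizing S with
  | zero => omega
  | succ n ih =>
    rw [pow_succ]
    refine mul_vanish ih (b := 1) (fun S hS => ?_) S hS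
    rw [card_eq_zero.1 (Nat.lt_one_iff.1 hS), hf]

end SetAlg
end

section

/-- Noncommutative solution of the recursions of Riccati type. -/
theorem exists_riccati_sequences {R : Type*} [Ring R] {K A : R} (h : Commute K A) :
    ∃ T U : ℕ → R, T 0 = A ∧ U 0 = 1 ∧
      (∀ n, T (n + 1) = ∑ j ∈ range (n + 1), (n.choose j : R) * (T j * T (n - j))
        - if n = 0 then K else 0) ∧
      (∀ n, U (n + 1) = ∑ j ∈ range (n + 1), (n.choose j : R) * (T j * U (n - j))) ∧
      ∀ n, U n = ∑ b ∈ range (n + 1), (tco n b : R) * (K ^ ((n - b) / 2) * A ^ b) := by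
  have hf : ∀ a : ℤ[X], Commute ((aeval K : ℤ[X] →ₐ[ℤ] R).toRingHom a) A := fun a => by
    induction a using Polynomial.induction_on' with
    | add p q hp hq => rw [map_add]; exact hp.add_left hq
    | monomial n a =>
      have : (aeval K : ℤ[X] →ₐ[ℤ] R).toRingHom (monomial n a) = (a : R) * K ^ n := by
        simp [aeval_monomial]
      rw [this]
      exact (Int.cast_commute a A).mul_left (h.pow_left n)
  let ev : ℤ[X][X] →+* R := eval₂RingHom' _ A hf
  have hX : ev X = A := eval₂_X _ _
  have hC : ev (C X) = K := by
    refine (eval₂_C _ _).trans ?_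
    simp
  refine ⟨fun n => ev (riccati^[n] X), fun n => ev (riccatiY^[n] 1), hX, map_one ev, fun n => ?_,
    fun n => ?_, fun n => ?_⟩
  · simp only [riccati_iterate_succ, map_sub, map_sum, map_mul, map_natCast]
    congr 1
    split_ifs
    · exact hC
    · exact map_zero ev
  · simp only [riccatiY_iterate_succ, map_sum, map_mul, map_natCast]
  · have hd : (riccatiY^[n] 1).natDegree < n + 1 := by
      refine Nat.lt_succ_of_le (natDegree_le_iff_coeff_eq_zero.2 fun b hb => ?_)
      rw [coeff_riccatiY_iterate, tco_eq_zero fun h' => by omega, C_0, zero_mul]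
    refine (eval₂_eq_sum_range' _ hd A).trans (sum_congr rfl fun b _ => ?_)
    rw [coeff_riccatiY_iterate, ← mul_assoc]
    congr 1
    simp

variable {ι : Type*} {V J : Finset ι} {lam : ι → ℕ} {w : ι → ℝ} {c : ℝ}

theorem sum_powerset_union (h : Disjoint V J) (F : Finset ι → ℤ) :
    ∑ A ∈ (V ∪ J).powerset, F A = ∑ A ∈ V.powerset, ∑ B ∈ J.powerset, F (A ∪ B) := by
  rw [← sum_product']
  refine sum_bij' (fun A _ => (A ∩ V, A ∩ J)) (fun p _ => p.1 ∪ p.2) ?_ ?_ ?_ ?_ ?_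
  · intro A hA
    simp
  · rintro ⟨A, B⟩ hA
    simp only [mem_product, mem_powerset] at hA ⊢
    exact union_subset_union hA.1 hA.2
  · intro A hA
    rw [← inter_union_distrib_left, inter_eq_left]
    exact mem_powerset.1 hA
  · rintro ⟨A, B⟩ hA
    simp only [mem_product, mem_powerset] at hA
    have h1 : B ∩ V = ∅ := disjoint_iff_inter_eq_empty.1
      (disjoint_of_subset_left hA.2 h.symm)
    have h2 : A ∩ J = ∅ := disjoint_iff_inter_eq_empty.1
      (disjoint_of_subset_left hA.1 h)
    simp only [union_inter_distrib_right, h1, h2, inter_eq_left.2 hA.1,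
      inter_eq_left.2 hA.2, union_empty, empty_union]
  · intro A hA
    rw [← inter_union_distrib_left, inter_eq_left.2 (mem_powerset.1 hA)]

/-- Splitting off vertices at pairwise different levels. -/
theorem sum_powerset_simple (hVJ : ∀ j ∈ J, ∀ k ∈ V, w j ≠ w k) (hJ : Set.InjOn w J)
    {f g : Finset ι → ℤ} {F G : ℕ → SetAlg (tw lam w)}
    (hf : ∀ A ⊆ V, ∀ B ⊆ J, f (A ∪ B) = F B.card A)
    (hg : ∀ A ⊆ V, ∀ B ⊆ J, g (A ∪ B) = G B.card A) :
    ∑ A ∈ (V ∪ J).powerset, twist lam w A ((V ∪ J) \ A) * (f A * g ((V ∪ J) \ A))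
      = (∑ j ∈ range (J.card + 1),
        (J.card.choose j : SetAlg (tw lam w)) * (F j * G (J.card - j))) V := by
  have hd : Disjoint V J := disjoint_left.2 fun j h1 h2 => hVJ j h2 j h1 rfl
  rw [sum_powerset_union hd, SetAlg.sum_apply]
  simp only [SetAlg.natCast_mul_apply]
  simp only [SetAlg.mul_apply, mul_sum]
  conv_rhs => rw [sum_comm]
  refine sum_congr rfl fun A hA => ?_
  rw [mem_powerset] at hA
  simp only [← nsmul_eq_mul]
  refine Eq.trans (sum_congr rfl fun B hB => ?_) (sum_powerset_apply_card (fun m =>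
    (∏ j ∈ A, ∏ k ∈ V \ A, tw lam w j k) * (F m A * G (J.card - m) (V \ A))))
  rw [mem_powerset] at hB
  have h1 : (V ∪ J) \ (A ∪ B) = V \ A ∪ J \ B := by grind
  have h2 : twist lam w (A ∪ B) (V \ A ∪ J \ B) = ∏ j ∈ A, ∏ k ∈ V \ A, tw lam w j k := by
    have hAB : Disjoint A B := Finset.disjoint_of_subset_left hA (Finset.disjoint_of_subset_right hB hd)
    have hVJ' : Disjoint (V \ A) (J \ B) := Finset.disjoint_of_subset_left Finset.sdiff_subset
      (disjoint_of_subset_right sdiff_subset hd)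
    rw [twist, prod_union hAB, prod_eq_one (s := B), mul_one]
    · refine prod_congr rfl fun j hj => ?_
      rw [prod_union hVJ', prod_eq_one (s := J \ B), mul_one]
      intro k hk
      rw [tw, if_neg (hVJ k (mem_sdiff.1 hk).1 j (hA hj)).symm]
    · intro j hj
      refine prod_eq_one fun k hk => ?_
      rw [tw, if_neg]
      rcases mem_union.1 hk with hk | hk
      · exact hVJ j (hB hj) k (mem_sdiff.1 hk).1
      · intro h
        have := hJ (hB hj) (mem_sdiff.1 hk).1 h
        exact (mem_sdiff.1 hk).2 (this ▸ hj)
  rw [h1, h2, hf A hA B hB, hg _ sdiff_subset _ sdiff_subset,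
    card_sdiff_of_subset hB]

theorem not_doubled_union_simple (hVJ : ∀ j ∈ J, ∀ k ∈ V, w j ≠ w k) (hJ : Set.InjOn w J)
    (hne : J.Nonempty) : ¬ Doubled (V ∪ J) lam w := by
  obtain ⟨j, hj⟩ := hne
  intro h
  have h1 : (V ∪ J).filter (fun k => lam k = lam j ∧ w k = w j) = {j} := by
    ext k
    simp only [mem_filter, mem_union, mem_singleton]
    constructor
    · rintro ⟨hk | hk, -, h2⟩
      · exact absurd h2.symm (hVJ j hj k hk)
      · exact hJ hk hj h2
    · rintro rfl
      exact ⟨Or.inr hj, rfl, rfl⟩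
  have := h (lam j) (w j)
  rw [h1] at this
  simp at this

/-- The numbers with simple vertices below the others, by recursion. -/
theorem tNum_uNum_union [Fintype ι] {T U : ℕ → SetAlg (tw lam w)} (hlam : ∀ k, 1 ≤ lam k)
    {K : SetAlg (tw lam w)} (hK : ∀ V, K V = kCount V lam fun j => w j - c)
    (hT0 : ∀ V, T 0 V = tNum lam w V) (hU0 : ∀ V, U 0 V = uNum lam w V)
    (hT : ∀ n, T (n + 1) = ∑ j ∈ range (n + 1),
      (n.choose j : SetAlg (tw lam w)) * (T j * T (n - j)) - if n = 0 then K else 0)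
    (hU : ∀ n, U (n + 1) = ∑ j ∈ range (n + 1),
      (n.choose j : SetAlg (tw lam w)) * (T j * U (n - j))) (n : ℕ) :
    ∀ V J : Finset ι, J.card = n → (∀ j ∈ J, lam j = 1) → (∀ j ∈ J, w j ≤ c) → (∀ j ∈ V, c < w j) →
      Set.InjOn w J → tNum lam w (V ∪ J) = T n V ∧ uNum lam w (V ∪ J) = U n V := by
  induction n using Nat.strong_induction_on with
  | _ n ih =>
  intro V J hn h1 hJc hVc hinj
  rcases n with _ | n
  · rw [card_eq_zero.1 hn, union_empty, hT0, hU0]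
    exact ⟨rfl, rfl⟩
  · obtain ⟨ξ, hξ, hmin⟩ := exists_min_image J w (card_pos.1 (by omega))
    have hJ : insert ξ (V ∪ J.erase ξ) = V ∪ J := by
      rw [← union_insert, insert_erase hξ]
    have hJ' : ∀ j ∈ J.erase ξ, w ξ < w j := fun j hj =>
      lt_of_le_of_ne (hmin j (mem_of_mem_erase hj)) fun h =>
        ne_of_mem_erase hj (hinj (mem_of_mem_erase hj) hξ h.symm)
    have hξV : ξ ∉ V ∪ J.erase ξ := by
      rw [mem_union, not_or]
      exact ⟨fun h => absurd (hVc ξ h) (hJc ξ hξ).not_gt, notMem_erase ξ J⟩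
    have hlow : ∀ j ∈ V ∪ J.erase ξ, w ξ < w j := fun j hj =>
      (mem_union.1 hj).elim (fun h => (hJc ξ hξ).trans_lt (hVc j h)) (hJ' j)
    have hVJ : ∀ j ∈ J.erase ξ, ∀ k ∈ V, w j ≠ w k := fun j hj k hk =>
      ((hJc j (mem_of_mem_erase hj)).trans_lt (hVc k hk)).ne
    have hcard : (J.erase ξ).card = n := by rw [card_erase_of_mem hξ, hn, Nat.add_sub_cancel]
    have hinj' : Set.InjOn w (J.erase ξ : Finset ι) :=
      hinj.mono (coe_subset.2 (erase_subset ξ J))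
    have key : ∀ A ⊆ V, ∀ B ⊆ J.erase ξ, tNum lam w (A ∪ B) = T B.card A ∧
        uNum lam w (A ∪ B) = U B.card A := fun A hA B hB => by
      have hBJ : ∀ j ∈ B, j ∈ J := fun j hj => mem_of_mem_erase (hB hj)
      exact ih B.card ((card_le_card hB).trans_lt (by omega)) A B rfl
        (fun j hj => h1 j (hBJ j hj)) (fun j hj => hJc j (hBJ j hj)) (fun j hj => hVc j (hA hj))
        (hinj.mono hBJ)
    rw [← hJ, tNum_insert (fun k _ => hlam k) hξV (h1 ξ hξ) hlow,
      uNum_insert (fun k _ => hlam k) hξV (h1 ξ hξ) hlow,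
      sum_powerset_simple hVJ hinj' (fun A hA B hB => (key A hA B hB).1)
        (fun A hA B hB => (key A hA B hB).1),
      sum_powerset_simple hVJ hinj' (fun A hA B hB => (key A hA B hB).1)
        (fun A hA B hB => (key A hA B hB).2), hcard, hT, hU, SetAlg.sub_apply]
    refine ⟨?_, rfl⟩
    congr 1
    split_ifs with h0
    · subst h0
      rw [card_eq_zero.1 hcard, union_empty, hK]
      exact kCount_shift (fun k _ => hlam k) hVc (hJc ξ hξ)
    · by_contra hne
      exact not_doubled_union_simple hVJ hinj' (card_pos.1 (by omega))
        (doubled_of_kCount_ne_zero hne).congr_sub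

variable {σ : Type*}

/-- The function `V ↦ kCount V`, with the levels measured from `c`. -/
def kAlg (lam : ι → ℕ) (w : ι → ℝ) (c : ℝ) : SetAlg (tw lam w) :=
  fun V => kCount V lam fun j => w j - c

/-- The function `V ↦ tNum V`. -/
def tAlg (lam : ι → ℕ) (w : ι → ℝ) : SetAlg (tw lam w) := fun V => tNum lam w V

/-- The function `V ↦ uNum V`. -/
def uAlg (lam : ι → ℕ) (w : ι → ℝ) : SetAlg (tw lam w) := fun V => uNum lam w V

theorem doubled_of_kAlg_ne_zero {V : Finset ι} (h : kAlg lam w c V ≠ 0) : Doubled V lam w :=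
  (doubled_of_kCount_ne_zero h).congr_sub

theorem kAlg_commute (f : SetAlg (tw lam w)) : Commute (kAlg lam w c) f :=
  SetAlg.commute_of_twist (fun A B hA => by
    have h := doubled_of_kAlg_ne_zero hA
    have h1 := twist_of_doubled_left (B := B) h
    have h2 := twist_of_doubled_right (A := B) h
    rw [twist] at h1 h2
    rw [h1, h2]) f

namespace SetAlg

/-- Restriction to the subsets of the image of an embedding. -/
def comap {τ : ι → ι → ℤ} {τ' : σ → σ → ℤ} (e : σ ↪ ι)
    (h : ∀ a b, τ' a b = τ (e a) (e b)) : SetAlg τ →+* SetAlg τ' where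
  toFun f := fun V => f (V.map e)
  map_zero' := rfl
  map_add' _ _ := rfl
  map_one' := by
    ext V
    change (if V.map e = ∅ then (1 : ℤ) else 0) = if V = ∅ then 1 else 0
    simp only [Finset.map_eq_empty]
  map_mul' f g := by
    ext V
    refine Eq.trans ?_ (mul_apply (τ := τ') _ _ V).symm
    refine Eq.trans (mul_apply _ _ _) ?_
    symm
    refine Finset.sum_bij' (fun A _ => A.map e) (fun A _ => V.filter fun j => e j ∈ A) ?_ ?_ ?_ ?_ ?_
    · simp_all
    · intro A hA
      exact Finset.mem_powerset.2 (Finset.filter_subset _ _)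
    · simp_all
    · grind
    · intro A hA
      simp only [← Finset.map_sdiff, Finset.prod_map, h]

end SetAlg

theorem comap_kAlg (e : σ ↪ ι) :
    SetAlg.comap (τ' := tw (lam ∘ e) (w ∘ e)) e (fun _ _ => rfl) (kAlg lam w c) = kAlg (lam ∘ e) (w ∘ e) c :=
  SetAlg.ext fun _ => kCount_map e

theorem comap_tAlg (e : σ ↪ ι) :
    SetAlg.comap (τ' := tw (lam ∘ e) (w ∘ e)) e (fun _ _ => rfl) (tAlg lam w) = tAlg (lam ∘ e) (w ∘ e) :=
  SetAlg.ext fun _ => tNum_map e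

theorem comap_uAlg (e : σ ↪ ι) :
    SetAlg.comap (τ' := tw (lam ∘ e) (w ∘ e)) e (fun _ _ => rfl) (uAlg lam w) = uAlg (lam ∘ e) (w ∘ e) :=
  SetAlg.ext fun _ => uNum_map e

/-- The coefficients of the generating function. -/
def cCoeff (lam : ι → ℕ) (w : ι → ℝ) (c : ℝ) (i j : ℕ) : SetAlg (tw lam w) :=
  (kAlg lam w c - 1) ^ i * (tAlg lam w ^ j * uAlg lam w)

theorem uNum_union_simple [Fintype ι] {e : σ ↪ ι} {V : Finset σ} {J : Finset ι} {L N : ℕ}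
    (hlam : ∀ k, 1 ≤ lam k)
    (h1 : ∀ j ∈ J, lam j = 1) (hJ : ∀ j ∈ J, w j ≤ c) (hV : ∀ j ∈ V, c < w (e j))
    (hinj : Set.InjOn w J) (hL : ∀ i j, L < i → cCoeff (lam ∘ e) (w ∘ e) c i j V = 0)
    (hN : ∀ i j, N < j → cCoeff (lam ∘ e) (w ∘ e) c i j V = 0) :
    uNum lam w (V.map e ∪ J) = ∑ i ∈ range (L + 1), ∑ b ∈ range (N + 1),
      tco J.card b * ((J.card - b) / 2).choose i * cCoeff (lam ∘ e) (w ∘ e) c i b V := by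
  obtain ⟨T, U, hT0, hU0, hT, hU, hUn⟩ := exists_riccati_sequences
    (kAlg_commute (c := c) (tAlg lam w))
  have h := (tNum_uNum_union (T := T) (U := fun n => U n * uAlg lam w) hlam (K := kAlg lam w c)
    (fun _ => rfl) (fun V => by rw [hT0]; rfl) (fun V => by rw [hU0, one_mul]; rfl) hT
    (fun n => by simp only [hU, sum_mul, mul_assoc]) J.card (V.map e) J rfl h1 hJ
    (by simpa using hV) hinj).2
  let res : SetAlg (tw lam w) →+* SetAlg (tw (lam ∘ e) (w ∘ e)) := SetAlg.comap e fun _ _ => rfl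
  have h2 : ∀ f : SetAlg (tw lam w), f (V.map e) = res f V := fun _ => rfl
  have h3 : ∀ p b, res (kAlg lam w c ^ p * tAlg lam w ^ b * uAlg lam w)
      = ∑ i ∈ range (p + 1), (p.choose i : SetAlg _) * cCoeff (lam ∘ e) (w ∘ e) c i b := by
    intro p b
    rw [map_mul, map_mul, map_pow, map_pow, comap_kAlg e, comap_tAlg e, comap_uAlg e, mul_assoc]
    have : kAlg (lam ∘ e) (w ∘ e) c = (kAlg (lam ∘ e) (w ∘ e) c - 1) + 1 := by abel
    conv_lhs => rw [this]
    rw [(Commute.one_right _).add_pow, sum_mul]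
    refine sum_congr rfl fun i _ => ?_
    rw [one_pow, mul_one, cCoeff, ← Nat.cast_comm, mul_assoc]
  have h4 : ∀ p b, res (kAlg lam w c ^ p * tAlg lam w ^ b * uAlg lam w) V
      = ∑ i ∈ range (L + 1), p.choose i * cCoeff (lam ∘ e) (w ∘ e) c i b V := by
    intro p b
    rw [h3, SetAlg.sum_apply]
    simp only [SetAlg.natCast_mul_apply]
    have hz : ∀ s : Finset ℕ, (∑ i ∈ s, (p.choose i : ℤ) * cCoeff (lam ∘ e) (w ∘ e) c i b V)
        = ∑ i ∈ s.filter (fun i => i ≤ p ∧ i ≤ L),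
          (p.choose i : ℤ) * cCoeff (lam ∘ e) (w ∘ e) c i b V := fun s => by
      refine (sum_filter_of_ne fun i _ hi => ⟨?_, ?_⟩).symm
      · by_contra hp
        rw [Nat.choose_eq_zero_of_lt (by omega)] at hi
        simp at hi
      · by_contra hp
        rw [hL i b (by omega)] at hi
        simp at hi
    rw [hz, hz (range (L + 1))]
    refine sum_congr ?_ fun _ _ => rfl
    ext i
    simp only [mem_filter, mem_range]
    omega
  rw [h, h2 (U J.card * _), hUn, sum_mul, map_sum, SetAlg.sum_apply, sum_comm]
  have h5 : ∀ b, res ((tco J.card b : SetAlg (tw lam w)) *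
      (kAlg lam w c ^ ((J.card - b) / 2) * tAlg lam w ^ b) * uAlg lam w) V
      = ∑ i ∈ range (L + 1), tco J.card b * ((J.card - b) / 2).choose i
        * cCoeff (lam ∘ e) (w ∘ e) c i b V := fun b => by
    rw [mul_assoc, map_mul, map_intCast, SetAlg.intCast_mul_apply, h4, mul_sum]
    simp only [mul_assoc]
  simp only [h5]
  have hz : ∀ s : Finset ℕ, (∑ b ∈ s, ∑ i ∈ range (L + 1), tco J.card b *
        ((J.card - b) / 2).choose i * cCoeff (lam ∘ e) (w ∘ e) c i b V)
      = ∑ b ∈ s.filter (fun b => b ≤ J.card ∧ b ≤ N), ∑ i ∈ range (L + 1), tco J.card b *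
        ((J.card - b) / 2).choose i * cCoeff (lam ∘ e) (w ∘ e) c i b V := fun s => by
    refine (sum_filter_of_ne fun b _ hb => ⟨?_, ?_⟩).symm
    · by_contra hp
      refine hb (sum_eq_zero fun i _ => ?_)
      rw [tco_eq_zero fun h' => hp h'.1]
      simp
    · by_contra hp
      refine hb (sum_eq_zero fun i _ => ?_)
      rw [hN i b (by omega), mul_zero]
  rw [hz, hz (range (N + 1))]
  refine sum_congr ?_ fun _ _ => rfl
  ext i
  simp only [mem_filter, mem_range]
  omega

theorem cCoeff_eq_zero_of_card_lt {V : Finset ι} {i j : ℕ} (h : V.card < j) :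
    cCoeff lam w c i j V = 0 := by
  rw [cCoeff]
  have h1 : ∀ S : Finset ι, S.card < j → (tAlg lam w ^ j * uAlg lam w) S = 0 := fun S hS =>
    SetAlg.mul_vanish (SetAlg.pow_vanish tNum_empty j) (b := 0) (by simp) S (by omega)
  exact SetAlg.mul_vanish (a := 0) (by simp) h1 V (by omega)

end

section
variable {σ : Type*} {lam : σ → ℕ} {w : σ → ℝ} {c : ℝ}

/-- The sign contributed by the labels of odd multiplicity. -/
def oddSign (lam : σ → ℕ) (w : σ → ℝ) (V : Finset σ) : ℤ :=
  ∏ o ∈ V.filter (fun j => Odd (lam j)), -∏ k ∈ V.erase o, tw lam w o k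

theorem oddSign_erase {V : Finset σ} {o : σ} (ho : o ∈ V.filter fun j => Odd (lam j))
    (h : Set.InjOn w {j | j ∈ V ∧ Odd (lam j)}) :
    oddSign lam w V = -(∏ k ∈ V.erase o, tw lam w o k) * oddSign lam w (V.erase o) := by
  rw [oddSign, oddSign, ← mul_prod_erase _ _ ho, filter_erase]
  congr 1
  refine prod_congr rfl fun p hp => ?_
  obtain ⟨hpo, hp⟩ := mem_erase.1 hp
  rw [← mul_prod_erase (V.erase p) (fun k => tw lam w p k) (a := o)
    (mem_erase.2 ⟨hpo.symm, (mem_filter.1 ho).1⟩), tw, if_neg, one_mul,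
    erase_right_comm]
  intro hw
  exact hpo (h (mem_filter.1 hp) (mem_filter.1 ho) hw)

theorem tAlg_pow_mul_uAlg [Fintype σ] (hlam : ∀ k, 1 ≤ lam k) (j : ℕ) :
    ∀ V : Finset σ, Set.InjOn w {j | j ∈ V ∧ Odd (lam j)} →
      Set.InjOn w {j | j ∈ V ∧ Even (lam j)} → (V.filter fun j => Odd (lam j)).card ≤ j →
      (tAlg lam w ^ j * uAlg lam w) V = if (V.filter fun j => Odd (lam j)).card = j then
        j.factorial * oddSign lam w V else 0 := by
  induction j with
  | zero =>
    intro V _ hE h0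
    have h0' := Nat.le_zero.1 h0
    have h1 : V.filter (fun j => Odd (lam j)) = ∅ := card_eq_zero.1 h0'
    have h2 : ∀ k ∈ V, Even (lam k) := fun k hk => by
      by_contra h
      exact eq_empty_iff_forall_notMem.1 h1 k
        (mem_filter.2 ⟨hk, Nat.not_even_iff_odd.1 h⟩)
    rw [pow_zero, one_mul, if_pos h0', oddSign, h1]
    refine (uNum_even hlam h2 fun a ha b hb => hE ⟨ha, h2 a ha⟩ ⟨hb, h2 b hb⟩).trans ?_
    simp
  | succ j ih =>
    intro V hO hE hV
    rw [pow_succ', mul_assoc, SetAlg.mul_apply]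
    have hsub : ∀ A ⊆ V, ((V \ A).filter fun j => Odd (lam j)).card
        + (A.filter fun j => Odd (lam j)).card = (V.filter fun j => Odd (lam j)).card := by
      intro A hA
      rw [← card_union_of_disjoint (disjoint_filter_filter sdiff_disjoint),
        ← filter_union, sdiff_union_of_subset hA]
    have hO' : ∀ A, Set.InjOn w {j | j ∈ V \ A ∧ Odd (lam j)} := fun A =>
      fun x hx y hy h =>
      hO ⟨(mem_sdiff.1 hx.1).1, hx.2⟩ ⟨(mem_sdiff.1 hy.1).1, hy.2⟩ h
    have hE' : ∀ A, Set.InjOn w {j | j ∈ V \ A ∧ Even (lam j)} := fun A =>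
      fun x hx y hy h =>
      hE ⟨(mem_sdiff.1 hx.1).1, hx.2⟩ ⟨(mem_sdiff.1 hy.1).1, hy.2⟩ h
    have hzero : ∀ A ⊆ V, tAlg lam w A * (tAlg lam w ^ j * uAlg lam w) (V \ A) ≠ 0 →
        (V.filter fun j => Odd (lam j)).card = j + 1 ∧ ∃ o, Odd (lam o) ∧ A = {o} := by
      intro A hA hne
      have h1 : tNum lam w A ≠ 0 := left_ne_zero_of_mul hne
      have h2 := right_ne_zero_of_mul hne
      obtain ⟨o, hoA, ho⟩ : ∃ o ∈ A, Odd (lam o) := by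
        by_contra hcon
        push Not at hcon
        refine h1 (if_neg ?_)
        rw [Nat.not_odd_iff_even]
        exact even_sum _ fun k hk => Nat.not_odd_iff_even.1 (hcon k hk)
      have h3 : 0 < (A.filter fun j => Odd (lam j)).card :=
        card_pos.2 ⟨o, mem_filter.2 ⟨hoA, ho⟩⟩
      have h4 := hsub A hA
      rw [ih (V \ A) (hO' A) (hE' A) (by omega)] at h2
      have h5 : ((V \ A).filter fun j => Odd (lam j)).card = j := by
        by_contra h
        exact h2 (if_neg h)
      refine ⟨by omega, o, ho, ?_⟩
      have h6 : ∀ k ∈ A, Odd (lam k) → k = o := fun k hk hk' =>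
        card_le_one.1 (show (A.filter fun j => Odd (lam j)).card ≤ 1 by omega) k
          (mem_filter.2 ⟨hk, hk'⟩) o (mem_filter.2 ⟨hoA, ho⟩)
      have h7 : ∀ k ∈ A.erase o, Even (lam k) := fun k hk => by
        by_contra h
        exact ne_of_mem_erase hk
          (h6 k (mem_of_mem_erase hk) (Nat.not_even_iff_odd.1 h))
      by_contra hA'
      have h8 : (A.erase o).Nonempty := by
        rw [nonempty_iff_ne_empty]
        intro h
        exact hA' (((erase_eq_empty_iff _ _).1 h).resolve_left
          (nonempty_iff_ne_empty.1 ⟨o, hoA⟩))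
      refine h1 ?_
      rw [← insert_erase hoA]
      exact tNum_insert_even hlam h8 h7 (fun a ha b hb => hE
        ⟨hA (mem_of_mem_erase ha), h7 a ha⟩ ⟨hA (mem_of_mem_erase hb), h7 b hb⟩) ho
    split_ifs with hc
    · rw [← sum_subset (s₁ := (V.filter fun j => Odd (lam j)).map
        ⟨fun o => ({o} : Finset σ), singleton_injective⟩)]
      · rw [sum_map, sum_congr rfl (g := fun _ => (j.factorial : ℤ) * oddSign lam w V),
          sum_const, hc, nsmul_eq_mul, Nat.factorial_succ]
        · push_cast
          ring
        · intro o ho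
          have hoV := (mem_filter.1 ho).1
          have h4 := hsub {o} (by simpa using hoV)
          rw [filter_singleton, if_pos (mem_filter.1 ho).2, card_singleton,
            hc] at h4
          have h5 := ih (V \ {o}) (hO' _) (hE' _) (by omega)
          rw [if_pos (by omega)] at h5
          dsimp only [Function.Embedding.coeFn_mk]
          rw [h5, prod_singleton, sdiff_singleton_eq_erase, oddSign_erase ho hO, tAlg,
            tNum_singleton (mem_filter.1 ho).2]
          ring
      · intro A hA
        obtain ⟨o, ho, rfl⟩ := mem_map.1 hA
        simpa using (mem_filter.1 ho).1
      · intro A hA hA'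
        by_contra hne
        obtain ⟨-, o, ho, rfl⟩ := hzero A (mem_powerset.1 hA) (right_ne_zero_of_mul hne)
        exact hA' (mem_map.2 ⟨o, mem_filter.2
          ⟨singleton_subset_iff.1 (mem_powerset.1 hA), ho⟩, rfl⟩)
    · refine sum_eq_zero fun A hA => ?_
      by_contra hne
      exact hc (hzero A (mem_powerset.1 hA) (right_ne_zero_of_mul hne)).1

/-- The labels with given multiplicity and level. -/
def cls (lam : σ → ℕ) (w : σ → ℝ) (V : Finset σ) (p : ℕ × ℝ) : Finset σ :=
  V.filter fun j => lam j = p.1 ∧ w j = p.2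

theorem mem_cls {V : Finset σ} {p : ℕ × ℝ} {j : σ} :
    j ∈ cls lam w V p ↔ j ∈ V ∧ lam j = p.1 ∧ w j = p.2 := mem_filter

theorem card_cls_sdiff {V A : Finset σ} (hA : A ⊆ V) (p : ℕ × ℝ) :
    (cls lam w (V \ A) p).card + (cls lam w A p).card = (cls lam w V p).card := by
  rw [cls, cls, cls, ← card_union_of_disjoint
    (disjoint_filter_filter sdiff_disjoint), ← filter_union,
    sdiff_union_of_subset hA]

theorem kAlg_sub_one_apply_empty : (kAlg lam w c - 1) ∅ = 0 := by
  rw [SetAlg.sub_apply, SetAlg.one_apply, if_pos rfl, kAlg, kCount_empty, sub_self]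

theorem doubled_of_kAlg_sub_one {A : Finset σ} (h : (kAlg lam w c - 1) A ≠ 0) :
    A ≠ ∅ ∧ Doubled A lam w := by
  have hA : A ≠ ∅ := by
    rintro rfl
    exact h kAlg_sub_one_apply_empty
  refine ⟨hA, doubled_of_kAlg_ne_zero (c := c) ?_⟩
  rwa [SetAlg.sub_apply, SetAlg.one_apply, if_neg hA, sub_zero] at h

variable [Fintype σ]

/-- All pairs of a multiplicity and a level. -/
def clsIdx (lam : σ → ℕ) (w : σ → ℝ) : Finset (ℕ × ℝ) :=
  univ.image fun j => (lam j, w j)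

/-- The number of disjoint pairs of labels with the same multiplicity and level. -/
def pairNum (lam : σ → ℕ) (w : σ → ℝ) (V : Finset σ) : ℕ :=
  ∑ p ∈ clsIdx lam w, (cls lam w V p).card / 2

/-- The number of pairings. -/
def pairWt (lam : σ → ℕ) (w : σ → ℝ) (V : Finset σ) : ℚ :=
  ∏ p ∈ clsIdx lam w, ((cls lam w V p).card.factorial : ℚ) / ((cls lam w V p).card / 2).factorial

theorem sum_card_cls (V : Finset σ) : ∑ p ∈ clsIdx lam w, (cls lam w V p).card = V.card := by
  rw [card_eq_sum_card_fiberwise (f := fun j => (lam j, w j)) (t := clsIdx lam w)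
    fun j _ => mem_image_of_mem _ (mem_univ j)]
  refine sum_congr rfl fun p _ => ?_
  congr 1
  ext j
  simp [cls, Prod.ext_iff]

theorem pairNum_sdiff {V A : Finset σ} (hA : A ⊆ V) (hd : Doubled A lam w) :
    2 * pairNum lam w (V \ A) + A.card = 2 * pairNum lam w V := by
  rw [← sum_card_cls (lam := lam) (w := w) A, pairNum, pairNum, mul_sum, mul_sum,
    ← sum_add_distrib]
  refine sum_congr rfl fun p _ => ?_
  have h1 := card_cls_sdiff (lam := lam) (w := w) hA p
  obtain ⟨r, hr⟩ := hd p.1 p.2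
  have hr' : (cls lam w A p).card = r + r := hr
  omega

theorem kAlg_pow_mul_eq_zero (G : SetAlg (tw lam w)) (i : ℕ) :
    ∀ V : Finset σ, pairNum lam w V < i → ((kAlg lam w c - 1) ^ i * G) V = 0 := by
  induction i with
  | zero => intro V h; omega
  | succ i ih =>
    intro V hV
    rw [pow_succ', mul_assoc]
    refine sum_eq_zero fun A hA => ?_
    by_cases h : (kAlg lam w c - 1) A = 0
    · rw [h, zero_mul, mul_zero]
    · obtain ⟨h1, h2⟩ := doubled_of_kAlg_sub_one h
      have h3 := pairNum_sdiff (mem_powerset.1 hA) h2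
      have h4 := card_pos.2 (nonempty_iff_ne_empty.2 h1)
      rw [ih _ (by omega), mul_zero, mul_zero]

theorem pair_weight (n : ℕ) : (n.choose 2 : ℚ) * (2 * ((n - 2).factorial / ((n - 2) / 2).factorial))
    = (n / 2 : ℕ) * (n.factorial / (n / 2).factorial) := by
  rcases n with _ | _ | n
  · simp
  · simp
  · have h1 : (n + 1 + 1) / 2 = n / 2 + 1 := by omega
    have h2 : ((n + 1 + 1).choose 2 : ℚ) * 2 = (n + 2) * (n + 1) := by
      rw [Nat.cast_choose_two]
      push_cast
      ring
    have h3 : ((n / 2 : ℕ).factorial : ℚ) ≠ 0 := by positivity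
    rw [h1, ← mul_assoc, h2, Nat.add_sub_cancel (n := n) (m := 2), Nat.factorial_succ, Nat.factorial_succ,
      Nat.factorial_succ]
    push_cast
    field_simp
    ring

theorem pairWt_sdiff {V A : Finset σ} {p : ℕ × ℝ} (hp : p ∈ clsIdx lam w) (hA : A ⊆ cls lam w V p)
    (h2 : A.card = 2) :
    ((cls lam w V p).card.choose 2 : ℚ) * (2 * pairWt lam w (V \ A))
      = ((cls lam w V p).card / 2 : ℕ) * pairWt lam w V := by
  have h0 : ∀ q, cls lam w A q = if q = p then A else ∅ := by
    intro q
    ext j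
    split_ifs with h
    · subst h
      rw [mem_cls]
      exact ⟨fun h => h.1, fun h => ⟨h, (mem_cls.1 (hA h)).2⟩⟩
    · simp only [mem_cls, notMem_empty, iff_false]
      rintro ⟨hj, h1, h2⟩
      obtain ⟨-, h3, h4⟩ := mem_cls.1 (hA hj)
      exact h (Prod.ext (h1.symm.trans h3) (h2.symm.trans h4))
  have hAV : A ⊆ V := hA.trans (filter_subset _ _)
  have h1 : ∀ q, (cls lam w (V \ A) q).card
      = if q = p then (cls lam w V p).card - 2 else (cls lam w V q).card := by
    intro q
    have := card_cls_sdiff (lam := lam) (w := w) hAV q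
    rw [h0] at this
    split_ifs at this ⊢ with h
    · subst h
      omega
    · simpa using this
  rw [pairWt, pairWt, ← mul_prod_erase _ _ hp, ← mul_prod_erase _ _ hp, h1, if_pos rfl]
  have h3 : ∏ q ∈ (clsIdx lam w).erase p, ((cls lam w (V \ A) q).card.factorial : ℚ)
        / ((cls lam w (V \ A) q).card / 2).factorial
      = ∏ q ∈ (clsIdx lam w).erase p, ((cls lam w V q).card.factorial : ℚ)
        / ((cls lam w V q).card / 2).factorial :=
    prod_congr rfl fun q hq => by rw [h1, if_neg (ne_of_mem_erase hq)]
  rw [h3]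
  linear_combination (pair_weight (cls lam w V p).card) * ∏ q ∈ (clsIdx lam w).erase p,
    ((cls lam w V q).card.factorial : ℚ) / ((cls lam w V q).card / 2).factorial

theorem kAlg_pow_mul (hlam : ∀ k, 1 ≤ lam k) (hw : ∀ k, c < w k) {G : SetAlg (tw lam w)}
    {Par : Finset σ → Prop} (hPar : ∀ V A, A ⊆ V → Par V → Doubled A lam w → Par (V \ A)) {v : ℤ}
    (hG : ∀ V, Par V → pairNum lam w V = 0 → G V = v) (i : ℕ) :
    ∀ V : Finset σ, Par V → pairNum lam w V = i →
      ((((kAlg lam w c - 1) ^ i * G) V : ℤ) : ℚ) = i.factorial * pairWt lam w V * v := by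
  induction i with
  | zero =>
    intro V hV h0
    rw [pow_zero, one_mul, hG V hV h0, pairWt, prod_eq_one]
    · simp
    · intro p hp
      have h1 := sum_eq_zero_iff.1 h0 p hp
      rw [h1]
      have h2 : (cls lam w V p).card = 0 ∨ (cls lam w V p).card = 1 := by omega
      rcases h2 with h2 | h2 <;> simp [h2]
  | succ i ih =>
    intro V hV hi
    have hpair : ∀ A ∈ V.powerset, ∀ p, A ⊆ cls lam w V p → A.card = 2 →
        (kAlg lam w c - 1) A = 2 ∧ Doubled A lam w := by
      intro A hA p hp h2
      obtain ⟨a, b, hab, rfl⟩ := card_eq_two.1 h2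
      have ha := (mem_cls.1 (hp (mem_insert_self a _))).2
      have hb := (mem_cls.1 (hp (mem_insert_of_mem (mem_singleton_self b)))).2
      have h3 : kAlg lam w c {a, b} = 2 :=
        kCount_pair hab (hb.1.trans ha.1.symm) (hb.2.trans ha.2.symm) (hlam a) (hw a)
      refine ⟨?_, doubled_of_kAlg_ne_zero (c := c) (by rw [h3]; norm_num)⟩
      rw [SetAlg.sub_apply, SetAlg.one_apply, if_neg (insert_ne_empty a _), h3, sub_zero]
    have hzero : ∀ A ⊆ V, (kAlg lam w c - 1) A * ((kAlg lam w c - 1) ^ i * G) (V \ A) ≠ 0 →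
        ∃ p ∈ clsIdx lam w, A ⊆ cls lam w V p ∧ A.card = 2 := by
      intro A hA hne
      obtain ⟨h1, h2⟩ := doubled_of_kAlg_sub_one (left_ne_zero_of_mul hne)
      have h3 : i ≤ pairNum lam w (V \ A) := by
        by_contra h
        exact right_ne_zero_of_mul hne (kAlg_pow_mul_eq_zero G i _ (by omega))
      have h4 := pairNum_sdiff hA h2
      obtain ⟨a, ha⟩ := nonempty_iff_ne_empty.2 h1
      have h5 : cls lam w A (lam a, w a) ⊆ A := filter_subset _ _
      obtain ⟨r, hr⟩ := h2 (lam a) (w a)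
      have hr' : (cls lam w A (lam a, w a)).card = r + r := hr
      have h6 : 0 < (cls lam w A (lam a, w a)).card :=
        card_pos.2 ⟨a, mem_cls.2 ⟨ha, rfl, rfl⟩⟩
      have h7 := card_le_card h5
      refine ⟨(lam a, w a), mem_image_of_mem _ (mem_univ a), ?_, by omega⟩
      rw [← eq_of_subset_of_card_le h5 (by omega)]
      exact filter_subset_filter _ hA
    rw [pow_succ', mul_assoc, SetAlg.mul_apply]
    rw [← sum_subset (s₁ := (clsIdx lam w).biUnion fun p =>
      (cls lam w V p).powersetCard 2), sum_biUnion]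
    · rw [Int.cast_sum]
      have h1 : ∀ p ∈ clsIdx lam w, ((∑ A ∈ (cls lam w V p).powersetCard 2,
          (∏ j ∈ A, ∏ k ∈ V \ A, tw lam w j k) * ((kAlg lam w c - 1) A *
            ((kAlg lam w c - 1) ^ i * G) (V \ A)) : ℤ) : ℚ)
          = ((cls lam w V p).card / 2 : ℕ) * (i.factorial * pairWt lam w V * v) := by
        intro p hp
        have h2 : ∀ A ∈ (cls lam w V p).powersetCard 2, (((∏ j ∈ A, ∏ k ∈ V \ A, tw lam w j k) *
            ((kAlg lam w c - 1) A * ((kAlg lam w c - 1) ^ i * G) (V \ A)) : ℤ) : ℚ)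
            = 2 * pairWt lam w (V \ A) * (i.factorial * v) := by
          intro A hA
          obtain ⟨hA1, hA2⟩ := mem_powersetCard.1 hA
          have hAV : A ⊆ V := hA1.trans (filter_subset _ _)
          obtain ⟨h3, h4⟩ := hpair A (mem_powerset.2 hAV) p hA1 hA2
          have h5 := pairNum_sdiff hAV h4
          have h6 : ∏ j ∈ A, ∏ k ∈ V \ A, tw lam w j k = 1 := twist_of_doubled_left h4
          rw [h3, h6, one_mul, Int.cast_mul, ih _ (hPar V A hAV hV h4) (by omega)]
          push_cast
          ring
        rw [Int.cast_sum]
        rcases ((cls lam w V p).powersetCard 2).eq_empty_or_nonempty with h0 | ⟨A₀, hA₀⟩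
        · have : (cls lam w V p).card < 2 := powersetCard_eq_empty.1 h0
          rw [h0, sum_empty, Nat.div_eq_of_lt this, Nat.cast_zero, zero_mul]
        · have h3 : ∀ A ∈ (cls lam w V p).powersetCard 2,
              2 * pairWt lam w (V \ A) * (i.factorial * v)
                = 2 * pairWt lam w (V \ A₀) * (i.factorial * (v : ℚ)) := by
            intro A hA
            have hcard : ((cls lam w V p).card.choose 2 : ℚ) ≠ 0 := by
              rw [← card_powersetCard]
              exact Nat.cast_ne_zero.2 (card_pos.2 ⟨A₀, hA₀⟩).ne'
            obtain ⟨hA1, hA2⟩ := mem_powersetCard.1 hA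
            obtain ⟨hA3, hA4⟩ := mem_powersetCard.1 hA₀
            congr 1
            exact mul_left_cancel₀ hcard
              ((pairWt_sdiff hp hA1 hA2).trans (pairWt_sdiff hp hA3 hA4).symm)
          obtain ⟨hA3, hA4⟩ := mem_powersetCard.1 hA₀
          rw [sum_congr rfl h2, sum_congr rfl h3, sum_const,
            card_powersetCard, nsmul_eq_mul, ← mul_assoc, pairWt_sdiff hp hA3 hA4]
          ring
      rw [sum_congr rfl h1, ← sum_mul, ← Nat.cast_sum]
      change ((pairNum lam w V : ℕ) : ℚ) * _ = _
      rw [hi, Nat.factorial_succ]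
      push_cast
      ring
    · intro p _ q _ hpq
      rw [Function.onFun, disjoint_left]
      intro A hA hA'
      obtain ⟨hA1, hA2⟩ := mem_powersetCard.1 hA
      obtain ⟨hA3, -⟩ := mem_powersetCard.1 hA'
      obtain ⟨a, ha⟩ := card_pos.1 (by omega : 0 < A.card)
      have h1 := (mem_cls.1 (hA1 ha)).2
      have h2 := (mem_cls.1 (hA3 ha)).2
      exact hpq (Prod.ext (h1.1.symm.trans h2.1) (h1.2.symm.trans h2.2))
    · intro A hA
      obtain ⟨p, -, hp⟩ := mem_biUnion.1 hA
      exact mem_powerset.2 ((mem_powersetCard.1 hp).1.trans (filter_subset _ _))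
    · grind

/-- The pairs of a multiplicity and a level taken by an odd number of labels. -/
def oddIdx (lam : σ → ℕ) (w : σ → ℝ) : Finset (ℕ × ℝ) :=
  (clsIdx lam w).filter fun p => Odd (cls lam w univ p).card

/-- The sign of a residual configuration. -/
def residualSign (R : Finset (ℕ × ℝ)) : ℤ :=
  ∏ p ∈ R.filter (fun p => Odd p.1), -∏ q ∈ R.erase p, tw Prod.fst Prod.snd p q

theorem residual_bij {V : Finset σ} (hpar : ∀ p, Odd (cls lam w V p).card ↔
    Odd (cls lam w univ p).card) (h0 : pairNum lam w V = 0) :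
    Set.InjOn (fun j => (lam j, w j)) V ∧ V.image (fun j => (lam j, w j)) = oddIdx lam w := by
  have hcard : ∀ p ∈ clsIdx lam w, (cls lam w V p).card ≤ 1 := fun p hp => by
    have h1 := sum_eq_zero_iff.1 h0 p hp
    omega
  have hidx : ∀ j, (lam j, w j) ∈ clsIdx lam w := fun j =>
    mem_image_of_mem _ (mem_univ j)
  refine ⟨fun a ha b hb hab => ?_, ?_⟩
  · have hab' := Prod.ext_iff.1 hab
    exact card_le_one.1 (hcard _ (hidx b)) a (mem_cls.2 ⟨ha, hab'⟩) b
      (mem_cls.2 ⟨hb, rfl, rfl⟩)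
  · ext p
    rw [mem_image, oddIdx, mem_filter]
    constructor
    · rintro ⟨j, hj, rfl⟩
      refine ⟨hidx j, (hpar _).1 ?_⟩
      have h1 : 0 < (cls lam w V (lam j, w j)).card :=
        card_pos.2 ⟨j, mem_cls.2 ⟨hj, rfl, rfl⟩⟩
      have h2 := hcard _ (hidx j)
      rw [show (cls lam w V (lam j, w j)).card = 1 by omega]
      exact odd_one
    · rintro ⟨hp, ho⟩
      obtain ⟨j, hj⟩ := card_pos.1 ((hpar p).2 ho).pos
      exact ⟨j, (mem_cls.1 hj).1, Prod.ext (mem_cls.1 hj).2.1 (mem_cls.1 hj).2.2⟩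

theorem residual_card {V : Finset σ} (hinj : Set.InjOn (fun j => (lam j, w j)) V)
    (him : V.image (fun j => (lam j, w j)) = oddIdx lam w) :
    (V.filter fun j => Odd (lam j)).card = ((oddIdx lam w).filter fun p => Odd p.1).card := by
  rw [← him, filter_image, card_image_of_injOn]
  exact hinj.mono (coe_subset.2 (filter_subset _ _))

theorem oddSign_residual {V : Finset σ} (hinj : Set.InjOn (fun j => (lam j, w j)) V)
    (him : V.image (fun j => (lam j, w j)) = oddIdx lam w) :
    oddSign lam w V = residualSign (oddIdx lam w) := by
  rw [residualSign, ← him, filter_image, prod_image, oddSign]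
  · refine prod_congr rfl fun o ho => ?_
    have hoV := (mem_filter.1 ho).1
    have h1 : (V.image fun j => (lam j, w j)).erase (lam o, w o)
        = (V.erase o).image fun j => (lam j, w j) := by
      ext p
      simp only [mem_erase, mem_image]
      constructor
      · rintro ⟨h1, j, hj, rfl⟩
        exact ⟨j, ⟨fun h => h1 (by rw [h]), hj⟩, rfl⟩
      · rintro ⟨j, ⟨h1, hj⟩, rfl⟩
        exact ⟨fun h => h1 (hinj hj hoV h), j, hj, rfl⟩
    rw [h1, prod_image (hinj.mono (coe_subset.2 (erase_subset o V)))]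
    rfl
  · exact hinj.mono (coe_subset.2 (filter_subset _ _))

theorem cCoeff_pairNum (hlam : ∀ k, 1 ≤ lam k) (hw : ∀ k, c < w k)
    (hodd : Set.InjOn Prod.snd {p | p ∈ oddIdx lam w ∧ Odd p.1})
    (heven : Set.InjOn Prod.snd {p | p ∈ oddIdx lam w ∧ Even p.1}) {j : ℕ}
    (hj : ((oddIdx lam w).filter fun p => Odd p.1).card ≤ j) :
    ((cCoeff lam w c (pairNum lam w univ) j univ : ℤ) : ℚ)
      = (pairNum lam w univ).factorial * pairWt lam w univ *
        ((if ((oddIdx lam w).filter fun p => Odd p.1).card = j then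
          j.factorial * residualSign (oddIdx lam w) else 0 : ℤ) : ℚ) := by
  refine kAlg_pow_mul hlam hw (Par := fun V => ∀ p, Odd (cls lam w V p).card ↔
    Odd (cls lam w univ p).card) (fun V A hA hV hd p => ?_) (fun V hV h0 => ?_) _ _
    (fun p => Iff.rfl) rfl
  · rw [← hV p, ← card_cls_sdiff hA p, Nat.odd_add]
    exact (iff_true_right (hd p.1 p.2)).symm
  · obtain ⟨h1, h2⟩ := residual_bij hV h0
    have h3 : ∀ a ∈ V, (lam a, w a) ∈ oddIdx lam w := fun a ha => by
      rw [← h2]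
      exact mem_image_of_mem _ ha
    rw [tAlg_pow_mul_uAlg hlam j V (fun a ha b hb hab => h1 ha.1 hb.1 ?_)
      (fun a ha b hb hab => h1 ha.1 hb.1 ?_) (by rwa [residual_card h1 h2]), residual_card h1 h2,
      oddSign_residual h1 h2]
    · exact hodd ⟨h3 a ha.1, ha.2⟩ ⟨h3 b hb.1, hb.2⟩ hab
    · exact heven ⟨h3 a ha.1, ha.2⟩ ⟨h3 b hb.1, hb.2⟩ hab

theorem cCoeff_eq_zero_of_pairNum_lt {V : Finset σ} {i j : ℕ} (h : pairNum lam w V < i) :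
    cCoeff lam w c i j V = 0 :=
  kAlg_pow_mul_eq_zero _ _ _ h

end

/-- The derivation of `p(tanh q) / cosh q` with respect to `q`. -/
def tanhDeriv : ℚ[X] →ₗ[ℚ] ℚ[X] :=
  (LinearMap.mulLeft ℚ (1 - X ^ 2)) ∘ₗ derivative - LinearMap.mulLeft ℚ X

/-- The `m`-th derivative at the origin of `p(tanh q) / cosh q`. -/
def tanhVal (m : ℕ) : ℚ[X] →ₗ[ℚ] ℚ :=
  Polynomial.lsum fun b => (tco m b : ℚ) • LinearMap.id

theorem tanhVal_monomial (m b : ℕ) (c : ℚ) : tanhVal m (monomial b c) = tco m b * c := by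
  simp [tanhVal, Polynomial.lsum_apply, Polynomial.sum_monomial_index]

theorem tanhDeriv_apply (p : ℚ[X]) : tanhDeriv p = (1 - X ^ 2) * derivative p - X * p := by
  simp [tanhDeriv]

theorem tanhVal_tanhDeriv (m : ℕ) (p : ℚ[X]) : tanhVal m (tanhDeriv p) = tanhVal (m + 1) p := by
  induction p using Polynomial.induction_on' with
  | add p q hp hq => rw [map_add, map_add, map_add, hp, hq]
  | monomial b c =>
    rw [tanhVal_monomial, tanhDeriv_apply, derivative_monomial, tco]
    have h : (1 - X ^ 2) * monomial (b - 1) (c * b) - X * monomial b c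
        = monomial (b - 1) (c * b) - monomial (b + 1) (c * (b + 1)) := by
      rcases b with _ | b
      · simp [← C_mul_X_eq_monomial]
      · rw [sub_mul, one_mul, X_pow_mul_monomial, X_mul_monomial, Nat.add_sub_cancel,
          show b + 1 + 1 = b + 2 from rfl, mul_add (c : ℚ), mul_one, map_add]
        ring
    rw [h, map_sub, tanhVal_monomial, tanhVal_monomial]
    push_cast
    ring

theorem hasDerivAt_tanh (q : ℝ) : HasDerivAt Real.tanh (1 - Real.tanh q ^ 2) q := by
  have h := (Real.hasDerivAt_sinh q).div (Real.hasDerivAt_cosh q) (Real.cosh_pos q).ne'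
  have h1 : Real.tanh = Real.sinh / Real.cosh := funext Real.tanh_eq_sinh_div_cosh
  rw [h1]
  refine h.congr_deriv ?_
  have := (Real.cosh_pos q).ne'
  rw [Pi.div_apply]
  field_simp

theorem hasDerivAt_tanhDeriv (p : ℚ[X]) (q : ℝ) :
    HasDerivAt (fun q => aeval (Real.tanh q) p / Real.cosh q)
      (aeval (Real.tanh q) (tanhDeriv p) / Real.cosh q) q := by
  have h0 : HasDerivAt (fun x : ℝ => aeval x p) (aeval (Real.tanh q) (derivative p))
      (Real.tanh q) := p.hasDerivAt_aeval _
  have h := (h0.comp q (hasDerivAt_tanh q)).div (Real.hasDerivAt_cosh q) (Real.cosh_pos q).ne'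
  refine h.congr_deriv ?_
  have h2 := (Real.cosh_pos q).ne'
  have h3 : Real.sinh q = Real.tanh q * Real.cosh q := by
    rw [Real.tanh_eq_sinh_div_cosh]
    field_simp
  rw [tanhDeriv_apply, h3]
  simp only [map_sub, map_mul, map_one, map_pow, aeval_X, Function.comp]
  field_simp

theorem contDiff_tanhDeriv (p : ℚ[X]) (n : ℕ) :
    ContDiff ℝ n fun q => aeval (Real.tanh q) p / Real.cosh q := by
  have h1 : ContDiff ℝ n Real.tanh := by
    rw [show Real.tanh = fun q => Real.sinh q / Real.cosh q from
      funext Real.tanh_eq_sinh_div_cosh]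
    exact Real.contDiff_sinh.div Real.contDiff_cosh fun q => (Real.cosh_pos q).ne'
  exact ((p.contDiff_aeval n).comp h1).div Real.contDiff_cosh fun q => (Real.cosh_pos q).ne'

theorem iteratedDeriv_tanhDeriv (p : ℚ[X]) (m : ℕ) :
    iteratedDeriv m (fun q => aeval (Real.tanh q) p / Real.cosh q) 0 = (tanhVal m p : ℝ) := by
  induction m generalizing p with
  | zero =>
    rw [iteratedDeriv_zero, Real.tanh_zero, Real.cosh_zero, div_one, aeval_def, eval₂_at_zero]
    induction p using Polynomial.induction_on' with
    | add p q hp hq => rw [coeff_add, map_add, map_add, hp, hq, Rat.cast_add]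
    | monomial b c =>
      rw [tanhVal_monomial, coeff_monomial, tco]
      split_ifs <;> simp
  | succ m ih =>
    rw [iteratedDeriv_succ', funext fun q => (hasDerivAt_tanhDeriv p q).deriv, ih,
      tanhVal_tanhDeriv]

theorem iteratedDeriv_mul_self {f : ℝ → ℝ} (m : ℕ) (hf : ∀ n : ℕ, ContDiff ℝ n f) :
    iteratedDeriv m (fun q => q * f q) 0 = m * iteratedDeriv (m - 1) f 0 := by
  rw [iteratedDeriv_fun_mul (f := fun q => q) contDiff_id.contDiffAt (hf m).contDiffAt]
  have h : ∀ i, iteratedDeriv i (fun q : ℝ => q) 0 = if i = 1 then 1 else 0 := by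
    intro i
    rcases i with _ | _ | i
    · simp
    · simp [iteratedDeriv_one]
    · rw [iteratedDeriv_succ', if_neg (by omega)]
      simp only [deriv_id'']
      simp [iteratedDeriv_const]
  rcases m with _ | m
  · simp
  · simp_all

theorem iteratedDeriv_pow_mul_tanh (p : ℚ[X]) (a m : ℕ) :
    iteratedDeriv m (fun q => q ^ a * (aeval (Real.tanh q) p / Real.cosh q)) 0
      = (m.descFactorial a * tanhVal (m - a) p : ℚ) := by
  induction a generalizing m with
  | zero => simpa using iteratedDeriv_tanhDeriv p m
  | succ a ih =>
    have h : (fun q : ℝ => q ^ (a + 1) * (aeval (Real.tanh q) p / Real.cosh q))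
        = fun q => q * (q ^ a * (aeval (Real.tanh q) p / Real.cosh q)) := by
      funext q
      ring
    rw [h, iteratedDeriv_mul_self, ih]
    · rcases m with _ | m
      · simp
      · rw [Nat.succ_descFactorial_succ, Nat.add_sub_cancel, Nat.add_sub_add_right]
        push_cast
        ring
    · exact fun n => (contDiff_id.pow a).mul (contDiff_tanhDeriv p n)

/-- The coefficients in the first variable of the polynomials `Q` for which the derivatives of
`Q(q, tanh q) / cosh q` at the origin are `tco m j * ((m - j) / 2).choose i`. -/
def binPoly (j : ℕ) : ℕ → ℕ → ℚ[X]
  | 0, a => if a = 0 then X ^ j else 0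
  | i + 1, a => C (1 / (2 * (i + 1)) : ℚ) * (C (a - (2 * i + j) : ℚ) * binPoly j i a +
      if a = 0 then 0 else tanhDeriv (binPoly j i (a - 1)))

theorem binPoly_eq_zero {j i a : ℕ} (h : i < a) : binPoly j i a = 0 := by
  induction i generalizing a with
  | zero => rw [binPoly, if_neg h.ne']
  | succ i ih => rw [binPoly, ih (by omega), ih (by omega), map_zero, ite_self]; simp

theorem coeff_tanhDeriv (p : ℚ[X]) (b : ℕ) : (tanhDeriv p).coeff (b + 1)
    = (b + 2) * p.coeff (b + 2) - (b + 1) * p.coeff b := by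
  rw [tanhDeriv_apply, coeff_sub, sub_mul, one_mul, coeff_sub, coeff_derivative, coeff_X_mul,
    coeff_X_pow_mul']
  rcases b with _ | b
  · simp
    ring
  · rw [if_pos (by omega), coeff_derivative, show b + 1 + 1 - 2 + 1 = b + 1 by omega,
      show b + 1 + 1 - 2 = b by omega]
    push_cast
    ring

theorem binPoly_coeff_self (j i b : ℕ) (hb : i + j ≤ b) : (binPoly j i i).coeff b
    = if b = i + j then (-1 / 2 : ℚ) ^ i * (i + j).factorial / (i.factorial * j.factorial)
      else 0 := by
  induction i generalizing b with
  | zero =>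
    rw [binPoly, if_pos rfl, coeff_X_pow, zero_add]
    have := Nat.cast_ne_zero (R := ℚ).2 j.factorial_ne_zero
    split_ifs
    · field_simp
      simp
    · rfl
  | succ i ih =>
    obtain ⟨b, rfl⟩ : ∃ b', b = b' + 1 := ⟨b - 1, by omega⟩
    rw [binPoly, binPoly_eq_zero (Nat.lt_succ_self i), mul_zero, zero_add, if_neg (by omega),
      Nat.add_sub_cancel, coeff_C_mul, coeff_tanhDeriv, ih _ (by omega), ih _ (by omega),
      if_neg (by omega), show i + 1 + j = (i + j) + 1 by ring]
    by_cases h : b = i + j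
    · rw [if_pos h, if_pos (by omega), h, Nat.factorial_succ, Nat.factorial_succ, pow_succ]
      have := Nat.cast_ne_zero (R := ℚ).2 j.factorial_ne_zero
      have := Nat.cast_ne_zero (R := ℚ).2 i.factorial_ne_zero
      have : (i : ℚ) + 1 ≠ 0 := by positivity
      push_cast
      field_simp
      ring
    · rw [if_neg h, if_neg (by omega)]
      ring

theorem sum_binPoly (m j i : ℕ) :
    ∑ a ∈ range (i + 1), (m.descFactorial a : ℚ) * tanhVal (m - a) (binPoly j i a)
      = tco m j * ((m - j) / 2).choose i := by
  induction i with
  | zero =>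
    rw [sum_range_one, binPoly, if_pos rfl, ← monomial_one_right_eq_X_pow,
      tanhVal_monomial]
    simp
  | succ i ih =>
    have h1 : ∀ a ∈ range (i + 1 + 1), (m.descFactorial a : ℚ) *
        tanhVal (m - a) (binPoly j (i + 1) a) = 1 / (2 * (i + 1)) * ((m.descFactorial a *
          ((a - (2 * i + j)) * tanhVal (m - a) (binPoly j i a))) +
          if a = 0 then 0 else m.descFactorial a *
            tanhVal (m - a + 1) (binPoly j i (a - 1))) := by
      intro a _
      rw [binPoly, ← smul_eq_C_mul, ← smul_eq_C_mul, map_smul, map_add, map_smul, smul_eq_mul,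
        smul_eq_mul]
      split_ifs with h
      · rw [map_zero]
        ring
      · rw [tanhVal_tanhDeriv]
        ring
    rw [sum_congr rfl h1, ← mul_sum, sum_add_distrib,
      sum_range_succ (fun a => (m.descFactorial a : ℚ) * _), binPoly_eq_zero (by omega),
      map_zero, mul_zero, mul_zero, add_zero,
      sum_range_succ' (fun a => if a = 0 then (0 : ℚ) else _), if_pos rfl, add_zero,
      ← sum_add_distrib]
    have h2 : ∀ a ∈ range (i + 1), ((m.descFactorial a : ℚ) *
        ((a - (2 * i + j)) * tanhVal (m - a) (binPoly j i a)) +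
          if a + 1 = 0 then 0 else m.descFactorial (a + 1) *
            tanhVal (m - (a + 1) + 1) (binPoly j i (a + 1 - 1)))
        = (m - (2 * i + j)) * (m.descFactorial a * tanhVal (m - a) (binPoly j i a)) := by
      intro a _
      rw [if_neg (by omega), Nat.add_sub_cancel, Nat.descFactorial_succ]
      rcases lt_trichotomy m a with h | h | h
      · simp [Nat.descFactorial_eq_zero_iff_lt.2 h]
      · subst h
        simp
        ring
      · rw [show m - (a + 1) + 1 = m - a by omega]
        push_cast [Nat.cast_sub h.le]
        ring
    rw [sum_congr rfl h2, ← mul_sum, ih]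
    by_cases h : j ≤ m ∧ Even (m - j)
    · obtain ⟨t, ht⟩ := h.2
      obtain rfl : m = j + (t + t) := by omega
      rw [show (j + (t + t) - j) / 2 = t by omega]
      have h3 := Nat.choose_succ_right_eq t i
      have h4 : (t.choose (i + 1) : ℚ) * (i + 1) = t.choose i * (t - i) := by
        rcases le_or_gt i t with h5 | h5
        · rw [← Nat.cast_sub h5]
          exact_mod_cast h3
        · rw [Nat.choose_eq_zero_of_lt h5, Nat.choose_eq_zero_of_lt (by omega)]
          simp
      have h5 : (i : ℚ) + 1 ≠ 0 := by positivity
      field_simp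
      push_cast
      linear_combination -2 * (tco (j + (t + t)) j : ℚ) * h4
    · rw [tco_eq_zero h]
      simp

/-- The polynomial in two variables with the given coefficients in the first variable. -/
def toMv (n : ℕ) (p : ℕ → ℚ[X]) : MvPolynomial (Fin 2) ℚ :=
  ∑ a ∈ range n, MvPolynomial.X 0 ^ a * aeval (MvPolynomial.X 1) (p a)

theorem coeff_toMv (n : ℕ) (p : ℕ → ℚ[X]) (v : Fin 2 →₀ ℕ) :
    MvPolynomial.coeff v (toMv n p) = if v 0 < n then (p (v 0)).coeff (v 1) else 0 := by
  have h : ∀ (a : ℕ) (q : ℚ[X]), MvPolynomial.coeff v (MvPolynomial.X 0 ^ a *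
      aeval (MvPolynomial.X 1 : MvPolynomial (Fin 2) ℚ) q) = if v 0 = a then q.coeff (v 1)
        else 0 := by
    intro a q
    induction q using Polynomial.induction_on' with
    | add p q hp hq =>
      rw [map_add, mul_add, MvPolynomial.coeff_add, hp, hq, coeff_add]
      split_ifs <;> simp
    | monomial b c =>
      rw [aeval_monomial, MvPolynomial.algebraMap_eq, mul_left_comm, MvPolynomial.coeff_C_mul,
        MvPolynomial.X_pow_eq_monomial, MvPolynomial.X_pow_eq_monomial,
        MvPolynomial.monomial_mul, MvPolynomial.coeff_monomial, coeff_monomial]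
      have : (Finsupp.single (0 : Fin 2) a + Finsupp.single 1 b = v) ↔ (v 0 = a ∧ b = v 1) := by
        rw [Finsupp.ext_iff, Fin.forall_fin_two]
        simp [eq_comm]
      simp only [this, mul_one]
      split_ifs <;> simp_all
  rw [toMv, MvPolynomial.coeff_sum, sum_congr rfl fun a _ => h a (p a),
    sum_ite_eq]
  simp

theorem iteratedDeriv_toMv (n : ℕ) (p : ℕ → ℚ[X]) (m : ℕ) :
    iteratedDeriv m (fun q : ℝ => MvPolynomial.aeval ![q, Real.tanh q] (toMv n p) /
      Real.cosh q) 0 = (∑ a ∈ range n, m.descFactorial a * tanhVal (m - a) (p a) : ℚ) := by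
  have h : (fun q : ℝ => MvPolynomial.aeval ![q, Real.tanh q] (toMv n p) / Real.cosh q)
      = fun q => ∑ a ∈ range n,
        q ^ a * (aeval (Real.tanh q) (p a) / Real.cosh q) := by
    funext q
    rw [toMv, map_sum, sum_div]
    refine sum_congr rfl fun a _ => ?_
    rw [map_mul, map_pow, MvPolynomial.aeval_X, ← aeval_algHom_apply, MvPolynomial.aeval_X,
      mul_div_assoc]
    rfl
  rw [h, iteratedDeriv_fun_sum (f := fun a q => q ^ a *
    (aeval (Real.tanh q) (p a) / Real.cosh q)) fun a _ => ((contDiff_id.pow a).mul (contDiff_tanhDeriv (p a) m)).contDiffAt]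
  push_cast
  refine sum_congr rfl fun a _ => (iteratedDeriv_pow_mul_tanh _ _ _).trans ?_
  push_cast
  rfl

theorem exists_tanh_poly (L N s : ℕ) (c : ℕ → ℕ → ℚ) (hsN : s ≤ N)
    (hc : ∀ j, s < j → c L j = 0) :
    ∃ Q : MvPolynomial (Fin 2) ℚ,
      (∀ m : ℕ, iteratedDeriv m (fun q : ℝ => (MvPolynomial.aeval ![q, Real.tanh q]) Q /
          Real.cosh q) 0 = (∑ i ∈ range (L + 1), ∑ j ∈ range (N + 1),
            tco m j * ((m - j) / 2).choose i * c i j : ℚ)) ∧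
      MvPolynomial.degreeOf 0 Q ≤ L ∧
      (∀ j : ℕ, L + s < j →
        MvPolynomial.coeff (Finsupp.single (0 : Fin 2) L + Finsupp.single 1 j) Q = 0) ∧
      MvPolynomial.coeff (Finsupp.single (0 : Fin 2) L + Finsupp.single 1 (L + s)) Q
        = c L s * ((-1 / 2 : ℚ) ^ L * (L + s).factorial / (L.factorial * s.factorial)) := by
  set p : ℕ → ℚ[X] := fun a => ∑ i ∈ range (L + 1), ∑ j ∈ range (N + 1),
    C (c i j) * binPoly j i a with hp
  have hco : ∀ b, MvPolynomial.coeff (Finsupp.single (0 : Fin 2) L + Finsupp.single 1 b)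
      (toMv (L + 1) p) = ∑ j ∈ range (N + 1), c L j * (binPoly j L L).coeff b := by
    intro b
    rw [coeff_toMv]
    simp only [Finsupp.add_apply, Finsupp.single_eq_same, ne_eq, one_ne_zero, zero_ne_one,
      not_false_eq_true, Finsupp.single_eq_of_ne, add_zero, zero_add, hp, finsetSum_coeff,
      coeff_C_mul, Nat.lt_succ_self, if_true]
    rw [sum_eq_single_of_mem L (self_mem_range_succ L)]
    intro i hi hiL
    refine sum_eq_zero fun j _ => ?_
    rw [binPoly_eq_zero (by have := mem_range.1 hi; omega), coeff_zero, mul_zero]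
  refine ⟨toMv (L + 1) p, fun m => ?_, ?_, fun b hb => ?_, ?_⟩
  · rw [iteratedDeriv_toMv]
    congr 1
    simp only [hp, map_sum, ← smul_eq_C_mul, map_smul, smul_eq_mul, mul_sum]
    rw [sum_comm]
    refine sum_congr rfl fun i hi => ?_
    rw [sum_comm]
    refine sum_congr rfl fun j _ => ?_
    rw [← sum_binPoly, sum_mul]
    have h : range (i + 1) ⊆ range (L + 1) := by
      have := mem_range.1 hi
      exact range_subset_range.2 (by omega)
    rw [← sum_subset h]
    · exact sum_congr rfl fun a _ => by ring
    · intro a _ ha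
      rw [binPoly_eq_zero (by have := mt mem_range.2 ha; omega), map_zero, mul_zero,
        mul_zero]
  · refine MvPolynomial.degreeOf_le_iff.2 fun v hv => ?_
    rw [MvPolynomial.mem_support_iff, coeff_toMv] at hv
    by_contra h
    exact hv (if_neg (by omega))
  · rw [hco]
    refine sum_eq_zero fun j _ => ?_
    rcases lt_or_ge s j with h | h
    · rw [hc j h, zero_mul]
    · rw [binPoly_coeff_self _ _ _ (by omega), if_neg (by omega), mul_zero]
  · rw [hco, sum_eq_single_of_mem s (mem_range.2 (by omega)),
      binPoly_coeff_self _ _ _ le_rfl, if_pos rfl]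
    intro j _ hj
    rcases lt_or_ge s j with h | h
    · rw [hc j h, zero_mul]
    · rw [binPoly_coeff_self _ _ _ (by omega), if_neg (by omega), mul_zero]

section
variable {ι : Type*} {lam : ι → ℕ} {w : ι → ℝ} {P : ℝ[X]} {x : ι → ℂ}

/-- The complexification of a real polynomial. -/
def cpx (P : ℝ[X]) : ℂ[X] := P.map (algebraMap ℝ ℂ)

/-- The critical points of given multiplicity and value. -/
def crit (P : ℝ[X]) (p : ℕ × ℝ) : Set ℂ :=
  {z | (derivative (cpx P)).rootMultiplicity z = p.1 ∧ (cpx P).eval z = (p.2 : ℂ)}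

/-- Labellings of the critical points by multiplicities and values. -/
def Lab (lam : ι → ℕ) (w : ι → ℝ) (P : ℝ[X]) (x : ι → ℂ) : Prop :=
  Function.Injective x ∧ ∀ j, x j ∈ crit P (lam j, w j)

theorem derivative_cpx (P : ℝ[X]) : derivative (cpx P) = cpx (derivative P) := derivative_map _ _

theorem cpx_ne_zero (hP : P ≠ 0) : cpx P ≠ 0 :=
  (Polynomial.map_ne_zero_iff (algebraMap ℝ ℂ).injective).2 hP

theorem derivative_ne_zero_of_natDegree {n : ℕ} (hd : P.natDegree = n + 1) :
    derivative P ≠ 0 := fun h => by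
  have := derivative_eq_zero.1 h
  omega

theorem natDegree_cpx (P : ℝ[X]) : (cpx P).natDegree = P.natDegree := natDegree_map _

theorem cpx_sub_C_ne_zero {n : ℕ} (hd : P.natDegree = n + 1) (v : ℂ) :
    cpx P - C v ≠ 0 := fun h => by
  have := congrArg natDegree (sub_eq_zero.1 h)
  rw [natDegree_cpx, hd, natDegree_C] at this
  omega

theorem rootMultiplicity_derivative_cpx {z v : ℂ} (h : (cpx P).eval z = v) :
    (derivative (cpx P)).rootMultiplicity z = (cpx P - C v).rootMultiplicity z - 1 := by
  rw [← derivative_rootMultiplicity_of_root (p := cpx P - C v) (by simp [h]), derivative_sub,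
    derivative_C, sub_zero]

theorem crit_finite {n : ℕ} (hd : P.natDegree = n + 1) {p : ℕ × ℝ} (hp : 1 ≤ p.1) :
    (crit P p).Finite := by
  have h0 : derivative (cpx P) ≠ 0 := by
    rw [derivative_cpx]
    exact cpx_ne_zero (derivative_ne_zero_of_natDegree hd)
  refine (derivative (cpx P)).roots.toFinset.finite_toSet.subset fun z hz => ?_
  rw [mem_coe, Multiset.mem_toFinset, mem_roots h0]
  refine (rootMultiplicity_pos h0).1 ?_
  rw [hz.1]
  exact hp

theorem count_redRamType {n : ℕ} (hd : P.natDegree = n + 1) {a : ℕ} (ha : 1 ≤ a) (v : ℝ) :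
    (redRamType P v).count a = (crit P (a, v)).ncard := by
  have h0 := cpx_sub_C_ne_zero hd v
  rw [redRamType, ramType, Multiset.count_filter_of_pos (by omega), Multiset.map_map,
    Multiset.count_map, ← filter_val, ← card_def, ← Set.ncard_coe_finset]
  congr 1
  ext z
  rw [mem_coe, mem_filter, Multiset.mem_toFinset]
  change z ∈ (cpx P - C (v : ℂ)).roots ∧ a = (cpx P - C (v : ℂ)).rootMultiplicity z - 1 ↔ _
  rw [mem_roots h0, IsRoot.def, eval_sub, eval_C, sub_eq_zero]
  exact ⟨fun h => ⟨(rootMultiplicity_derivative_cpx h.1).trans h.2.symm, h.1⟩,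
    fun h => ⟨h.2, h.1.symm.trans (rootMultiplicity_derivative_cpx h.2)⟩⟩

variable [Fintype ι]

theorem Lab.derivative_eq (hx : Lab lam w P x) (hm : P.Monic)
    (hd : P.natDegree = ∑ j, lam j + 1) :
    derivative (cpx P) = wpoly univ lam x (P.natDegree : ℂ) 0 := by
  have h0 : derivative (cpx P) ≠ 0 := by
    rw [derivative_cpx]
    exact cpx_ne_zero (derivative_ne_zero_of_natDegree hd)
  have h1 : vprod univ lam x ∣ derivative (cpx P) := by
    refine prod_dvd_of_coprime (fun j _ k _ hjk => ?_) fun j _ => ?_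
    · exact (pairwise_coprime_X_sub_C hx.1 hjk).pow
    · rw [show lam j = _ from (hx.2 j).1.symm]
      exact pow_rootMultiplicity_dvd _ _
  obtain ⟨q, hq⟩ := h1
  have hq0 : q ≠ 0 := by
    rintro rfl
    exact h0 (by rw [hq, mul_zero])
  have h2 : (derivative (cpx P)).natDegree = ∑ j, lam j := by
    rw [natDegree_derivative, natDegree_cpx, hd, Nat.add_sub_cancel]
  have h3 : q.natDegree = 0 := by
    have := congrArg natDegree hq
    rw [(vprod_monic _ _ _).natDegree_mul' hq0, natDegree_vprod, h2] at this
    omega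
  obtain ⟨c, rfl⟩ := natDegree_eq_zero.1 h3
  have h4 : c = (P.natDegree : ℂ) := by
    have h5 := congrArg leadingCoeff hq
    rw [leadingCoeff_mul, (vprod_monic _ _ _).leadingCoeff, one_mul, leadingCoeff_C] at h5
    rw [← h5, leadingCoeff, h2, coeff_derivative, ← hd, cpx, coeff_map, coeff_natDegree,
      hm.leadingCoeff, hd]
    push_cast
    ring
  rw [hq, wpoly, h4, pow_zero, mul_one, mul_comm]

theorem Lab.rootMultiplicity (hx : Lab lam w P x) (hm : P.Monic)
    (hd : P.natDegree = ∑ j, lam j + 1) (z : ℂ) :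
    (derivative (cpx P)).rootMultiplicity z = ∑ k with x k = z, lam k := by
  rw [hx.derivative_eq hm hd,
    rootMultiplicity_wpoly (Nat.cast_ne_zero.2 (hd ▸ Nat.succ_ne_zero (∑ j, lam j)))]
  simp

theorem Lab.exists_eq (hx : Lab lam w P x) (hm : P.Monic) (hd : P.natDegree = ∑ j, lam j + 1)
    {z : ℂ} (hz : (derivative (cpx P)).rootMultiplicity z ≠ 0) : ∃ k, x k = z := by
  rw [hx.rootMultiplicity hm hd] at hz
  obtain ⟨k, hk, _⟩ := exists_ne_zero_of_sum_ne_zero hz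
  exact ⟨k, (mem_filter.1 hk).2⟩

theorem Lab.crit_eq (hx : Lab lam w P x) (hm : P.Monic) (hd : P.natDegree = ∑ j, lam j + 1)
    {p : ℕ × ℝ} (hp : 1 ≤ p.1) : crit P p = x '' cls lam w univ p := by
  ext z
  constructor
  · intro hz
    obtain ⟨k, rfl⟩ := hx.exists_eq hm hd (z := z) (by rw [hz.1]; omega)
    refine ⟨k, mem_cls.2 ⟨mem_univ k, (hx.2 k).1.symm.trans hz.1, ?_⟩, rfl⟩
    exact_mod_cast (hx.2 k).2.symm.trans hz.2
  · rintro ⟨k, hk, rfl⟩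
    obtain ⟨_, h1, h2⟩ := mem_cls.1 hk
    rw [show p = (lam k, w k) from Prod.ext h1.symm h2.symm]
    exact hx.2 k

theorem count_map_level (v : ℝ) (a : ℕ) :
    ((univ.filter fun j => w j = v).val.map lam).count a
      = (cls lam w univ (a, v)).card := by
  rw [Multiset.count_map, ← filter_val, ← card_def, filter_filter]
  congr 1
  ext j
  simp [mem_cls, and_comm, eq_comm]

theorem Lab.redRamType_eq (hlam : ∀ j, 1 ≤ lam j) (hx : Lab lam w P x) (hm : P.Monic)
    (hd : P.natDegree = ∑ j, lam j + 1) (v : ℝ) :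
    redRamType P v = (univ.filter fun j => w j = v).val.map lam := by
  ext a
  rw [count_map_level]
  rcases a with _ | a
  · rw [redRamType, Multiset.count_filter_of_neg (by simp), eq_comm, card_eq_zero]
    refine eq_empty_of_forall_notMem fun j hj => ?_
    have h1 := hlam j
    have h2 := (mem_cls.1 hj).2.1
    simp only at h2
    omega
  · rw [count_redRamType hd (by omega), hx.crit_eq hm hd (by simp),
      Set.ncard_image_of_injective _ hx.1, Set.ncard_coe_finset]

theorem crit_ncard (hlam : ∀ j, 1 ≤ lam j) (hd : P.natDegree = ∑ j, lam j + 1)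
    (h : ∀ j, redRamType P (w j) = (univ.filter fun i => w i = w j).val.map lam) (j : ι) :
    (crit P (lam j, w j)).ncard = (cls lam w univ (lam j, w j)).card := by
  rw [← count_redRamType hd (hlam j), h, count_map_level]

theorem exists_lab (hlam : ∀ j, 1 ≤ lam j) (hd : P.natDegree = ∑ j, lam j + 1)
    (h : ∀ j, (crit P (lam j, w j)).ncard = (cls lam w univ (lam j, w j)).card) :
    ∃ x, Lab lam w P x := by
  have h1 : ∀ j, ∃ f : ι → ℂ,
      Set.BijOn f (cls lam w univ (lam j, w j)) (crit P (lam j, w j)) := fun j => by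
    refine Set.Finite.exists_bijOn_of_encard_eq (finite_toSet _) ?_
    rw [← (crit_finite hd (hlam j)).cast_ncard_eq, h, Set.encard_coe_eq_coe_finsetCard]
  have h2 : ∀ p : ℕ × ℝ, ∃ f : ι → ℂ, ∀ j, (lam j, w j) = p →
      Set.BijOn f (cls lam w univ p) (crit P p) := fun p => by
    by_cases hp : ∃ j, (lam j, w j) = p
    · obtain ⟨j, rfl⟩ := hp
      obtain ⟨f, hf⟩ := h1 j
      exact ⟨f, fun _ _ => hf⟩
    · exact ⟨fun _ => 0, fun j hj => absurd ⟨j, hj⟩ hp⟩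
  choose f hf using h2
  have h3 : ∀ j, f (lam j, w j) j ∈ crit P (lam j, w j) := fun j =>
    (hf _ j rfl).mapsTo (mem_cls.2 ⟨mem_univ j, rfl, rfl⟩)
  refine ⟨fun j => f (lam j, w j) j, fun j k hjk => ?_, h3⟩
  have hj := h3 j
  have hk := h3 k
  dsimp only at hjk
  rw [hjk] at hj
  have hl : lam j = lam k := hj.1.symm.trans hk.1
  have hw : w j = w k := by exact_mod_cast hj.2.symm.trans hk.2
  rw [hl, hw] at hjk
  exact (hf _ k rfl).injOn (mem_cls.2 ⟨mem_univ j, hl, hw⟩)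
    (mem_cls.2 ⟨mem_univ k, rfl, rfl⟩) hjk

theorem card_lab (hlam : ∀ j, 1 ≤ lam j) (hm : P.Monic) (hd : P.natDegree = ∑ j, lam j + 1)
    (h : ∀ j, redRamType P (w j) = (univ.filter fun i => w i = w j).val.map lam) :
    {x | Lab lam w P x}.ncard
      = ∏ p ∈ clsIdx lam w, (cls lam w univ p).card.factorial := by
  obtain ⟨x, hx⟩ := exists_lab hlam hd (crit_ncard hlam hd h)
  set τ : ι → ℕ × ℝ := fun j => (lam j, w j) with hτ
  have h1 : {y | Lab lam w P y} = (fun g : Equiv.Perm ι => x ∘ g) '' {g | τ ∘ g = τ} := by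
    ext y
    constructor
    · intro hy
      have h2 : ∀ j, ∃ k, x k = y j := fun j =>
        hx.exists_eq hm hd (by have := hlam j; rw [(hy.2 j).1]; dsimp only; omega)
      choose g hg using h2
      have hgi : Function.Injective g := fun a b hab => hy.1 (by rw [← hg, hab, hg])
      refine ⟨Equiv.ofBijective g (Finite.injective_iff_bijective.1 hgi), ?_, funext hg⟩
      funext j
      have h3 := hx.2 (g j)
      rw [hg j] at h3
      exact Prod.ext (h3.1.symm.trans (hy.2 j).1)
        (by exact_mod_cast h3.2.symm.trans (hy.2 j).2)
    · rintro ⟨g, hg, rfl⟩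
      refine ⟨hx.1.comp g.injective, fun j => ?_⟩
      have h2 := hx.2 (g j)
      rwa [show (lam (g j), w (g j)) = (lam j, w j) from congrFun hg j] at h2
  have hinj : Function.Injective fun g : Equiv.Perm ι => x ∘ g := fun g g' hgg =>
    Equiv.ext fun j => hx.1 (congrFun hgg j)
  rw [h1, Set.ncard_image_of_injective _ hinj, ← Nat.card_coe_set_eq, Nat.card_eq_fintype_card]
  have h2 := DomMulAct.stabilizer_card' τ
  refine (Fintype.card_congr (Equiv.refl _)).trans (h2.trans (prod_congr rfl fun p _ => ?_))
  rw [Fintype.card_subtype]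
  congr 2
  ext j
  simp [hτ, mem_cls, Prod.ext_iff]

variable {P' : ℝ[X]}

theorem exists_cpx_eq {q : ℂ[X]} (hq : pconj q = q) : ∃ P : ℝ[X], cpx P = q := by
  refine (lifts_iff_coeff_lifts q).2 fun n => ?_
  have h := congrArg (fun p => p.coeff n) hq
  simp only [pconj, coeff_map] at h
  obtain ⟨r, hr⟩ := conj_eq_iff_real.1 h
  exact ⟨r, hr.symm⟩

theorem pconj_cpx (P : ℝ[X]) : pconj (cpx P) = cpx P := by
  rw [pconj, cpx, Polynomial.map_map]
  congr 1
  ext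
  simp

theorem eval_cpx_conj (P : ℝ[X]) (z : ℂ) :
    (cpx P).eval (conj z) = conj ((cpx P).eval z) := by
  conv_lhs => rw [← pconj_cpx]
  exact eval_pconj _ _

theorem center_eq {u : ℂ} (hS : 1 ≤ ∑ j, lam j)
    (h : derivative (cpx P) = wpoly univ lam x u 0) :
    ((P.coeff (∑ j, lam j) : ℝ) : ℂ) * (∑ j, lam j : ℕ) = u * -∑ j, (lam j : ℂ) * x j := by
  have h1 : (vprod univ lam x).coeff (∑ j, lam j - 1) = -∑ j, (lam j : ℂ) * x j := by
    have h2 := nextCoeff_of_natDegree_pos (p := vprod univ lam x)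
      (by rw [natDegree_vprod]; exact hS)
    rw [natDegree_vprod] at h2
    rw [← h2, vprod, Monic.nextCoeff_prod _ _ fun k _ => (monic_X_sub_C _).pow _,
      ← sum_neg_distrib]
    refine sum_congr rfl fun k _ => ?_
    rw [(monic_X_sub_C _).nextCoeff_pow, nextCoeff_X_sub_C, nsmul_eq_mul, mul_neg]
  have h2 := congrArg (fun p => p.coeff (∑ j, lam j - 1)) h
  simp only [coeff_derivative, wpoly, pow_zero, mul_one, coeff_C_mul, h1, Nat.sub_add_cancel hS,
    Nat.cast_sub hS] at h2
  rw [← h2, cpx, coeff_map]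
  simp

theorem Lab.mem_Sol (hlam : ∀ j, 1 ≤ lam j) (hx : Lab lam w P x)
    (hn : IsNormalized (∑ j, lam j + 1) P) :
    x ∈ Sol univ lam ((∑ j, lam j + 1 : ℕ) : ℂ) w := by
  obtain ⟨hd, hm, hc⟩ := hn
  have hD := hx.derivative_eq hm hd
  have hW : cpx P - C ((cpx P).eval 0) = prim (wpoly univ lam x (P.natDegree : ℂ) 0) :=
    eq_prim (by rw [derivative_sub, derivative_C, sub_zero, hD]) (by simp)
  refine ⟨fun j hj => absurd (mem_univ j) hj, hx.1.injOn, fun j _ => ?_, ?_,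
    fun j _ k _ => ?_⟩
  · have h1 : (derivative (cpx P)).rootMultiplicity (conj (x j)) = lam j := by
      have h2 := eq_rootMultiplicity_map (f := conj) (p := derivative (cpx P))
        (starRingEnd ℂ).injective (x j)
      have h3 := pconj_cpx (derivative P)
      rw [← derivative_cpx, pconj] at h3
      rw [h3] at h2
      exact h2.symm.trans (hx.2 j).1
    obtain ⟨k, hk⟩ := hx.exists_eq hm hd (z := conj (x j))
      (by have := hlam j; rw [h1]; omega)
    rw [← hk] at h1
    refine ⟨k, mem_univ k, hk, (hx.2 k).1.symm.trans h1, ?_⟩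
    have h4 := (hx.2 k).2
    rw [hk, eval_cpx_conj, (hx.2 j).2, conj_ofReal] at h4
    exact_mod_cast h4.symm
  · rcases Nat.eq_zero_or_pos (∑ j, lam j) with h0 | h0
    · refine sum_eq_zero fun j hj => ?_
      rw [sum_eq_zero_iff.1 h0 j hj, Nat.cast_zero, zero_mul]
    · have h1 := center_eq h0 hD
      rw [Nat.add_sub_cancel] at hc
      rw [hc, ofReal_zero, zero_mul, hd] at h1
      have h2 : ((∑ j, lam j + 1 : ℕ) : ℂ) ≠ 0 := Nat.cast_ne_zero.2 (Nat.succ_ne_zero _)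
      exact neg_eq_zero.1 ((mul_eq_zero.1 h1.symm).resolve_left h2)
  · rw [← hd, ← hW, eval_sub, eval_sub, eval_C, eval_C, (hx.2 j).2, (hx.2 k).2]
    push_cast
    ring

theorem Lab.unique (hx : Lab lam w P x) (hx' : Lab lam w P' x)
    (hn : IsNormalized (∑ j, lam j + 1) P) (hn' : IsNormalized (∑ j, lam j + 1) P') : P = P' := by
  have hD := hx.derivative_eq hn.2.1 hn.1
  rw [hn.1, ← hn'.1, ← hx'.derivative_eq hn'.2.1 hn'.1] at hD
  have h1 : derivative (cpx (P - P')) = 0 := by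
    rw [cpx, Polynomial.map_sub, derivative_sub, sub_eq_zero]
    exact hD
  rw [derivative_cpx, cpx, Polynomial.map_eq_zero] at h1
  have h2 := eq_C_of_derivative_eq_zero h1
  rw [← sub_eq_zero, h2, C_eq_zero]
  rcases isEmpty_or_nonempty ι with h | ⟨⟨j⟩⟩
  · have h3 := hn.2.2
    have h4 := hn'.2.2
    rw [Fintype.sum_empty, zero_add] at h3 h4
    rw [coeff_sub, h3, h4, sub_zero]
  · have h3 := congrArg (fun p => (cpx p).eval (x j)) h2
    have h4 := (hx.2 j).2.trans (hx'.2 j).2.symm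
    rw [← sub_eq_zero] at h4
    simp only [cpx, Polynomial.map_sub, eval_sub, map_C, eval_C] at h3 h4
    rw [h4] at h3
    exact (map_eq_zero (algebraMap ℝ ℂ)).1 h3.symm

theorem exists_lab_of_mem_Sol (hlam : ∀ j, 1 ≤ lam j)
    (hx : x ∈ Sol univ lam ((∑ j, lam j + 1 : ℕ) : ℂ) w) :
    ∃ P, IsNormalized (∑ j, lam j + 1) P ∧ Lab lam w P x := by
  rcases isEmpty_or_nonempty ι with h | ⟨⟨i⟩⟩
  · refine ⟨X, ⟨?_, monic_X, ?_⟩, fun j => isEmptyElim j, fun j => isEmptyElim j⟩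
    · rw [Fintype.sum_empty, natDegree_X]
    · simp
  obtain ⟨-, hinj, hr, hc, hv⟩ := hx
  set u : ℂ := ((∑ j, lam j + 1 : ℕ) : ℂ) with hu
  have hu0 : u ≠ 0 := Nat.cast_ne_zero.2 (Nat.succ_ne_zero _)
  set W := wpoly univ lam x u 0 with hW
  have hS : 1 ≤ ∑ j, lam j :=
    (hlam i).trans (single_le_sum (fun j _ => Nat.zero_le (lam j)) (mem_univ i))
  obtain ⟨κ, hκ, hκ'⟩ := hr.exists_inv hinj
  have hp : pconj (prim W) = prim W := by
    rw [pconj_prim, hW, ← pconj_wpoly_inv hκ (map_natCast _ _) x]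
    congr 2
    funext j
    rw [hκ' j (mem_univ j), conj_conj]
  set c : ℂ := w i - (prim W).eval (x i) with hcdef
  have hcr : conj c = c := by
    have h1 := hv i (mem_univ i) (κ i) (mem_univ _)
    rw [hκ.d_eq i (mem_univ i), sub_self, ofReal_zero, sub_eq_zero,
      hκ' i (mem_univ i)] at h1
    rw [hcdef, map_sub, conj_ofReal, ← eval_pconj, hp, h1]
  obtain ⟨P, hP⟩ := exists_cpx_eq (q := prim W + C c) (by
    rw [pconj, Polynomial.map_add, map_C, hcr]
    exact congrArg (· + C c) hp)
  have hD : derivative (cpx P) = W := by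
    rw [hP, derivative_add, derivative_prim, derivative_C, add_zero]
  have hd : P.natDegree = ∑ j, lam j + 1 := by
    have h1 := congrArg natDegree hD
    rw [natDegree_derivative, natDegree_cpx, hW, natDegree_wpoly hu0] at h1
    omega
  have hm : P.Monic := by
    have h1 := congrArg (fun p => p.coeff (∑ j, lam j)) hD
    have h2 : (vprod univ lam x).coeff (∑ j, lam j) = 1 := by
      rw [← natDegree_vprod univ lam x]
      exact vprod_monic _ _ _
    simp only [coeff_derivative, hW, wpoly, pow_zero, mul_one, coeff_C_mul, h2, cpx,
      coeff_map] at h1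
    rw [Monic, leadingCoeff, hd]
    have h3 : ((P.coeff (∑ j, lam j + 1) : ℝ) : ℂ) * u = 1 * u := by
      refine Eq.trans ?_ (h1.trans (one_mul u).symm)
      rw [hu, Nat.cast_succ]
      rfl
    exact_mod_cast mul_right_cancel₀ hu0 h3
  refine ⟨P, ⟨hd, hm, ?_⟩, fun a b => hinj (mem_univ a) (mem_univ b), fun j => ?_⟩
  · have h1 := center_eq hS hD
    rw [hc, neg_zero, mul_zero, mul_eq_zero, Nat.cast_eq_zero] at h1
    rw [Nat.add_sub_cancel]
    exact_mod_cast h1.resolve_right (by omega)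
  · constructor
    · rw [hD, hW, rootMultiplicity_wpoly hu0, ite_self, zero_add]
      have h1 : (univ.filter fun k => x k = x j) = {j} := by
        ext k
        rw [mem_filter, mem_singleton]
        exact ⟨fun h => hinj (mem_univ k) (mem_univ j) h.2,
          fun h => ⟨mem_univ k, h ▸ rfl⟩⟩
      rw [h1, sum_singleton]
    · have h1 := hv i (mem_univ i) j (mem_univ j)
      rw [hP, eval_add, eval_C, hcdef]
      push_cast at h1
      linear_combination h1

end

section

theorem eval_mul_leadingCoeff_pos {Q : ℝ[X]} {a : ℝ} (h : ∀ y, a ≤ y → Q.eval y ≠ 0) :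
    0 < Q.eval a * Q.leadingCoeff := by
  have hQ : Q ≠ 0 := by
    rintro rfl
    exact h a le_rfl eval_zero
  have hl := leadingCoeff_ne_zero.2 hQ
  rcases Nat.eq_zero_or_pos Q.natDegree with hd | hd
  · obtain ⟨c, rfl⟩ := natDegree_eq_zero.1 hd
    rw [eval_C, leadingCoeff_C] at *
    exact mul_self_pos.2 hl
  by_contra hneg
  have ht : Tendsto (fun y => (C Q.leadingCoeff * Q).eval y) atTop atTop := by
    refine tendsto_atTop_of_leadingCoeff_nonneg _ ?_ ?_
    · rw [degree_C_mul hl]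
      exact natDegree_pos_iff_degree_pos.1 hd
    · rw [leadingCoeff_mul, leadingCoeff_C]
      exact mul_self_nonneg _
  obtain ⟨y, hy, hay⟩ := ((ht.eventually_gt_atTop 0).and (eventually_ge_atTop a)).exists
  obtain ⟨z, hz, hz0⟩ := intermediate_value_Icc hay
    ((C Q.leadingCoeff * Q).continuous.continuousOn)
    (show (0 : ℝ) ∈ Set.Icc _ _ from
      ⟨by rw [eval_mul, eval_C, mul_comm]; exact not_lt.1 hneg, hy.le⟩)
  dsimp only at hz0
  rw [eval_mul, eval_C] at hz0
  exact h z hz.1 ((mul_eq_zero.1 hz0).resolve_left hl)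

theorem eval_mul_leadingCoeff_mul_pos (Q : ℝ[X]) {a : ℝ} (h : Q.eval a ≠ 0) :
    0 < Q.eval a * Q.leadingCoeff * (-1) ^ (Q.roots.filter (a < ·)).card := by
  induction hn : (Q.roots.filter (a < ·)).card generalizing Q with
  | zero =>
    have hQ : Q ≠ 0 := by
      rintro rfl
      exact h eval_zero
    rw [pow_zero, mul_one]
    refine eval_mul_leadingCoeff_pos fun y hy h0 => ?_
    have h1 : y ∈ Q.roots.filter (a < ·) := Multiset.mem_filter.2
      ⟨(mem_roots hQ).2 h0, lt_of_le_of_ne hy fun h2 => h (h2 ▸ h0)⟩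
    rw [Multiset.card_eq_zero.1 hn] at h1
    exact absurd h1 (Multiset.notMem_zero y)
  | succ n ih =>
    obtain ⟨y, hy⟩ := Multiset.card_pos_iff_exists_mem (s := Q.roots.filter (a < ·)).1
      (by rw [hn]; exact Nat.succ_pos n)
    obtain ⟨hyr, hay⟩ := Multiset.mem_filter.1 hy
    obtain ⟨R, rfl⟩ := dvd_iff_isRoot.2 (isRoot_of_mem_roots hyr)
    have h0 : (X - C y) * R ≠ 0 := by
      intro h0
      rw [h0] at h
      exact h eval_zero
    rw [roots_mul h0, roots_X_sub_C, Multiset.singleton_add, Multiset.filter_cons_of_pos _ hay,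
      Multiset.card_cons] at hn
    rw [eval_mul] at h ⊢
    have h1 := ih R (right_ne_zero_of_mul h) (by convert Nat.succ_injective hn)
    rw [leadingCoeff_mul, leadingCoeff_X_sub_C, one_mul, pow_succ]
    simp only [eval_sub, eval_X, eval_C]
    nlinarith [sub_pos.2 hay]

theorem filter_roots_pow_mul {R : ℝ[X]} (hR : R ≠ 0) (a : ℝ) (n : ℕ) :
    ((X - C a) ^ n * R).roots.filter (a < ·) = R.roots.filter (a < ·) := by
  rw [roots_mul (mul_ne_zero (pow_ne_zero _ (X_sub_C_ne_zero a)) hR), Multiset.filter_add,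
    roots_pow, roots_X_sub_C, Multiset.filter_eq_nil.2, zero_add]
  intro y hy
  rw [Multiset.mem_singleton.1 (Multiset.mem_of_mem_nsmul hy)]
  exact lt_irrefl a

/-- A polynomial and its derivative have the same number of roots to the right of a root of the
polynomial modulo two. -/
theorem neg_one_pow_card_roots_derivative {F : ℝ[X]} {a : ℝ} (h0 : derivative F ≠ 0)
    (ha : F.eval a = 0) : (-1 : ℤ) ^ (F.roots.filter (a < ·)).card
      = (-1) ^ ((derivative F).roots.filter (a < ·)).card := by
  have hF : F ≠ 0 := by
    rintro rfl
    exact h0 derivative_zero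
  obtain ⟨R, hR, hnd⟩ := exists_eq_pow_rootMultiplicity_mul_and_not_dvd F hF a
  obtain ⟨n, hn⟩ : ∃ n, F.rootMultiplicity a = n + 1 :=
    ⟨_, (Nat.succ_pred_eq_of_pos ((rootMultiplicity_pos hF).2 ha)).symm⟩
  rw [hn] at hR
  rw [dvd_iff_isRoot, IsRoot.def] at hnd
  set R2 : ℝ[X] := C ((n : ℝ) + 1) * R + (X - C a) * derivative R with hR2
  have hD : derivative F = (X - C a) ^ n * R2 := by
    conv_lhs => rw [hR]
    rw [derivative_mul, derivative_pow, derivative_X_sub_C, hR2, Nat.add_sub_cancel, pow_succ]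
    push_cast
    ring
  have he : R2.eval a = (n + 1) * R.eval a := by simp [hR2]
  have hn1 : (0 : ℝ) < n + 1 := by positivity
  have he2 : R2.eval a ≠ 0 := by
    rw [he]
    exact mul_ne_zero hn1.ne' hnd
  have hR0 : R ≠ 0 := by
    rintro rfl
    exact hnd eval_zero
  have hR20 : R2 ≠ 0 := fun h => he2 (by rw [h, eval_zero])
  have hd : F.natDegree ≠ 0 := fun h => h0 (derivative_eq_zero.2 h)
  have hl : R2.leadingCoeff = R.leadingCoeff * F.natDegree := by
    have h1 := congrArg leadingCoeff hR
    have h2 := congrArg leadingCoeff hD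
    rw [leadingCoeff_mul, ((monic_X_sub_C a).pow _).leadingCoeff, one_mul] at h1 h2
    rw [← h1, ← h2, leadingCoeff, natDegree_derivative, coeff_derivative,
      Nat.sub_add_cancel (Nat.one_le_iff_ne_zero.2 hd), leadingCoeff,
      Nat.cast_sub (Nat.one_le_iff_ne_zero.2 hd)]
    push_cast
    ring
  have h1 := eval_mul_leadingCoeff_mul_pos R hnd
  have h2 := eval_mul_leadingCoeff_mul_pos R2 he2
  have hF1 : F.roots.filter (a < ·) = R.roots.filter (a < ·) := by
    rw [hR, filter_roots_pow_mul hR0]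
  rw [hF1, hD, filter_roots_pow_mul hR20]
  rw [he, hl] at h2
  have hd' : (0 : ℝ) < F.natDegree := by positivity
  rcases neg_one_pow_eq_or ℝ (R.roots.filter (a < ·)).card with h3 | h3 <;>
    rcases neg_one_pow_eq_or ℝ (R2.roots.filter (a < ·)).card with h4 | h4 <;>
    rw [h3] at h1 <;> rw [h4] at h2
  · exact_mod_cast h3.trans h4.symm
  · nlinarith [mul_pos (mul_pos h1 hn1) hd']
  · nlinarith [mul_pos (mul_pos h1 hn1) hd']
  · exact_mod_cast h3.trans h4.symm

theorem neg_one_pow_card_roots (Q : ℝ[X]) (a : ℝ) :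
    (-1 : ℤ) ^ (Q.roots.filter (a < ·)).card
      = ∏ y ∈ Q.roots.toFinset with a < y, (-1) ^ Q.rootMultiplicity y := by
  rw [prod_pow_eq_pow_sum, ← Multiset.toFinset_sum_count_eq, Multiset.toFinset_filter]
  congr 1
  refine sum_congr rfl fun y hy => ?_
  rw [Multiset.count_filter_of_pos (mem_filter.1 hy).2, count_roots]

variable {ι : Type*} {lam : ι → ℕ} {w : ι → ℝ} {P : ℝ[X]} {x : ι → ℂ}

theorem eval_cpx_ofReal (P : ℝ[X]) (y : ℝ) : (cpx P).eval (y : ℂ) = (P.eval y : ℝ) :=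
  eval_map_apply (algebraMap ℝ ℂ) y

theorem rootMultiplicity_sub_C {n : ℕ} (hd : P.natDegree = n + 1) {y v : ℝ} (h : P.eval y = v) :
    (P - C v).rootMultiplicity y = (derivative P).rootMultiplicity y + 1 := by
  have h0 : P - C v ≠ 0 := fun h1 => by
    have := congrArg natDegree (sub_eq_zero.1 h1)
    rw [hd, natDegree_C] at this
    omega
  have h2 : (P - C v).IsRoot y := by simp [h]
  have h1 := derivative_rootMultiplicity_of_root h2
  rw [derivative_sub, derivative_C, sub_zero] at h1
  have h3 := (rootMultiplicity_pos h0).2 h2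
  omega

theorem Lab.rootMultiplicity_re (hx : Lab lam w P x) {j : ι} (hj : (x j).im = 0) :
    (derivative P).rootMultiplicity (x j).re = lam j ∧ P.eval (x j).re = w j := by
  have h1 : (((x j).re : ℝ) : ℂ) = x j := Complex.ext rfl hj.symm
  have h2 := hx.2 j
  rw [← h1] at h2
  refine ⟨(eq_rootMultiplicity_map (algebraMap ℝ ℂ).injective _).trans ?_, ?_⟩
  · rw [← derivative_map]
    exact h2.1
  · have h3 := h2.2
    rw [eval_cpx_ofReal] at h3
    exact_mod_cast h3

theorem Lab.prod_real (hx : Lab lam w P x) {K : Finset ι} (hK : ∀ k ∈ K, (x k).im = 0)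
    {F : Finset ℝ} (hKF : ∀ k ∈ K, (x k).re ∈ F) {f : ℕ → ℤ}
    (hF : ∀ y ∈ F, (∀ k ∈ K, (x k).re ≠ y) → f ((derivative P).rootMultiplicity y) = 1) :
    ∏ y ∈ F, f ((derivative P).rootMultiplicity y) = ∏ k ∈ K, f (lam k) := by
  have h1 : ∏ y ∈ K.image fun k => (x k).re, f ((derivative P).rootMultiplicity y)
      = ∏ k ∈ K, f (lam k) := by
    rw [prod_image fun a ha b hb hab =>
      hx.1 (Complex.ext hab ((hK a ha).trans (hK b hb).symm))]
    exact prod_congr rfl fun k hk => by rw [(hx.rootMultiplicity_re (hK k hk)).1]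
  rw [← h1]
  refine (prod_subset (image_subset_iff.2 hKF) fun y hy hy' => hF y hy ?_).symm
  exact fun k hk h => hy' (mem_image.2 ⟨k, hk, h⟩)

variable [Fintype ι]

theorem Lab.exists_re_eq (hx : Lab lam w P x) (hm : P.Monic) (hd : P.natDegree = ∑ j, lam j + 1)
    {y : ℝ} (hy : (derivative P).rootMultiplicity y ≠ 0) : ∃ k, (x k).im = 0 ∧ (x k).re = y := by
  rw [eq_rootMultiplicity_map (algebraMap ℝ ℂ).injective, ← derivative_map] at hy
  obtain ⟨k, hk⟩ := hx.exists_eq hm hd hy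
  exact ⟨k, by rw [hk]; rfl, by rw [hk]; rfl⟩

/-- The second points of the disorders that start at a given vertex. -/
def disFrom (lam : ι → ℕ) (w : ι → ℝ) (P : ℝ[X]) (x : ι → ℂ) (j : ι) : Finset ℝ :=
  ((P - C (w j)).roots.toFinset.filter ((x j).re < ·)).filter
    fun y => (derivative P).rootMultiplicity y < lam j

theorem Lab.neg_one_pow_disFrom (hlam : ∀ j, 1 ≤ lam j) (hx : Lab lam w P x) (hm : P.Monic)
    (hd : P.natDegree = ∑ j, lam j + 1) {j : ι} (hj : (x j).im = 0) :
    (-1) ^ (disFrom lam w P x j).card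
      = ∏ k with (x k).im = 0 ∧ (x j).re < (x k).re, es lam w j k := by
  have hD0 := derivative_ne_zero_of_natDegree hd
  have hDe : derivative (P - C (w j)) = derivative P := by
    rw [derivative_sub, derivative_C, sub_zero]
  have hP0 : P - C (w j) ≠ 0 := fun h => hD0 (by rw [← hDe, h, derivative_zero])
  set a := (x j).re with ha
  set F := (P - C (w j)).roots.toFinset.filter (a < ·) with hF
  set K := univ.filter fun k => (x k).im = 0 ∧ a < (x k).re with hK
  have hKm : ∀ k ∈ K, (x k).im = 0 ∧ a < (x k).re := fun k hk => (mem_filter.1 hk).2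
  have hpar := neg_one_pow_card_roots_derivative (F := P - C (w j)) (a := a) (by rwa [hDe])
    (by rw [eval_sub, (hx.rootMultiplicity_re hj).2, eval_C, sub_self])
  rw [hDe, neg_one_pow_card_roots, neg_one_pow_card_roots] at hpar
  have hF1 : ∏ y ∈ F, (-1 : ℤ) ^ (P - C (w j)).rootMultiplicity y
      = ∏ y ∈ F, (-1) ^ ((derivative P).rootMultiplicity y + 1) := by
    refine prod_congr rfl fun y hy => ?_
    have h1 := isRoot_of_mem_roots (Multiset.mem_toFinset.1 (mem_filter.1 hy).1)
    rw [IsRoot.def, eval_sub, eval_C, sub_eq_zero] at h1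
    rw [rootMultiplicity_sub_C hd h1]
  have hG : ∏ y ∈ (derivative P).roots.toFinset with a < y,
      (-1 : ℤ) ^ (derivative P).rootMultiplicity y = ∏ k ∈ K, (-1) ^ lam k := by
    refine hx.prod_real (f := fun r => (-1) ^ r) (fun k hk => (hKm k hk).1) (fun k hk => ?_)
      fun y hy hy' => ?_
    · rw [mem_filter, Multiset.mem_toFinset, mem_roots hD0, ← rootMultiplicity_pos hD0,
        (hx.rootMultiplicity_re (hKm k hk).1).1]
      exact ⟨hlam k, (hKm k hk).2⟩
    · obtain ⟨hy1, hy2⟩ := mem_filter.1 hy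
      rw [Multiset.mem_toFinset, mem_roots hD0, ← rootMultiplicity_pos hD0] at hy1
      obtain ⟨k, hk, rfl⟩ := hx.exists_re_eq hm hd hy1.ne'
      exact absurd rfl (hy' k (mem_filter.2 ⟨mem_univ k, hk, hy2⟩))
  set f : ℕ → ℤ := fun r => (if r < lam j then -1 else 1) * (-1) ^ (r + 1) with hf
  have hT : ∏ y ∈ F, f ((derivative P).rootMultiplicity y) = ∏ k ∈ K, tw lam w j k := by
    rw [hx.prod_real (K := K.filter fun k => w j = w k)
      (fun k hk => (hKm k (mem_filter.1 hk).1).1), prod_filter]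
    · refine prod_congr rfl fun k _ => ?_
      rw [tw, hf]
      dsimp only
      split_ifs <;> ring
    · intro k hk
      obtain ⟨hk, hw⟩ := mem_filter.1 hk
      rw [hF, mem_filter, Multiset.mem_toFinset, mem_roots hP0, IsRoot.def, eval_sub,
        eval_C, (hx.rootMultiplicity_re (hKm k hk).1).2, hw, sub_self]
      exact ⟨rfl, (hKm k hk).2⟩
    · intro y hy hy'
      by_cases h0 : (derivative P).rootMultiplicity y = 0
      · rw [h0, hf]
        dsimp only
        rw [if_pos (show 0 < lam j from hlam j)]
        norm_num
      · obtain ⟨k, hk, rfl⟩ := hx.exists_re_eq hm hd h0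
        obtain ⟨hy1, hy2⟩ := mem_filter.1 hy
        have h1 := isRoot_of_mem_roots (Multiset.mem_toFinset.1 hy1)
        rw [IsRoot.def, eval_sub, eval_C, (hx.rootMultiplicity_re hk).2, sub_eq_zero] at h1
        exact absurd rfl (hy' k (mem_filter.2
          ⟨mem_filter.2 ⟨mem_univ k, hk, hy2⟩, h1.symm⟩))
  have hdis : (-1 : ℤ) ^ (disFrom lam w P x j).card
      = ∏ y ∈ F, if (derivative P).rootMultiplicity y < lam j then -1 else 1 := by
    rw [prod_ite, prod_const, prod_const_one, mul_one, disFrom]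
  rw [hf, prod_mul_distrib, ← hdis, ← hF1, hpar, hG] at hT
  simp only [es]
  rw [prod_mul_distrib, ← hT, mul_left_comm, ← prod_mul_distrib,
    prod_eq_one (f := fun k => (-1 : ℤ) ^ lam k * (-1) ^ lam k), mul_one]
  exact fun k _ => by rw [← mul_pow, neg_one_mul, neg_neg, one_pow]

theorem Lab.sgn_eq (hlam : ∀ j, 1 ≤ lam j) (hx : Lab lam w P x) (hm : P.Monic)
    (hd : P.natDegree = ∑ j, lam j + 1) : sgn univ lam w x = epsilonP P := by
  have hD0 := derivative_ne_zero_of_natDegree hd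
  set E : Finset (Σ _ : ι, ℝ) :=
    (univ.filter fun j => (x j).im = 0).sigma fun j => disFrom lam w P x j with hE
  have himg : disorders P = (fun q : Σ _ : ι, ℝ => ((x q.1).re, q.2)) '' E := by
    have hP0 : ∀ v, P - C v ≠ 0 := fun v h => hD0 (by
      have := congrArg derivative h
      rwa [derivative_sub, derivative_C, sub_zero, derivative_zero] at this)
    ext ⟨a, b⟩
    constructor
    · rintro ⟨h1, h2, h3⟩
      dsimp only at h1 h2 h3
      rw [rootMultiplicity_sub_C hd rfl, rootMultiplicity_sub_C hd rfl] at h3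
      obtain ⟨j, hj, rfl⟩ := hx.exists_re_eq hm hd (y := a) (by omega)
      obtain ⟨h4, h5⟩ := hx.rootMultiplicity_re hj
      refine ⟨⟨j, b⟩, ?_, rfl⟩
      rw [mem_coe, hE, mem_sigma, disFrom, mem_filter, mem_filter,
        mem_filter, Multiset.mem_toFinset, mem_roots (hP0 _), IsRoot.def, eval_sub, eval_C]
      dsimp only
      exact ⟨⟨mem_univ j, hj⟩, ⟨by rw [← h2, h5, sub_self], h1⟩, by omega⟩
    · rintro ⟨⟨j, y⟩, hq, he⟩
      obtain ⟨rfl, rfl⟩ := Prod.ext_iff.1 he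
      rw [mem_coe, hE, mem_sigma, disFrom, mem_filter, mem_filter,
        mem_filter, Multiset.mem_toFinset, mem_roots (hP0 _), IsRoot.def, eval_sub, eval_C,
        sub_eq_zero] at hq
      obtain ⟨⟨-, hj⟩, ⟨h1, h2⟩, h3⟩ := hq
      obtain ⟨h4, h5⟩ := hx.rootMultiplicity_re hj
      refine ⟨h2, h5.trans h1.symm, ?_⟩
      rw [rootMultiplicity_sub_C hd rfl, rootMultiplicity_sub_C hd rfl]
      dsimp only at h3 h4 ⊢
      omega
  have hinj : Set.InjOn (fun q : Σ _ : ι, ℝ => ((x q.1).re, q.2)) E := by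
    rintro ⟨j, y⟩ hj ⟨k, z⟩ hk h
    obtain ⟨h1, h2⟩ := Prod.ext_iff.1 h
    have hj' := (mem_filter.1 (mem_sigma.1 hj).1).2
    have hk' := (mem_filter.1 (mem_sigma.1 hk).1).2
    obtain rfl := hx.1 (Complex.ext h1 (hj'.trans hk'.symm))
    dsimp only at h2
    rw [h2]
  rw [epsilonP, Nat.card_coe_set_eq, himg, hinj.ncard_image, Set.ncard_coe_finset, hE,
    card_sigma, ← prod_pow_eq_pow_sum, sgn, prod_filter]
  refine prod_congr rfl fun j _ => ?_
  split_ifs with hj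
  · rw [hx.neg_one_pow_disFrom hlam hm hd hj, prod_filter]
    exact prod_congr rfl fun k _ => by simp only [hj, true_and]
  · exact prod_eq_one fun k _ => if_neg fun h => hj h.1

/-- The signed number of polynomials with prescribed ramification in terms of configurations. -/
theorem finsum_epsilonP_mul (hlam : ∀ j, 1 ≤ lam j) {T : Set ℝ} (hT : ∀ j, w j ∈ T) {A : Set ℝ[X]}
    (hA : ∀ P, P ∈ A ↔ IsNormalized (∑ j, lam j + 1) P ∧
      ∀ v ∈ T, redRamType P v = (univ.filter fun j => w j = v).val.map lam) :
    (∑ᶠ P ∈ A, epsilonP P) * ∏ p ∈ clsIdx lam w, (cls lam w univ p).card.factorial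
      = sCount univ lam w 1 := by
  have hn0 : (0 : ℝ) < ((∑ j, lam j + 1 : ℕ) : ℝ) := by positivity
  have hS := Sol_finite (V := univ) (w := w) (u := ((∑ j, lam j + 1 : ℕ) : ℂ))
    (Nat.cast_ne_zero.2 (Nat.succ_ne_zero _)) fun k _ => hlam k
  have hex : ∀ x, ∃ P : ℝ[X], x ∈ Sol univ lam ((∑ j, lam j + 1 : ℕ) : ℂ) w →
      IsNormalized (∑ j, lam j + 1) P ∧ Lab lam w P x := fun x => by
    by_cases hx : x ∈ Sol univ lam ((∑ j, lam j + 1 : ℕ) : ℂ) w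
    · exact (exists_lab_of_mem_Sol hlam hx).imp fun P hP _ => hP
    · exact ⟨0, fun h => absurd h hx⟩
  choose F hF using hex
  have hFA : ∀ x ∈ hS.toFinset, F x ∈ A := fun x hx => by
    obtain ⟨h1, h2⟩ := hF x (hS.mem_toFinset.1 hx)
    exact (hA _).2 ⟨h1, fun v _ => h2.redRamType_eq hlam h1.2.1 h1.1 v⟩
  have hfib : ∀ P ∈ A, ((hS.toFinset.filter fun x => F x = P : Finset (ι → ℂ)) : Set (ι → ℂ))
      = {x | Lab lam w P x} := fun P hP => by
    obtain ⟨hn, -⟩ := (hA P).1 hP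
    ext x
    rw [coe_filter]
    constructor
    · rintro ⟨hx, rfl⟩
      exact (hF x (hS.mem_toFinset.1 hx)).2
    · intro hx
      have h1 := Lab.mem_Sol hlam hx hn
      exact ⟨hS.mem_toFinset.2 h1, Lab.unique (hF x h1).2 hx (hF x h1).1 hn⟩
  have hcard : ∀ P ∈ A, (hS.toFinset.filter fun x => F x = P).card
      = ∏ p ∈ clsIdx lam w, (cls lam w univ p).card.factorial := fun P hP => by
    obtain ⟨hn, h⟩ := (hA P).1 hP
    rw [← card_lab hlam hn.2.1 hn.1 fun j => h _ (hT j), ← hfib P hP, Set.ncard_coe_finset]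
  have hAe : A = (hS.toFinset.image F : Finset ℝ[X]) := by
    ext P
    rw [mem_coe, mem_image]
    constructor
    · intro hP
      have h1 : 0 < (hS.toFinset.filter fun x => F x = P).card := by
        rw [hcard P hP]
        exact prod_pos fun p _ => Nat.factorial_pos _
      obtain ⟨x, hx⟩ := card_pos.1 h1
      exact ⟨x, mem_filter.1 hx⟩
    · rintro ⟨x, hx, rfl⟩
      exact hFA x hx
  rw [← sCount_of_pos hn0, ofReal_natCast, sCount, finsum_mem_eq_finite_toFinset_sum _ hS,
    ← sum_fiberwise_of_maps_to (g := F) (t := hS.toFinset.image F)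
      fun x hx => mem_image_of_mem F hx]
  conv_lhs => rw [hAe]
  rw [finsum_mem_coe_finset, sum_mul]
  refine sum_congr rfl fun P hP => ?_
  have hP' : P ∈ A := by
    rw [hAe]
    exact hP
  obtain ⟨hn, -⟩ := (hA P).1 hP'
  rw [← hcard P hP', mul_comm, ← nsmul_eq_mul, ← sum_const]
  refine sum_congr rfl fun x hx => (Lab.sgn_eq hlam ?_ hn.2.1 hn.1).symm
  rw [← mem_coe, hfib P hP'] at hx
  exact hx

end

section
variable {σ K : Type*} [Fintype σ] {lam : σ → ℕ} {w : σ → ℝ} {M : K → Multiset ℕ} {L : K → ℝ}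

/-- The labels on the level `L i` have the multiplicities `M i`. -/
def Labels (lam : σ → ℕ) (w : σ → ℝ) (M : K → Multiset ℕ) (L : K → ℝ) : Prop :=
  Function.Injective L ∧ (∀ j, ∃ i, w j = L i) ∧
    ∀ i, (univ.filter fun j => w j = L i).val.map lam = M i

theorem Labels.card_cls (h : Labels lam w M L) (i : K) (a : ℕ) :
    (cls lam w univ (a, L i)).card = (M i).count a := by
  rw [← count_map_level, h.2.2]

theorem Labels.mem_clsIdx (h : Labels lam w M L) (p : ℕ × ℝ) :
    p ∈ clsIdx lam w ↔ ∃ i, L i = p.2 ∧ p.1 ∈ M i := by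
  rw [clsIdx, mem_image]
  constructor
  · rintro ⟨j, -, rfl⟩
    obtain ⟨i, hi⟩ := h.2.1 j
    refine ⟨i, hi.symm, ?_⟩
    rw [← h.2.2 i]
    exact Multiset.mem_map_of_mem lam (mem_filter.2 ⟨mem_univ j, hi⟩)
  · rintro ⟨i, hi, ha⟩
    rw [← h.2.2 i] at ha
    obtain ⟨j, hj, hja⟩ := Multiset.mem_map.1 ha
    exact ⟨j, mem_univ j, Prod.ext hja ((mem_filter.1 hj).2.trans hi)⟩

@[to_additive]
theorem Labels.prod_clsIdx [Fintype K] (h : Labels lam w M L) {α : Type*} [CommMonoid α] (f : ℕ × ℝ → α) :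
    ∏ p ∈ clsIdx lam w, f p = ∏ i, ∏ a ∈ (M i).toFinset, f (a, L i) := by
  rw [prod_sigma']
  refine (prod_nbij (fun q : Σ _ : K, ℕ => (q.2, L q.1)) ?_ ?_ ?_ fun _ _ => rfl).symm
  · intro q hq
    exact (h.mem_clsIdx _).2 ⟨q.1, rfl, Multiset.mem_toFinset.1 (mem_sigma.1 hq).2⟩
  · rintro ⟨i, a⟩ - ⟨j, b⟩ - hab
    obtain ⟨h1, h2⟩ := Prod.ext_iff.1 hab
    obtain rfl := h.1 h2
    dsimp only at h1
    rw [h1]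
  · intro p hp
    obtain ⟨i, hi, ha⟩ := (h.mem_clsIdx p).1 hp
    exact ⟨⟨i, p.1⟩, mem_sigma.2 ⟨mem_univ i, Multiset.mem_toFinset.2 ha⟩,
      Prod.ext rfl hi⟩

theorem Labels.mem_oddIdx (h : Labels lam w M L) (p : ℕ × ℝ) :
    p ∈ oddIdx lam w ↔ ∃ i, L i = p.2 ∧ Odd ((M i).count p.1) := by
  rw [oddIdx, mem_filter, h.mem_clsIdx]
  obtain ⟨a, v⟩ := p
  constructor
  · rintro ⟨⟨i, rfl, -⟩, h2⟩
    rw [h.card_cls] at h2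
    exact ⟨i, rfl, h2⟩
  · rintro ⟨i, rfl, h2⟩
    refine ⟨⟨i, rfl, Multiset.count_pos.1 h2.pos⟩, ?_⟩
    rw [h.card_cls]
    exact h2

theorem Labels.injOn_oddIdx (h : Labels lam w M L) {p : ℕ → Prop}
    (hp : ∀ i, {a | p a ∧ Odd ((M i).count a)}.Subsingleton) :
    Set.InjOn Prod.snd {q | q ∈ oddIdx lam w ∧ p q.1} := by
  rintro q ⟨hq, hq1⟩ r ⟨hr, hr1⟩ hqr
  obtain ⟨i, hi, h1⟩ := (h.mem_oddIdx q).1 hq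
  obtain ⟨j, hj, h2⟩ := (h.mem_oddIdx r).1 hr
  obtain rfl : i = j := h.1 (hi.trans (hqr.trans hj.symm))
  exact Prod.ext (hp i ⟨hq1, h1⟩ ⟨hr1, h2⟩) hqr

theorem Labels.card_filter_oddIdx (h : Labels lam w M L)
    (hp : ∀ i, {a | Odd a ∧ Odd ((M i).count a)}.Subsingleton) :
    ((oddIdx lam w).filter fun p => Odd p.1).card
      = Nat.card {i | ∃ a, Odd a ∧ Odd ((M i).count a)} := by
  have hinj : Set.InjOn Prod.snd ((oddIdx lam w).filter fun p => Odd p.1 : Set (ℕ × ℝ)) := by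
    simpa using h.injOn_oddIdx hp
  rw [← card_image_of_injOn hinj, Nat.card_coe_set_eq,
    ← Set.ncard_image_of_injective _ h.1, ← Set.ncard_coe_finset]
  congr 1
  ext v
  rw [mem_coe, mem_image]
  constructor
  · rintro ⟨q, hq, rfl⟩
    obtain ⟨i, hi, h1⟩ := (h.mem_oddIdx q).1 (mem_filter.1 hq).1
    exact ⟨i, ⟨q.1, (mem_filter.1 hq).2, h1⟩, hi⟩
  · rintro ⟨i, ⟨a, h1, h2⟩, rfl⟩
    exact ⟨(a, L i), mem_filter.2 ⟨(h.mem_oddIdx _).2 ⟨i, rfl, h2⟩, h1⟩, rfl⟩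

theorem Labels.residualSign_eq [Fintype K] (h : Labels lam w M L)
    (hodd : ∀ i, {a | Odd a ∧ Odd ((M i).count a)}.Subsingleton)
    (heven : ∀ i, {a | Even a ∧ Odd ((M i).count a)}.Subsingleton) :
    residualSign (oddIdx lam w) = ∏ i,
      (if ((∃ a : ℕ, Odd a ∧ Odd ((M i).count a)) ∧ ¬ (∃ b : ℕ, Even b ∧ Odd ((M i).count b))) ∨
          (∃ a b : ℕ, Odd a ∧ Odd ((M i).count a) ∧ Even b ∧ Odd ((M i).count b) ∧ b < a)
        then -1 else 1) := by
  have key : ∀ f : ℕ × ℝ → ℤ, ∏ p ∈ (oddIdx lam w).filter (fun p => Odd p.1), f p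
      = ∏ i, ∏ a ∈ (M i).toFinset, if Odd ((M i).count a) ∧ Odd a then f (a, L i) else 1 := by
    intro f
    rw [oddIdx, filter_filter, prod_filter, h.prod_clsIdx]
    simp only [h.card_cls]
  rw [residualSign, key]
  refine prod_congr rfl fun i _ => ?_
  have hmem : ∀ {a}, Odd ((M i).count a) → (a, L i) ∈ oddIdx lam w := fun h2 =>
    (h.mem_oddIdx _).2 ⟨i, rfl, h2⟩
  by_cases ha : ∃ a, Odd a ∧ Odd ((M i).count a)
  · obtain ⟨a, ha1, ha2⟩ := ha
    rw [prod_eq_single_of_mem a (Multiset.mem_toFinset.2 (Multiset.count_pos.1 ha2.pos))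
      fun b _ hb => if_neg fun h1 => hb (hodd i ⟨h1.2, h1.1⟩ ⟨ha1, ha2⟩), if_pos ⟨ha2, ha1⟩]
    have hq : ∀ q ∈ (oddIdx lam w).erase (a, L i), L i = q.2 →
        Even q.1 ∧ Odd ((M i).count q.1) := fun q hq hi => by
      obtain ⟨hqa, hq⟩ := mem_erase.1 hq
      obtain ⟨j, hj, h2⟩ := (h.mem_oddIdx q).1 hq
      obtain rfl := h.1 (hi.trans hj.symm)
      exact ⟨Nat.not_odd_iff_even.1 fun h1 =>
        hqa (Prod.ext (hodd i ⟨h1, h2⟩ ⟨ha1, ha2⟩) hi.symm), h2⟩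
    simp only [tw]
    by_cases hb : ∃ b, Even b ∧ Odd ((M i).count b)
    · obtain ⟨b, hb1, hb2⟩ := hb
      have hba : b ≠ a := by
        rintro rfl
        exact Nat.not_odd_iff_even.2 hb1 ha1
      rw [prod_eq_single_of_mem (b, L i)
        (mem_erase.2 ⟨fun h1 => hba (Prod.ext_iff.1 h1).1, hmem hb2⟩)
        fun q hq' hqb => if_neg fun h1 => hqb (Prod.ext (heven i (hq q hq' h1) ⟨hb1, hb2⟩) h1.symm),
        if_pos rfl]
      by_cases hlt : b < a
      · rw [if_pos hlt, if_pos (Or.inr ⟨a, b, ha1, ha2, hb1, hb2, hlt⟩),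
          hb1.add_one.add_one.neg_one_pow]
      · rw [if_neg hlt, add_zero, hb1.add_one.neg_one_pow, neg_neg, if_neg]
        rintro (⟨-, h1⟩ | ⟨a', b', h1, h2, h3, h4, h5⟩)
        · exact h1 ⟨b, hb1, hb2⟩
        · rw [heven i ⟨h3, h4⟩ ⟨hb1, hb2⟩, hodd i ⟨h1, h2⟩ ⟨ha1, ha2⟩] at h5
          exact hlt h5
    · rw [if_pos (Or.inl ⟨⟨a, ha1, ha2⟩, hb⟩), prod_eq_one]
      exact fun q hq' => if_neg fun h1 => hb ⟨q.1, hq q hq' h1⟩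
  · rw [if_neg, prod_eq_one]
    · exact fun a _ => if_neg fun h1 => ha ⟨a, h1.2, h1.1⟩
    · rintro (⟨h1, -⟩ | ⟨a, b, h1, h2, -⟩)
      exacts [ha h1, ha ⟨a, h1, h2⟩]

end

section
variable {k m : ℕ}

/-- The level of the prescribed ramification types and the simple branch points. -/
def lvl (k m : ℕ) : Fin k ⊕ Fin m → ℝ :=
  Sum.elim (fun i => -(((i : ℕ) + 1 : ℕ) : ℝ)) fun j => -((k + (j : ℕ) + 1 : ℕ) : ℝ)

theorem lvl_injective : Function.Injective (lvl k m) := by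
  rintro (i | i) (j | j) h <;>
    simp only [lvl, Sum.elim_inl, Sum.elim_inr, neg_inj, Nat.cast_inj] at h
  · exact congrArg _ (Fin.ext (by omega))
  · exact absurd i.2 (by omega)
  · exact absurd j.2 (by omega)
  · exact congrArg _ (Fin.ext (by omega))

theorem lvl_inl_injective : Function.Injective fun i => lvl k m (.inl i) :=
  lvl_injective.comp Sum.inl_injective

theorem labels_sigma {K : Type*} [Fintype K] (M : K → Multiset ℕ) {L : K → ℝ}
    (hL : Function.Injective L) :
    Labels (fun q : Σ i, M i => (q.2.1 : ℕ)) (fun q => L q.1) M L := by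
  refine ⟨hL, fun q => ⟨q.1, rfl⟩, fun i => ?_⟩
  have h : (univ.filter fun q : Σ i, M i => L q.1 = L i)
      = univ.map (Function.Embedding.sigmaMk i) := by
    ext ⟨j, y⟩
    rw [Finset.mem_filter, Finset.mem_map]
    constructor
    · rintro ⟨-, h⟩
      obtain rfl := hL h
      exact ⟨y, mem_univ y, rfl⟩
    · rintro ⟨z, -, h⟩
      exact ⟨mem_univ _, by rw [← h]; rfl⟩
  rw [h, map_val, Multiset.map_map]
  exact Multiset.map_univ_coe (M i)

theorem labels_sum {σ : Type*} [Fintype σ] {μ : σ → ℕ} {w : σ → ℝ} {lam : Fin k → Multiset ℕ}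
    (h : Labels μ w lam fun i => lvl k m (.inl i)) :
    Labels (Sum.elim μ fun _ : Fin m => 1) (Sum.elim w fun j => lvl k m (.inr j))
      (Sum.elim lam fun _ => {1}) (lvl k m) := by
  refine ⟨lvl_injective, ?_, ?_⟩
  · rintro (q | j)
    · exact (h.2.1 q).imp' Sum.inl fun i hi => hi
    · exact ⟨.inr j, rfl⟩
  · rintro (i | j)
    · have h1 : (univ.filter fun q => (Sum.elim w fun j => lvl k m (.inr j)) q
          = lvl k m (.inl i)) = (univ.filter fun q => w q = lvl k m (.inl i)).map
            Function.Embedding.inl := by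
        ext (q | j)
        · simp
        · simp [lvl_injective.eq_iff]
      rw [h1, map_val, Multiset.map_map]
      exact h.2.2 i
    · have h1 : (univ.filter fun q => (Sum.elim w fun j => lvl k m (.inr j)) q
          = lvl k m (.inr j)) = {.inr j} := by
        ext (q | j')
        · obtain ⟨i, hi⟩ := h.2.1 q
          simp [hi, lvl_injective.eq_iff]
        · simp [lvl_injective.eq_iff]
      rw [h1]
      simp

theorem sOdd_mul {lam : Fin k → Multiset ℕ} (hlam : ∀ i, 0 ∉ lam i) (m : ℕ) :
    sOdd lam m * ∏ i, ∏ a ∈ (lam i).toFinset, (((lam i).count a).factorial : ℤ)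
      = uNum (Sum.elim (fun q : Σ i, lam i => (q.2.1 : ℕ)) fun _ : Fin m => 1)
        (Sum.elim (fun q => lvl k m (.inl q.1)) fun j => lvl k m (.inr j)) univ := by
  have h := labels_sum (labels_sigma lam (lvl_inl_injective (k := k) (m := m)))
  set ν := Sum.elim (fun q : Σ i, lam i => (q.2.1 : ℕ)) fun _ : Fin m => 1 with hν
  set w := Sum.elim (fun q : Σ i, lam i => lvl k m (.inl q.1)) fun j => lvl k m (.inr j)
  have hsum : ∑ q, ν q = m + ∑ i, (lam i).sum := by
    rw [Fintype.sum_sum_type, Fintype.sum_sigma, add_comm]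
    congr 1
    · simp [hν]
    · refine sum_congr rfl fun i _ => ?_
      exact congrArg Multiset.sum (Multiset.map_univ_coe (lam i))
  have h1 : ∀ q, 1 ≤ ν q := by
    rintro (⟨i, y⟩ | j)
    · exact Nat.one_le_iff_ne_zero.2 fun h0 => hlam i (h0 ▸ Multiset.coe_mem)
    · exact le_rfl
  have h2 := finsum_epsilonP_mul (w := w) (T := Set.range (lvl k m)) h1
    (fun j => (h.2.1 j).imp fun _ => Eq.symm) (A := {P |
      IsNormalized (m + (∑ i, (lam i).sum) + 1) P ∧
      (∀ i : Fin k, redRamType P (-(((i : ℕ) + 1 : ℕ) : ℝ)) = lam i) ∧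
      ∀ j : Fin m, redRamType P (-((k + (j : ℕ) + 1 : ℕ) : ℝ)) = ({1} : Multiset ℕ)}) fun P => by
    rw [hsum, Set.forall_mem_range, Sum.forall]
    simp only [h.2.2]
    rfl
  rw [h.prod_clsIdx, Fintype.prod_sum_type, prod_eq_one (s := (univ : Finset (Fin m)))
    fun j _ => ?_, mul_one] at h2
  · simp only [h.card_cls, Sum.elim_inl] at h2
    rw [uNum, hsum, ← h2, sOdd]
    simp only [Nat.odd_add_one, Nat.not_odd_iff_even]
    split_ifs
    · simp only [Nat.cast_prod]
      rfl
    · rw [zero_mul]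
  · simp [h.card_cls]

theorem uNum_sum {σ : Type*} [Fintype σ] {μ : σ → ℕ} {w : σ → ℝ} (hμ : ∀ q, 1 ≤ μ q)
    (hw : ∀ q, -((k + 1 : ℕ) : ℝ) < w q) {L N : ℕ} (hL : pairNum μ w univ ≤ L)
    (hN : Fintype.card σ ≤ N) : uNum (Sum.elim μ fun _ : Fin m => 1)
      (Sum.elim w fun j => lvl k m (.inr j)) univ
      = ∑ i ∈ range (L + 1), ∑ b ∈ range (N + 1),
        tco m b * ((m - b) / 2).choose i * cCoeff μ w (-((k + 1 : ℕ) : ℝ)) i b univ := by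
  have h := uNum_union_simple (lam := Sum.elim μ fun _ : Fin m => 1)
    (w := Sum.elim w fun j => lvl k m (.inr j)) (e := ⟨Sum.inl, Sum.inl_injective⟩)
    (V := univ) (J := univ.map ⟨Sum.inr, Sum.inr_injective⟩)
    (c := -((k + 1 : ℕ) : ℝ)) (L := L) (N := N) ?_ ?_ ?_ (fun j _ => hw j) ?_
    (fun i j hi => cCoeff_eq_zero_of_pairNum_lt (hL.trans_lt hi))
    (fun i j hj => cCoeff_eq_zero_of_card_lt (hN.trans_lt hj))
  · rw [card_map, card_fin] at h
    refine Eq.trans (congrArg _ ?_) h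
    ext (q | j) <;> simp
  · rintro (q | j)
    exacts [hμ q, le_rfl]
  · intro j hj
    obtain ⟨i, -, rfl⟩ := mem_map.1 hj
    rfl
  · intro j hj
    obtain ⟨i, -, rfl⟩ := mem_map.1 hj
    exact neg_le_neg (Nat.cast_le.2 (by omega))
  · rintro a ha b hb hab
    obtain ⟨i, -, rfl⟩ := mem_map.1 ha
    obtain ⟨j, -, rfl⟩ := mem_map.1 hb
    exact congrArg _ (lvl_injective.comp Sum.inr_injective
      (show lvl k m (.inr i) = lvl k m (.inr j) from hab))

end

end

/-- The leading coefficient of `F^odd/g` as a polynomial in `q` and `tanh q`: if in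
each `λᵢ` at most one odd and at most one even number appears an odd number of times,
`s` is the number of indices `i` such that some odd number appears an odd number of
times in `λᵢ`, `ℓ = Σᵢ l([λᵢ/2])` and `ε = Πᵢ εᵢ` with `εᵢ` as in the text, then there
is a rational polynomial `Q(X, Y)` whose associated function `q ↦ Q(q, tanh q)/cosh q`
has `m`-th derivative `s^odd(m)` at `0` for all `m`, of degree at most `ℓ` in `X`,
whose coefficient of `X^ℓ Y^j` vanishes for `j > ℓ+s` and whose coefficient of
`X^ℓ Y^(ℓ+s)` equals `(-1/2)^ℓ ε (ℓ+s)!/Πᵢ Aut[λᵢ/2]`; in particular this coefficient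
is nonzero. -/
theorem Fodd_leading_coefficient (k : ℕ) (lam : Fin k → Multiset ℕ)
    (hlam : ∀ i, (0 : ℕ) ∉ lam i)
    (hcond : ∀ i, ({a : ℕ | Odd a ∧ Odd ((lam i).count a)} : Set ℕ).Subsingleton ∧
      ({a : ℕ | Even a ∧ Odd ((lam i).count a)} : Set ℕ).Subsingleton)
    (s : ℕ) (hs : s = Nat.card {i : Fin k | ∃ a : ℕ, Odd a ∧ Odd ((lam i).count a)})
    (ℓ : ℕ) (hℓ : ℓ = ∑ i, ∑ a ∈ (lam i).toFinset, (lam i).count a / 2)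
    (ε : ℚ) (hε : ε = ∏ i,
      (if ((∃ a : ℕ, Odd a ∧ Odd ((lam i).count a)) ∧
            ¬ (∃ b : ℕ, Even b ∧ Odd ((lam i).count b))) ∨
          (∃ a b : ℕ, Odd a ∧ Odd ((lam i).count a) ∧
            Even b ∧ Odd ((lam i).count b) ∧ b < a)
        then (-1 : ℚ) else 1)) :
    ∃ Q : MvPolynomial (Fin 2) ℚ,
      (∀ m : ℕ,
        iteratedDeriv m
            (fun q : ℝ => (MvPolynomial.aeval ![q, Real.tanh q]) Q / Real.cosh q) 0
          = (sOdd lam m : ℝ)) ∧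
      MvPolynomial.degreeOf 0 Q ≤ ℓ ∧
      (∀ j : ℕ, ℓ + s < j →
        MvPolynomial.coeff (Finsupp.single (0 : Fin 2) ℓ + Finsupp.single 1 j) Q = 0) ∧
      MvPolynomial.coeff
          (Finsupp.single (0 : Fin 2) ℓ + Finsupp.single 1 (ℓ + s)) Q
        = (-1 / 2 : ℚ) ^ ℓ * ε * (Nat.factorial (ℓ + s) : ℚ) /
            (∏ i, ∏ a ∈ (lam i).toFinset, (Nat.factorial ((lam i).count a / 2) : ℚ)) ∧
      MvPolynomial.coeff
          (Finsupp.single (0 : Fin 2) ℓ + Finsupp.single 1 (ℓ + s)) Q ≠ 0 := by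
  have hσ := labels_sigma lam (lvl_inl_injective (k := k) (m := 0))
  set μ : (Σ i, lam i) → ℕ := fun q => q.2.1 with hμ
  set w : (Σ i, lam i) → ℝ := fun q => lvl k 0 (.inl q.1) with hw
  set c : ℝ := -((k + 1 : ℕ) : ℝ) with hc
  set Z : ℚ := ∏ i, ∏ a ∈ (lam i).toFinset, (((lam i).count a).factorial : ℚ) with hZ
  have hZ0 : Z ≠ 0 := Finset.prod_ne_zero_iff.2 fun i _ => Finset.prod_ne_zero_iff.2 fun a _ =>
    Nat.cast_ne_zero.2 (Nat.factorial_ne_zero _)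
  have hpair : pairNum μ w Finset.univ = ℓ := by
    rw [pairNum, hσ.sum_clsIdx, hℓ]
    simp only [hσ.card_cls]
  have hwt : pairWt μ w Finset.univ
      = Z / ∏ i, ∏ a ∈ (lam i).toFinset, (((lam i).count a / 2).factorial : ℚ) := by
    rw [pairWt, hσ.prod_clsIdx, hZ, ← Finset.prod_div_distrib]
    simp only [hσ.card_cls, Finset.prod_div_distrib]
  have hres : ((residualSign (oddIdx μ w) : ℤ) : ℚ) = ε := by
    rw [hσ.residualSign_eq (fun i => (hcond i).1) fun i => (hcond i).2, hε]
    push_cast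
    rfl
  have hμ1 : ∀ q, 1 ≤ μ q := fun q =>
    Nat.one_le_iff_ne_zero.2 fun h0 => hlam q.1 (h0 ▸ Multiset.coe_mem)
  have hcw : ∀ q, c < w q := fun q =>
    neg_lt_neg (Nat.cast_lt.2 (Nat.add_lt_add_right q.1.2 1))
  have hco : ∀ j, s ≤ j → ((cCoeff μ w c ℓ j Finset.univ : ℤ) : ℚ)
      = ℓ.factorial * pairWt μ w Finset.univ * if s = j then j.factorial * ε else 0 := by
    intro j hj
    have hcard := hσ.card_filter_oddIdx fun i => (hcond i).1
    rw [← hs] at hcard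
    have h := cCoeff_pairNum hμ1 hcw (hσ.injOn_oddIdx fun i => (hcond i).1)
      (hσ.injOn_oddIdx fun i => (hcond i).2) (j := j) (by rwa [hcard])
    rw [hpair, hcard] at h
    rw [h, ← hres]
    push_cast
    rfl
  obtain ⟨Q, hQ1, hQ2, hQ3, hQ4⟩ := exists_tanh_poly ℓ (Fintype.card (Σ i, lam i) + s) s
    (fun i j => ((cCoeff μ w c i j Finset.univ : ℤ) : ℚ) / Z) (Nat.le_add_left _ _) fun j hj => by
      rw [hco j hj.le, if_neg hj.ne, mul_zero, zero_div]
  have hA : (∏ i, ∏ a ∈ (lam i).toFinset, (((lam i).count a / 2).factorial : ℚ)) ≠ 0 :=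
    Finset.prod_ne_zero_iff.2 fun i _ => Finset.prod_ne_zero_iff.2 fun a _ =>
      Nat.cast_ne_zero.2 (Nat.factorial_ne_zero _)
  have htop : MvPolynomial.coeff (Finsupp.single (0 : Fin 2) ℓ + Finsupp.single 1 (ℓ + s)) Q
      = (-1 / 2 : ℚ) ^ ℓ * ε * (Nat.factorial (ℓ + s) : ℚ) /
        (∏ i, ∏ a ∈ (lam i).toFinset, (Nat.factorial ((lam i).count a / 2) : ℚ)) := by
    have h1 : (ℓ.factorial : ℚ) ≠ 0 := Nat.cast_ne_zero.2 (Nat.factorial_ne_zero _)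
    have h2 : (s.factorial : ℚ) ≠ 0 := Nat.cast_ne_zero.2 (Nat.factorial_ne_zero _)
    rw [hQ4, hco s le_rfl, if_pos rfl, hwt]
    field_simp
  refine ⟨Q, fun m => ?_, hQ2, hQ3, htop, ?_⟩
  · rw [hQ1 m]
    have h5 := congrArg (Int.cast (R := ℚ)) ((sOdd_mul hlam m).trans
      (uNum_sum hμ1 hcw hpair.le (Nat.le_add_right _ s)))
    have h6 : ((sOdd lam m : ℤ) : ℝ) = ((sOdd lam m : ℚ) : ℝ) := by norm_cast
    rw [h6, Rat.cast_inj, ← mul_left_inj' hZ0, Finset.sum_mul]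
    push_cast at h5
    rw [hZ, h5]
    refine Finset.sum_congr rfl fun i _ => ?_
    rw [Finset.sum_mul]
    refine Finset.sum_congr rfl fun j _ => ?_
    rw [← hZ, mul_assoc, div_mul_cancel₀ _ hZ0]
    rw [hc, Nat.cast_succ]
  · rw [htop, hε]
    refine div_ne_zero (mul_ne_zero (mul_ne_zero (pow_ne_zero _ (by norm_num))
      (Finset.prod_ne_zero_iff.2 fun i _ => ?_)) (Nat.cast_ne_zero.2 (Nat.factorial_ne_zero _))) hA
    split_ifs <;> norm_num
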